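/- The Cauchy problem for the fifth-order modified KdV equation with the coefficient constraint is globally well-posed in the energy space H²(𝕋): for every real-valued u₀ ∈ H²(𝕋) and every T > 0 there exists a solution u ∈ C([−T,T]; H²(𝕋)) with initial datum u₀, unique in the class of solutions whose gauged function η(t)·NT(u) lies in F²(T) (with d₁ = 10∫u₀², d₂ = 10∫((∂ₓu₀)² + u₀⁴) in the definition of F²(T)), and the solution map is continuous on each level set {u₀ : ∫ u₀² = γ₁, ∫ (∂ₓu₀)² + u₀⁴ = γ₂} with the H² topology. -/

import Mathlib

noncomputable section

open scoped BigOperators ComplexConjugate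
open MeasureTheory Complex Set

namespace MKdV5

/-! ### Sobolev data on the Fourier side.

A function `u ∈ H^s(𝕋)` (with `𝕋 = ℝ/2πℤ`) is represented by its sequence of Fourier
coefficients `a : ℤ → ℂ`, `a n = û(n) = (2π)^{-1/2}∫_𝕋 e^{-inx}u(x)dx`; real-valuedness of `u`
corresponds to `conj (a n) = a (-n)`. -/

/-- The weight `(1+n²)^s` of the `H^s(𝕋)` norm. -/
def hsWeight (s : ℝ) (n : ℤ) : ℝ := (1 + (n : ℝ) ^ 2) ^ s

/-- `a` is (the sequence of Fourier coefficients of) an element of `H^s(𝕋)`. -/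
def InHs (s : ℝ) (a : ℤ → ℂ) : Prop := Summable fun n : ℤ => hsWeight s n * ‖a n‖ ^ 2

/-- The square of the `H^s(𝕋)` norm. -/
def hsNormSq (s : ℝ) (a : ℤ → ℂ) : ℝ := ∑' n : ℤ, hsWeight s n * ‖a n‖ ^ 2

/-- The `H^s(𝕋)` norm. -/
def hsNorm (s : ℝ) (a : ℤ → ℂ) : ℝ := Real.sqrt (hsNormSq s a)

/-- The Fourier coefficients of a real-valued function satisfy `conj (a n) = a (-n)`. -/
def IsRealCoeff (a : ℤ → ℂ) : Prop := ∀ n : ℤ, conj (a n) = a (-n)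

/-- `u ∈ C([-T,T]; H^s(𝕋))`, on the Fourier side. -/
def ContHs (s T : ℝ) (u : ℝ → ℤ → ℂ) : Prop :=
  (∀ t ∈ Icc (-T) T, InHs s (u t)) ∧
    ∀ t ∈ Icc (-T) T, ∀ ε > 0, ∃ δ > 0, ∀ t' ∈ Icc (-T) T,
      |t' - t| < δ → hsNorm s (fun n => u t' n - u t n) < ε

/-- `u ∈ C([-T,T]; H^∞(𝕋))`. -/
def ContHinf (T : ℝ) (u : ℝ → ℤ → ℂ) : Prop := ∀ s : ℝ, ContHs s T u

/-- The nonresonance condition defining `𝒩_{3,n}`. -/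
abbrev N3cond (n₁ n₂ n₃ : ℤ) : Prop := (n₁ + n₂) * (n₁ + n₃) * (n₂ + n₃) ≠ 0

/-- The nonresonance condition defining `𝒩_{5,n}`: no four of the five frequencies sum to zero. -/
abbrev N5cond (n₁ n₂ n₃ n₄ n₅ : ℤ) : Prop :=
  n₁ + n₂ + n₃ + n₄ ≠ 0 ∧ n₁ + n₂ + n₃ + n₅ ≠ 0 ∧ n₁ + n₂ + n₄ + n₅ ≠ 0 ∧
    n₁ + n₃ + n₄ + n₅ ≠ 0 ∧ n₂ + n₃ + n₄ + n₅ ≠ 0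

/-- Sum over `(n₁,n₂,n₃) ∈ 𝒩_{3,n}` of `K(n₁,n₂,n₃)·a(n₁)b(n₂)c(n₃)`. -/
def cubicN3Sum (K : ℤ → ℤ → ℤ → ℂ) (a b c : ℤ → ℂ) (n : ℤ) : ℂ :=
  ∑' p : ℤ × ℤ, if N3cond p.1 p.2 (n - p.1 - p.2) then
    K p.1 p.2 (n - p.1 - p.2) * a p.1 * b p.2 * c (n - p.1 - p.2) else 0

/-- Sum over `(n₁,…,n₅) ∈ 𝒩_{5,n}` of `a₁(n₁)⋯a₅(n₅)`. -/
def quinticN5Sum (a₁ a₂ a₃ a₄ a₅ : ℤ → ℂ) (n : ℤ) : ℂ :=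
  ∑' q : ℤ × ℤ × ℤ × ℤ,
    if N5cond q.1 q.2.1 q.2.2.1 q.2.2.2 (n - q.1 - q.2.1 - q.2.2.1 - q.2.2.2) then
      a₁ q.1 * a₂ q.2.1 * a₃ q.2.2.1 * a₄ q.2.2.2 * a₅ (n - q.1 - q.2.1 - q.2.2.1 - q.2.2.2)
    else 0

/-- The dispersion relation `μ(n) = n⁵ + d₁n³ + d₂n`. -/
def muPhase (d₁ d₂ : ℝ) (n : ℤ) : ℝ := (n : ℝ) ^ 5 + d₁ * (n : ℝ) ^ 3 + d₂ * (n : ℝ)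

end MKdV5

namespace MKdV5

/-! ### The fifth-order mKdV equation (Duhamel formulation on the Fourier side). -/

/-- The Fourier multiplier of the cubic part
`c₁ u∂ₓu∂ₓ²u + c₂u²∂ₓ³u + c₃(∂ₓu)³` at frequencies `(n₁,n₂,n₃)`. -/
def mkdvCubicKer (c₁ c₂ c₃ : ℝ) (n₁ n₂ n₃ : ℤ) : ℂ :=
  (c₁ : ℂ) * (I * (n₂ : ℂ)) * (I * (n₃ : ℂ)) ^ 2 + (c₂ : ℂ) * (I * (n₃ : ℂ)) ^ 3 +
    (c₃ : ℂ) * (I * (n₁ : ℂ)) * (I * (n₂ : ℂ)) * (I * (n₃ : ℂ))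

/-- `ℱₓ[c₁ u∂ₓu∂ₓ²u + c₂u²∂ₓ³u + c₃(∂ₓu)³ + c₄u⁴∂ₓu](n)` for `û = a`. -/
def mkdvNonlin (c₁ c₂ c₃ c₄ : ℝ) (a : ℤ → ℂ) (n : ℤ) : ℂ :=
  ((2 * Real.pi : ℝ) : ℂ)⁻¹ *
      (∑' p : ℤ × ℤ,
        mkdvCubicKer c₁ c₂ c₃ p.1 p.2 (n - p.1 - p.2) * a p.1 * a p.2 * a (n - p.1 - p.2)) +
    (((2 * Real.pi : ℝ) : ℂ) ^ 2)⁻¹ * (c₄ : ℂ) *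
      (∑' q : ℤ × ℤ × ℤ × ℤ,
        (I * ((n - q.1 - q.2.1 - q.2.2.1 - q.2.2.2 : ℤ) : ℂ)) * a q.1 * a q.2.1 * a q.2.2.1 *
          a q.2.2.2 * a (n - q.1 - q.2.1 - q.2.2.1 - q.2.2.2))

/-- The coefficient constraint `c₁/4 = c₂ = c₃`, `c₄ = -3c₁²/160`. -/
def CoeffConstraint (c₁ c₂ c₃ c₄ : ℝ) : Prop :=
  c₁ / 4 = c₂ ∧ c₂ = c₃ ∧ c₄ = -3 * c₁ ^ 2 / 160

/-- `u` is a solution of the fifth-order mKdV equation on `[-T,T]` with initial datum `u₀`: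
it belongs to `C([-T,T];H^s)`, is real-valued, and satisfies the Duhamel formula
`û(t,n) = e^{itn⁵}û₀(n) - ∫₀ᵗ e^{i(t-τ)n⁵} ℱₓ[nonlinearity](τ,n) dτ`. -/
def IsSolution (c₁ c₂ c₃ c₄ s T : ℝ) (u₀ : ℤ → ℂ) (u : ℝ → ℤ → ℂ) : Prop :=
  ContHs s T u ∧ (∀ t ∈ Icc (-T) T, IsRealCoeff (u t)) ∧ (∀ n : ℤ, u 0 n = u₀ n) ∧
    ∀ t ∈ Icc (-T) T, ∀ n : ℤ,
      u t n = Complex.exp (I * (t : ℂ) * (n : ℂ) ^ 5) * u₀ n -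
        ∫ τ in (0:ℝ)..t, Complex.exp (I * ((t - τ : ℝ) : ℂ) * (n : ℂ) ^ 5) *
          mkdvNonlin c₁ c₂ c₃ c₄ (u τ) n

end MKdV5

namespace MKdV5

/-! ### The gauge transformation `NT` and the conserved quantities of low order. -/

/-- `‖u‖_{L⁴(𝕋)}⁴ = ∫_𝕋 u⁴ dx`, computed on the Fourier side (a complex number which is
real for real-valued `u`). -/
def l4pow (a : ℤ → ℂ) : ℂ :=
  ((2 * Real.pi : ℝ) : ℂ)⁻¹ *
    ∑' q : ℤ × ℤ × ℤ, a q.1 * a q.2.1 * a q.2.2 * a (-(q.1 + q.2.1 + q.2.2))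

/-- The gauge transformation `NT`:
`NT(u)^(t,n) = e^{-20in∫₀ᵗ ‖u(σ)‖_{L⁴}⁴ dσ} û(t,n)`. -/
def gauge (u : ℝ → ℤ → ℂ) : ℝ → ℤ → ℂ := fun t n =>
  Complex.exp (-(20 : ℂ) * I * (n : ℂ) * ∫ τ in (0:ℝ)..t, l4pow (u τ)) * u t n

/-- `∫_𝕋 u² dx` on the Fourier side (for real-valued `u`). -/
def mass (a : ℤ → ℂ) : ℝ := ∑' n : ℤ, ‖a n‖ ^ 2

/-- `∫_𝕋 (∂ₓu)² + u⁴ dx` on the Fourier side (for real-valued `u`). -/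
def energy1 (a : ℤ → ℂ) : ℝ := (∑' n : ℤ, (n : ℝ) ^ 2 * ‖a n‖ ^ 2) + (l4pow a).re

end MKdV5

namespace MKdV5

/-! ### Short-time function spaces `X_k`, `F_k`, `N_k`, `F^s(T)`, `N^s(T)`, `E^s(T)`. -/

/-- A smooth bump function `η₀ : ℝ → [0,1]` supported in `[-2,2]`, equal to `1` on `[-1,1]`. -/
structure BumpFun (η₀ : ℝ → ℝ) : Prop where
  smooth : ContDiff ℝ (⊤ : ℕ∞) η₀
  mem : ∀ x, η₀ x ∈ Icc (0 : ℝ) 1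
  supp : ∀ x, 2 < |x| → η₀ x = 0
  eq_one : ∀ x ∈ Icc (-1 : ℝ) 1, η₀ x = 1

/-- The dyadic cutoffs `χ₀ = η₀`, `χ_k(ξ) = η₀(ξ/2^k) - η₀(ξ/2^{k-1})` for `k ≥ 1`. -/
def chi (η₀ : ℝ → ℝ) : ℕ → ℝ → ℝ
  | 0 => η₀
  | k + 1 => fun ξ => η₀ (ξ / 2 ^ (k + 1)) - η₀ (ξ / 2 ^ k)

/-- `η_{≤l} = Σ_{j≤l} χ_j` (in the modulation variable). -/
def chiLe (η₀ : ℝ → ℝ) (l : ℕ) (x : ℝ) : ℝ := ∑ j ∈ Finset.range (l + 1), chi η₀ j x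

/-- `χ_k` read on the integers. -/
def chiZ (η₀ : ℝ → ℝ) (k : ℕ) (n : ℤ) : ℝ := chi η₀ k (n : ℝ)

/-- `ψ_k(n) = n·χ_k'(n)`. -/
def psiZ (η₀ : ℝ → ℝ) (k : ℕ) (n : ℤ) : ℝ := (n : ℝ) * deriv (chi η₀ k) (n : ℝ)

/-- The modulation weight `β_{j,k}`: `β_{j,0} = 1`, `β_{j,k} = 1 + 2^{(j-5k)/4}` for `k ≥ 1`. -/
def betaWt (j k : ℕ) : ℝ := if k = 0 then 1 else 1 + (2 : ℝ) ^ (((j : ℝ) - 5 * (k : ℝ)) / 4)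

/-- The `L²_τ ℓ²_n` norm. -/
def l2l2 (f : ℝ → ℤ → ℂ) : ℝ := Real.sqrt (∫ τ : ℝ, ∑' n : ℤ, ‖f τ n‖ ^ 2)

/-- The `X_k = X^{0,1/2,1}`-type norm with weights `β_{j,k}`. -/
def Xnorm (η₀ : ℝ → ℝ) (d₁ d₂ : ℝ) (k : ℕ) (f : ℝ → ℤ → ℂ) : ℝ :=
  ∑' j : ℕ, (2 : ℝ) ^ ((j : ℝ) / 2) * betaWt j k *
    l2l2 fun τ n => ((chi η₀ j (τ - muPhase d₁ d₂ n) : ℝ) : ℂ) * f τ n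

/-- Finiteness of the `X_k` norm: measurability, square-integrability of each dyadic
modulation piece, and summability of the defining series. -/
def XFinite (η₀ : ℝ → ℝ) (d₁ d₂ : ℝ) (k : ℕ) (f : ℝ → ℤ → ℂ) : Prop :=
  Measurable (Function.uncurry f) ∧
  (∀ j : ℕ, Integrable (fun τ : ℝ =>
      ∑' n : ℤ, ‖((chi η₀ j (τ - muPhase d₁ d₂ n) : ℝ) : ℂ) * f τ n‖ ^ 2)) ∧
  Summable (fun j : ℕ => (2 : ℝ) ^ ((j : ℝ) / 2) * betaWt j k *
    l2l2 fun τ n => ((chi η₀ j (τ - muPhase d₁ d₂ n) : ℝ) : ℂ) * f τ n)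

/-- The Fourier transform in time. -/
def timeFT (u : ℝ → ℤ → ℂ) : ℝ → ℤ → ℂ := fun τ n =>
  ((Real.sqrt (2 * Real.pi) : ℝ) : ℂ)⁻¹ * ∫ t : ℝ, Complex.exp (-(I * (τ : ℂ) * (t : ℂ))) * u t n

/-- The inverse Fourier transform in time. -/
def timeIFT (f : ℝ → ℤ → ℂ) : ℝ → ℤ → ℂ := fun t n =>
  ((Real.sqrt (2 * Real.pi) : ℝ) : ℂ)⁻¹ * ∫ τ : ℝ, Complex.exp (I * (τ : ℂ) * (t : ℂ)) * f τ n

/-- Localization of `u` to time scale `2^{-2k}` around `t_k`. -/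
def timeLoc (η₀ : ℝ → ℝ) (k : ℕ) (tk : ℝ) (u : ℝ → ℤ → ℂ) : ℝ → ℤ → ℂ := fun t n =>
  ((η₀ ((2 : ℝ) ^ (2 * k) * (t - tk)) : ℝ) : ℂ) * u t n

/-- The `F_k` norm: `sup_{t_k} ‖ℱ[u·η₀(2^{2k}(t-t_k))]‖_{X_k}`. -/
def FkNorm (η₀ : ℝ → ℝ) (d₁ d₂ : ℝ) (k : ℕ) (u : ℝ → ℤ → ℂ) : ℝ :=
  ⨆ tk : ℝ, Xnorm η₀ d₁ d₂ k (timeFT (timeLoc η₀ k tk u))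

/-- Finiteness of the `F_k` norm. -/
def FkFinite (η₀ : ℝ → ℝ) (d₁ d₂ : ℝ) (k : ℕ) (u : ℝ → ℤ → ℂ) : Prop :=
  BddAbove (Set.range fun tk : ℝ => Xnorm η₀ d₁ d₂ k (timeFT (timeLoc η₀ k tk u)))

/-- The `N_k` norm: `sup_{t_k} ‖(τ-μ(n)+i2^{2k})⁻¹ℱ[u·η₀(2^{2k}(t-t_k))]‖_{X_k}`. -/
def NkNorm (η₀ : ℝ → ℝ) (d₁ d₂ : ℝ) (k : ℕ) (u : ℝ → ℤ → ℂ) : ℝ :=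
  ⨆ tk : ℝ, Xnorm η₀ d₁ d₂ k fun τ n =>
    ((τ : ℂ) - ((muPhase d₁ d₂ n : ℝ) : ℂ) + I * (((2 : ℝ) ^ (2 * k) : ℝ) : ℂ))⁻¹ *
      timeFT (timeLoc η₀ k tk u) τ n

/-- The time-restricted norm `F_k(T)` (infimum over extensions from `[-T,T]`). -/
def FkTNorm (η₀ : ℝ → ℝ) (d₁ d₂ : ℝ) (k : ℕ) (T : ℝ) (u : ℝ → ℤ → ℂ) : ℝ :=
  sInf (FkNorm η₀ d₁ d₂ k '' {w | ∀ t ∈ Icc (-T) T, w t = u t})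

/-- The time-restricted norm `N_k(T)` (infimum over extensions from `[-T,T]`). -/
def NkTNorm (η₀ : ℝ → ℝ) (d₁ d₂ : ℝ) (k : ℕ) (T : ℝ) (u : ℝ → ℤ → ℂ) : ℝ :=
  sInf (NkNorm η₀ d₁ d₂ k '' {w | ∀ t ∈ Icc (-T) T, w t = u t})

/-- The Littlewood-Paley projection `P_k`. -/
def Pk (η₀ : ℝ → ℝ) (k : ℕ) (u : ℝ → ℤ → ℂ) : ℝ → ℤ → ℂ := fun t n =>
  ((chiZ η₀ k n : ℝ) : ℂ) * u t n

/-- `‖u‖²_{F^s(T)} = Σ_k 2^{2sk}‖P_k u‖²_{F_k(T)}`. -/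
def FsTNormSq (η₀ : ℝ → ℝ) (d₁ d₂ s T : ℝ) (u : ℝ → ℤ → ℂ) : ℝ :=
  ∑' k : ℕ, (2 : ℝ) ^ (2 * s * (k : ℝ)) * (FkTNorm η₀ d₁ d₂ k T (Pk η₀ k u)) ^ 2

/-- The `F^s(T)` norm. -/
def FsTNorm (η₀ : ℝ → ℝ) (d₁ d₂ s T : ℝ) (u : ℝ → ℤ → ℂ) : ℝ :=
  Real.sqrt (FsTNormSq η₀ d₁ d₂ s T u)

/-- Membership in `F^s(T)` (finiteness of the norm). -/
def MemFsT (η₀ : ℝ → ℝ) (d₁ d₂ s T : ℝ) (u : ℝ → ℤ → ℂ) : Prop :=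
  Summable fun k : ℕ => (2 : ℝ) ^ (2 * s * (k : ℝ)) * (FkTNorm η₀ d₁ d₂ k T (Pk η₀ k u)) ^ 2

/-- `‖u‖²_{N^s(T)} = Σ_k 2^{2sk}‖P_k u‖²_{N_k(T)}`. -/
def NsTNormSq (η₀ : ℝ → ℝ) (d₁ d₂ s T : ℝ) (u : ℝ → ℤ → ℂ) : ℝ :=
  ∑' k : ℕ, (2 : ℝ) ^ (2 * s * (k : ℝ)) * (NkTNorm η₀ d₁ d₂ k T (Pk η₀ k u)) ^ 2

/-- The `N^s(T)` norm. -/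
def NsTNorm (η₀ : ℝ → ℝ) (d₁ d₂ s T : ℝ) (u : ℝ → ℤ → ℂ) : ℝ :=
  Real.sqrt (NsTNormSq η₀ d₁ d₂ s T u)

/-- `‖u‖²_{E^s(T)} = ‖P₀u(0)‖²_{L²} + Σ_{k≥1} sup_{t_k∈[-T,T]} 2^{2sk}‖P_k u(t_k)‖²_{L²}`. -/
def EsTNormSq (η₀ : ℝ → ℝ) (s T : ℝ) (u : ℝ → ℤ → ℂ) : ℝ :=
  (∑' n : ℤ, ‖((chiZ η₀ 0 n : ℝ) : ℂ) * u 0 n‖ ^ 2) +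
    ∑' k : ℕ, sSup ((fun t : ℝ => (2 : ℝ) ^ (2 * s * ((k : ℝ) + 1)) *
      ∑' n : ℤ, ‖((chiZ η₀ (k + 1) n : ℝ) : ℂ) * u t n‖ ^ 2) '' Icc (-T) T)

/-- The `E^s(T)` norm. -/
def EsTNorm (η₀ : ℝ → ℝ) (s T : ℝ) (u : ℝ → ℤ → ℂ) : ℝ :=
  Real.sqrt (EsTNormSq η₀ s T u)

end MKdV5
namespace MKdV5

/-- Membership in `F_k(T)`: some extension from `[-T,T]` has finite `F_k` norm. -/
def FkTFinite (η₀ : ℝ → ℝ) (d₁ d₂ : ℝ) (k : ℕ) (T : ℝ) (u : ℝ → ℤ → ℂ) : Prop :=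
  ∃ w : ℝ → ℤ → ℂ, (∀ t ∈ Icc (-T) T, w t = u t) ∧ FkFinite η₀ d₁ d₂ k w

end MKdV5

namespace MKdV5

/-- A cutoff function `η ∈ C^∞(ℝ)` with `supp η ⊂ [-T,T]`. -/
def IsCutoff (T : ℝ) (η : ℝ → ℝ) : Prop :=
  ContDiff ℝ (⊤ : ℕ∞) η ∧ ∀ t : ℝ, t ∉ Icc (-T) T → η t = 0

/-- The gauged function `η(t)·NT(u)`. -/
def gaugedCut (η : ℝ → ℝ) (u : ℝ → ℤ → ℂ) : ℝ → ℤ → ℂ := fun t n =>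
  ((η t : ℝ) : ℂ) * gauge u t n

/-- The uniqueness class: for every smooth cutoff `η` supported in `[-T,T]`, the gauged
function `η(t)·NT(u)` belongs to `F^s(T)`. -/
def InGaugeClass (η₀ : ℝ → ℝ) (d₁ d₂ s T : ℝ) (u : ℝ → ℤ → ℂ) : Prop :=
  ∀ η : ℝ → ℝ, IsCutoff T η → MemFsT η₀ d₁ d₂ s T (gaugedCut η u)

/-- The level set `{u₀ ∈ H^s(𝕋) : ∫u₀² = γ₁, ∫(∂ₓu₀)² + u₀⁴ = γ₂}` (of real-valued data). -/
def InLevelSet (s γ₁ γ₂ : ℝ) (a : ℤ → ℂ) : Prop :=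
  InHs s a ∧ IsRealCoeff a ∧ mass a = γ₁ ∧ energy1 a = γ₂

end MKdV5

namespace MKdV5

/-! ### Nonnegative families with bounded sums. -/

/-- `f` is a nonnegative family all of whose finite sums are at most `C`. -/
def BddSum {ι : Type*} (f : ι → ℝ) (C : ℝ) : Prop :=
  (∀ i, 0 ≤ f i) ∧ ∀ s : Finset ι, ∑ i ∈ s, f i ≤ C

namespace BddSum

variable {ι κ : Type*} {f g : ι → ℝ} {C D : ℝ}

lemma bound_nonneg (h : BddSum f C) : 0 ≤ C := by simpa using h.2 ∅

lemma summable (h : BddSum f C) : Summable f := summable_of_sum_le h.1 h.2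

lemma tsum_le (h : BddSum f C) : ∑' i, f i ≤ C := h.summable.tsum_le_of_sum_le h.2

lemma tsum_nonneg (h : BddSum f C) : 0 ≤ ∑' i, f i := _root_.tsum_nonneg h.1

lemma of_summable (h0 : ∀ i, 0 ≤ f i) (hs : Summable f) (hC : ∑' i, f i ≤ C) : BddSum f C :=
  ⟨h0, fun s => (hs.sum_le_tsum s fun i _ => h0 i).trans hC⟩

lemma apply_le (h : BddSum f C) (i : ι) : f i ≤ C := by simpa using h.2 {i}

lemma mono (h : BddSum f C) (h0 : ∀ i, 0 ≤ g i) (hg : ∀ i, g i ≤ f i) : BddSum g C :=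
  ⟨h0, fun s => (Finset.sum_le_sum fun i _ => hg i).trans (h.2 s)⟩

lemma le (h : BddSum f C) (hCD : C ≤ D) : BddSum f D := ⟨h.1, fun s => (h.2 s).trans hCD⟩

lemma add (h : BddSum f C) (h' : BddSum g D) : BddSum (fun i => f i + g i) (C + D) :=
  ⟨fun i => add_nonneg (h.1 i) (h'.1 i), fun s => by
    rw [Finset.sum_add_distrib]; exact add_le_add (h.2 s) (h'.2 s)⟩

lemma const_mul (h : BddSum f C) {c : ℝ} (hc : 0 ≤ c) : BddSum (fun i => c * f i) (c * C) :=
  ⟨fun i => mul_nonneg hc (h.1 i), fun s => by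
    rw [← Finset.mul_sum]; exact mul_le_mul_of_nonneg_left (h.2 s) hc⟩

lemma comp_injective (h : BddSum f C) {e : κ → ι} (he : Function.Injective e) :
    BddSum (fun k => f (e k)) C :=
  ⟨fun k => h.1 _, fun s => by
    have := h.2 (s.map ⟨e, he⟩)
    simpa [Finset.sum_map] using this⟩

lemma mul_prod {h : κ → ℝ} (hf : BddSum f C) (hh : BddSum h D) :
    BddSum (fun p : ι × κ => f p.1 * h p.2) (C * D) := by
  classical
  refine ⟨fun p => mul_nonneg (hf.1 _) (hh.1 _), fun s => ?_⟩
  calc ∑ p ∈ s, f p.1 * h p.2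
      ≤ ∑ p ∈ (s.image Prod.fst) ×ˢ (s.image Prod.snd), f p.1 * h p.2 := by
        refine Finset.sum_le_sum_of_subset_of_nonneg Finset.subset_product
          fun p _ _ => mul_nonneg (hf.1 _) (hh.1 _)
    _ = (∑ i ∈ s.image Prod.fst, f i) * ∑ k ∈ s.image Prod.snd, h k := by
        rw [Finset.sum_product, Finset.sum_mul_sum]
    _ ≤ C * D := mul_le_mul (hf.2 _) (hh.2 _) (Finset.sum_nonneg fun i _ => hh.1 i)
        hf.bound_nonneg

lemma fiber {f : ι × κ → ℝ} (h : BddSum f C) (i : ι) : BddSum (fun k => f (i, k)) C :=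
  h.comp_injective (e := fun k => (i, k)) fun a b hab => by simpa using hab

lemma tsum_fiber {f : ι × κ → ℝ} (h : BddSum f C) : BddSum (fun i => ∑' k, f (i, k)) C :=
  of_summable (fun i => _root_.tsum_nonneg fun k => h.1 _) h.summable.prod
    (by rw [← h.summable.tsum_prod]; exact h.tsum_le)

lemma of_fiber {f : ι × κ → ℝ} (hf : ∀ i, BddSum (fun k => f (i, k)) (g i)) (hg : BddSum g C) :
    BddSum f C := by
  have hs : Summable f := by
    refine (summable_prod_of_nonneg (fun p => (hf p.1).1 p.2)).2 ⟨fun i => (hf i).summable, ?_⟩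
    exact Summable.of_nonneg_of_le (fun i => (hf i).tsum_nonneg) (fun i => (hf i).tsum_le)
      hg.summable
  refine of_summable (fun p => (hf p.1).1 p.2) hs ?_
  rw [hs.tsum_prod]
  exact (hs.prod.tsum_le_tsum (fun i => (hf i).tsum_le) hg.summable).trans hg.tsum_le

/-- Arithmetic-geometric mean. -/
lemma amgm {F x z : ι → ℝ} (hF : ∀ i, 0 ≤ F i) (hxz : ∀ i, 0 ≤ x i * z i)
    (hx : BddSum (fun i => F i * x i ^ 2) C) (hz : BddSum (fun i => F i * z i ^ 2) D) :
    BddSum (fun i => F i * (x i * z i)) (C + D) :=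
  (hx.add hz).mono (fun i => mul_nonneg (hF i) (hxz i)) fun i => by
    have := hF i
    nlinarith [sq_nonneg (x i - z i), mul_nonneg (hF i) (sq_nonneg (x i - z i)), hxz i,
      mul_nonneg (hF i) (hxz i)]

/-- Cauchy-Schwarz. -/
lemma cauchy_schwarz {x z : ι → ℝ} (hx0 : ∀ i, 0 ≤ x i) (hz0 : ∀ i, 0 ≤ z i)
    (hx : BddSum (fun i => x i ^ 2) C) (hz : BddSum (fun i => z i ^ 2) D) :
    BddSum (fun i => x i * z i) (Real.sqrt C * Real.sqrt D) :=
  ⟨fun i => mul_nonneg (hx0 i) (hz0 i), fun s =>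
    (Real.sum_mul_le_sqrt_mul_sqrt s x z).trans
      (mul_le_mul (Real.sqrt_le_sqrt (hx.2 s)) (Real.sqrt_le_sqrt (hz.2 s)) (Real.sqrt_nonneg _)
        (Real.sqrt_nonneg _))⟩

/-- Weighted Cauchy-Schwarz in the inner variable. -/
lemma sq_tsum [Nonempty ι] {F x : ι × κ → ℝ} {A B : ℝ} (hx0 : ∀ p, 0 ≤ x p)
    (hF : ∀ i, BddSum (fun k => F (i, k)) A) (hx : BddSum (fun p => F p * x p ^ 2) B) :
    (∀ i, Summable fun k => F (i, k) * x (i, k)) ∧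
    BddSum (fun i => (∑' k, F (i, k) * x (i, k)) ^ 2) (A * B) := by
  have hF0 : ∀ p : ι × κ, 0 ≤ F p := fun p => (hF p.1).1 p.2
  have key : ∀ i, BddSum (fun k => F (i, k) * x (i, k))
      (Real.sqrt A * Real.sqrt (∑' k, F (i, k) * x (i, k) ^ 2)) := by
    intro i
    have h1 : BddSum (fun k => Real.sqrt (F (i, k)) ^ 2) A := by
      simpa only [Real.sq_sqrt (hF0 _)] using hF i
    have h2 : BddSum (fun k => (Real.sqrt (F (i, k)) * x (i, k)) ^ 2)
        (∑' k, F (i, k) * x (i, k) ^ 2) := by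
      simp only [mul_pow, Real.sq_sqrt (hF0 _)]
      exact of_summable (hx.fiber i).1 (hx.fiber i).summable le_rfl
    have h3 := cauchy_schwarz (fun k => Real.sqrt_nonneg _)
      (fun k => mul_nonneg (Real.sqrt_nonneg _) (hx0 _)) h1 h2
    simpa only [← mul_assoc, Real.mul_self_sqrt (hF0 _)] using h3
  refine ⟨fun i => (key i).summable, ?_⟩
  have hA : 0 ≤ A := (hF (Classical.arbitrary ι)).bound_nonneg
  refine (hx.tsum_fiber.const_mul hA).mono (fun i => sq_nonneg _) fun i => ?_
  have h0 := (hx.fiber i).tsum_nonneg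
  calc (∑' k, F (i, k) * x (i, k)) ^ 2
      ≤ (Real.sqrt A * Real.sqrt (∑' k, F (i, k) * x (i, k) ^ 2)) ^ 2 :=
        pow_le_pow_left₀ (key i).tsum_nonneg (key i).tsum_le 2
    _ = _ := by rw [mul_pow, Real.sq_sqrt hA, Real.sq_sqrt h0]

lemma summable_norm {f : ι → ℂ} (h : BddSum (fun i => ‖f i‖) C) : Summable f :=
  h.summable.of_norm

lemma norm_tsum_le {f : ι → ℂ} (h : BddSum (fun i => ‖f i‖) C) : ‖∑' i, f i‖ ≤ C :=
  (norm_tsum_le_tsum_norm h.summable).trans h.tsum_le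

lemma of_norm_le {F : ι → ℂ} (h : BddSum f C) (hF : ∀ i, ‖F i‖ ≤ f i) :
    BddSum (fun i => ‖F i‖) C := h.mono (fun _ => norm_nonneg _) hF

end BddSum

/-! ### Weights and convolutions. -/

/-- The weight `1 + |n|`. -/
def jp (n : ℤ) : ℝ := 1 + |(n : ℝ)|

lemma one_le_jp (n : ℤ) : 1 ≤ jp n := by unfold jp; linarith [abs_nonneg (n : ℝ)]

lemma jp_pos (n : ℤ) : 0 < jp n := lt_of_lt_of_le one_pos (one_le_jp n)

lemma abs_le_jp (n : ℤ) : |(n : ℝ)| ≤ jp n := by unfold jp; linarith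

lemma jp_neg (n : ℤ) : jp (-n) = jp n := by simp [jp]

lemma jp_add_le (a b : ℤ) : jp (a + b) ≤ jp a * jp b := by
  unfold jp
  push_cast
  nlinarith [abs_add_le (a : ℝ) b, mul_nonneg (abs_nonneg (a : ℝ)) (abs_nonneg (b : ℝ))]

lemma sq_le_jp_sq (n : ℤ) : (n : ℝ) ^ 2 ≤ jp n ^ 2 := by
  rw [← sq_abs]; exact pow_le_pow_left₀ (abs_nonneg _) (abs_le_jp n) 2

lemma jp_sq_le (n : ℤ) : jp n ^ 2 ≤ 2 * (1 + (n : ℝ) ^ 2) := by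
  unfold jp; nlinarith [sq_abs (n : ℝ), sq_nonneg (|(n : ℝ)| - 1)]

lemma one_add_sq_le_jp_sq (n : ℤ) : 1 + (n : ℝ) ^ 2 ≤ jp n ^ 2 := by
  unfold jp; nlinarith [sq_abs (n : ℝ), abs_nonneg (n : ℝ)]

/-- Convolution of two sequences. -/
def conv {𝕜 : Type*} [NormedRing 𝕜] (f g : ℤ → 𝕜) (n : ℤ) : 𝕜 := ∑' m : ℤ, f m * g (n - m)

lemma conv_pair_bdd {f g : ℤ → ℝ} {A B : ℝ} (hf : BddSum f A) (hg : BddSum g B) :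
    BddSum (fun p : ℤ × ℤ => f p.2 * g (p.1 - p.2)) (A * B) :=
  (hf.mul_prod hg).comp_injective (e := fun p : ℤ × ℤ => (p.2, p.1 - p.2)) (by
    rintro ⟨a, b⟩ ⟨c, d⟩ h
    simp only [Prod.mk.injEq] at h ⊢
    omega)

lemma conv_fiber_bdd {f g : ℤ → ℝ} {A B : ℝ} (hf : BddSum f A) (hg : BddSum g B) (n : ℤ) :
    BddSum (fun m => f m * g (n - m)) (conv f g n) :=
  BddSum.of_summable ((conv_pair_bdd hf hg).fiber n).1 ((conv_pair_bdd hf hg).fiber n).summable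
    le_rfl

lemma conv_bdd {f g : ℤ → ℝ} {A B : ℝ} (hf : BddSum f A) (hg : BddSum g B) :
    BddSum (conv f g) (A * B) := (conv_pair_bdd hf hg).tsum_fiber

lemma conv_sq_bdd {f g : ℤ → ℝ} {A B : ℝ} (hf : BddSum f A) (hg0 : ∀ n, 0 ≤ g n)
    (hg : BddSum (fun n => g n ^ 2) B) :
    (∀ n, BddSum (fun m => f m * g (n - m)) (conv f g n)) ∧
      BddSum (fun n => conv f g n ^ 2) (A * (A * B)) := by
  have h := BddSum.sq_tsum (F := fun p : ℤ × ℤ => f p.2) (x := fun p : ℤ × ℤ => g (p.1 - p.2))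
    (fun p => hg0 _) (fun _ => hf) (conv_pair_bdd hf hg)
  exact ⟨fun n => BddSum.of_summable (fun m => mul_nonneg (hf.1 _) (hg0 _)) (h.1 n) le_rfl, h.2⟩

lemma norm_conv_le {f g : ℤ → ℂ} {n : ℤ} {C : ℝ}
    (h : BddSum (fun m => ‖f m‖ * ‖g (n - m)‖) C) : ‖conv f g n‖ ≤ C :=
  BddSum.norm_tsum_le (by simpa only [norm_mul] using h)

/-- Weighted `ℓ¹` bound. -/
def W1 (f : ℤ → ℂ) (A : ℝ) : Prop := BddSum (fun n => jp n * ‖f n‖) A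

lemma W1.l1 {f : ℤ → ℂ} {A : ℝ} (h : W1 f A) : BddSum (fun n => ‖f n‖) A :=
  h.mono (fun _ => norm_nonneg _) fun n => le_mul_of_one_le_left (norm_nonneg _) (one_le_jp n)

lemma W1.le {f : ℤ → ℂ} {A B : ℝ} (h : W1 f A) (hAB : A ≤ B) : W1 f B := BddSum.le h hAB

lemma W1.bound_nonneg {f : ℤ → ℂ} {A : ℝ} (h : W1 f A) : 0 ≤ A := BddSum.bound_nonneg h

lemma W1.conv {f g : ℤ → ℂ} {A B : ℝ} (hf : W1 f A) (hg : W1 g B) : W1 (conv f g) (A * B) := by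
  refine (conv_bdd hf hg).mono (fun n => mul_nonneg (jp_pos n).le (norm_nonneg _)) fun n => ?_
  have h1 : BddSum (fun m => jp n * (‖f m‖ * ‖g (n - m)‖))
      (MKdV5.conv (fun n => jp n * ‖f n‖) (fun n => jp n * ‖g n‖) n) := by
    refine (conv_fiber_bdd hf hg n).mono (fun m => by have := jp_pos n; positivity) fun m => ?_
    have : jp n ≤ jp m * jp (n - m) := by simpa using jp_add_le m (n - m)
    calc jp n * (‖f m‖ * ‖g (n - m)‖) ≤ (jp m * jp (n - m)) * (‖f m‖ * ‖g (n - m)‖) := by gcongr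
      _ = _ := by ring
  have h2 : BddSum (fun m => ‖f m‖ * ‖g (n - m)‖) ((jp n)⁻¹ *
      MKdV5.conv (fun n => jp n * ‖f n‖) (fun n => jp n * ‖g n‖) n) := by
    have := h1.const_mul (inv_nonneg.2 (jp_pos n).le)
    simpa only [inv_mul_cancel_left₀ (jp_pos n).ne'] using this
  calc jp n * ‖MKdV5.conv f g n‖ ≤ jp n * ((jp n)⁻¹ *
      MKdV5.conv (fun n => jp n * ‖f n‖) (fun n => jp n * ‖g n‖) n) :=
        mul_le_mul_of_nonneg_left (norm_conv_le h2) (jp_pos n).le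
    _ = _ := mul_inv_cancel_left₀ (jp_pos n).ne' _

lemma W1.add {f g : ℤ → ℂ} {A B : ℝ} (hf : W1 f A) (hg : W1 g B) :
    W1 (fun n => f n + g n) (A + B) := by
  refine (BddSum.add hf hg).mono (fun n => mul_nonneg (jp_pos n).le (norm_nonneg _)) fun n => ?_
  rw [← mul_add]
  exact mul_le_mul_of_nonneg_left (norm_add_le _ _) (jp_pos n).le

lemma conv_fiber_summable_of_bddSum {f g : ℤ → ℂ} {A B : ℝ} (hf : BddSum (fun n => ‖f n‖) A)
    (hg : BddSum (fun n => ‖g n‖) B) (n : ℤ) : Summable fun m => f m * g (n - m) :=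
  BddSum.summable_norm (C := MKdV5.conv (fun n => ‖f n‖) (fun n => ‖g n‖) n)
    (by simpa only [norm_mul] using conv_fiber_bdd hf hg n)

lemma conv_fiber_summable {f g : ℤ → ℂ} {A B : ℝ} (hf : W1 f A) (hg : W1 g B) (n : ℤ) :
    Summable fun m => f m * g (n - m) := conv_fiber_summable_of_bddSum hf.l1 hg.l1 n

lemma norm_conv_bdd {f g : ℤ → ℂ} {A B : ℝ} (hf : BddSum (fun n => ‖f n‖) A)
    (hg : BddSum (fun n => ‖g n‖) B) : BddSum (fun n => ‖conv f g n‖) (A * B) :=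
  (conv_bdd hf hg).mono (fun _ => norm_nonneg _) fun n => norm_conv_le (conv_fiber_bdd hf hg n)

lemma conv_comm (f g : ℤ → ℂ) : conv f g = conv g f := by
  funext n
  unfold conv
  rw [← (Equiv.subLeft n).tsum_eq]
  simp [mul_comm]

lemma conv_add_right {f g h : ℤ → ℂ} {A B C : ℝ} (hf : W1 f A) (hg : W1 g B) (hh : W1 h C) :
    conv f (fun n => g n + h n) = fun n => conv f g n + conv f h n := by
  funext n
  unfold conv
  rw [← (conv_fiber_summable hf hg n).tsum_add (conv_fiber_summable hf hh n)]
  simp only [mul_add]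

lemma conv_sub_right {f g h : ℤ → ℂ} {A B C : ℝ} (hf : W1 f A) (hg : W1 g B) (hh : W1 h C) :
    conv f (fun n => g n - h n) = fun n => conv f g n - conv f h n := by
  funext n
  unfold conv
  rw [← (conv_fiber_summable hf hg n).tsum_sub (conv_fiber_summable hf hh n)]
  simp only [mul_sub]

lemma conv_add_left {f g h : ℤ → ℂ} {A B C : ℝ} (hf : W1 f A) (hg : W1 g B) (hh : W1 h C) :
    conv (fun n => g n + h n) f = fun n => conv g f n + conv h f n := by
  rw [conv_comm, conv_add_right hf hg hh, conv_comm f g, conv_comm f h]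

lemma conv_sub_left {f g h : ℤ → ℂ} {A B C : ℝ} (hf : W1 f A) (hg : W1 g B) (hh : W1 h C) :
    conv (fun n => g n - h n) f = fun n => conv g f n - conv h f n := by
  rw [conv_comm, conv_sub_right hf hg hh, conv_comm f g, conv_comm f h]

lemma conv_assoc_of_bddSum {f g h : ℤ → ℂ} {A B C : ℝ} (hf : BddSum (fun n => ‖f n‖) A)
    (hg : BddSum (fun n => ‖g n‖) B) (hh : BddSum (fun n => ‖h n‖) C) :
    conv (conv f g) h = conv f (conv g h) := by
  funext n
  have hb : BddSum (fun p : ℤ × ℤ => ‖f p.1 * (g p.2 * h (n - p.1 - p.2))‖) (A * B * C) := by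
    refine ((hf.mul_prod hg).const_mul hh.bound_nonneg).mono (fun _ => norm_nonneg _)
      (fun p => ?_) |>.le (by linarith [mul_comm (A * B) C])
    have := hh.apply_le (n - p.1 - p.2)
    rw [norm_mul, norm_mul, ← mul_assoc, mul_comm C]
    gcongr
  let e : ℤ × ℤ ≃ ℤ × ℤ :=
    { toFun := fun p => (p.2, p.1 - p.2)
      invFun := fun p => (p.1 + p.2, p.1)
      left_inv := fun p => by ext <;> simp
      right_inv := fun p => by ext <;> simp }
  have h1 : conv f (conv g h) n = ∑' p : ℤ × ℤ, f p.1 * (g p.2 * h (n - p.1 - p.2)) := by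
    rw [hb.summable_norm.tsum_prod]
    unfold conv
    simp only [tsum_mul_left]
  have h2 : conv (conv f g) h n =
      ∑' p : ℤ × ℤ, f (e p).1 * (g (e p).2 * h (n - (e p).1 - (e p).2)) := by
    have hb2 := hb.comp_injective e.injective
    rw [hb2.summable_norm.tsum_prod]
    unfold conv
    refine tsum_congr fun m => ?_
    rw [← tsum_mul_right]
    refine tsum_congr fun k => ?_
    simp only [e, Equiv.coe_fn_mk]
    rw [show n - k - (m - k) = n - m by ring, mul_assoc]
  rw [h1, h2, e.tsum_eq (fun p : ℤ × ℤ => f p.1 * (g p.2 * h (n - p.1 - p.2)))]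

lemma conv_assoc {f g h : ℤ → ℂ} {A B C : ℝ} (hf : W1 f A) (hg : W1 g B) (hh : W1 h C) :
    conv (conv f g) h = conv f (conv g h) := conv_assoc_of_bddSum hf.l1 hg.l1 hh.l1

/-- The quintic convolution. -/
def Q5 (u : ℤ → ℂ) : ℤ → ℂ := conv (conv (conv u u) (conv u u)) u

/-- The kernel of the difference of two quintic convolutions. -/
def D5 (u v : ℤ → ℂ) : ℤ → ℂ := fun n =>
  conv (conv u u) (conv u u) n +
    conv (conv (fun m => conv u u m + conv v v m) (fun m => u m + v m)) v n

lemma D5_W1 {u v : ℤ → ℂ} {A : ℝ} (hu : W1 u A) (hv : W1 v A) : W1 (D5 u v) (5 * A ^ 4) := by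
  refine BddSum.le (W1.add ((hu.conv hu).conv (hu.conv hu))
    ((((hu.conv hu).add (hv.conv hv)).conv (hu.add hv)).conv hv)) (le_of_eq (by ring))

lemma Q5_sub {u v : ℤ → ℂ} {A : ℝ} (hu : W1 u A) (hv : W1 v A)
    (hw : W1 (fun n => u n - v n) (2 * A)) (n : ℤ) :
    Q5 u n - Q5 v n = conv (D5 u v) (fun n => u n - v n) n := by
  set w : ℤ → ℂ := fun n => u n - v n with hwdef
  set Pu := conv u u
  set Pv := conv v v
  have hPu : W1 Pu (A * A) := hu.conv hu
  have hPv : W1 Pv (A * A) := hv.conv hv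
  have hs : W1 (fun m => u m + v m) (A + A) := hu.add hv
  have hX : W1 (fun m => Pu m + Pv m) _ := hPu.add hPv
  have e1 : conv (fun m => u m + v m) w = fun n => Pu n - Pv n := by
    rw [hwdef, conv_sub_right hs hu hv]
    funext n
    rw [conv_add_left hu hu hv, conv_add_left hv hu hv, conv_comm v u]
    simp only [Pu, Pv]; ring
  have hPd : W1 (fun n => Pu n - Pv n) _ := e1 ▸ hs.conv hw
  have e2 : conv (fun m => Pu m + Pv m) (fun n => Pu n - Pv n) =
      fun n => conv Pu Pu n - conv Pv Pv n := by
    rw [conv_sub_right hX hPu hPv]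
    funext n
    rw [conv_add_left hPu hPu hPv, conv_add_left hPv hPu hPv, conv_comm Pv Pu]
    simp only; ring
  have e3 : conv (conv (conv (fun m => Pu m + Pv m) (fun m => u m + v m)) v) w =
      fun n => conv (conv Pu Pu) v n - conv (conv Pv Pv) v n := by
    rw [conv_assoc (hX.conv hs) hv hw, conv_comm v w, ← conv_assoc (hX.conv hs) hw hv,
      conv_assoc hX hs hw, e1, e2, conv_sub_left hv (hPu.conv hPu) (hPv.conv hPv)]
  unfold D5
  rw [conv_add_left hw (hPu.conv hPu) ((hX.conv hs).conv hv), e3, hwdef,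
    conv_sub_right (hPu.conv hPu) hu hv]
  simp only [Q5, Pu, Pv]
  ring

/-! ### Majorants in `H²` and the trilinear form. -/

/-- `α` majorizes a bounded set of `H²`. -/
structure Maj (α : ℤ → ℝ) (K : ℝ) : Prop where
  one_le : 1 ≤ K
  l1j : BddSum (fun n => jp n * α n) K
  l2j : BddSum (fun n => (jp n ^ 2 * α n) ^ 2) K

namespace Maj

variable {α : ℤ → ℝ} {K : ℝ}

lemma pos (h : Maj α K) : 0 < K := lt_of_lt_of_le one_pos h.one_le

lemma nonneg (h : Maj α K) (n : ℤ) : 0 ≤ α n :=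
  nonneg_of_mul_nonneg_right (h.l1j.1 n) (jp_pos n)

lemma l1 (h : Maj α K) : BddSum α K :=
  h.l1j.mono h.nonneg fun n => le_mul_of_one_le_left (h.nonneg n) (one_le_jp n)

lemma l2 (h : Maj α K) : BddSum (fun n => (jp n * α n) ^ 2) K :=
  h.l2j.mono (fun n => sq_nonneg _) fun n => by
    have := h.nonneg n
    have h1 := one_le_jp n
    gcongr
    exact le_self_pow₀ h1 two_ne_zero

lemma l2z (h : Maj α K) : BddSum (fun n => α n ^ 2) K :=
  h.l2.mono (fun _ => sq_nonneg _) fun n =>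
    pow_le_pow_left₀ (h.nonneg n) (le_mul_of_one_le_left (h.nonneg n) (one_le_jp n)) 2

lemma l2n (h : Maj α K) : BddSum (fun n : ℤ => ((n : ℝ) ^ 2 * α n) ^ 2) K :=
  h.l2j.mono (fun n => sq_nonneg _) fun n => by
    have := h.nonneg n
    have := sq_le_jp_sq n
    gcongr

lemma sup (h : Maj α K) (n : ℤ) : jp n ^ 2 * α n ≤ K := by
  have h1 := h.l2j.apply_le n
  have h2 := h.one_le
  have h3 := h.nonneg n
  by_contra! hc
  nlinarith

lemma le (h : Maj α K) {K' : ℝ} (hK : K ≤ K') : Maj α K' :=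
  ⟨h.one_le.trans hK, h.l1j.le hK, h.l2j.le hK⟩

lemma W1 (h : Maj α K) {u : ℤ → ℂ} (hu : ∀ n, ‖u n‖ ≤ α n) : W1 u K :=
  h.l1j.mono (fun n => mul_nonneg (jp_pos n).le (norm_nonneg _)) fun n =>
    mul_le_mul_of_nonneg_left (hu n) (jp_pos n).le

end Maj

/-- The symbol `n² + p₁² + p₂² + p₃²` on `n = p₁ + p₂ + p₃`. -/
def sym3 (n p₁ p₂ : ℤ) : ℝ :=
  (n : ℝ) ^ 2 + (p₁ : ℝ) ^ 2 + (p₂ : ℝ) ^ 2 + ((n - p₁ - p₂ : ℤ) : ℝ) ^ 2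

lemma sym3_nonneg (n p₁ p₂ : ℤ) : 0 ≤ sym3 n p₁ p₂ := by unfold sym3; positivity

/-- The cubic form of the equation. -/
def T3 (β : ℤ → ℤ → ℂ) (w : ℤ → ℂ) (n : ℤ) : ℂ :=
  ∑' p : ℤ × ℤ, ((sym3 n p.1 p.2 : ℝ) : ℂ) * (β p.1 p.2 * w (n - p.1 - p.2))

/-- The majorant of the cubic form. -/
def T3maj (α : ℤ → ℝ) (n : ℤ) : ℝ :=
  12 * ∑' p : ℤ × ℤ, α p.1 * α p.2 *
    (((n - p.1 - p.2 : ℤ) : ℝ) ^ 2 * α (n - p.1 - p.2))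

/-- The shear `(n, p₁, p₂) ↦ (p₁, p₂, n - p₁ - p₂)`. -/
def shear3 : ℤ × ℤ × ℤ ≃ ℤ × ℤ × ℤ where
  toFun q := (q.2.1, q.2.2, q.1 - q.2.1 - q.2.2)
  invFun q := (q.1 + q.2.1 + q.2.2, q.1, q.2.1)
  left_inv q := by ext <;> simp
  right_inv q := by ext <;> simp; ring

lemma T3maj_bdd {α : ℤ → ℝ} {K : ℝ} (h : Maj α K) :
    (∀ n, BddSum (fun p : ℤ × ℤ => sym3 n p.1 p.2 * (α p.1 * α p.2 * α (n - p.1 - p.2)))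
      (T3maj α n)) ∧ BddSum (fun n => T3maj α n ^ 2) (144 * K ^ 5) := by
  have h0 := h.nonneg
  have h1 := BddSum.sq_tsum (ι := ℤ) (κ := ℤ × ℤ) (F := fun q => α q.2.1 * α q.2.2)
    (x := fun q => ((q.1 - q.2.1 - q.2.2 : ℤ) : ℝ) ^ 2 * α (q.1 - q.2.1 - q.2.2))
    (A := K * K) (B := K * (K * K))
    (fun q => mul_nonneg (sq_nonneg _) (h0 _)) (fun _ => h.l1.mul_prod h.l1)
    (((h.l1.mul_prod (h.l1.mul_prod h.l2n)).comp_injective shear3.injective).mono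
      (fun q => mul_nonneg (mul_nonneg (h0 _) (h0 _)) (sq_nonneg _))
      fun q => by simp [shear3, mul_assoc])
  have hF : ∀ n : ℤ, BddSum (fun p : ℤ × ℤ => α p.1 * α p.2 *
      (((n - p.1 - p.2 : ℤ) : ℝ) ^ 2 * α (n - p.1 - p.2))) (T3maj α n / 12) := fun n =>
    BddSum.of_summable (fun p => mul_nonneg (mul_nonneg (h0 _) (h0 _))
      (mul_nonneg (sq_nonneg _) (h0 _))) (h1.1 n) (by simp [T3maj])
  refine ⟨fun n => ?_, ?_⟩
  · have e1 := (hF n).comp_injective (e := fun p : ℤ × ℤ => (n - p.1 - p.2, p.2)) (by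
      rintro ⟨a, b⟩ ⟨c, d⟩ hh
      simp only [Prod.mk.injEq] at hh ⊢
      omega)
    have e2 := (hF n).comp_injective (e := fun p : ℤ × ℤ => (p.1, n - p.1 - p.2)) (by
      rintro ⟨a, b⟩ ⟨c, d⟩ hh
      simp only [Prod.mk.injEq] at hh ⊢
      omega)
    refine ((((hF n).add e1).add e2).const_mul (c := 4) (by norm_num)).mono
      (fun p => mul_nonneg (sym3_nonneg _ _ _) (mul_nonneg (mul_nonneg (h0 _) (h0 _)) (h0 _)))
      (fun p => ?_) |>.le (by linarith)
    have hs : sym3 n p.1 p.2 ≤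
        4 * (((n - p.1 - p.2 : ℤ) : ℝ) ^ 2 + (p.1 : ℝ) ^ 2 + (p.2 : ℝ) ^ 2) := by
      unfold sym3
      push_cast
      nlinarith [sq_nonneg ((n : ℝ) - p.1 - p.2 - p.1), sq_nonneg ((n : ℝ) - p.1 - p.2 - p.2),
        sq_nonneg ((p.1 : ℝ) - p.2)]
    have hn : 0 ≤ α p.1 * α p.2 * α (n - p.1 - p.2) :=
      mul_nonneg (mul_nonneg (h0 _) (h0 _)) (h0 _)
    refine (mul_le_mul_of_nonneg_right hs hn).trans (le_of_eq ?_)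
    rw [show n - (n - p.1 - p.2) - p.2 = p.1 by ring, show n - p.1 - (n - p.1 - p.2) = p.2 by ring]
    ring
  · refine (h1.2.const_mul (c := 144) (by norm_num)).mono (fun n => sq_nonneg _) (fun n => ?_)
      |>.le (le_of_eq (by ring))
    unfold T3maj
    rw [mul_pow]
    norm_num

section
variable {α : ℤ → ℝ} {K : ℝ} {β : ℤ → ℤ → ℂ} {w : ℤ → ℂ}

lemma T3_fiber (h : Maj α K) (hβ : ∀ a b, ‖β a b‖ ≤ α a * α b) (hw : ∀ n, ‖w n‖ ≤ α n) (n : ℤ) :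
    BddSum (fun p : ℤ × ℤ => ‖((sym3 n p.1 p.2 : ℝ) : ℂ) * (β p.1 p.2 * w (n - p.1 - p.2))‖)
      (T3maj α n) := by
  refine BddSum.of_norm_le ((T3maj_bdd h).1 n) fun p => ?_
  rw [norm_mul, norm_mul, Complex.norm_real, Real.norm_of_nonneg (sym3_nonneg _ _ _)]
  exact mul_le_mul_of_nonneg_left (mul_le_mul (hβ _ _) (hw _) (norm_nonneg _)
    (mul_nonneg (h.nonneg _) (h.nonneg _))) (sym3_nonneg _ _ _)

lemma norm_T3_le (h : Maj α K) (hβ : ∀ a b, ‖β a b‖ ≤ α a * α b) (hw : ∀ n, ‖w n‖ ≤ α n) (n : ℤ) :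
    ‖T3 β w n‖ ≤ T3maj α n := (T3_fiber h hβ hw n).norm_tsum_le

/-- The cubic form is controlled, frequency by frequency, by the `ℓ²` norm of its last
argument. -/
lemma norm_T3_le_sqrt (h : Maj α K) (hβ : ∀ a b, ‖β a b‖ ≤ α a * α b) {y : ℝ}
    (hy : BddSum (fun n => ‖w n‖ ^ 2) y) (n : ℤ) :
    ‖T3 β w n‖ ≤ 8 * K ^ 2 * jp n ^ 2 * Real.sqrt y := by
  have h0 := h.nonneg
  have hK := h.one_le
  have hy0 := hy.bound_nonneg
  have hc : BddSum (fun p : ℤ × ℤ => (jp p.1 ^ 2 * α p.1) * (α p.2 * ‖w (n - p.1 - p.2)‖))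
      (K * Real.sqrt (K * y)) := by
    have hx : BddSum (fun p : ℤ × ℤ => ((jp p.1 ^ 2 * α p.1) * Real.sqrt (α p.2)) ^ 2) (K * K) :=
      (h.l2j.mul_prod h.l1).mono (fun _ => sq_nonneg _) fun p => by
        rw [mul_pow _ (Real.sqrt _), Real.sq_sqrt (h0 _)]
    have hz : BddSum (fun p : ℤ × ℤ => (Real.sqrt (α p.2) * ‖w (n - p.1 - p.2)‖) ^ 2) (K * y) :=
      ((h.l1.mul_prod hy).comp_injective (e := fun p : ℤ × ℤ => (p.2, n - p.1 - p.2)) (by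
        rintro ⟨a, b⟩ ⟨c, d⟩ hh
        simp only [Prod.mk.injEq] at hh ⊢
        omega)).mono (fun _ => sq_nonneg _) fun p => by
        rw [mul_pow (Real.sqrt _), Real.sq_sqrt (h0 _)]
    have := BddSum.cauchy_schwarz
      (fun p => mul_nonneg (mul_nonneg (sq_nonneg _) (h0 _)) (Real.sqrt_nonneg _))
      (fun p => mul_nonneg (Real.sqrt_nonneg _) (norm_nonneg _)) hx hz
    rw [Real.sqrt_mul_self h.pos.le] at this
    refine this.mono (fun p => mul_nonneg (mul_nonneg (sq_nonneg _) (h0 _))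
      (mul_nonneg (h0 _) (norm_nonneg _))) fun p => le_of_eq ?_
    have e := Real.mul_self_sqrt (h0 p.2)
    calc _ = (jp p.1 ^ 2 * α p.1) * ((Real.sqrt (α p.2) * Real.sqrt (α p.2)) *
          ‖w (n - p.1 - p.2)‖) := by rw [e]
      _ = _ := by ring
  have hc' := hc.comp_injective (e := Prod.swap) Prod.swap_injective
  have hb : BddSum (fun p : ℤ × ℤ => ‖((sym3 n p.1 p.2 : ℝ) : ℂ) *
      (β p.1 p.2 * w (n - p.1 - p.2))‖) (4 * jp n ^ 2 * (K * Real.sqrt (K * y) +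
        K * Real.sqrt (K * y))) := by
    refine BddSum.of_norm_le ((hc.add hc').const_mul (c := 4 * jp n ^ 2) (by positivity))
      fun p => ?_
    rw [norm_mul, norm_mul, Complex.norm_real, Real.norm_of_nonneg (sym3_nonneg _ _ _)]
    have hs : sym3 n p.1 p.2 ≤ 4 * jp n ^ 2 * (jp p.1 ^ 2 + jp p.2 ^ 2) := by
      have a1 := sq_le_jp_sq p.1
      have a2 := sq_le_jp_sq p.2
      have a3 := one_add_sq_le_jp_sq n
      have a4 := one_le_pow₀ (n := 2) (one_le_jp n)
      have a5 := one_le_pow₀ (n := 2) (one_le_jp p.1)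
      have a6 := one_le_pow₀ (n := 2) (one_le_jp p.2)
      have : sym3 n p.1 p.2 ≤ 4 * ((n : ℝ) ^ 2 + (p.1 : ℝ) ^ 2 + (p.2 : ℝ) ^ 2) := by
        unfold sym3
        push_cast
        nlinarith [sq_nonneg ((n : ℝ) + p.1), sq_nonneg ((n : ℝ) + p.2),
          sq_nonneg ((p.1 : ℝ) - p.2)]
      nlinarith
    have hd : n - p.2 - p.1 = n - p.1 - p.2 := by ring
    simp only [Prod.fst_swap, Prod.snd_swap, hd]
    calc _ ≤ (4 * jp n ^ 2 * (jp p.1 ^ 2 + jp p.2 ^ 2)) *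
          ((α p.1 * α p.2) * ‖w (n - p.1 - p.2)‖) := by
          have := hβ p.1 p.2
          have := h0 p.1
          have := h0 p.2
          gcongr
      _ = _ := by ring
  refine hb.norm_tsum_le.trans ?_
  have : Real.sqrt (K * y) ≤ K * Real.sqrt y := by
    rw [Real.sqrt_mul h.pos.le]
    refine mul_le_mul_of_nonneg_right ?_ (Real.sqrt_nonneg _)
    exact Real.sqrt_le_self_iff.2 (Or.inr hK)
  have h2 := jp_pos n
  have hKp := h.pos
  calc _ = 8 * jp n ^ 2 * K * Real.sqrt (K * y) := by ring
    _ ≤ 8 * jp n ^ 2 * K * (K * Real.sqrt y) := by gcongr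
    _ = _ := by ring

end

/-- The gradient of the potential energy. -/
def G (κ l : ℝ) (u : ℤ → ℂ) (n : ℤ) : ℂ := κ * T3 (fun a b => u a * u b) u n - l * Q5 u n

/-- The ball of radius `√R` of `H²`. -/
def HBall (R : ℝ) (a : ℤ → ℂ) : Prop :=
  BddSum (fun n : ℤ => (1 + (n : ℝ) ^ 2) ^ 2 * ‖a n‖ ^ 2) R

lemma summable_jp : Summable fun n : ℤ => (jp n ^ 2)⁻¹ := by
  have h : Summable fun n : ℤ => |(n : ℝ)| ^ (-2 : ℝ) := Real.summable_abs_int_rpow (by norm_num)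
  refine Summable.of_norm_bounded_eventually h ?_
  filter_upwards [(Set.finite_singleton (0 : ℤ)).compl_mem_cofinite] with n hn
  have hn0 : (0 : ℝ) < |(n : ℝ)| := by simpa using hn
  rw [Real.rpow_neg hn0.le, Real.norm_of_nonneg (inv_nonneg.2 (sq_nonneg _)),
    show (2 : ℝ) = ((2 : ℕ) : ℝ) by norm_num, Real.rpow_natCast]
  gcongr
  exact abs_le_jp n

/-- The sum of `jp⁻²`. -/
def Jsum : ℝ := ∑' n : ℤ, (jp n ^ 2)⁻¹

lemma bddSum_jp : BddSum (fun n : ℤ => (jp n ^ 2)⁻¹) Jsum :=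
  BddSum.of_summable (fun _ => inv_nonneg.2 (sq_nonneg _)) summable_jp le_rfl

namespace HBall

variable {R : ℝ} {a b : ℤ → ℂ}

/-- The constant of the majorant attached to a ball. -/
def const (R : ℝ) : ℝ := 1 + 4 * R + Real.sqrt Jsum * Real.sqrt (4 * R)

lemma radius_nonneg (h : HBall R a) : 0 ≤ R := h.bound_nonneg

lemma le {R' : ℝ} (h : HBall R a) (hR : R ≤ R') : HBall R' a := BddSum.le h hR

lemma maj (h : HBall R a) : Maj (fun n => ‖a n‖) (const R) := by
  have hR := h.radius_nonneg
  have h2 : BddSum (fun n => (jp n ^ 2 * ‖a n‖) ^ 2) (4 * R) := by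
    refine (BddSum.const_mul h (c := 4) (by norm_num)).mono (fun n => sq_nonneg _) fun n => ?_
    have := jp_sq_le n
    have h0 := one_le_jp n
    calc (jp n ^ 2 * ‖a n‖) ^ 2 ≤ (2 * (1 + (n : ℝ) ^ 2) * ‖a n‖) ^ 2 := by gcongr
      _ = _ := by ring
  have h1 : BddSum (fun n => jp n * ‖a n‖) (Real.sqrt Jsum * Real.sqrt (4 * R)) := by
    refine (BddSum.cauchy_schwarz (x := fun n => (jp n)⁻¹) (z := fun n => jp n ^ 2 * ‖a n‖)
      (fun n => inv_nonneg.2 (jp_pos n).le)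
      (fun n => mul_nonneg (sq_nonneg _) (norm_nonneg _)) (C := Jsum)
      (by simpa only [inv_pow] using bddSum_jp) h2).mono
      (fun n => mul_nonneg (jp_pos n).le (norm_nonneg _)) fun n => le_of_eq ?_
    have := (jp_pos n).ne'
    field_simp
  have h3 : 0 ≤ Real.sqrt Jsum * Real.sqrt (4 * R) := by positivity
  exact ⟨by unfold const; linarith, h1.le (by unfold const; linarith),
    h2.le (by unfold const; linarith)⟩

lemma apply_le (h : HBall R a) (n : ℤ) : ‖a n‖ ≤ 2 * Real.sqrt R * (jp n ^ 2)⁻¹ := by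
  have h1 : ((1 + (n : ℝ) ^ 2) * ‖a n‖) ^ 2 ≤ R := by
    have := BddSum.apply_le h n
    rwa [← mul_pow] at this
  have h2 : (1 + (n : ℝ) ^ 2) * ‖a n‖ ≤ Real.sqrt R := Real.le_sqrt_of_sq_le h1
  have h3 := jp_sq_le n
  have h4 : 0 < jp n ^ 2 := pow_pos (jp_pos n) 2
  rw [← div_eq_mul_inv, le_div_iff₀ h4]
  nlinarith [norm_nonneg (a n), mul_le_mul_of_nonneg_left h3 (norm_nonneg (a n))]

lemma sub (ha : HBall R a) (hb : HBall R b) : HBall (4 * R) (fun n => a n - b n) := by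
  refine ((BddSum.add ha hb).const_mul (c := 2) (by norm_num)).mono
    (fun n => by positivity) (fun n => ?_) |>.le (by linarith)
  have h1 : ‖a n - b n‖ ^ 2 ≤ 2 * (‖a n‖ ^ 2 + ‖b n‖ ^ 2) := by
    have := norm_sub_le (a n) (b n)
    nlinarith [sq_nonneg (‖a n‖ - ‖b n‖), norm_nonneg (a n - b n)]
  calc _ ≤ (1 + (n : ℝ) ^ 2) ^ 2 * (2 * (‖a n‖ ^ 2 + ‖b n‖ ^ 2)) := by gcongr
    _ = _ := by ring

lemma maj_add (ha : HBall R a) (hb : HBall R b) :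
    Maj (fun n => ‖a n‖ + ‖b n‖) (const (4 * R)) := by
  have h : HBall (4 * R) (fun n => ((‖a n‖ + ‖b n‖ : ℝ) : ℂ)) := by
    refine ((BddSum.add ha hb).const_mul (c := 2) (by norm_num)).mono
      (fun n => by positivity) (fun n => ?_) |>.le (by linarith)
    rw [Complex.norm_real, Real.norm_of_nonneg (by positivity)]
    calc _ ≤ (1 + (n : ℝ) ^ 2) ^ 2 * (2 * (‖a n‖ ^ 2 + ‖b n‖ ^ 2)) := by
          gcongr; nlinarith [sq_nonneg (‖a n‖ - ‖b n‖)]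
      _ = _ := by ring
  have := h.maj
  simpa only [Complex.norm_real, Real.norm_of_nonneg (add_nonneg (norm_nonneg _) (norm_nonneg _))]
    using this

end HBall

/-! ### Quartic index sets and resonance weights. -/

/-- The fourth frequency: `n₁ + n₂ + n₃ + n₄ = 0`. -/
def fourth (q : ℤ × ℤ × ℤ) : ℤ := -q.1 - q.2.1 - q.2.2

/-- The sum of the squares of the four frequencies. -/
def sumSq (q : ℤ × ℤ × ℤ) : ℝ :=
  (q.1 : ℝ) ^ 2 + (q.2.1 : ℝ) ^ 2 + (q.2.2 : ℝ) ^ 2 + (fourth q : ℝ) ^ 2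

lemma sumSq_nonneg (q : ℤ × ℤ × ℤ) : 0 ≤ sumSq q := by unfold sumSq; positivity

/-- The normal form symbol `((n₁ + n₃)(n₂ + n₃))⁻¹`, zero on resonances. -/
def nfSym (q : ℤ × ℤ × ℤ) : ℝ := (((q.1 + q.2.2 : ℤ) : ℝ) * ((q.2.1 + q.2.2 : ℤ) : ℝ))⁻¹

/-- Exchange of the last two frequencies. -/
def swap34 : ℤ × ℤ × ℤ ≃ ℤ × ℤ × ℤ where
  toFun q := (q.1, q.2.1, fourth q)
  invFun q := (q.1, q.2.1, fourth q)
  left_inv q := by ext <;> simp [fourth]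
  right_inv q := by ext <;> simp [fourth]

/-- Exchange of the first two frequencies. -/
def swap12 : ℤ × ℤ × ℤ ≃ ℤ × ℤ × ℤ where
  toFun q := (q.2.1, q.1, q.2.2)
  invFun q := (q.2.1, q.1, q.2.2)
  left_inv _ := rfl
  right_inv _ := rfl

lemma fourth_swap34 (q : ℤ × ℤ × ℤ) : fourth (swap34 q) = q.2.2 := by
  simp [fourth, swap34]

lemma sumSq_swap34 (q : ℤ × ℤ × ℤ) : sumSq (swap34 q) = sumSq q := by
  unfold sumSq
  rw [fourth_swap34]
  simp only [swap34, Equiv.coe_fn_mk]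
  ring

lemma nfSym_swap34 (q : ℤ × ℤ × ℤ) : nfSym (swap34 q) = nfSym q := by
  unfold nfSym
  congr 1
  simp only [swap34, fourth, Equiv.coe_fn_mk]
  push_cast
  ring

lemma nfSym_swap12 (q : ℤ × ℤ × ℤ) : nfSym (swap12 q) = nfSym q := by
  unfold nfSym
  congr 1
  simp only [swap12, Equiv.coe_fn_mk]
  ring

lemma fourth_swap12 (q : ℤ × ℤ × ℤ) : fourth (swap12 q) = fourth q := by
  simp only [fourth, swap12, Equiv.coe_fn_mk]
  ring

lemma bddSum_inv : BddSum (fun n : ℤ => (|(n : ℝ)|⁻¹) ^ 2) (4 * Jsum) := by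
  refine (bddSum_jp.const_mul (c := 4) (by norm_num)).mono (fun n => sq_nonneg _) fun n => ?_
  rcases eq_or_ne n 0 with rfl | hn
  · simp [jp]
  · have h1 : (1 : ℝ) ≤ |(n : ℝ)| := by exact_mod_cast Int.one_le_abs hn
    have h2 : jp n ≤ 2 * |(n : ℝ)| := by unfold jp; linarith
    rw [inv_pow, ← div_eq_mul_inv, le_div_iff₀ (pow_pos (jp_pos n) 2), inv_mul_le_iff₀ (by positivity)]
    nlinarith [jp_pos n]

/-- `|n₁| / |ab| ≤ (1 + |n₂|)(1/|a| + 1/|b|)`. -/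
lemma nfSym_mul_first_le (q : ℤ × ℤ × ℤ) :
    |nfSym q| * |(q.1 : ℝ)| ≤
      jp q.2.1 * (|((q.1 + q.2.2 : ℤ) : ℝ)|⁻¹ + |((q.2.1 + q.2.2 : ℤ) : ℝ)|⁻¹) := by
  obtain ⟨x, y, z⟩ := q
  simp only [nfSym]
  rcases eq_or_ne (x + z) 0 with ha | ha
  · simp only [ha, Int.cast_zero, zero_mul, inv_zero, abs_zero]
    have := jp_pos y
    positivity
  rcases eq_or_ne (y + z) 0 with hb | hb
  · simp only [hb, Int.cast_zero, mul_zero, inv_zero, abs_zero, zero_mul]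
    have := jp_pos y
    positivity
  have ha1 : (1 : ℝ) ≤ |((x + z : ℤ) : ℝ)| := by exact_mod_cast Int.one_le_abs ha
  have hb1 : (1 : ℝ) ≤ |((y + z : ℤ) : ℝ)| := by exact_mod_cast Int.one_le_abs hb
  have hx : |(x : ℝ)| ≤ |(y : ℝ)| + |((x + z : ℤ) : ℝ)| + |((y + z : ℤ) : ℝ)| := by
    have : (x : ℝ) = y + ((x + z : ℤ) : ℝ) - ((y + z : ℤ) : ℝ) := by push_cast; ring
    calc |(x : ℝ)| = |(y : ℝ) + ((x + z : ℤ) : ℝ) - ((y + z : ℤ) : ℝ)| := by rw [← this]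
      _ ≤ |(y : ℝ) + ((x + z : ℤ) : ℝ)| + |((y + z : ℤ) : ℝ)| := abs_sub _ _
      _ ≤ _ := by gcongr; exact abs_add_le _ _
  rw [abs_inv, abs_mul, inv_mul_le_iff₀ (by positivity)]
  set A := |((x + z : ℤ) : ℝ)|
  set B := |((y + z : ℤ) : ℝ)|
  have e : A * B * (jp y * (A⁻¹ + B⁻¹)) = jp y * (A + B) := by
    field_simp
    ring
  rw [e]
  unfold jp
  nlinarith [abs_nonneg (y : ℝ)]

/-- `|n₃| / |ab| ≤ (1 + |n₁|) / |b|`. -/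
lemma nfSym_mul_third_le (q : ℤ × ℤ × ℤ) :
    |nfSym q| * |(q.2.2 : ℝ)| ≤ jp q.1 * |((q.2.1 + q.2.2 : ℤ) : ℝ)|⁻¹ := by
  obtain ⟨x, y, z⟩ := q
  simp only [nfSym]
  rcases eq_or_ne (x + z) 0 with ha | ha
  · simp only [ha, Int.cast_zero, zero_mul, inv_zero, abs_zero]
    have := jp_pos x
    positivity
  have ha1 : (1 : ℝ) ≤ |((x + z : ℤ) : ℝ)| := by exact_mod_cast Int.one_le_abs ha
  have hz : |(z : ℝ)| ≤ |((x + z : ℤ) : ℝ)| + |(x : ℝ)| := by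
    have : (z : ℝ) = ((x + z : ℤ) : ℝ) - x := by push_cast; ring
    calc |(z : ℝ)| = |((x + z : ℤ) : ℝ) - x| := by rw [← this]
      _ ≤ _ := abs_sub _ _
  rw [abs_inv, abs_mul, mul_inv, mul_right_comm]
  refine mul_le_mul_of_nonneg_right ?_ (by positivity)
  rw [inv_mul_le_iff₀ (by positivity)]
  unfold jp
  nlinarith [abs_nonneg (x : ℝ)]

lemma nfSym_mul_third_le' (q : ℤ × ℤ × ℤ) :
    |nfSym q| * |(q.2.2 : ℝ)| ≤ jp q.2.1 * |((q.1 + q.2.2 : ℤ) : ℝ)|⁻¹ := by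
  have := nfSym_mul_third_le (swap12 q)
  rwa [nfSym_swap12] at this

lemma int_inv_abs_le_one (n : ℤ) : |(n : ℝ)|⁻¹ ≤ 1 := by
  rcases eq_or_ne n 0 with rfl | hn
  · simp
  · exact inv_le_one_of_one_le₀ (by exact_mod_cast Int.one_le_abs hn)

lemma nfSym_mul_third_le_jp (q : ℤ × ℤ × ℤ) : |nfSym q| * |(q.2.2 : ℝ)| ≤ jp q.1 :=
  (nfSym_mul_third_le q).trans (mul_le_of_le_one_right (jp_pos _).le (int_inv_abs_le_one _))

lemma abs_nfSym_le_one (q : ℤ × ℤ × ℤ) : |nfSym q| ≤ 1 := by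
  unfold nfSym
  rw [← Int.cast_mul, abs_inv]
  exact int_inv_abs_le_one _

/-- The sum of the absolute values of the four frequencies. -/
def sumAbs (q : ℤ × ℤ × ℤ) : ℝ :=
  |(q.1 : ℝ)| + |(q.2.1 : ℝ)| + |(q.2.2 : ℝ)| + |(fourth q : ℝ)|

lemma sumAbs_nonneg (q : ℤ × ℤ × ℤ) : 0 ≤ sumAbs q := by unfold sumAbs; positivity

lemma jp_three (a b c : ℤ) : |(a : ℝ)| + |(b : ℝ)| + |(c : ℝ)| ≤ jp a * jp b * jp c := by
  unfold jp
  have := abs_nonneg (a : ℝ)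
  have := abs_nonneg (b : ℝ)
  have := abs_nonneg (c : ℝ)
  have h1 : 0 ≤ |(a : ℝ)| * |(b : ℝ)| := by positivity
  have h2 : 0 ≤ |(a : ℝ)| * |(c : ℝ)| := by positivity
  have h3 : 0 ≤ |(b : ℝ)| * |(c : ℝ)| := by positivity
  have h4 : 0 ≤ |(a : ℝ)| * |(b : ℝ)| * |(c : ℝ)| := by positivity
  nlinarith

lemma sumAbs_mul_sumSq_le (q : ℤ × ℤ × ℤ) :
    sumAbs q * sumSq q ≤ 2 * ((q.1 : ℝ) ^ 2 * (jp q.2.1 * jp q.2.2 * jp (fourth q)) +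
      (q.2.1 : ℝ) ^ 2 * (jp q.1 * jp q.2.2 * jp (fourth q)) +
      (q.2.2 : ℝ) ^ 2 * (jp q.1 * jp q.2.1 * jp (fourth q)) +
      (fourth q : ℝ) ^ 2 * (jp q.1 * jp q.2.1 * jp q.2.2)) := by
  obtain ⟨x, y, z⟩ := q
  have h4 : (fourth (x, y, z) : ℝ) = -x - y - z := by simp [fourth]
  set t := fourth (x, y, z)
  have g : ∀ a b c d : ℝ, a = -b - c - d → |a| ≤ |b| + |c| + |d| := by
    rintro a b c d rfl
    calc |-b - c - d| ≤ |-b - c| + |d| := abs_sub _ _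
      _ ≤ |-b| + |c| + |d| := by gcongr; exact abs_sub _ _
      _ = _ := by rw [abs_neg]
  have gx := g (x : ℝ) y z t (by rw [h4]; ring)
  have gy := g (y : ℝ) x z t (by rw [h4]; ring)
  have gz := g (z : ℝ) x y t (by rw [h4]; ring)
  have gt := g (t : ℝ) x y z h4
  have e1 := jp_three y z t
  have e2 := jp_three x z t
  have e3 := jp_three x y t
  have e4 := jp_three x y z
  unfold sumAbs sumSq
  simp only
  change (|(x : ℝ)| + |(y : ℝ)| + |(z : ℝ)| + |(t : ℝ)|) *
    ((x : ℝ) ^ 2 + (y : ℝ) ^ 2 + (z : ℝ) ^ 2 + (t : ℝ) ^ 2) ≤ _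
  have i1 : (x : ℝ) ^ 2 * (|(x : ℝ)| + |(y : ℝ)| + |(z : ℝ)| + |(t : ℝ)|) ≤
      (x : ℝ) ^ 2 * (2 * (jp y * jp z * jp t)) := by gcongr; linarith
  have i2 : (y : ℝ) ^ 2 * (|(x : ℝ)| + |(y : ℝ)| + |(z : ℝ)| + |(t : ℝ)|) ≤
      (y : ℝ) ^ 2 * (2 * (jp x * jp z * jp t)) := by gcongr; linarith
  have i3 : (z : ℝ) ^ 2 * (|(x : ℝ)| + |(y : ℝ)| + |(z : ℝ)| + |(t : ℝ)|) ≤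
      (z : ℝ) ^ 2 * (2 * (jp x * jp y * jp t)) := by gcongr; linarith
  have i4 : (t : ℝ) ^ 2 * (|(x : ℝ)| + |(y : ℝ)| + |(z : ℝ)| + |(t : ℝ)|) ≤
      (t : ℝ) ^ 2 * (2 * (jp x * jp y * jp z)) := by gcongr; linarith
  linarith

section
variable {α γ : ℤ → ℝ} {K : ℝ}

/-- Absolute convergence of quartic sums with one derivative more than the energy. -/
lemma quartic_bdd (h : Maj α K) :
    BddSum (fun q : ℤ × ℤ × ℤ => sumAbs q * sumSq q * (α q.1 * α q.2.1 * (α q.2.2 * α (fourth q))))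
      (8 * K ^ 4) := by
  have h0 := h.nonneg
  have hp : BddSum (fun q : ℤ × ℤ × ℤ => K * ((jp q.1 * α q.1) * ((jp q.2.1 * α q.2.1) *
      (jp q.2.2 * α q.2.2)))) (K * (K * (K * K))) :=
    (h.l1j.mul_prod (h.l1j.mul_prod h.l1j)).const_mul h.pos.le
  have p1 := hp.comp_injective (e := fun q : ℤ × ℤ × ℤ => (q.2.1, q.2.2, fourth q)) (by
    rintro ⟨a, b, c⟩ ⟨a', b', c'⟩ hh
    simp only [Prod.mk.injEq, fourth] at hh ⊢
    omega)
  have p2 := hp.comp_injective (e := fun q : ℤ × ℤ × ℤ => (q.1, q.2.2, fourth q)) (by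
    rintro ⟨a, b, c⟩ ⟨a', b', c'⟩ hh
    simp only [Prod.mk.injEq, fourth] at hh ⊢
    omega)
  have p3 := hp.comp_injective (e := fun q : ℤ × ℤ × ℤ => (q.1, q.2.1, fourth q)) (by
    rintro ⟨a, b, c⟩ ⟨a', b', c'⟩ hh
    simp only [Prod.mk.injEq, fourth] at hh ⊢
    omega)
  refine ((((p1.add p2).add p3).add hp).const_mul (c := 2) (by norm_num)).mono
    (fun q => mul_nonneg (mul_nonneg (sumAbs_nonneg q) (sumSq_nonneg q))
      (mul_nonneg (mul_nonneg (h0 _) (h0 _)) (mul_nonneg (h0 _) (h0 _)))) (fun q => ?_)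
    |>.le (le_of_eq (by ring))
  have hs : ∀ n : ℤ, (n : ℝ) ^ 2 * α n ≤ K := fun n =>
    (mul_le_mul_of_nonneg_right (sq_le_jp_sq n) (h0 n)).trans (h.sup n)
  have hx := h0 q.1
  have hy := h0 q.2.1
  have hz := h0 q.2.2
  have ht := h0 (fourth q)
  have jx := jp_pos q.1
  have jy := jp_pos q.2.1
  have jz := jp_pos q.2.2
  have jt := jp_pos (fourth q)
  calc _ ≤ 2 * ((q.1 : ℝ) ^ 2 * (jp q.2.1 * jp q.2.2 * jp (fourth q)) +
      (q.2.1 : ℝ) ^ 2 * (jp q.1 * jp q.2.2 * jp (fourth q)) +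
      (q.2.2 : ℝ) ^ 2 * (jp q.1 * jp q.2.1 * jp (fourth q)) +
      (fourth q : ℝ) ^ 2 * (jp q.1 * jp q.2.1 * jp q.2.2)) *
      (α q.1 * α q.2.1 * (α q.2.2 * α (fourth q))) :=
        mul_le_mul_of_nonneg_right (sumAbs_mul_sumSq_le q) (by positivity)
    _ = 2 * (((q.1 : ℝ) ^ 2 * α q.1) * ((jp q.2.1 * α q.2.1) * ((jp q.2.2 * α q.2.2) *
            (jp (fourth q) * α (fourth q)))) +
        ((q.2.1 : ℝ) ^ 2 * α q.2.1) * ((jp q.1 * α q.1) * ((jp q.2.2 * α q.2.2) *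
            (jp (fourth q) * α (fourth q)))) +
        ((q.2.2 : ℝ) ^ 2 * α q.2.2) * ((jp q.1 * α q.1) * ((jp q.2.1 * α q.2.1) *
            (jp (fourth q) * α (fourth q)))) +
        ((fourth q : ℝ) ^ 2 * α (fourth q)) * ((jp q.1 * α q.1) * ((jp q.2.1 * α q.2.1) *
            (jp q.2.2 * α q.2.2)))) := by ring
    _ ≤ _ := by
      gcongr
      · exact hs _
      · exact hs _
      · exact hs _
      · exact hs _

/-- The nonlinear evolution of the coefficients of the normal form correction. -/
lemma nf_coeff_bdd (h : Maj α K) (hγ0 : ∀ n, 0 ≤ γ n) (hγ : BddSum (fun n => γ n ^ 2) K)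
    {ω : ℤ → ℝ} (hω : ∀ n, 0 ≤ ω n) {y : ℝ} (hy : BddSum (fun n => ω n ^ 2) y) :
    BddSum (fun q : ℤ × ℤ × ℤ => |nfSym q| *
      ((|(q.1 : ℝ)| * γ q.1 * α q.2.1) * (ω q.2.2 * ω (fourth q))))
      (2 * (K * (4 * Jsum * y) + K * (K * y))) := by
  have h0 := h.nonneg
  have hF : ∀ q : ℤ × ℤ × ℤ, 0 ≤ jp q.2.1 * α q.2.1 := fun q => h.l1j.1 _
  have hi : ∀ n : ℤ, 0 ≤ |(n : ℝ)|⁻¹ := fun n => by positivity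
  have ta : BddSum (fun q : ℤ × ℤ × ℤ => (jp q.2.1 * α q.2.1) *
      ((|((q.1 + q.2.2 : ℤ) : ℝ)|⁻¹ * ω q.2.2) * (γ q.1 * ω (fourth q))))
      (K * (4 * Jsum * y) + K * (K * y)) := by
    refine BddSum.amgm hF (fun q => mul_nonneg (mul_nonneg (hi _) (hω _))
      (mul_nonneg (hγ0 _) (hω _))) ?_ ?_
    · refine ((h.l1j.mul_prod (bddSum_inv.mul_prod hy)).comp_injective
        (e := fun q : ℤ × ℤ × ℤ => (q.2.1, q.1 + q.2.2, q.2.2)) ?_).mono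
        (fun q => mul_nonneg (hF q) (sq_nonneg _)) fun q => by simp only [mul_pow]; rfl
      rintro ⟨a, b, c⟩ ⟨a', b', c'⟩ hh
      simp only [Prod.mk.injEq] at hh ⊢
      omega
    · refine ((h.l1j.mul_prod (hγ.mul_prod hy)).comp_injective
        (e := fun q : ℤ × ℤ × ℤ => (q.2.1, q.1, fourth q)) ?_).mono
        (fun q => mul_nonneg (hF q) (sq_nonneg _)) fun q => by simp only [mul_pow]; rfl
      rintro ⟨a, b, c⟩ ⟨a', b', c'⟩ hh
      simp only [Prod.mk.injEq, fourth] at hh ⊢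
      omega
  have tb : BddSum (fun q : ℤ × ℤ × ℤ => (jp q.2.1 * α q.2.1) *
      ((|((q.2.1 + q.2.2 : ℤ) : ℝ)|⁻¹ * ω (fourth q)) * (γ q.1 * ω q.2.2)))
      (K * (4 * Jsum * y) + K * (K * y)) := by
    refine BddSum.amgm hF (fun q => mul_nonneg (mul_nonneg (hi _) (hω _))
      (mul_nonneg (hγ0 _) (hω _))) ?_ ?_
    · refine ((h.l1j.mul_prod (bddSum_inv.mul_prod hy)).comp_injective
        (e := fun q : ℤ × ℤ × ℤ => (q.2.1, q.2.1 + q.2.2, fourth q)) ?_).mono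
        (fun q => mul_nonneg (hF q) (sq_nonneg _)) fun q => by simp only [mul_pow]; rfl
      rintro ⟨a, b, c⟩ ⟨a', b', c'⟩ hh
      simp only [Prod.mk.injEq, fourth] at hh ⊢
      omega
    · refine ((h.l1j.mul_prod (hγ.mul_prod hy)).comp_injective
        (e := fun q : ℤ × ℤ × ℤ => (q.2.1, q.1, q.2.2)) ?_).mono
        (fun q => mul_nonneg (hF q) (sq_nonneg _)) fun q => by simp only [mul_pow]; rfl
      rintro ⟨a, b, c⟩ ⟨a', b', c'⟩ hh
      simp only [Prod.mk.injEq] at hh ⊢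
      omega
  refine (ta.add tb).mono (fun q => ?_) (fun q => ?_) |>.le (le_of_eq (by ring))
  · have := hγ0 q.1
    have := h0 q.2.1
    have := hω q.2.2
    have := hω (fourth q)
    positivity
  · have hr : 0 ≤ (γ q.1 * α q.2.1) * (ω q.2.2 * ω (fourth q)) :=
      mul_nonneg (mul_nonneg (hγ0 _) (h0 _)) (mul_nonneg (hω _) (hω _))
    calc _ = (|nfSym q| * |(q.1 : ℝ)|) * ((γ q.1 * α q.2.1) * (ω q.2.2 * ω (fourth q))) := by ring
      _ ≤ _ := mul_le_mul_of_nonneg_right (nfSym_mul_first_le q) hr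
      _ = _ := by ring

end

/-! ### The sextic correction of the normal form. -/

/-- Indices `((n₁, n₂, n₃), (p₁, p₂))` of the sextic correction. -/
abbrev Sextic := (ℤ × ℤ × ℤ) × (ℤ × ℤ)

/-- The frequency `n₃ - p₁ - p₂`. -/
def inner6 (x : Sextic) : ℤ := x.1.2.2 - x.2.1 - x.2.2

/-- The symbol of the sextic correction. -/
def sym6 (x : Sextic) : ℝ := nfSym x.1 * (x.1.2.2 : ℝ) * sym3 x.1.2.2 x.2.1 x.2.2

/-- The involution exchanging the two unbalanced frequencies. -/
def swap6 : Sextic ≃ Sextic where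
  toFun x := ((x.2.1, x.2.2, -x.1.2.2), (x.1.1, x.1.2.1))
  invFun x := ((x.2.1, x.2.2, -x.1.2.2), (x.1.1, x.1.2.1))
  left_inv x := by ext <;> simp
  right_inv x := by ext <;> simp

/-- The region where four of the six frequencies are small. -/
def Small6 (x : Sextic) : Prop :=
  8 * |(x.1.1 : ℝ)| ≤ |(x.1.2.2 : ℝ)| ∧ 8 * |(x.1.2.1 : ℝ)| ≤ |(x.1.2.2 : ℝ)| ∧
    8 * |(x.2.1 : ℝ)| ≤ |(x.1.2.2 : ℝ)| ∧ 8 * |(x.2.2 : ℝ)| ≤ |(x.1.2.2 : ℝ)|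

lemma small6_swap6 (x : Sextic) : Small6 (swap6 x) ↔ Small6 x := by
  simp only [Small6, swap6, Equiv.coe_fn_mk, Int.cast_neg, abs_neg]
  tauto

lemma inner6_swap6 (x : Sextic) : inner6 (swap6 x) = fourth x.1 := by
  simp only [inner6, swap6, Equiv.coe_fn_mk, fourth]
  ring

lemma fourth_swap6 (x : Sextic) : fourth (swap6 x).1 = inner6 x := by
  simp only [inner6, swap6, Equiv.coe_fn_mk, fourth]
  ring

lemma perturb_sum_sq {m p r : ℝ} (hp : 8 * |p| ≤ |m|) (hr : 8 * |r| ≤ |m|) :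
    |m ^ 2 + p ^ 2 + r ^ 2 + (m - p - r) ^ 2 - 2 * m ^ 2| ≤ 3 * |m| * (|p| + |r|) := by
  have e : m ^ 2 + p ^ 2 + r ^ 2 + (m - p - r) ^ 2 - 2 * m ^ 2 =
      -2 * m * (p + r) + ((p + r) ^ 2 + p ^ 2 + r ^ 2) := by ring
  have h1 : |p + r| ≤ |p| + |r| := abs_add_le _ _
  have h2 : |-2 * m * (p + r)| ≤ 2 * |m| * (|p| + |r|) := by
    rw [abs_mul, abs_mul]
    norm_num
    gcongr
  have h3 : |(p + r) ^ 2 + p ^ 2 + r ^ 2| ≤ |m| * (|p| + |r|) := by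
    rw [abs_of_nonneg (by positivity), ← sq_abs (p + r), ← sq_abs p, ← sq_abs r]
    nlinarith [abs_nonneg p, abs_nonneg r, abs_nonneg (p + r)]
  rw [e]
  exact (abs_add_le _ _).trans (by linarith)

lemma perturb_prod {m p r : ℝ} (hp : 8 * |p| ≤ |m|) :
    |(p - m) * (r - m) - m ^ 2| ≤ 2 * |m| * (|p| + |r|) := by
  have e : (p - m) * (r - m) - m ^ 2 = -(m * (p + r)) + p * r := by ring
  have h2 : |-(m * (p + r))| ≤ |m| * (|p| + |r|) := by
    rw [abs_neg, abs_mul]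
    gcongr
    exact abs_add_le _ _
  have h3 : |p * r| ≤ |m| * (|p| + |r|) := by
    rw [abs_mul]
    nlinarith [abs_nonneg p, abs_nonneg r]
  rw [e]
  exact (abs_add_le _ _).trans (by linarith)

lemma perturb_num {m A B U V s1 s2 : ℝ} (hs1 : 0 ≤ s1) (hs2 : 0 ≤ s2)
    (a1 : |A - 2 * m ^ 2| ≤ 3 * |m| * s1) (a2 : |B - 2 * m ^ 2| ≤ 3 * |m| * s2)
    (b1 : |V - m ^ 2| ≤ 2 * |m| * s1) (b2 : |U - m ^ 2| ≤ 2 * |m| * s2)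
    (hU : |U| ≤ 2 * |m| ^ 2) (hV : |V| ≤ 2 * |m| ^ 2) :
    |A * V - B * U| ≤ 20 * |m| ^ 3 * (s1 + s2) := by
  have e2 : A * V - B * U = (A - 2 * m ^ 2) * V - (B - 2 * m ^ 2) * U +
      2 * m ^ 2 * ((V - m ^ 2) - (U - m ^ 2)) := by ring
  have t1 : |(A - 2 * m ^ 2) * V| ≤ (3 * |m| * s1) * (2 * |m| ^ 2) := by
    rw [abs_mul]
    gcongr
  have t2 : |(B - 2 * m ^ 2) * U| ≤ (3 * |m| * s2) * (2 * |m| ^ 2) := by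
    rw [abs_mul]
    gcongr
  have t3 : |2 * m ^ 2 * ((V - m ^ 2) - (U - m ^ 2))| ≤
      2 * |m| ^ 2 * (2 * |m| * s1 + 2 * |m| * s2) := by
    rw [abs_mul, abs_of_nonneg (by positivity : 0 ≤ 2 * m ^ 2), sq_abs]
    have : |(V - m ^ 2) - (U - m ^ 2)| ≤ 2 * |m| * s1 + 2 * |m| * s2 :=
      (abs_sub _ _).trans (add_le_add b1 b2)
    gcongr
  have h0 : 0 ≤ |m| ^ 3 * (s1 + s2) := by positivity
  rw [e2]
  have := (abs_add_le ((A - 2 * m ^ 2) * V - (B - 2 * m ^ 2) * U)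
    (2 * m ^ 2 * ((V - m ^ 2) - (U - m ^ 2)))).trans (add_le_add (abs_sub _ _) le_rfl)
  nlinarith

/-- The cancellation between the two unbalanced frequencies. -/
lemma perturb_quotient {m x y p r : ℝ} (hx : 8 * |x| ≤ |m|) (hy : 8 * |y| ≤ |m|)
    (hp : 8 * |p| ≤ |m|) (hr : 8 * |r| ≤ |m|) :
    |((x + m) * (y + m))⁻¹ * m * (m ^ 2 + p ^ 2 + r ^ 2 + (m - p - r) ^ 2) +
      ((p + -m) * (r + -m))⁻¹ * (-m) * (m ^ 2 + x ^ 2 + y ^ 2 + (-m - x - y) ^ 2)| ≤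
      80 * (|x| + |y| + |p| + |r|) := by
  rcases eq_or_ne m 0 with rfl | hm
  · simp only [mul_zero, neg_zero, zero_mul, add_zero, abs_zero]
    positivity
  have hM : 0 < |m| := abs_pos.2 hm
  have a1 := perturb_sum_sq hp hr
  have a2 := perturb_sum_sq (m := m) (p := -x) (r := -y) (by rwa [abs_neg]) (by rwa [abs_neg])
  have b1 := perturb_prod (r := r) hp
  have b2 := perturb_prod (m := m) (p := -x) (r := -y) (by rwa [abs_neg])
  rw [abs_neg, abs_neg] at a2 b2
  set A := m ^ 2 + p ^ 2 + r ^ 2 + (m - p - r) ^ 2 with hA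
  have hA2 : m ^ 2 + x ^ 2 + y ^ 2 + (-m - x - y) ^ 2 =
    m ^ 2 + (-x) ^ 2 + (-y) ^ 2 + (m - -x - -y) ^ 2 := by ring
  rw [hA2]
  set B := m ^ 2 + (-x) ^ 2 + (-y) ^ 2 + (m - -x - -y) ^ 2 with hB
  have hU : (x + m) * (y + m) = (-x - m) * (-y - m) := by ring
  have hV : (p + -m) * (r + -m) = (p - m) * (r - m) := by ring
  rw [hU, hV]
  set U := (-x - m) * (-y - m)
  set V := (p - m) * (r - m)
  set s1 := |p| + |r|
  set s2 := |x| + |y|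
  have hs1 : 4 * s1 ≤ |m| := by simp only [s1]; linarith
  have hs2 : 4 * s2 ≤ |m| := by simp only [s2]; linarith
  have hs10 : 0 ≤ s1 := by positivity
  have hs20 : 0 ≤ s2 := by positivity
  have hmm : m ^ 2 = |m| ^ 2 := (sq_abs m).symm
  have hUl : |m| ^ 2 / 2 ≤ U := by
    have := (abs_le.1 b2).1
    nlinarith
  have hVl : |m| ^ 2 / 2 ≤ V := by
    have := (abs_le.1 b1).1
    nlinarith
  have hU0 : 0 < U := lt_of_lt_of_le (by positivity) hUl
  have hV0 : 0 < V := lt_of_lt_of_le (by positivity) hVl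
  have e : U⁻¹ * m * A + V⁻¹ * (-m) * B = m * (A * V - B * U) / (U * V) := by
    field_simp
    ring
  have hVu : |V| ≤ 2 * |m| ^ 2 := by
    rw [abs_of_pos hV0]
    have := (abs_le.1 b1).2
    nlinarith
  have hUu : |U| ≤ 2 * |m| ^ 2 := by
    rw [abs_of_pos hU0]
    have := (abs_le.1 b2).2
    nlinarith
  have hnum : |A * V - B * U| ≤ 20 * |m| ^ 3 * (s1 + s2) :=
    perturb_num hs10 hs20 a1 a2 b1 b2 hUu hVu
  rw [e, abs_div, abs_mul, abs_of_pos (mul_pos hU0 hV0), div_le_iff₀ (mul_pos hU0 hV0)]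
  have hUV : |m| ^ 4 / 4 ≤ U * V := by
    calc |m| ^ 4 / 4 = (|m| ^ 2 / 2) * (|m| ^ 2 / 2) := by ring
      _ ≤ U * V := by gcongr
  calc |m| * |A * V - B * U| ≤ |m| * (20 * |m| ^ 3 * (s1 + s2)) := by gcongr
    _ = 80 * (s1 + s2) * (|m| ^ 4 / 4) := by ring
    _ ≤ 80 * (s1 + s2) * (U * V) := by gcongr
    _ = _ := by simp only [s1, s2]; ring

lemma sym6_add_swap6 {x : Sextic} (hx : Small6 x) :
    |sym6 x + sym6 (swap6 x)| ≤ 80 * (jp x.1.1 * jp x.1.2.1 * (jp x.2.1 * jp x.2.2)) := by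
  obtain ⟨⟨a, b, m⟩, p, r⟩ := x
  obtain ⟨h1, h2, h3, h4⟩ := hx
  have h := perturb_quotient h1 h2 h3 h4
  have e : |(a : ℝ)| + |(b : ℝ)| + |(p : ℝ)| + |(r : ℝ)| ≤ jp a * jp b * (jp p * jp r) := by
    have := jp_three a b p
    unfold jp at this ⊢
    have h0 : 0 ≤ (1 + |(a : ℝ)|) * (1 + |(b : ℝ)|) * (1 + |(p : ℝ)|) := by positivity
    have h5 : 1 ≤ (1 + |(a : ℝ)|) * (1 + |(b : ℝ)|) * (1 + |(p : ℝ)|) :=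
      one_le_mul_of_one_le_of_one_le (one_le_mul_of_one_le_of_one_le (by simp) (by simp)) (by simp)
    nlinarith [abs_nonneg (r : ℝ)]
  refine le_trans (le_trans (le_of_eq ?_) h) (by linarith)
  simp only [sym6, swap6, Equiv.coe_fn_mk, nfSym, sym3]
  push_cast
  rw [neg_sq]

lemma sym6_far {x : Sextic} (hx : ¬ Small6 x) :
    |sym6 x| ≤ 260 * (|nfSym x.1| * |(x.1.2.2 : ℝ)| * ((x.1.1 : ℝ) ^ 2 + (x.1.2.1 : ℝ) ^ 2 +
      (x.2.1 : ℝ) ^ 2 + (x.2.2 : ℝ) ^ 2)) := by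
  obtain ⟨⟨a, b, m⟩, p, r⟩ := x
  have hm : (m : ℝ) ^ 2 ≤ 64 * ((a : ℝ) ^ 2 + (b : ℝ) ^ 2 + (p : ℝ) ^ 2 + (r : ℝ) ^ 2) := by
    have g : ∀ t : ℝ, |(m : ℝ)| < 8 * |t| → (m : ℝ) ^ 2 ≤ 64 * t ^ 2 := by
      intro t ht
      rw [← sq_abs (m : ℝ), ← sq_abs t]
      nlinarith [abs_nonneg (m : ℝ)]
    simp only [Small6, not_and_or, not_le] at hx
    rcases hx with h | h | h | h <;> have := g _ h <;>
      nlinarith [sq_nonneg (a : ℝ), sq_nonneg (b : ℝ), sq_nonneg (p : ℝ), sq_nonneg (r : ℝ)]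
  have hs : sym3 m p r ≤ 260 * ((a : ℝ) ^ 2 + (b : ℝ) ^ 2 + (p : ℝ) ^ 2 + (r : ℝ) ^ 2) := by
    unfold sym3
    push_cast
    nlinarith [sq_nonneg ((m : ℝ) + p), sq_nonneg ((m : ℝ) + r), sq_nonneg ((p : ℝ) - r),
      sq_nonneg (a : ℝ), sq_nonneg (b : ℝ)]
  unfold sym6
  rw [abs_mul, abs_mul, abs_of_nonneg (sym3_nonneg _ _ _)]
  calc _ ≤ |nfSym (a, b, m)| * |(m : ℝ)| *
        (260 * ((a : ℝ) ^ 2 + (b : ℝ) ^ 2 + (p : ℝ) ^ 2 + (r : ℝ) ^ 2)) := by gcongr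
    _ = _ := by ring

section
variable {α ω : ℤ → ℝ} {K y : ℝ}

lemma sextic_small_bdd (h : Maj α K) (hω : ∀ n, 0 ≤ ω n) (hy : BddSum (fun n => ω n ^ 2) y) :
    BddSum (fun x : Sextic => (jp x.1.1 * jp x.1.2.1 * (jp x.2.1 * jp x.2.2)) *
      ((α x.1.1 * α x.1.2.1) * (α x.2.1 * α x.2.2) * (ω (inner6 x) * ω (fourth x.1))))
      (2 * K ^ 4 * y) := by
  have h0 := h.nonneg
  have hF : ∀ n, 0 ≤ jp n * α n := fun n => h.l1j.1 n
  have hb := h.l1j.mul_prod (h.l1j.mul_prod (h.l1j.mul_prod (h.l1j.mul_prod hy)))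
  have b1 := hb.comp_injective
    (e := fun x : Sextic => (x.1.1, x.1.2.1, x.2.1, x.2.2, inner6 x)) (by
      rintro ⟨⟨a, b, c⟩, d, e⟩ ⟨⟨a', b', c'⟩, d', e'⟩ hh
      simp only [Prod.mk.injEq, inner6] at hh ⊢
      omega)
  have b2 := hb.comp_injective
    (e := fun x : Sextic => (x.1.1, x.1.2.1, x.2.1, x.2.2, fourth x.1)) (by
      rintro ⟨⟨a, b, c⟩, d, e⟩ ⟨⟨a', b', c'⟩, d', e'⟩ hh
      simp only [Prod.mk.injEq, fourth] at hh ⊢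
      omega)
  refine (BddSum.amgm (F := fun x : Sextic => (jp x.1.1 * α x.1.1) * ((jp x.1.2.1 * α x.1.2.1) *
      ((jp x.2.1 * α x.2.1) * (jp x.2.2 * α x.2.2))))
    (x := fun x => ω (inner6 x)) (z := fun x => ω (fourth x.1))
    (fun x => mul_nonneg (hF _) (mul_nonneg (hF _) (mul_nonneg (hF _) (hF _))))
    (fun x => mul_nonneg (hω _) (hω _))
    (b1.mono (fun x => ?_) fun x => le_of_eq ?_)
    (b2.mono (fun x => ?_) fun x => le_of_eq ?_)).mono (fun x => ?_) (fun x => le_of_eq ?_)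
    |>.le (le_of_eq (by ring))
  · exact mul_nonneg (mul_nonneg (hF _) (mul_nonneg (hF _) (mul_nonneg (hF _) (hF _)))) (sq_nonneg _)
  · ring
  · exact mul_nonneg (mul_nonneg (hF _) (mul_nonneg (hF _) (mul_nonneg (hF _) (hF _)))) (sq_nonneg _)
  · ring
  · have := fun n => (jp_pos n).le
    exact mul_nonneg (mul_nonneg (mul_nonneg (this _) (this _)) (mul_nonneg (this _) (this _)))
      (mul_nonneg (mul_nonneg (mul_nonneg (h0 _) (h0 _)) (mul_nonneg (h0 _) (h0 _)))
        (mul_nonneg (hω _) (hω _)))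
  · ring

lemma sextic_far_aux (h : Maj α K) (hω : ∀ n, 0 ≤ ω n) (hy : BddSum (fun n => ω n ^ 2) y)
    (e₁ e₂ e₃ d x : Sextic → ℤ)
    (hi : Function.Injective fun t : Sextic => (e₁ t, e₂ t, e₃ t, d t, inner6 t))
    (hj : Function.Injective fun t : Sextic => (e₁ t, e₂ t, e₃ t, x t, fourth t.1)) :
    BddSum (fun t : Sextic => ((jp (e₁ t) * α (e₁ t)) * (α (e₂ t) * α (e₃ t))) *
      ((|(d t : ℝ)|⁻¹ * ω (inner6 t)) * ((x t : ℝ) ^ 2 * α (x t) * ω (fourth t.1))))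
      (K ^ 3 * (4 * Jsum + K) * y) := by
  have h0 := h.nonneg
  have hF : ∀ n, 0 ≤ jp n * α n := fun n => h.l1j.1 n
  have hG : ∀ t : Sextic, 0 ≤ (jp (e₁ t) * α (e₁ t)) * (α (e₂ t) * α (e₃ t)) := fun t =>
    mul_nonneg (hF _) (mul_nonneg (h0 _) (h0 _))
  refine (BddSum.amgm hG (fun t => ?_)
    (((h.l1j.mul_prod (h.l1.mul_prod (h.l1.mul_prod (bddSum_inv.mul_prod hy)))).comp_injective
      hi).mono (fun t => mul_nonneg (hG t) (sq_nonneg _)) fun t => le_of_eq ?_)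
    (((h.l1j.mul_prod (h.l1.mul_prod (h.l1.mul_prod (h.l2n.mul_prod hy)))).comp_injective
      hj).mono (fun t => mul_nonneg (hG t) (sq_nonneg _)) fun t => le_of_eq ?_)).le
        (le_of_eq (by ring))
  · exact mul_nonneg (mul_nonneg (by positivity) (hω _))
      (mul_nonneg (mul_nonneg (sq_nonneg _) (h0 _)) (hω _))
  · simp only [mul_pow]; ring
  · simp only [mul_pow]; ring

lemma sextic_far_bdd (h : Maj α K) (hω : ∀ n, 0 ≤ ω n) (hy : BddSum (fun n => ω n ^ 2) y) :
    BddSum (fun t : Sextic => (|nfSym t.1| * |(t.1.2.2 : ℝ)| * ((t.1.1 : ℝ) ^ 2 +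
      (t.1.2.1 : ℝ) ^ 2 + (t.2.1 : ℝ) ^ 2 + (t.2.2 : ℝ) ^ 2)) *
      ((α t.1.1 * α t.1.2.1) * (α t.2.1 * α t.2.2) * (ω (inner6 t) * ω (fourth t.1))))
      (4 * (K ^ 3 * (4 * Jsum + K) * y)) := by
  have h0 := h.nonneg
  have c1 := sextic_far_aux h hω hy (fun t => t.1.1) (fun t => t.1.2.1) (fun t => t.2.2)
    (fun t => t.1.2.1 + t.1.2.2) (fun t => t.2.1)
    (by
      rintro ⟨⟨a, b, c⟩, d, e⟩ ⟨⟨a', b', c'⟩, d', e'⟩ hh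
      simp only [Prod.mk.injEq, inner6] at hh ⊢
      omega)
    (by
      rintro ⟨⟨a, b, c⟩, d, e⟩ ⟨⟨a', b', c'⟩, d', e'⟩ hh
      simp only [Prod.mk.injEq, fourth] at hh ⊢
      omega)
  have c2 := sextic_far_aux h hω hy (fun t => t.1.1) (fun t => t.1.2.1) (fun t => t.2.1)
    (fun t => t.1.2.1 + t.1.2.2) (fun t => t.2.2)
    (by
      rintro ⟨⟨a, b, c⟩, d, e⟩ ⟨⟨a', b', c'⟩, d', e'⟩ hh
      simp only [Prod.mk.injEq, inner6] at hh ⊢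
      omega)
    (by
      rintro ⟨⟨a, b, c⟩, d, e⟩ ⟨⟨a', b', c'⟩, d', e'⟩ hh
      simp only [Prod.mk.injEq, fourth] at hh ⊢
      omega)
  have c3 := sextic_far_aux h hω hy (fun t => t.1.1) (fun t => t.2.1) (fun t => t.2.2)
    (fun t => t.1.2.1 + t.1.2.2) (fun t => t.1.2.1)
    (by
      rintro ⟨⟨a, b, c⟩, d, e⟩ ⟨⟨a', b', c'⟩, d', e'⟩ hh
      simp only [Prod.mk.injEq, inner6] at hh ⊢
      omega)
    (by
      rintro ⟨⟨a, b, c⟩, d, e⟩ ⟨⟨a', b', c'⟩, d', e'⟩ hh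
      simp only [Prod.mk.injEq, fourth] at hh ⊢
      omega)
  have c4 := sextic_far_aux h hω hy (fun t => t.1.2.1) (fun t => t.2.1) (fun t => t.2.2)
    (fun t => t.1.1 + t.1.2.2) (fun t => t.1.1)
    (by
      rintro ⟨⟨a, b, c⟩, d, e⟩ ⟨⟨a', b', c'⟩, d', e'⟩ hh
      simp only [Prod.mk.injEq, inner6] at hh ⊢
      omega)
    (by
      rintro ⟨⟨a, b, c⟩, d, e⟩ ⟨⟨a', b', c'⟩, d', e'⟩ hh
      simp only [Prod.mk.injEq, fourth] at hh ⊢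
      omega)
  refine (((c1.add c2).add c3).add c4).mono (fun t => ?_) (fun t => ?_) |>.le
    (le_of_eq (by ring))
  · exact mul_nonneg (by positivity) (mul_nonneg (mul_nonneg (mul_nonneg (h0 _) (h0 _))
      (mul_nonneg (h0 _) (h0 _))) (mul_nonneg (hω _) (hω _)))
  · have k1 := nfSym_mul_third_le t.1
    have k2 := nfSym_mul_third_le' t.1
    have hr : 0 ≤ (α t.1.1 * α t.1.2.1) * (α t.2.1 * α t.2.2) * (ω (inner6 t) * ω (fourth t.1)) :=
      mul_nonneg (mul_nonneg (mul_nonneg (h0 _) (h0 _)) (mul_nonneg (h0 _) (h0 _)))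
        (mul_nonneg (hω _) (hω _))
    have := mul_le_mul_of_nonneg_right k2 (mul_nonneg (sq_nonneg (t.1.1 : ℝ)) hr)
    have := mul_le_mul_of_nonneg_right k1 (mul_nonneg (sq_nonneg (t.1.2.1 : ℝ)) hr)
    have := mul_le_mul_of_nonneg_right k1 (mul_nonneg (sq_nonneg (t.2.1 : ℝ)) hr)
    have := mul_le_mul_of_nonneg_right k1 (mul_nonneg (sq_nonneg (t.2.2 : ℝ)) hr)
    linarith

end

/-! ### The modified energy of a difference of two solutions: static identities. -/

lemma two_tsum_symm {ι : Type*} (e : ι ≃ ι) {F : ι → ℂ} (hF : Summable F) :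
    2 * ∑' i, F i = ∑' i, (F i + F (e i)) := by
  have h1 : Summable fun i => F (e i) := e.summable_iff.2 hF
  rw [hF.tsum_add h1, e.tsum_eq F, two_mul]

/-- The static data at a given time for the difference `w` of two solutions. -/
structure StabData (α γ : ℤ → ℝ) (w gw : ℤ → ℂ) (β B : ℤ → ℤ → ℂ) (D : ℤ → ℂ)
    (κ l K y : ℝ) : Prop where
  maj : Maj α K
  γ_nonneg : ∀ n, 0 ≤ γ n
  γ_bdd : BddSum (fun n => γ n ^ 2) K
  β_le : ∀ a b, ‖β a b‖ ≤ α a * α b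
  B_le : ∀ a b : ℤ, ‖B a b‖ ≤ |(a : ℝ)| * γ a * α b + |(b : ℝ)| * α a * γ b
  w_le : ∀ n, ‖w n‖ ≤ α n
  gw_le : ∀ n, ‖gw n‖ ≤ γ n
  w_bdd : BddSum (fun n => ‖w n‖ ^ 2) y
  D_W1 : W1 D K
  gw_eq : ∀ n, gw n = κ * T3 β w n - l * conv D w n

/-- The product `β(n₁,n₂) w(n₃) w(n₄)`. -/
def quad (β : ℤ → ℤ → ℂ) (w : ℤ → ℂ) (q : ℤ × ℤ × ℤ) : ℂ :=
  β q.1 q.2.1 * (w q.2.2 * w (fourth q))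

lemma quad_swap34 (β : ℤ → ℤ → ℂ) (w : ℤ → ℂ) (q : ℤ × ℤ × ℤ) :
    quad β w (swap34 q) = quad β w q := by
  simp only [quad, fourth_swap34]
  simp only [swap34, Equiv.coe_fn_mk]
  ring

namespace StabData
variable {α γ : ℤ → ℝ} {w gw : ℤ → ℂ} {β B : ℤ → ℤ → ℂ} {D : ℤ → ℂ} {κ l K y : ℝ}

lemma quad_le (h : StabData α γ w gw β B D κ l K y) (q : ℤ × ℤ × ℤ) :
    ‖quad β w q‖ ≤ α q.1 * α q.2.1 * (α q.2.2 * α (fourth q)) := by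
  have := h.maj.nonneg
  rw [quad, norm_mul, norm_mul]
  exact mul_le_mul (h.β_le _ _) (mul_le_mul (h.w_le _) (h.w_le _) (norm_nonneg _) (this _))
    (by positivity) (mul_nonneg (this _) (this _))

/-- A quadrilinear form with symbol controlled by `sumAbs * sumSq` is absolutely convergent. -/
lemma quad_bdd (h : StabData α γ w gw β B D κ l K y) {c : ℤ × ℤ × ℤ → ℂ} {A : ℝ} (hA : 0 ≤ A)
    (hc : ∀ q, ‖c q‖ ≤ A * (sumAbs q * sumSq q)) :
    BddSum (fun q => ‖c q * quad β w q‖) (A * (8 * K ^ 4)) := by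
  refine ((quartic_bdd h.maj).const_mul hA).of_norm_le fun q => ?_
  rw [norm_mul, ← mul_assoc]
  exact mul_le_mul (hc q) (h.quad_le q) (norm_nonneg _)
    (mul_nonneg hA (mul_nonneg (sumAbs_nonneg q) (sumSq_nonneg q)))

lemma norm_fourth_mul_sumSq_le (q : ℤ × ℤ × ℤ) :
    ‖-(fourth q : ℂ) * ((sumSq q : ℝ) : ℂ)‖ ≤ 1 * (sumAbs q * sumSq q) := by
  rw [norm_mul, norm_neg, Complex.norm_real, Real.norm_of_nonneg (sumSq_nonneg q), one_mul,
    ← Complex.ofReal_intCast, Complex.norm_real, Real.norm_eq_abs]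
  refine mul_le_mul_of_nonneg_right ?_ (sumSq_nonneg q)
  unfold sumAbs
  have := abs_nonneg (q.1 : ℝ)
  have := abs_nonneg (q.2.1 : ℝ)
  have := abs_nonneg (q.2.2 : ℝ)
  linarith

lemma tsum_cubic (h : StabData α γ w gw β B D κ l K y) :
    Summable (fun n : ℤ => (n : ℂ) * T3 β w n * w (-n)) ∧
    2 * ∑' n : ℤ, (n : ℂ) * T3 β w n * w (-n) =
      ∑' q : ℤ × ℤ × ℤ, ((q.1 + q.2.1 : ℤ) : ℂ) * ((sumSq q : ℝ) : ℂ) * quad β w q := by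
  set H : ℤ × ℤ × ℤ → ℂ := fun q => -(fourth q : ℂ) * ((sumSq q : ℝ) : ℂ) * quad β w q with hHdef
  have hH : Summable H := (h.quad_bdd zero_le_one norm_fourth_mul_sumSq_le).summable_norm
  have hF : Summable (H ∘ shear3) := (shear3.summable_iff).2 hH
  have hFe : ∀ n : ℤ, ∑' p : ℤ × ℤ, (H ∘ shear3) (n, p) = (n : ℂ) * T3 β w n * w (-n) := by
    intro n
    rw [T3, ← tsum_mul_left, ← tsum_mul_right]
    refine tsum_congr fun p => ?_
    have e : fourth (shear3 (n, p)) = -n := by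
      simp only [shear3, Equiv.coe_fn_mk, fourth]; ring
    have e2 : sumSq (shear3 (n, p)) = sym3 n p.1 p.2 := by
      simp only [sumSq, e, sym3]
      simp only [shear3, Equiv.coe_fn_mk]
      push_cast
      ring
    simp only [hHdef, Function.comp, quad, e, e2]
    simp only [shear3, Equiv.coe_fn_mk]
    push_cast
    ring
  refine ⟨by simpa only [hFe] using hF.prod, ?_⟩
  have e1 : ∑' n : ℤ, (n : ℂ) * T3 β w n * w (-n) = ∑' q, H q := by
    rw [← shear3.tsum_eq H]
    change _ = ∑' x, (H ∘ shear3) x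
    rw [hF.tsum_prod]
    exact tsum_congr fun n => (hFe n).symm
  rw [e1, two_tsum_symm swap34 hH]
  refine tsum_congr fun q => ?_
  simp only [hHdef, quad_swap34, sumSq_swap34, fourth_swap34]
  simp only [fourth]
  push_cast
  ring

/-- The involution `(n, m) ↦ (m - n, m)`. -/
def reflectFst : ℤ × ℤ ≃ ℤ × ℤ where
  toFun p := (p.2 - p.1, p.2)
  invFun p := (p.2 - p.1, p.2)
  left_inv p := by ext <;> simp
  right_inv p := by ext <;> simp

lemma tsum_quintic (h : StabData α γ w gw β B D κ l K y) :
    Summable (fun n : ℤ => (n : ℂ) * conv D w n * w (-n)) ∧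
    ‖∑' n : ℤ, (n : ℂ) * conv D w n * w (-n)‖ ≤ K * y := by
  have hα := h.maj.nonneg
  have hK := h.maj.pos
  set F : ℤ × ℤ → ℂ := fun p => (p.1 : ℂ) * (D p.2 * w (p.1 - p.2)) * w (-p.1) with hFdef
  have hF : Summable F := by
    have b := ((h.D_W1.l1.mul_prod h.maj.l1j).const_mul hK.le).comp_injective
      (e := fun p : ℤ × ℤ => (p.2, -p.1)) (by
        rintro ⟨a, b⟩ ⟨c, d⟩ hh
        simp only [Prod.mk.injEq] at hh ⊢
        omega)
    refine (b.of_norm_le (F := F) fun p => ?_).summable_norm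
    simp only [hFdef, norm_mul]
    have h1 : ‖w (p.1 - p.2)‖ ≤ K := (h.w_le _).trans (h.maj.l1.apply_le _)
    have h2 : ‖w (-p.1)‖ ≤ α (-p.1) := h.w_le _
    have h3 : ‖(p.1 : ℂ)‖ ≤ jp (-p.1) := by
      rw [jp_neg, ← Complex.ofReal_intCast, Complex.norm_real, Real.norm_eq_abs]
      exact abs_le_jp _
    have h4 := (jp_pos (-p.1)).le
    calc _ ≤ jp (-p.1) * (‖D p.2‖ * K) * α (-p.1) := by gcongr
      _ = _ := by ring
  have hFe : ∀ n : ℤ, ∑' m, F (n, m) = (n : ℂ) * conv D w n * w (-n) := by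
    intro n
    rw [conv, ← tsum_mul_left, ← tsum_mul_right]
  refine ⟨by simpa only [hFe] using hF.prod, ?_⟩
  have e1 : ∑' n : ℤ, (n : ℂ) * conv D w n * w (-n) = ∑' p, F p := by
    rw [hF.tsum_prod]
    exact tsum_congr fun n => (hFe n).symm
  have hd := BddSum.mul_prod h.D_W1 h.w_bdd
  have b1 := hd.comp_injective (e := fun p : ℤ × ℤ => (p.2, p.1 - p.2)) (by
    rintro ⟨a, b⟩ ⟨c, d⟩ hh
    simp only [Prod.mk.injEq] at hh ⊢
    omega)
  have b2 := hd.comp_injective (e := fun p : ℤ × ℤ => (p.2, -p.1)) (by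
    rintro ⟨a, b⟩ ⟨c, d⟩ hh
    simp only [Prod.mk.injEq] at hh ⊢
    omega)
  have b3 := BddSum.amgm (F := fun p : ℤ × ℤ => jp p.2 * ‖D p.2‖)
    (x := fun p => ‖w (p.1 - p.2)‖) (z := fun p => ‖w (-p.1)‖)
    (fun p => mul_nonneg (jp_pos _).le (norm_nonneg _)) (fun p => by positivity) b1 b2
  have b4 : ‖∑' p, (F p + F (reflectFst p))‖ ≤ K * y + K * y := by
    refine (b3.of_norm_le fun p => ?_).norm_tsum_le
    have : F p + F (reflectFst p) = (p.2 : ℂ) * D p.2 * (w (p.1 - p.2) * w (-p.1)) := by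
      simp only [hFdef, reflectFst, Equiv.coe_fn_mk, sub_sub_cancel_left, neg_sub]
      push_cast
      ring
    rw [this]
    simp only [norm_mul]
    have h3 : ‖(p.2 : ℂ)‖ ≤ jp p.2 := by
      rw [← Complex.ofReal_intCast, Complex.norm_real, Real.norm_eq_abs]
      exact abs_le_jp _
    gcongr
  rw [← two_tsum_symm reflectFst hF, norm_mul, Complex.norm_two, ← e1] at b4
  linarith

/-- The time derivative of `w(n) w(-n)`. -/
def dMass (gw w : ℤ → ℂ) (n : ℤ) : ℂ :=
  I * n * gw n * w (-n) + w n * (I * ((-n : ℤ) : ℂ) * gw (-n))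

lemma mass_flux_bdd (h : StabData α γ w gw β B D κ l K y) :
    BddSum (fun n : ℤ => ‖(n : ℂ) * gw n * w (-n)‖) (K + K) := by
  have hα := h.maj.nonneg
  refine (BddSum.amgm (F := fun _ => 1) (fun _ => zero_le_one)
    (fun n => mul_nonneg (h.γ_nonneg n) (mul_nonneg (jp_pos (-n)).le (hα (-n))))
    (by simpa using h.γ_bdd) (by simpa using h.maj.l2.comp_injective neg_injective)).of_norm_le
      fun n => ?_
  rw [norm_mul, norm_mul]
  have h3 : ‖(n : ℂ)‖ ≤ jp (-n) := by
    rw [jp_neg, ← Complex.ofReal_intCast, Complex.norm_real, Real.norm_eq_abs]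
    exact abs_le_jp _
  calc _ ≤ jp (-n) * γ n * α (-n) := by
        have := h.gw_le n
        have := h.w_le (-n)
        have := h.γ_nonneg n
        have := jp_pos (-n)
        gcongr
    _ = _ := by ring

lemma dMass_bdd (h : StabData α γ w gw β B D κ l K y) :
    BddSum (fun n : ℤ => ‖dMass gw w n‖) (4 * K) := by
  have h1 := h.mass_flux_bdd
  refine ((h1.add (h1.comp_injective neg_injective)).of_norm_le fun n => ?_).le
    (le_of_eq (by ring))
  refine (norm_add_le _ _).trans (le_of_eq ?_)
  rw [neg_neg]
  simp only [norm_mul, Complex.norm_I]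
  ring

lemma tsum_dMass (h : StabData α γ w gw β B D κ l K y) :
    ∑' n, dMass gw w n = 2 * I * ∑' n : ℤ, (n : ℂ) * gw n * w (-n) := by
  have h1 := h.mass_flux_bdd.summable_norm.mul_left I
  rw [mul_assoc, ← tsum_mul_left, two_tsum_symm (Equiv.neg ℤ) h1]
  refine tsum_congr fun n => ?_
  simp only [dMass, Equiv.neg_apply, neg_neg]
  ring

lemma tsum_flux (h : StabData α γ w gw β B D κ l K y) :
    ∑' n : ℤ, (n : ℂ) * gw n * w (-n) = κ * (∑' n : ℤ, (n : ℂ) * T3 β w n * w (-n)) -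
      l * ∑' n : ℤ, (n : ℂ) * conv D w n * w (-n) := by
  rw [← tsum_mul_left, ← tsum_mul_left,
    ← (h.tsum_cubic.1.mul_left _).tsum_sub (h.tsum_quintic.1.mul_left _)]
  refine tsum_congr fun n => ?_
  rw [h.gw_eq]
  ring

end StabData

/-- The resonance function of the quartic form. -/
def omega5 (q : ℤ × ℤ × ℤ) : ℝ :=
  (q.1 : ℝ) ^ 5 + (q.2.1 : ℝ) ^ 5 + (q.2.2 : ℝ) ^ 5 + (fourth q : ℝ) ^ 5

/-- The resonant frequencies of the quartic form. -/
abbrev Res (q : ℤ × ℤ × ℤ) : Prop := q.1 + q.2.2 = 0 ∨ q.2.1 + q.2.2 = 0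

lemma omega5_mul_nfSym (q : ℤ × ℤ × ℤ) : omega5 q * nfSym q =
    if Res q then 0 else -(5 / 2) * (((q.1 + q.2.1 : ℤ) : ℝ) * sumSq q) := by
  obtain ⟨a, b, c⟩ := q
  split_ifs with h
  · rcases h with h | h <;> simp only at h <;> simp [nfSym, h]
  · simp only [Res, not_or] at h
    have h1 : ((a : ℝ) + c) ≠ 0 := by exact_mod_cast h.1
    have h2 : ((b : ℝ) + c) ≠ 0 := by exact_mod_cast h.2
    simp only [nfSym, omega5, sumSq, fourth]
    push_cast
    field_simp
    ring

lemma abs_add_mul_sumSq_le (q : ℤ × ℤ × ℤ) :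
    |((q.1 + q.2.1 : ℤ) : ℝ) * sumSq q| ≤ sumAbs q * sumSq q := by
  rw [abs_mul, abs_of_nonneg (sumSq_nonneg q)]
  refine mul_le_mul_of_nonneg_right ?_ (sumSq_nonneg q)
  unfold sumAbs
  push_cast
  have := abs_add_le (q.1 : ℝ) (q.2.1 : ℝ)
  have := abs_nonneg (q.2.2 : ℝ)
  have := abs_nonneg (fourth q : ℝ)
  linarith

/-- The normal form correction. -/
def nfTerm (β : ℤ → ℤ → ℂ) (w : ℤ → ℂ) (q : ℤ × ℤ × ℤ) : ℂ := (nfSym q : ℂ) * quad β w q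

/-- The linear part of the time derivative of the normal form correction. -/
def nfLin (β : ℤ → ℤ → ℂ) (w : ℤ → ℂ) (q : ℤ × ℤ × ℤ) : ℂ :=
  I * ((omega5 q * nfSym q : ℝ) : ℂ) * quad β w q

/-- The part of the derivative of the correction falling on the coefficient `β`. -/
def nfCoeff (B : ℤ → ℤ → ℂ) (w : ℤ → ℂ) (q : ℤ × ℤ × ℤ) : ℂ :=
  (nfSym q : ℂ) * (B q.1 q.2.1 * (w q.2.2 * w (fourth q)))

/-- Half of the part of the derivative of the correction falling on the differences. -/
def nfHalf (β : ℤ → ℤ → ℂ) (g w : ℤ → ℂ) (q : ℤ × ℤ × ℤ) : ℂ :=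
  (nfSym q : ℂ) * (β q.1 q.2.1 * ((q.2.2 : ℂ) * g q.2.2 * w (fourth q)))

/-- The part of the derivative of the correction falling on the differences. -/
def nfDiff (β : ℤ → ℤ → ℂ) (g w : ℤ → ℂ) (q : ℤ × ℤ × ℤ) : ℂ :=
  (nfSym q : ℂ) * (β q.1 q.2.1 *
    (I * q.2.2 * g q.2.2 * w (fourth q) + w q.2.2 * (I * fourth q * g (fourth q))))

/-- The resonant part of the quartic form. -/
def resTerm (β : ℤ → ℤ → ℂ) (w : ℤ → ℂ) (q : ℤ × ℤ × ℤ) : ℂ :=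
  if Res q then ((q.1 + q.2.1 : ℤ) : ℂ) * ((sumSq q : ℝ) : ℂ) * quad β w q else 0

namespace StabData
variable {α γ : ℤ → ℝ} {w gw : ℤ → ℂ} {β B : ℤ → ℤ → ℂ} {D : ℤ → ℂ} {κ l K y : ℝ}

lemma nfLin_bdd (h : StabData α γ w gw β B D κ l K y) :
    BddSum (fun q => ‖nfLin β w q‖) (5 / 2 * (8 * K ^ 4)) := by
  refine h.quad_bdd (by norm_num) fun q => ?_
  rw [norm_mul, Complex.norm_I, one_mul, Complex.norm_real, Real.norm_eq_abs, omega5_mul_nfSym]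
  split_ifs with hq
  · rw [abs_zero]
    exact mul_nonneg (by norm_num) (mul_nonneg (sumAbs_nonneg q) (sumSq_nonneg q))
  · rw [abs_mul]
    rw [show |-(5 / 2 : ℝ)| = 5 / 2 by norm_num]
    exact mul_le_mul_of_nonneg_left (abs_add_mul_sumSq_le q) (by norm_num)

lemma quart_summable (h : StabData α γ w gw β B D κ l K y) :
    Summable fun q : ℤ × ℤ × ℤ =>
      ((q.1 + q.2.1 : ℤ) : ℂ) * ((sumSq q : ℝ) : ℂ) * quad β w q := by
  refine (h.quad_bdd (A := 1) zero_le_one fun q => ?_).summable_norm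
  rw [← Complex.ofReal_intCast, ← Complex.ofReal_mul, Complex.norm_real, Real.norm_eq_abs, one_mul]
  exact abs_add_mul_sumSq_le q

lemma cubic_cancel (h : StabData α γ w gw β B D κ l K y) :
    I * (∑' q : ℤ × ℤ × ℤ, ((q.1 + q.2.1 : ℤ) : ℂ) * ((sumSq q : ℝ) : ℂ) * quad β w q) +
      2 / 5 * ∑' q, nfLin β w q = I * ∑' q, resTerm β w q := by
  rw [← tsum_mul_left, ← tsum_mul_left, ← tsum_mul_left,
    ← (h.quart_summable.mul_left I).tsum_add (h.nfLin_bdd.summable_norm.mul_left _)]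
  refine tsum_congr fun q => ?_
  rw [nfLin, omega5_mul_nfSym, resTerm]
  split_ifs with hq
  · push_cast
    ring
  · push_cast
    ring

lemma nfCoeff_bdd (h : StabData α γ w gw β B D κ l K y) :
    BddSum (fun q => ‖nfCoeff B w q‖) (4 * (K * (4 * Jsum * y) + K * (K * y))) := by
  have b1 := nf_coeff_bdd h.maj h.γ_nonneg h.γ_bdd (ω := fun n => ‖w n‖)
    (fun n => norm_nonneg _) h.w_bdd
  have b2 := b1.comp_injective swap12.injective
  refine ((b1.add b2).of_norm_le fun q => ?_).le (le_of_eq (by ring))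
  rw [nfSym_swap12, fourth_swap12]
  simp only [swap12, Equiv.coe_fn_mk]
  rw [nfCoeff, norm_mul, norm_mul, norm_mul, Complex.norm_real, Real.norm_eq_abs]
  have := h.B_le q.1 q.2.1
  have h0 : 0 ≤ |nfSym q| * (‖w q.2.2‖ * ‖w (fourth q)‖) := by positivity
  have := mul_le_mul_of_nonneg_left this h0
  linarith

lemma nfHalf_le (h : StabData α γ w gw β B D κ l K y) (g : ℤ → ℂ) (q : ℤ × ℤ × ℤ) :
    ‖nfHalf β g w q‖ ≤ (jp q.1 * α q.1 * α q.2.1) * (‖g q.2.2‖ * ‖w (fourth q)‖) := by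
  have hα := h.maj.nonneg
  rw [nfHalf, norm_mul, norm_mul, norm_mul, norm_mul, Complex.norm_real, Real.norm_eq_abs,
    ← Complex.ofReal_intCast, Complex.norm_real, Real.norm_eq_abs]
  calc |nfSym q| * (‖β q.1 q.2.1‖ * (|(q.2.2 : ℝ)| * ‖g q.2.2‖ * ‖w (fourth q)‖)) =
        |nfSym q| * |(q.2.2 : ℝ)| * (‖β q.1 q.2.1‖ * (‖g q.2.2‖ * ‖w (fourth q)‖)) := by ring
    _ ≤ jp q.1 * ((α q.1 * α q.2.1) * (‖g q.2.2‖ * ‖w (fourth q)‖)) := by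
        have := h.β_le q.1 q.2.1
        have := nfSym_mul_third_le_jp q
        have := (jp_pos q.1).le
        gcongr
    _ = _ := by ring

lemma nfHalf_bdd (h : StabData α γ w gw β B D κ l K y) {g : ℤ → ℂ} {C : ℝ}
    (hg : BddSum (fun n => ‖g n‖ ^ 2) C) :
    BddSum (fun q => ‖nfHalf β g w q‖) (K * (K * C) + K * (K * y)) := by
  have hα := h.maj.nonneg
  have b1 := (h.maj.l1j.mul_prod (h.maj.l1.mul_prod hg))
  have b2 := (h.maj.l1j.mul_prod (h.maj.l1.mul_prod h.w_bdd)).comp_injective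
    (e := fun q : ℤ × ℤ × ℤ => (q.1, q.2.1, fourth q)) swap34.injective
  have hF : ∀ q : ℤ × ℤ × ℤ, 0 ≤ jp q.1 * α q.1 * α q.2.1 := fun q =>
    mul_nonneg (h.maj.l1j.1 _) (hα _)
  refine (BddSum.amgm (x := fun q => ‖g q.2.2‖) (z := fun q => ‖w (fourth q)‖) hF
    (fun q => by positivity)
    (b1.mono (fun q => mul_nonneg (hF q) (sq_nonneg _)) fun q => le_of_eq (by ring))
    (b2.mono (fun q => mul_nonneg (hF q) (sq_nonneg _)) fun q => le_of_eq (by ring))).of_norm_le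
    fun q => h.nfHalf_le g q

lemma gw_bdd (h : StabData α γ w gw β B D κ l K y) : BddSum (fun n => ‖gw n‖ ^ 2) K :=
  h.γ_bdd.mono (fun _ => sq_nonneg _) fun n => pow_le_pow_left₀ (norm_nonneg _) (h.gw_le n) 2

lemma nfDiff_eq (q : ℤ × ℤ × ℤ) (g : ℤ → ℂ) :
    nfDiff β g w q = I * nfHalf β g w q + I * nfHalf β g w (swap34 q) := by
  simp only [nfDiff, nfHalf, nfSym_swap34, fourth_swap34]
  simp only [swap34, Equiv.coe_fn_mk]
  ring

lemma nfDiff_bdd (h : StabData α γ w gw β B D κ l K y) :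
    BddSum (fun q => ‖nfDiff β gw w q‖) (2 * (K * (K * K) + K * (K * y))) := by
  have b1 := h.nfHalf_bdd h.gw_bdd
  refine ((b1.add (b1.comp_injective swap34.injective)).of_norm_le fun q => ?_).le
    (le_of_eq (by ring))
  rw [nfDiff_eq]
  refine (norm_add_le _ _).trans (le_of_eq ?_)
  rw [norm_mul, norm_mul, Complex.norm_I, one_mul, one_mul]

lemma tsum_nfDiff (h : StabData α γ w gw β B D κ l K y) :
    ∑' q, nfDiff β gw w q = 2 * I * ∑' q, nfHalf β gw w q := by
  have h1 := (h.nfHalf_bdd h.gw_bdd).summable_norm.mul_left I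
  rw [mul_assoc, ← tsum_mul_left, two_tsum_symm swap34 h1]
  exact tsum_congr fun q => nfDiff_eq q gw

lemma conv_sq_bdd (h : StabData α γ w gw β B D κ l K y) :
    BddSum (fun n => ‖conv D w n‖ ^ 2) (K * (K * y)) := by
  obtain ⟨h1, h2⟩ := MKdV5.conv_sq_bdd h.D_W1.l1 (fun n => norm_nonneg (w n)) h.w_bdd
  exact h2.mono (fun _ => sq_nonneg _) fun n =>
    pow_le_pow_left₀ (norm_nonneg _) (norm_conv_le (h1 n)) 2

lemma T3_sq_bdd (h : StabData α γ w gw β B D κ l K y) :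
    BddSum (fun n => ‖T3 β w n‖ ^ 2) (144 * K ^ 5) :=
  (T3maj_bdd h.maj).2.mono (fun _ => sq_nonneg _) fun n =>
    pow_le_pow_left₀ (norm_nonneg _) (norm_T3_le h.maj h.β_le h.w_le n) 2

/-- The sextic form. -/
def sexticTerm (β : ℤ → ℤ → ℂ) (w : ℤ → ℂ) (x : Sextic) : ℂ :=
  ((sym6 x : ℝ) : ℂ) *
    (β x.1.1 x.1.2.1 * β x.2.1 x.2.2 * (w (inner6 x) * w (fourth x.1)))

lemma sextic_bdd (h : StabData α γ w gw β B D κ l K y) :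
    BddSum (fun x => ‖sexticTerm β w x‖)
      (K * (K * (144 * K ^ 5)) + K * (K * K)) := by
  have hα := h.maj.nonneg
  have b1 := h.maj.l1j.mul_prod (h.maj.l1.mul_prod (T3maj_bdd h.maj).2)
  have b2 := (h.maj.l1j.mul_prod (h.maj.l1.mul_prod h.maj.l2z)).comp_injective
    (e := fun q : ℤ × ℤ × ℤ => (q.1, q.2.1, fourth q)) swap34.injective
  have hF : ∀ q : ℤ × ℤ × ℤ, 0 ≤ jp q.1 * α q.1 * α q.2.1 := fun q =>
    mul_nonneg (h.maj.l1j.1 _) (hα _)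
  have hT : ∀ n, 0 ≤ T3maj α n := fun n => ((T3maj_bdd h.maj).1 n).bound_nonneg
  have b3 := (BddSum.amgm (x := fun q => T3maj α q.2.2) (z := fun q => α (fourth q)) hF
    (fun q => mul_nonneg (hT _) (hα _))
    (b1.mono (fun q => mul_nonneg (hF q) (sq_nonneg _)) fun q => le_of_eq (by ring))
    (b2.mono (fun q => mul_nonneg (hF q) (sq_nonneg _)) fun q => le_of_eq (by ring)))
  refine BddSum.of_fiber (fun q => ?_) b3
  have b4 := ((T3maj_bdd h.maj).1 q.2.2).const_mul (c := jp q.1 * α q.1 * α q.2.1 * α (fourth q))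
    (mul_nonneg (hF q) (hα _))
  refine (b4.of_norm_le fun p => ?_).le (le_of_eq (by ring))
  rw [sexticTerm, sym6, norm_mul, norm_mul, norm_mul, norm_mul, Complex.norm_real,
    Real.norm_eq_abs, abs_mul, abs_mul, abs_of_nonneg (sym3_nonneg _ _ _)]
  have h1 := nfSym_mul_third_le_jp q
  have h2 := h.β_le q.1 q.2.1
  have h3 := h.β_le p.1 p.2
  have h4 := h.w_le (inner6 (q, p))
  have h5 := h.w_le (fourth q)
  have h6 := sym3_nonneg q.2.2 p.1 p.2
  have := hα q.1
  have := hα q.2.1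
  have := hα p.1
  have := hα p.2
  have := hα (fourth q)
  have := hα (inner6 (q, p))
  have := (jp_pos q.1).le
  calc |nfSym q| * |(q.2.2 : ℝ)| * sym3 q.2.2 p.1 p.2 *
        (‖β q.1 q.2.1‖ * ‖β p.1 p.2‖ * (‖w (inner6 (q, p))‖ * ‖w (fourth q)‖)) ≤
      jp q.1 * sym3 q.2.2 p.1 p.2 * ((α q.1 * α q.2.1) * (α p.1 * α p.2) *
        (α (inner6 (q, p)) * α (fourth q))) := by gcongr
    _ = _ := by simp only [inner6]; ring

lemma tsum_sextic (h : StabData α γ w gw β B D κ l K y) :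
    ∑' q, nfHalf β (T3 β w) w q = ∑' x, sexticTerm β w x := by
  rw [h.sextic_bdd.summable_norm.tsum_prod]
  refine tsum_congr fun q => ?_
  rw [nfHalf, T3, ← tsum_mul_left, ← tsum_mul_right, ← tsum_mul_left, ← tsum_mul_left]
  refine tsum_congr fun p => ?_
  simp only [sexticTerm, sym6, inner6]
  push_cast
  ring

open Classical in
lemma norm_tsum_sextic_le (h : StabData α γ w gw β B D κ l K y) :
    ‖∑' x, sexticTerm β w x‖ ≤ (80 * K ^ 4 + 1040 * (K ^ 3 * (4 * Jsum + K))) * y := by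
  have hα := h.maj.nonneg
  have hs := h.sextic_bdd.summable_norm
  set S : Sextic → ℂ := fun x => if Small6 x then sexticTerm β w x else 0
  set L : Sextic → ℂ := fun x => if Small6 x then 0 else sexticTerm β w x
  have hS : Summable S := (h.sextic_bdd.mono (fun _ => norm_nonneg _) fun x => by
    simp only [S]; split_ifs <;> simp).summable_norm (f := S)
  have hL : Summable L := (h.sextic_bdd.mono (fun _ => norm_nonneg _) fun x => by
    simp only [L]; split_ifs <;> simp).summable_norm (f := L)
  have e : ∑' x, sexticTerm β w x = ∑' x, S x + ∑' x, L x := by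
    rw [← hS.tsum_add hL]
    refine tsum_congr fun x => ?_
    simp only [S, L]
    split_ifs <;> simp
  have hββ : ∀ x : Sextic, ‖β x.1.1 x.1.2.1 * β x.2.1 x.2.2 * (w (inner6 x) * w (fourth x.1))‖ ≤
      (α x.1.1 * α x.1.2.1) * (α x.2.1 * α x.2.2) * (‖w (inner6 x)‖ * ‖w (fourth x.1)‖) := by
    intro x
    rw [norm_mul, norm_mul, norm_mul]
    have h2 := h.β_le x.1.1 x.1.2.1
    have h3 := h.β_le x.2.1 x.2.2
    have := mul_nonneg (hα x.1.1) (hα x.1.2.1)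
    gcongr
  have bL : ‖∑' x, L x‖ ≤ 260 * (4 * (K ^ 3 * (4 * Jsum + K) * y)) := by
    refine (((sextic_far_bdd h.maj (fun n => norm_nonneg (w n)) h.w_bdd).const_mul
      (by norm_num : (0 : ℝ) ≤ 260)).of_norm_le fun x => ?_).norm_tsum_le
    have h0 : 0 ≤ (α x.1.1 * α x.1.2.1) * (α x.2.1 * α x.2.2) *
        (‖w (inner6 x)‖ * ‖w (fourth x.1)‖) := (norm_nonneg _).trans (hββ x)
    simp only [L]
    split_ifs with hx
    · rw [norm_zero]
      positivity
    · rw [sexticTerm, norm_mul, Complex.norm_real, Real.norm_eq_abs]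
      exact (mul_le_mul (sym6_far hx) (hββ x) (norm_nonneg _) (by positivity)).trans
        (le_of_eq (by ring))
  have bS : ‖∑' x, (S x + S (swap6 x))‖ ≤ 80 * (2 * K ^ 4 * y) := by
    refine (((sextic_small_bdd h.maj (fun n => norm_nonneg (w n)) h.w_bdd).const_mul
      (by norm_num : (0 : ℝ) ≤ 80)).of_norm_le fun x => ?_).norm_tsum_le
    have h0 : 0 ≤ (α x.1.1 * α x.1.2.1) * (α x.2.1 * α x.2.2) *
        (‖w (inner6 x)‖ * ‖w (fourth x.1)‖) := (norm_nonneg _).trans (hββ x)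
    have hj : 0 ≤ jp x.1.1 * jp x.1.2.1 * (jp x.2.1 * jp x.2.2) :=
      mul_nonneg (mul_nonneg (jp_pos _).le (jp_pos _).le) (mul_nonneg (jp_pos _).le (jp_pos _).le)
    simp only [S, small6_swap6]
    split_ifs with hx
    · have e2 : sexticTerm β w x + sexticTerm β w (swap6 x) =
          ((sym6 x + sym6 (swap6 x) : ℝ) : ℂ) *
            (β x.1.1 x.1.2.1 * β x.2.1 x.2.2 * (w (inner6 x) * w (fourth x.1))) := by
        simp only [sexticTerm, inner6_swap6, fourth_swap6]
        simp only [swap6, Equiv.coe_fn_mk]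
        push_cast
        ring
      rw [e2, norm_mul, Complex.norm_real, Real.norm_eq_abs]
      exact (mul_le_mul (sym6_add_swap6 hx) (hββ x) (norm_nonneg _) (by positivity)).trans
        (le_of_eq (by ring))
    · rw [add_zero, norm_zero]
      positivity
  rw [← two_tsum_symm swap6 hS, norm_mul, Complex.norm_two] at bS
  rw [e]
  refine (norm_add_le _ _).trans ?_
  linarith

lemma norm_tsum_nfDiff_le (h : StabData α γ w gw β B D κ l K y) :
    ‖∑' q, nfDiff β gw w q‖ ≤
      2 * (|κ| * ((80 * K ^ 4 + 1040 * (K ^ 3 * (4 * Jsum + K))) * y) +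
        |l| * (K * (K * (K * (K * y))) + K * (K * y))) := by
  have b1 := (h.nfHalf_bdd h.T3_sq_bdd)
  have b2 := (h.nfHalf_bdd h.conv_sq_bdd)
  have e : ∑' q, nfHalf β gw w q = κ * ∑' q, nfHalf β (T3 β w) w q -
      l * ∑' q, nfHalf β (conv D w) w q := by
    rw [← tsum_mul_left, ← tsum_mul_left,
      ← (b1.summable_norm.mul_left _).tsum_sub (b2.summable_norm.mul_left _)]
    refine tsum_congr fun q => ?_
    simp only [nfHalf]
    rw [h.gw_eq]
    ring
  rw [h.tsum_nfDiff, e, h.tsum_sextic, norm_mul, norm_mul, Complex.norm_two, Complex.norm_I,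
    mul_one]
  refine mul_le_mul_of_nonneg_left ?_ (by norm_num)
  refine (norm_sub_le _ _).trans ?_
  rw [norm_mul, norm_mul, Complex.norm_real, Complex.norm_real, Real.norm_eq_abs, Real.norm_eq_abs]
  exact add_le_add (mul_le_mul_of_nonneg_left h.norm_tsum_sextic_le (abs_nonneg _))
    (mul_le_mul_of_nonneg_left b2.norm_tsum_le (abs_nonneg _))

end StabData

/-! ### The resonant part. -/

/-- The moment `Σ nʲ f(n) w(-n)`. -/
def moment (j : ℕ) (f w : ℤ → ℂ) : ℂ := ∑' n : ℤ, (n : ℂ) ^ j * (f n * w (-n))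

lemma norm_intCast_eq (n : ℤ) : ‖(n : ℂ)‖ = |(n : ℝ)| := by
  rw [← Complex.ofReal_intCast, Complex.norm_real, Real.norm_eq_abs]

section
variable {α : ℤ → ℝ} {K y : ℝ} {f g w : ℤ → ℂ}

lemma moment_three_bdd (h : Maj α K) (hf : ∀ n, ‖f n‖ ≤ α n) (hw : ∀ n, ‖w n‖ ≤ α n) :
    BddSum (fun n : ℤ => jp n ^ 3 * (‖f n‖ * ‖w (-n)‖)) (K + K) := by
  have hα := h.nonneg
  have hj := fun n => (jp_pos n).le
  refine (BddSum.amgm (F := fun _ => 1) (fun _ => zero_le_one)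
    (x := fun n => jp n ^ 2 * α n) (z := fun n => jp (-n) * α (-n))
    (fun n => mul_nonneg (mul_nonneg (sq_nonneg _) (hα n)) (mul_nonneg (hj _) (hα _)))
    (by simpa using h.l2j) (by simpa using h.l2.comp_injective neg_injective)).mono
    (fun n => mul_nonneg (pow_nonneg (hj n) 3) (by positivity)) fun n => ?_
  have h1 := hf n
  have h2 := hw (-n)
  have h3 := hα n
  have h4 := hj n
  rw [jp_neg]
  calc jp n ^ 3 * (‖f n‖ * ‖w (-n)‖) ≤ jp n ^ 3 * (α n * α (-n)) := by gcongr
    _ = _ := by ring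

lemma moment_bdd (h : Maj α K) (hf : ∀ n, ‖f n‖ ≤ α n) (hw : ∀ n, ‖w n‖ ≤ α n) {j : ℕ}
    (hj : j ≤ 3) : BddSum (fun n : ℤ => ‖(n : ℂ) ^ j * (f n * w (-n))‖) (K + K) := by
  refine (moment_three_bdd h hf hw).of_norm_le fun n => ?_
  rw [norm_mul, norm_mul, norm_pow, norm_intCast_eq]
  refine mul_le_mul_of_nonneg_right ?_ (by positivity)
  calc |(n : ℝ)| ^ j ≤ jp n ^ j := pow_le_pow_left₀ (abs_nonneg _) (abs_le_jp n) j
    _ ≤ jp n ^ 3 := pow_le_pow_right₀ (one_le_jp n) hj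

lemma norm_moment_le_sqrt (h : Maj α K) (hf : ∀ n, ‖f n‖ ≤ α n)
    (hy : BddSum (fun n => ‖w n‖ ^ 2) y) {j : ℕ} (hj : j ≤ 2) :
    ‖moment j f w‖ ≤ Real.sqrt K * Real.sqrt y := by
  have hα := h.nonneg
  refine ((BddSum.cauchy_schwarz (x := fun n => jp n ^ 2 * α n) (z := fun n => ‖w (-n)‖)
    (fun n => mul_nonneg (sq_nonneg _) (hα n)) (fun n => norm_nonneg _) h.l2j
    (hy.comp_injective neg_injective)).of_norm_le fun n => ?_).norm_tsum_le
  rw [norm_mul, norm_mul, norm_pow, norm_intCast_eq, ← mul_assoc]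
  refine mul_le_mul_of_nonneg_right (mul_le_mul ?_ (hf n) (norm_nonneg _) (sq_nonneg _))
    (norm_nonneg _)
  calc |(n : ℝ)| ^ j ≤ jp n ^ j := pow_le_pow_left₀ (abs_nonneg _) (abs_le_jp n) j
    _ ≤ jp n ^ 2 := pow_le_pow_right₀ (one_le_jp n) hj

/-- The doubly indexed resonant sum, for a tensor product. -/
def resPair (f g w : ℤ → ℂ) (p : ℤ × ℤ) : ℂ :=
  2 * ((p.1 + p.2 : ℂ) * ((p.1 : ℂ) ^ 2 + (p.2 : ℂ) ^ 2)) * (f p.1 * g p.2 * (w (-p.1) * w (-p.2)))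

lemma resPair_summable (h : Maj α K) (hf : ∀ n, ‖f n‖ ≤ α n) (hg : ∀ n, ‖g n‖ ≤ α n)
    (hw : ∀ n, ‖w n‖ ≤ α n) : Summable (resPair f g w) ∧
    ∑' p, resPair f g w p = 2 * (moment 3 f w * moment 0 g w + moment 2 f w * moment 1 g w +
      moment 1 f w * moment 2 g w + moment 0 f w * moment 3 g w) := by
  have hF := fun j (hj : j ≤ 3) => (moment_bdd h hf hw hj).summable
  have hG := fun j (hj : j ≤ 3) => (moment_bdd h hg hw hj).summable
  have hs := fun i j (hi : i ≤ 3) (hj : j ≤ 3) =>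
    summable_mul_of_summable_norm (hF i hi) (hG j hj)
  have ht := fun i j (hi : i ≤ 3) (hj : j ≤ 3) =>
    tsum_mul_tsum_of_summable_norm (hF i hi) (hG j hj)
  have e : resPair f g w = fun p => 2 * (((((p.1 : ℂ) ^ 3 * (f p.1 * w (-p.1))) *
      ((p.2 : ℂ) ^ 0 * (g p.2 * w (-p.2))) +
      ((p.1 : ℂ) ^ 2 * (f p.1 * w (-p.1))) * ((p.2 : ℂ) ^ 1 * (g p.2 * w (-p.2)))) +
      ((p.1 : ℂ) ^ 1 * (f p.1 * w (-p.1))) * ((p.2 : ℂ) ^ 2 * (g p.2 * w (-p.2)))) +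
      ((p.1 : ℂ) ^ 0 * (f p.1 * w (-p.1))) * ((p.2 : ℂ) ^ 3 * (g p.2 * w (-p.2)))) := by
    funext p
    simp only [resPair]
    ring
  have s30 := hs 3 0 (by norm_num) (by norm_num)
  have s21 := hs 2 1 (by norm_num) (by norm_num)
  have s12 := hs 1 2 (by norm_num) (by norm_num)
  have s03 := hs 0 3 (by norm_num) (by norm_num)
  rw [e]
  refine ⟨(((s30.add s21).add s12).add s03).mul_left 2, ?_⟩
  rw [tsum_mul_left, ((s30.add s21).add s12).tsum_add s03, (s30.add s21).tsum_add s12,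
    s30.tsum_add s21]
  simp only [moment]
  rw [ht 3 0 (by norm_num) (by norm_num), ht 2 1 (by norm_num) (by norm_num),
    ht 1 2 (by norm_num) (by norm_num), ht 0 3 (by norm_num) (by norm_num)]

lemma norm_tsum_resPair_le (h : Maj α K) (hf : ∀ n, ‖f n‖ ≤ α n) (hg : ∀ n, ‖g n‖ ≤ α n)
    (hw : ∀ n, ‖w n‖ ≤ α n) (hy : BddSum (fun n => ‖w n‖ ^ 2) y)
    (hf0 : ‖moment 0 f w‖ ≤ y) (hg0 : ‖moment 0 g w‖ ≤ y) :
    ‖∑' p, resPair f g w p‖ ≤ 12 * (K * y) := by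
  have hK := h.pos.le
  have hy0 := hy.bound_nonneg
  have e : (Real.sqrt K * Real.sqrt y) * (Real.sqrt K * Real.sqrt y) = K * y := by
    rw [mul_mul_mul_comm, Real.mul_self_sqrt hK, Real.mul_self_sqrt hy0]
  rw [(resPair_summable h hf hg hw).2, norm_mul, Complex.norm_two]
  have t1 : ‖moment 3 f w * moment 0 g w‖ ≤ (K + K) * y := by
    rw [norm_mul]
    exact mul_le_mul (moment_bdd h hf hw le_rfl).norm_tsum_le hg0 (norm_nonneg _) (by positivity)
  have t2 : ‖moment 2 f w * moment 1 g w‖ ≤ K * y := by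
    rw [norm_mul, ← e]
    exact mul_le_mul (norm_moment_le_sqrt h hf hy le_rfl)
      (norm_moment_le_sqrt h hg hy (by norm_num)) (norm_nonneg _) (by positivity)
  have t3 : ‖moment 1 f w * moment 2 g w‖ ≤ K * y := by
    rw [norm_mul, ← e]
    exact mul_le_mul (norm_moment_le_sqrt h hf hy (by norm_num))
      (norm_moment_le_sqrt h hg hy le_rfl) (norm_nonneg _) (by positivity)
  have t4 : ‖moment 0 f w * moment 3 g w‖ ≤ y * (K + K) := by
    rw [norm_mul]
    exact mul_le_mul hf0 (moment_bdd h hg hw le_rfl).norm_tsum_le (norm_nonneg _) hy0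
  have h4 := norm_add₄_le (a := moment 3 f w * moment 0 g w) (b := moment 2 f w * moment 1 g w)
    (c := moment 1 f w * moment 2 g w) (d := moment 0 f w * moment 3 g w)
  linarith

end

/-- The coefficient `u⊗u + u⊗v + v⊗v`. -/
def tens (u v : ℤ → ℂ) (a b : ℤ) : ℂ := u a * u b + u a * v b + v a * v b

namespace StabData
variable {α γ : ℤ → ℝ} {w gw : ℤ → ℂ} {B : ℤ → ℤ → ℂ} {D : ℤ → ℂ} {κ l K y : ℝ}
  {u v : ℤ → ℂ}

lemma norm_tsum_resTerm_le (h : StabData α γ w gw (tens u v) B D κ l K y)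
    (hu : ∀ n, ‖u n‖ ≤ α n) (hv : ∀ n, ‖v n‖ ≤ α n)
    (hu0 : ‖moment 0 u w‖ ≤ y) (hv0 : ‖moment 0 v w‖ ≤ y) :
    ‖∑' q, resTerm (tens u v) w q‖ ≤ 80 * K ^ 2 * y := by
  have hα := h.maj.nonneg
  have hK := h.maj.one_le
  have hy0 := h.w_bdd.bound_nonneg
  set F : ℤ × ℤ × ℤ → ℂ := fun q =>
    ((q.1 + q.2.1 : ℤ) : ℂ) * ((sumSq q : ℝ) : ℂ) * quad (tens u v) w q with hF
  have hFs : Summable F := h.quart_summable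
  have hind : ∀ (P : ℤ × ℤ × ℤ → Prop) [DecidablePred P],
      Summable fun q => if P q then F q else 0 := fun P _ =>
    (BddSum.mono (BddSum.of_summable (fun _ => norm_nonneg _) hFs.norm le_rfl)
      (fun _ => norm_nonneg _) fun q => by split_ifs <;> simp).summable_norm
  have key : ∀ p, resPair u u w p + resPair u v w p + resPair v v w p =
      2 * ((p.1 + p.2 : ℂ) * ((p.1 : ℂ) ^ 2 + (p.2 : ℂ) ^ 2)) *
        (tens u v p.1 p.2 * (w (-p.1) * w (-p.2))) := by
    intro p
    simp only [resPair, tens]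
    ring
  set R : ℂ := ∑' p, (resPair u u w p + resPair u v w p + resPair v v w p) with hR
  have hRle : ‖R‖ ≤ 36 * (K * y) := by
    have s1 := (resPair_summable h.maj hu hu h.w_le).1
    have s2 := (resPair_summable h.maj hu hv h.w_le).1
    have s3 := (resPair_summable h.maj hv hv h.w_le).1
    rw [hR, (s1.add s2).tsum_add s3, s1.tsum_add s2]
    have b1 := norm_tsum_resPair_le h.maj hu hu h.w_le h.w_bdd hu0 hu0
    have b2 := norm_tsum_resPair_le h.maj hu hv h.w_le h.w_bdd hu0 hv0
    have b3 := norm_tsum_resPair_le h.maj hv hv h.w_le h.w_bdd hv0 hv0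
    refine (norm_add₃_le).trans ?_
    linarith
  have e1 : ∑' q : ℤ × ℤ × ℤ, (if q.1 + q.2.2 = 0 then F q else 0) = R := by
    have hinj : Function.Injective fun p : ℤ × ℤ => ((p.1, p.2, -p.1) : ℤ × ℤ × ℤ) := by
      rintro ⟨a, b⟩ ⟨c, d⟩ hh
      simp only [Prod.mk.injEq] at hh ⊢
      exact ⟨hh.1, hh.2.1⟩
    rw [hR, ← hinj.tsum_eq]
    · refine tsum_congr fun p => ?_
      rw [key]
      simp only [hF, quad, sumSq, fourth, add_neg_cancel, if_true]
      rw [show -p.1 - p.2 - -p.1 = -p.2 by ring]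
      push_cast
      ring
    · rintro ⟨a, b, c⟩ hq
      rw [Function.mem_support] at hq
      have : a + c = 0 := by
        by_contra hc
        simp [hc] at hq
      exact ⟨(a, b), by ext <;> simp; omega⟩
  have e2 : ∑' q : ℤ × ℤ × ℤ, (if q.2.1 + q.2.2 = 0 then F q else 0) = R := by
    have hinj : Function.Injective fun p : ℤ × ℤ => ((p.1, p.2, -p.2) : ℤ × ℤ × ℤ) := by
      rintro ⟨a, b⟩ ⟨c, d⟩ hh
      simp only [Prod.mk.injEq] at hh ⊢
      exact ⟨hh.1, hh.2.1⟩
    rw [hR, ← hinj.tsum_eq]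
    · refine tsum_congr fun p => ?_
      rw [key]
      simp only [hF, quad, sumSq, fourth, add_neg_cancel, if_true]
      rw [show -p.1 - p.2 - -p.2 = -p.1 by ring]
      push_cast
      ring
    · rintro ⟨a, b, c⟩ hq
      rw [Function.mem_support] at hq
      have : b + c = 0 := by
        by_contra hc
        simp [hc] at hq
      exact ⟨(a, b), by ext <;> simp; omega⟩
  have e3 : ‖∑' q : ℤ × ℤ × ℤ, (if q.1 + q.2.2 = 0 ∧ q.2.1 + q.2.2 = 0 then F q else 0)‖ ≤
      8 * K ^ 2 * y := by
    have hinj : Function.Injective fun n : ℤ => ((n, n, -n) : ℤ × ℤ × ℤ) := by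
      intro a b hh
      simp only [Prod.mk.injEq] at hh
      exact hh.1
    rw [← hinj.tsum_eq]
    · refine (((h.w_bdd.comp_injective neg_injective).const_mul (c := 8 * K ^ 2)
        (by positivity)).of_norm_le fun n => ?_).norm_tsum_le
      have e : F (n, n, -n) = 8 * (n : ℂ) ^ 3 * (tens u v n n * (w (-n) * w (-n))) := by
        simp only [hF, quad, sumSq, fourth]
        rw [show -n - n - -n = -n by ring]
        push_cast
        ring
      simp only [add_neg_cancel, and_self, if_true, e, norm_mul, norm_pow, norm_intCast_eq]
      have h1 := h.β_le n n
      have h2 := h.maj.sup n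
      have h3 := h.maj.l1j.apply_le n
      have h4 := abs_le_jp n
      have h5 := hα n
      have h6 := (jp_pos n).le
      have h8 : ‖(8 : ℂ)‖ = 8 := by norm_num
      rw [h8]
      calc 8 * |(n : ℝ)| ^ 3 * (‖tens u v n n‖ * (‖w (-n)‖ * ‖w (-n)‖)) ≤
          8 * jp n ^ 3 * ((α n * α n) * (‖w (-n)‖ * ‖w (-n)‖)) := by gcongr
        _ = 8 * ((jp n ^ 2 * α n) * (jp n * α n)) * ‖w (-n)‖ ^ 2 := by ring
        _ ≤ 8 * (K * K) * ‖w (-n)‖ ^ 2 := by gcongr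
        _ = _ := by ring
    · rintro ⟨a, b, c⟩ hq
      rw [Function.mem_support] at hq
      have : a + c = 0 ∧ b + c = 0 := by
        by_contra hc
        simp [hc] at hq
      exact ⟨a, by ext <;> simp <;> omega⟩
  have e4 : ∑' q, resTerm (tens u v) w q = R + R -
      ∑' q : ℤ × ℤ × ℤ, (if q.1 + q.2.2 = 0 ∧ q.2.1 + q.2.2 = 0 then F q else 0) := by
    have hRR : R + R = (∑' q : ℤ × ℤ × ℤ, if q.1 + q.2.2 = 0 then F q else 0) +
        ∑' q : ℤ × ℤ × ℤ, if q.2.1 + q.2.2 = 0 then F q else 0 := by rw [e1, e2]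
    have i1 := hind fun q => q.1 + q.2.2 = 0
    have i2 := hind fun q => q.2.1 + q.2.2 = 0
    have i3 := hind fun q => q.1 + q.2.2 = 0 ∧ q.2.1 + q.2.2 = 0
    rw [hRR, ← i1.tsum_add i2, ← (i1.add i2).tsum_sub i3]
    refine tsum_congr fun q => ?_
    simp only [resTerm, Res]
    by_cases ha : q.1 + q.2.2 = 0 <;> by_cases hb : q.2.1 + q.2.2 = 0 <;> simp [ha, hb, hF]
  rw [e4]
  refine (norm_sub_le _ _).trans ?_
  have := norm_add_le R R
  have hKK : K * y ≤ K ^ 2 * y := mul_le_mul_of_nonneg_right (by nlinarith) hy0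
  linarith

end StabData

/-! ### The modified energy: coercivity and growth. -/

/-- The frequencies of size at most `M`. -/
def lowSet (M : ℕ) : Finset ℤ := Finset.Icc (-(M : ℤ)) M

lemma lt_abs_of_notMem_lowSet {M : ℕ} {n : ℤ} (hn : n ∉ lowSet M) : (M : ℝ) ≤ |(n : ℝ)| := by
  simp only [lowSet, Finset.mem_Icc, not_and_or, not_le] at hn
  have : (M : ℤ) ≤ |n| := by
    rcases hn with h | h
    · exact (by omega : (M : ℤ) ≤ -n).trans (neg_le_abs n)
    · exact h.le.trans (le_abs_self n)
  exact_mod_cast this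

/-- The modified energy of the difference `w` of two solutions. -/
def modEnergy (κ Λ : ℝ) (M : ℕ) (β : ℤ → ℤ → ℂ) (w : ℤ → ℂ) : ℂ :=
  ∑' n, w n * w (-n) + 2 * κ / 5 * ∑' q, nfTerm β w q + Λ * ∑ n ∈ lowSet M, w n * w (-n)

/-- The time derivative of the modified energy. -/
def modFlux (κ Λ : ℝ) (M : ℕ) (β B : ℤ → ℤ → ℂ) (gw w : ℤ → ℂ) : ℂ :=
  ∑' n, StabData.dMass gw w n +
    2 * κ / 5 * (∑' q, nfLin β w q + ∑' q, nfCoeff B w q + ∑' q, nfDiff β gw w q) +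
    Λ * ∑ n ∈ lowSet M, StabData.dMass gw w n

namespace StabData
variable {α γ : ℤ → ℝ} {w gw : ℤ → ℂ} {β B : ℤ → ℤ → ℂ} {D : ℤ → ℂ} {κ l K y : ℝ}

lemma nfTerm_bdd (h : StabData α γ w gw β B D κ l K y) {ε : ℝ} (hε : 0 < ε) {M : ℕ}
    (hM : 1 ≤ ε * M) : BddSum (fun q => ‖nfTerm β w q‖)
      (K * (K * (ε⁻¹ * (∑ n ∈ lowSet M, ‖w n‖ ^ 2) + 2 * ε * y))) := by
  have hα := h.maj.nonneg
  set c : ℤ → ℝ := fun n => if n ∈ lowSet M then 1 else ε with hc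
  have hc0 : ∀ n, 0 ≤ c n := fun n => by simp only [hc]; split_ifs <;> positivity
  have b0 : BddSum (fun n => if n ∈ lowSet M then ‖w n‖ ^ 2 else 0)
      (∑ n ∈ lowSet M, ‖w n‖ ^ 2) := by
    refine ⟨fun n => by dsimp only; split_ifs <;> positivity, fun s => ?_⟩
    rw [Finset.sum_ite_mem]
    exact Finset.sum_le_sum_of_subset_of_nonneg Finset.inter_subset_right
      fun _ _ _ => sq_nonneg _
  have b1 : BddSum (fun n => (Real.sqrt ε⁻¹ * (c n * ‖w n‖)) ^ 2)
      (ε⁻¹ * (∑ n ∈ lowSet M, ‖w n‖ ^ 2) + ε * y) := by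
    refine ((b0.const_mul (inv_nonneg.2 hε.le)).add (h.w_bdd.const_mul hε.le)).mono
      (fun n => sq_nonneg _) fun n => ?_
    rw [mul_pow, Real.sq_sqrt (inv_nonneg.2 hε.le), mul_pow]
    simp only [hc]
    split_ifs
    · have : 0 ≤ ε * ‖w n‖ ^ 2 := by positivity
      linarith
    · rw [mul_zero, zero_add]
      exact le_of_eq (by field_simp)
  have b2 : BddSum (fun n => (Real.sqrt ε * ‖w n‖) ^ 2) (ε * y) := by
    simpa only [mul_pow, Real.sq_sqrt hε.le] using h.w_bdd.const_mul hε.le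
  have p1 := h.maj.l1j.mul_prod (h.maj.l1.mul_prod b1)
  have p2 := (h.maj.l1j.mul_prod (h.maj.l1.mul_prod b2)).comp_injective
    (e := fun q : ℤ × ℤ × ℤ => (q.1, q.2.1, fourth q)) swap34.injective
  refine ((BddSum.amgm (F := fun q : ℤ × ℤ × ℤ => jp q.1 * α q.1 * α q.2.1)
    (x := fun q => Real.sqrt ε⁻¹ * (c q.2.2 * ‖w q.2.2‖))
    (z := fun q => Real.sqrt ε * ‖w (fourth q)‖)
    (fun q => mul_nonneg (mul_nonneg (jp_pos _).le (hα _)) (hα _))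
    (fun q => mul_nonneg (mul_nonneg (Real.sqrt_nonneg _) (mul_nonneg (hc0 _) (norm_nonneg _)))
      (mul_nonneg (Real.sqrt_nonneg _) (norm_nonneg _)))
    (by simpa only [mul_assoc] using p1)
    (by simpa only [mul_assoc] using p2)).of_norm_le fun q => ?_).le (le_of_eq (by ring))
  have hcn : |nfSym q| ≤ jp q.1 * c q.2.2 := by
    simp only [hc]
    split_ifs with hq
    · rw [mul_one]
      exact (abs_nfSym_le_one q).trans (one_le_jp _)
    · have h1 := lt_abs_of_notMem_lowSet hq
      have h2 := nfSym_mul_third_le_jp q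
      have h3 := abs_nonneg (nfSym q)
      have h4 : 1 ≤ ε * |(q.2.2 : ℝ)| := hM.trans (mul_le_mul_of_nonneg_left h1 hε.le)
      calc |nfSym q| ≤ |nfSym q| * (ε * |(q.2.2 : ℝ)|) := le_mul_of_one_le_right h3 h4
        _ = ε * (|nfSym q| * |(q.2.2 : ℝ)|) := by ring
        _ ≤ ε * jp q.1 := mul_le_mul_of_nonneg_left h2 hε.le
        _ = _ := mul_comm _ _
  have e : Real.sqrt ε⁻¹ * Real.sqrt ε = 1 := by
    rw [← Real.sqrt_mul (inv_nonneg.2 hε.le), inv_mul_cancel₀ hε.ne', Real.sqrt_one]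
  rw [nfTerm, quad, norm_mul, norm_mul, norm_mul, Complex.norm_real, Real.norm_eq_abs]
  have := h.β_le q.1 q.2.1
  have := hc0 q.2.2
  have := jp_pos q.1
  have := hα q.1
  have := hα q.2.1
  calc |nfSym q| * (‖β q.1 q.2.1‖ * (‖w q.2.2‖ * ‖w (fourth q)‖)) ≤
      (jp q.1 * c q.2.2) * ((α q.1 * α q.2.1) * (‖w q.2.2‖ * ‖w (fourth q)‖)) := by gcongr
    _ = (Real.sqrt ε⁻¹ * Real.sqrt ε) * ((jp q.1 * c q.2.2) *
      ((α q.1 * α q.2.1) * (‖w q.2.2‖ * ‖w (fourth q)‖))) := by rw [e, one_mul]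
    _ = _ := by ring

lemma w_le_sqrt (h : StabData α γ w gw β B D κ l K y) (n : ℤ) : ‖w n‖ ≤ Real.sqrt y :=
  Real.le_sqrt_of_sq_le (h.w_bdd.apply_le n)

lemma gw_le_sqrt (h : StabData α γ w gw β B D κ l K y) (n : ℤ) :
    ‖gw n‖ ≤ (|κ| * (8 * K ^ 2 * jp n ^ 2) + |l| * K) * Real.sqrt y := by
  have h1 := norm_T3_le_sqrt h.maj h.β_le h.w_bdd n
  have h2 : ‖conv D w n‖ ≤ Real.sqrt y * K := by
    refine norm_conv_le ((h.D_W1.l1.const_mul (Real.sqrt_nonneg y)).mono (fun m => by positivity)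
      fun m => ?_)
    rw [mul_comm]
    exact mul_le_mul_of_nonneg_right (h.w_le_sqrt _) (norm_nonneg _)
  rw [h.gw_eq]
  refine (norm_sub_le _ _).trans ?_
  rw [norm_mul, norm_mul, Complex.norm_real, Complex.norm_real, Real.norm_eq_abs, Real.norm_eq_abs]
  calc _ ≤ |κ| * (8 * K ^ 2 * jp n ^ 2 * Real.sqrt y) + |l| * (Real.sqrt y * K) := by gcongr
    _ = _ := by ring

lemma dMass_le (h : StabData α γ w gw β B D κ l K y) (n : ℤ) :
    ‖dMass gw w n‖ ≤ 2 * |(n : ℝ)| * (|κ| * (8 * K ^ 2 * jp n ^ 2) + |l| * K) * y := by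
  have h1 := h.gw_le_sqrt n
  have h2 := h.gw_le_sqrt (-n)
  have h3 := h.w_le_sqrt n
  have h4 := h.w_le_sqrt (-n)
  rw [jp_neg] at h2
  have hK := h.maj.pos.le
  have e := Real.mul_self_sqrt h.w_bdd.bound_nonneg
  have h0 := jp_pos n
  refine (norm_add_le _ _).trans ?_
  simp only [norm_mul, Complex.norm_I, norm_intCast_eq, one_mul]
  push_cast
  rw [abs_neg]
  calc _ ≤ |(n : ℝ)| * ((|κ| * (8 * K ^ 2 * jp n ^ 2) + |l| * K) * Real.sqrt y) * Real.sqrt y +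
        Real.sqrt y * (|(n : ℝ)| * ((|κ| * (8 * K ^ 2 * jp n ^ 2) + |l| * K) * Real.sqrt y)) := by
        gcongr
    _ = 2 * |(n : ℝ)| * (|κ| * (8 * K ^ 2 * jp n ^ 2) + |l| * K) *
      (Real.sqrt y * Real.sqrt y) := by ring
    _ = _ := by rw [e]

lemma mul_neg_eq {w : ℤ → ℂ} (hw : IsRealCoeff w) (n : ℤ) : w n * w (-n) = ((‖w n‖ ^ 2 : ℝ) : ℂ) := by
  rw [← hw n, Complex.mul_conj, Complex.normSq_eq_norm_sq]

end StabData

/-- Coercivity and growth of the modified energy, with constants depending only on the size `K`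
of the solutions. -/
theorem exists_modEnergy_bounds (κ l K : ℝ) : ∃ (M : ℕ) (Λ A : ℝ), 0 ≤ A ∧
    ∀ (α γ : ℤ → ℝ) (w gw : ℤ → ℂ) (β B : ℤ → ℤ → ℂ) (D : ℤ → ℂ) (y : ℝ),
      StabData α γ w gw β B D κ l K y → IsRealCoeff w → ∑' n, ‖w n‖ ^ 2 = y →
      ‖∑' q, resTerm β w q‖ ≤ 80 * K ^ 2 * y →
      Summable (nfTerm β w) ∧
      y ≤ 2 * ‖modEnergy κ Λ M β w‖ ∧ ‖modEnergy κ Λ M β w‖ ≤ A * y ∧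
        ‖modFlux κ Λ M β B gw w‖ ≤ A * y := by
  set ε : ℝ := (2 * (|κ| * K ^ 2 + 1))⁻¹ with hεdef
  have hε : 0 < ε := by positivity
  obtain ⟨M, hM⟩ := exists_nat_ge ε⁻¹
  have hM' : 1 ≤ ε * M := by
    have := mul_le_mul_of_nonneg_left hM hε.le
    rwa [mul_inv_cancel₀ hε.ne'] at this
  set Λ : ℝ := 2 * |κ| / 5 * (K * (K * ε⁻¹)) with hΛ
  have hΛ0 : 0 ≤ Λ := by rw [hΛ, ← mul_assoc K]; have := mul_self_nonneg K; positivity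
  have hsmall : 2 * |κ| / 5 * (K * (K * (2 * ε))) ≤ 1 / 2 := by
    have : ε * (2 * (|κ| * K ^ 2 + 1)) = 1 := inv_mul_cancel₀ (by positivity)
    nlinarith [hε]
  set A₁ : ℝ := 1 + 2 * |κ| / 5 * (K * (K * (ε⁻¹ + 2 * ε))) + Λ
  set A₂ : ℝ := 2 * |l| * K + |κ| * (80 * K ^ 2) +
    2 * |κ| / 5 * (4 * (K * (4 * Jsum) + K * K) +
      2 * (|κ| * (80 * K ^ 4 + 1040 * (K ^ 3 * (4 * Jsum + K))) +
        |l| * (K * (K * (K * K)) + K * K))) +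
    Λ * ∑ n ∈ lowSet M, 2 * |(n : ℝ)| * (|κ| * (8 * K ^ 2 * jp n ^ 2) + |l| * K)
  refine ⟨M, Λ, |A₁| + |A₂|, by positivity, ?_⟩
  intro α γ w gw β B D y h hw hy hres
  have hy0 : 0 ≤ y := h.w_bdd.bound_nonneg
  have hK := h.maj.pos.le
  set yM := ∑ n ∈ lowSet M, ‖w n‖ ^ 2 with hyM
  have hyM0 : 0 ≤ yM := Finset.sum_nonneg fun _ _ => sq_nonneg _
  have hyMy : yM ≤ y := h.w_bdd.2 _
  have hnf := h.nfTerm_bdd hε hM'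
  have e1 : ∑' n, w n * w (-n) = ((y : ℝ) : ℂ) := by
    rw [← hy, Complex.ofReal_tsum]
    exact tsum_congr fun n => StabData.mul_neg_eq hw n
  have e2 : ∑ n ∈ lowSet M, w n * w (-n) = ((yM : ℝ) : ℂ) := by
    rw [hyM, Complex.ofReal_sum]
    exact Finset.sum_congr rfl fun n _ => StabData.mul_neg_eq hw n
  have hE : modEnergy κ Λ M β w = ((y + Λ * yM : ℝ) : ℂ) + 2 * κ / 5 * ∑' q, nfTerm β w q := by
    rw [modEnergy, e1, e2]; push_cast; ring
  have hκ : ‖(2 * κ / 5 : ℂ)‖ = 2 * |κ| / 5 := by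
    rw [norm_div, norm_mul, Complex.norm_real, Real.norm_eq_abs]; norm_num
  have hN : ‖(2 * κ / 5 : ℂ) * ∑' q, nfTerm β w q‖ ≤
      2 * |κ| / 5 * (K * (K * (ε⁻¹ * yM + 2 * ε * y))) := by
    rw [norm_mul, hκ]
    exact mul_le_mul_of_nonneg_left hnf.norm_tsum_le (by positivity)
  have hN2 : 2 * |κ| / 5 * (K * (K * (ε⁻¹ * yM + 2 * ε * y))) ≤ Λ * yM + 1 / 2 * y := by
    calc _ = Λ * yM + 2 * |κ| / 5 * (K * (K * (2 * ε))) * y := by rw [hΛ]; ring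
      _ ≤ _ := by gcongr
  have hΛy : 0 ≤ y + Λ * yM := by positivity
  have hnr : ‖((y + Λ * yM : ℝ) : ℂ)‖ = y + Λ * yM := by
    rw [Complex.norm_real, Real.norm_of_nonneg hΛy]
  refine ⟨hnf.summable_norm, ?_, ?_, ?_⟩
  · rw [hE]
    have := norm_sub_le_norm_add ((y + Λ * yM : ℝ) : ℂ) ((2 * κ / 5 : ℂ) * ∑' q, nfTerm β w q)
    rw [hnr] at this
    linarith
  · rw [hE]
    refine (norm_add_le _ _).trans ?_
    rw [hnr]
    have h2 : 2 * |κ| / 5 * (K * (K * (ε⁻¹ * yM + 2 * ε * y))) ≤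
        2 * |κ| / 5 * (K * (K * (ε⁻¹ * y + 2 * ε * y))) := by gcongr
    have h3 : Λ * yM ≤ Λ * y := by gcongr
    calc _ ≤ A₁ * y := by
          have : A₁ * y = y + 2 * |κ| / 5 * (K * (K * (ε⁻¹ * y + 2 * ε * y))) + Λ * y := by
            simp only [A₁]; ring
          linarith
      _ ≤ (|A₁| + |A₂|) * y := by
          gcongr
          linarith [le_abs_self A₁, abs_nonneg A₂]
  · have e3 : ∑' n, StabData.dMass gw w n + 2 * κ / 5 * ∑' q, nfLin β w q =
        κ * (I * ∑' q, resTerm β w q) -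
          2 * I * (l * ∑' n : ℤ, (n : ℂ) * conv D w n * w (-n)) := by
      rw [h.tsum_dMass, h.tsum_flux, ← h.cubic_cancel, ← h.tsum_cubic.2]
      ring
    have e4 : modFlux κ Λ M β B gw w = κ * (I * ∑' q, resTerm β w q) -
          2 * I * (l * ∑' n : ℤ, (n : ℂ) * conv D w n * w (-n)) +
        2 * κ / 5 * (∑' q, nfCoeff B w q + ∑' q, nfDiff β gw w q) +
        Λ * ∑ n ∈ lowSet M, StabData.dMass gw w n := by
      rw [← e3, modFlux]; ring
    have b1 : ‖(κ : ℂ) * (I * ∑' q, resTerm β w q)‖ ≤ |κ| * (80 * K ^ 2 * y) := by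
      rw [norm_mul, norm_mul, Complex.norm_real, Complex.norm_I, one_mul, Real.norm_eq_abs]
      gcongr
    have b2 : ‖2 * I * (l * ∑' n : ℤ, (n : ℂ) * conv D w n * w (-n))‖ ≤ 2 * (|l| * (K * y)) := by
      rw [norm_mul, norm_mul, norm_mul, Complex.norm_real, Complex.norm_I, Complex.norm_two,
        mul_one, Real.norm_eq_abs]
      have := h.tsum_quintic.2
      gcongr
    have b3 : ‖(2 * κ / 5 : ℂ) * (∑' q, nfCoeff B w q + ∑' q, nfDiff β gw w q)‖ ≤
        2 * |κ| / 5 * (4 * (K * (4 * Jsum * y) + K * (K * y)) +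
          2 * (|κ| * ((80 * K ^ 4 + 1040 * (K ^ 3 * (4 * Jsum + K))) * y) +
            |l| * (K * (K * (K * (K * y))) + K * (K * y)))) := by
      rw [norm_mul, hκ]
      refine mul_le_mul_of_nonneg_left ((norm_add_le _ _).trans ?_) (by positivity)
      exact add_le_add h.nfCoeff_bdd.norm_tsum_le h.norm_tsum_nfDiff_le
    have b4 : ‖(Λ : ℂ) * ∑ n ∈ lowSet M, StabData.dMass gw w n‖ ≤ Λ * ((∑ n ∈ lowSet M,
        2 * |(n : ℝ)| * (|κ| * (8 * K ^ 2 * jp n ^ 2) + |l| * K)) * y) := by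
      rw [norm_mul, Complex.norm_real, Real.norm_of_nonneg hΛ0, Finset.sum_mul]
      exact mul_le_mul_of_nonneg_left
        ((norm_sum_le _ _).trans (Finset.sum_le_sum fun n _ => h.dMass_le n)) hΛ0
    have b : ‖modFlux κ Λ M β B gw w‖ ≤ A₂ * y := by
      rw [e4]
      refine (norm_add_le _ _).trans ?_
      refine (add_le_add ((norm_add_le _ _).trans
        (add_le_add ((norm_sub_le _ _).trans (add_le_add b1 b2)) b3)) b4).trans (le_of_eq ?_)
      simp only [A₂]
      ring
    refine b.trans ?_
    gcongr
    linarith [le_abs_self A₂, abs_nonneg A₁]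

/-! ### The difference of two solutions. -/

lemma Q5_W1 {u : ℤ → ℂ} {A : ℝ} (hu : W1 u A) : W1 (Q5 u) (A ^ 5) :=
  (((hu.conv hu).conv (hu.conv hu)).conv hu).le (le_of_eq (by ring))

lemma W1.sq_bdd {f : ℤ → ℂ} {A : ℝ} (h : W1 f A) : BddSum (fun n => ‖f n‖ ^ 2) (A ^ 2) := by
  have := h.bound_nonneg
  refine ((h.l1.const_mul this).mono (fun n => sq_nonneg _) fun n => ?_).le (le_of_eq (sq A).symm)
  rw [sq]
  exact mul_le_mul_of_nonneg_right (h.l1.apply_le n) (norm_nonneg _)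

lemma Maj.G_sq_bdd {α : ℤ → ℝ} {K : ℝ} (h : Maj α K) {u : ℤ → ℂ} (hu : ∀ n, ‖u n‖ ≤ α n)
    (κ l : ℝ) :
    BddSum (fun n => ‖G κ l u n‖ ^ 2) (2 * κ ^ 2 * (144 * K ^ 5) + 2 * l ^ 2 * (K ^ 5) ^ 2) := by
  have hα := h.nonneg
  have b1 := (T3maj_bdd h).2.const_mul (c := 2 * κ ^ 2) (by positivity)
  have b2 := (Q5_W1 (h.W1 hu)).sq_bdd.const_mul (c := 2 * l ^ 2) (by positivity)
  refine (b1.add b2).mono (fun n => sq_nonneg _) fun n => ?_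
  have h1 := norm_T3_le h (β := fun a b => u a * u b) (w := u) (fun a b => by
    rw [norm_mul]; exact mul_le_mul (hu a) (hu b) (norm_nonneg _) (hα a)) hu n
  have h2 : ‖G κ l u n‖ ≤ |κ| * T3maj α n + |l| * ‖Q5 u n‖ := by
    rw [G]
    refine (norm_sub_le _ _).trans ?_
    rw [norm_mul, norm_mul, Complex.norm_real, Complex.norm_real, Real.norm_eq_abs,
      Real.norm_eq_abs]
    gcongr
  calc ‖G κ l u n‖ ^ 2 ≤ (|κ| * T3maj α n + |l| * ‖Q5 u n‖) ^ 2 := by gcongr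
    _ ≤ 2 * ((|κ| * T3maj α n) ^ 2 + (|l| * ‖Q5 u n‖) ^ 2) := by
      nlinarith [sq_nonneg (|κ| * T3maj α n - |l| * ‖Q5 u n‖)]
    _ = _ := by rw [mul_pow, mul_pow, sq_abs, sq_abs]; ring

/-- Permutation of the last two frequencies of the cubic form. -/
def swapSnd (n : ℤ) : ℤ × ℤ ≃ ℤ × ℤ where
  toFun p := (p.1, n - p.1 - p.2)
  invFun p := (p.1, n - p.1 - p.2)
  left_inv p := by ext <;> simp
  right_inv p := by ext <;> simp

/-- Permutation of the outer two frequencies of the cubic form. -/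
def swapFst (n : ℤ) : ℤ × ℤ ≃ ℤ × ℤ where
  toFun p := (n - p.1 - p.2, p.2)
  invFun p := (n - p.1 - p.2, p.2)
  left_inv p := by ext <;> simp; ring
  right_inv p := by ext <;> simp; ring

lemma T3_swapSnd (f g h : ℤ → ℂ) (n : ℤ) :
    T3 (fun a b => f a * g b) h n = T3 (fun a b => f a * h b) g n := by
  unfold T3
  rw [← (swapSnd n).tsum_eq]
  refine tsum_congr fun p => ?_
  simp only [swapSnd, Equiv.coe_fn_mk, sym3]
  rw [show n - p.1 - (n - p.1 - p.2) = p.2 by ring]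
  push_cast
  ring

lemma T3_swapFst (f g h : ℤ → ℂ) (n : ℤ) :
    T3 (fun a b => f a * g b) h n = T3 (fun a b => h a * g b) f n := by
  unfold T3
  rw [← (swapFst n).tsum_eq]
  refine tsum_congr fun p => ?_
  simp only [swapFst, Equiv.coe_fn_mk, sym3]
  rw [show n - (n - p.1 - p.2) - p.2 = p.1 by ring]
  push_cast
  ring

lemma Maj.T3_sub {α : ℤ → ℝ} {K : ℝ} (h : Maj α K) {u v : ℤ → ℂ} (hu : ∀ n, ‖u n‖ ≤ α n)
    (hv : ∀ n, ‖v n‖ ≤ α n) (n : ℤ) :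
    T3 (fun a b => u a * u b) u n - T3 (fun a b => v a * v b) v n =
      T3 (tens u v) (fun m => u m - v m) n := by
  have hα := h.nonneg
  have hs : ∀ {f g k : ℤ → ℂ}, (∀ n, ‖f n‖ ≤ α n) → (∀ n, ‖g n‖ ≤ α n) → (∀ n, ‖k n‖ ≤ α n) →
      Summable fun p : ℤ × ℤ => ((sym3 n p.1 p.2 : ℝ) : ℂ) * (f p.1 * g p.2 * k (n - p.1 - p.2)) :=
    fun {f g k} hf hg hk => (T3_fiber h (β := fun a b => f a * g b) (fun a b => by
      rw [norm_mul]; exact mul_le_mul (hf a) (hg b) (norm_nonneg _) (hα a)) hk n).summable_norm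
  have e1 := T3_swapSnd u v u n
  have e2 := T3_swapFst v v u n
  have e : T3 (tens u v) (fun m => u m - v m) n =
      T3 (fun a b => u a * u b) u n + T3 (fun a b => u a * v b) u n +
      T3 (fun a b => v a * v b) u n - T3 (fun a b => u a * u b) v n -
      T3 (fun a b => u a * v b) v n - T3 (fun a b => v a * v b) v n := by
    simp only [T3]
    rw [← (hs hu hu hu).tsum_add (hs hu hv hu),
      ← ((hs hu hu hu).add (hs hu hv hu)).tsum_add (hs hv hv hu),
      ← (((hs hu hu hu).add (hs hu hv hu)).add (hs hv hv hu)).tsum_sub (hs hu hu hv),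
      ← ((((hs hu hu hu).add (hs hu hv hu)).add (hs hv hv hu)).sub (hs hu hu hv)).tsum_sub
        (hs hu hv hv),
      ← (((((hs hu hu hu).add (hs hu hv hu)).add (hs hv hv hu)).sub (hs hu hu hv)).sub
        (hs hu hv hv)).tsum_sub (hs hv hv hv)]
    refine tsum_congr fun p => ?_
    simp only [tens]
    ring
  rw [e, e1, e2]
  ring

/-- The nonlinear part of the derivative of `tens u v` along two solutions. -/
def tensFlux (κ l : ℝ) (u v : ℤ → ℂ) (a b : ℤ) : ℂ :=
  (I * a * G κ l u a * u b + u a * (I * b * G κ l u b)) +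
    (I * a * G κ l u a * v b + u a * (I * b * G κ l v b)) +
    (I * a * G κ l v a * v b + v a * (I * b * G κ l v b))

lemma norm_tens_le (u v : ℤ → ℂ) (a b : ℤ) :
    ‖tens u v a b‖ ≤ (‖u a‖ + ‖v a‖) * (‖u b‖ + ‖v b‖) := by
  refine norm_add₃_le.trans ?_
  simp only [norm_mul]
  have := mul_nonneg (norm_nonneg (v a)) (norm_nonneg (u b))
  nlinarith

lemma norm_tensFlux_le (κ l : ℝ) (u v : ℤ → ℂ) (a b : ℤ) : ‖tensFlux κ l u v a b‖ ≤
    |(a : ℝ)| * (‖G κ l u a‖ + ‖G κ l v a‖) * (‖u b‖ + ‖v b‖) +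
      |(b : ℝ)| * (‖u a‖ + ‖v a‖) * (‖G κ l u b‖ + ‖G κ l v b‖) := by
  refine norm_add₃_le.trans ((add_le_add (add_le_add (norm_add_le _ _) (norm_add_le _ _))
    (norm_add_le _ _)).trans ?_)
  simp only [norm_mul, Complex.norm_I, norm_intCast_eq, one_mul]
  have h1 : 0 ≤ |(a : ℝ)| * ‖G κ l v a‖ * ‖u b‖ := by positivity
  have h2 : 0 ≤ |(b : ℝ)| * ‖v a‖ * ‖G κ l u b‖ := by positivity
  linarith

/-- The size constant of the stability estimate in the ball of radius `√R` of `H²`. -/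
def stabConst (κ l R : ℝ) : ℝ :=
  HBall.const (4 * R) + 5 * HBall.const (4 * R) ^ 4 +
    4 * (2 * κ ^ 2 * (144 * HBall.const (4 * R) ^ 5) + 2 * l ^ 2 * (HBall.const (4 * R) ^ 5) ^ 2)

lemma stabData_sub {κ l R : ℝ} {u v : ℤ → ℂ} (hu : HBall R u) (hv : HBall R v) :
    StabData (fun n => ‖u n‖ + ‖v n‖) (fun n => ‖G κ l u n‖ + ‖G κ l v n‖) (fun n => u n - v n)
      (fun n => G κ l u n - G κ l v n) (tens u v) (tensFlux κ l u v) (D5 u v) κ l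
      (stabConst κ l R) (∑' n, ‖u n - v n‖ ^ 2) := by
  have hm := hu.maj_add hv
  have hu' : ∀ n, ‖u n‖ ≤ ‖u n‖ + ‖v n‖ := fun n => le_add_of_nonneg_right (norm_nonneg _)
  have hv' : ∀ n, ‖v n‖ ≤ ‖u n‖ + ‖v n‖ := fun n => le_add_of_nonneg_left (norm_nonneg _)
  have hw' : ∀ n, ‖u n - v n‖ ≤ ‖u n‖ + ‖v n‖ := fun n => norm_sub_le _ _
  have hpos := hm.pos
  set C := HBall.const (4 * R)
  have hC1 : C ≤ stabConst κ l R := by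
    rw [stabConst, add_assoc]; exact le_add_of_nonneg_right (by positivity)
  have hG : (0 : ℝ) ≤ 2 * κ ^ 2 * (144 * C ^ 5) + 2 * l ^ 2 * (C ^ 5) ^ 2 := by positivity
  refine ⟨hm.le hC1, fun n => by positivity, ?_, norm_tens_le u v, norm_tensFlux_le κ l u v, hw',
    fun n => norm_sub_le _ _, ?_, ?_, fun n => ?_⟩
  · refine (((hm.G_sq_bdd hu' κ l).add (hm.G_sq_bdd hv' κ l)).const_mul
      (c := 2) (by norm_num)).mono (fun n => sq_nonneg _) (fun n => ?_) |>.le ?_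
    · nlinarith [sq_nonneg (‖G κ l u n‖ - ‖G κ l v n‖)]
    · have : 0 ≤ C + 5 * C ^ 4 := by positivity
      rw [stabConst]
      linarith
  · refine BddSum.of_summable (fun n => sq_nonneg _) ?_ le_rfl
    exact (hm.l2z.mono (fun n => sq_nonneg _)
      fun n => pow_le_pow_left₀ (norm_nonneg _) (hw' n) 2).summable
  · refine (D5_W1 (hm.W1 hu') (hm.W1 hv')).le ?_
    rw [stabConst]
    linarith
  · have h5 := Q5_sub (hm.W1 hu') (hm.W1 hv') ((hm.W1 hw').le (by linarith)) n
    have h3 := hm.T3_sub hu' hv' n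
    rw [G, G, ← h5, ← h3]
    ring

lemma HBall.summable_sq {R : ℝ} {a : ℤ → ℂ} (h : HBall R a) : Summable fun n => ‖a n‖ ^ 2 :=
  h.maj.l2z.summable

/-- If two real sequences have equal mass, the zeroth moments against their difference are
controlled by the mass of the difference. -/
lemma norm_moment_zero_le {R : ℝ} {u v : ℤ → ℂ} (hu : HBall R u) (hv : HBall R v)
    (hur : IsRealCoeff u) (hvr : IsRealCoeff v) (hm : mass u = mass v) :
    ‖moment 0 u (fun n => u n - v n)‖ ≤ ∑' n, ‖u n - v n‖ ^ 2 ∧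
      ‖moment 0 v (fun n => u n - v n)‖ ≤ ∑' n, ‖u n - v n‖ ^ 2 := by
  have hwr : IsRealCoeff fun n => u n - v n := fun n => by
    simp only [map_sub]; rw [hur, hvr]
  have hM := hu.maj_add hv
  have hs : ∀ {f g : ℤ → ℂ}, (∀ n, ‖f n‖ ≤ ‖u n‖ + ‖v n‖) → (∀ n, ‖g n‖ ≤ ‖u n‖ + ‖v n‖) →
      Summable fun n => f n * g (-n) := fun {f g} hf hg => by
    simpa using (moment_bdd hM hf hg (Nat.zero_le 3)).summable_norm
  have hu' : ∀ n, ‖u n‖ ≤ ‖u n‖ + ‖v n‖ := fun n => le_add_of_nonneg_right (norm_nonneg _)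
  have hv' : ∀ n, ‖v n‖ ≤ ‖u n‖ + ‖v n‖ := fun n => le_add_of_nonneg_left (norm_nonneg _)
  have suu := hs hu' hu'
  have suv := hs hu' hv'
  have svu := hs hv' hu'
  have svv := hs hv' hv'
  have e1 : moment 0 u (fun n => u n - v n) = ∑' n, u n * u (-n) - ∑' n, u n * v (-n) := by
    rw [← suu.tsum_sub suv]
    exact tsum_congr fun n => by ring
  have e2 : moment 0 v (fun n => u n - v n) = ∑' n, v n * u (-n) - ∑' n, v n * v (-n) := by
    rw [← svu.tsum_sub svv]
    exact tsum_congr fun n => by ring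
  have e3 : ∑' n, v n * u (-n) = ∑' n, u n * v (-n) := by
    rw [← (Equiv.neg ℤ).tsum_eq]
    exact tsum_congr fun n => by simp [mul_comm]
  have em : ∀ {f : ℤ → ℂ}, IsRealCoeff f → ∑' n, f n * f (-n) = ((∑' n, ‖f n‖ ^ 2 : ℝ) : ℂ) :=
    fun {f} hf => by
      rw [Complex.ofReal_tsum]
      exact tsum_congr fun n => StabData.mul_neg_eq hf n
  have e4 : ∑' n, u n * u (-n) = ∑' n, v n * v (-n) := by
    rw [em hur, em hvr]; exact congrArg _ hm
  have e5 : (((∑' n, ‖u n - v n‖ ^ 2 : ℝ)) : ℂ) = 2 * ∑' n, u n * u (-n) -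
      2 * ∑' n, u n * v (-n) := by
    rw [← em hwr, show (2 : ℂ) * ∑' n, u n * u (-n) - 2 * ∑' n, u n * v (-n) =
      ∑' n, u n * u (-n) - ∑' n, u n * v (-n) - ∑' n, v n * u (-n) + ∑' n, v n * v (-n) by
        rw [e3, ← e4]; ring,
      ← suu.tsum_sub suv, ← (suu.sub suv).tsum_sub svu, ← ((suu.sub suv).sub svu).tsum_add svv]
    exact tsum_congr fun n => by ring
  set y := ∑' n, ‖u n - v n‖ ^ 2
  have hy : 0 ≤ y := tsum_nonneg fun n => sq_nonneg _
  have h1 : moment 0 u (fun n => u n - v n) = ((y / 2 : ℝ) : ℂ) := by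
    rw [e1]; push_cast; rw [e5]; ring
  have h2 : moment 0 v (fun n => u n - v n) = -((y / 2 : ℝ) : ℂ) := by
    rw [e2, e3, ← e4]; push_cast; rw [e5]; ring
  rw [h1, h2, norm_neg, Complex.norm_real, Real.norm_of_nonneg (by positivity)]
  exact ⟨by linarith, by linarith⟩

/-- The modified energy of the difference of two real sequences of equal mass is comparable with
the mass of the difference, and its flux is controlled by it. -/
theorem exists_modEnergy_sub_bounds (κ l R : ℝ) : ∃ (M : ℕ) (Λ A : ℝ), 0 ≤ A ∧
    ∀ u v : ℤ → ℂ, HBall R u → HBall R v → IsRealCoeff u → IsRealCoeff v → mass u = mass v →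
      ∑' n, ‖u n - v n‖ ^ 2 ≤ 2 * ‖modEnergy κ Λ M (tens u v) (fun n => u n - v n)‖ ∧
      ‖modEnergy κ Λ M (tens u v) (fun n => u n - v n)‖ ≤ A * ∑' n, ‖u n - v n‖ ^ 2 ∧
      ‖modFlux κ Λ M (tens u v) (tensFlux κ l u v) (fun n => G κ l u n - G κ l v n)
        (fun n => u n - v n)‖ ≤ A * ∑' n, ‖u n - v n‖ ^ 2 := by
  obtain ⟨M, Λ, A, hA, h⟩ := exists_modEnergy_bounds κ l (stabConst κ l R)
  refine ⟨M, Λ, A, hA, fun u v hu hv hur hvr hm => ?_⟩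
  have hd := stabData_sub (κ := κ) (l := l) hu hv
  have hmom := norm_moment_zero_le hu hv hur hvr hm
  have hwr : IsRealCoeff fun n => u n - v n := fun n => by
    simp only [map_sub]; rw [hur, hvr]
  exact (h _ _ _ _ _ _ _ _ hd hwr rfl (hd.norm_tsum_resTerm_le
    (fun n => le_add_of_nonneg_right (norm_nonneg _))
    (fun n => le_add_of_nonneg_left (norm_nonneg _)) hmom.1 hmom.2)).2

/-! ### Termwise differentiation of series and a Gronwall inequality. -/

/-- Fundamental theorem of calculus for a series differentiated term by term. -/
lemma tsum_sub_tsum_eq_integral {ι : Type*} [Countable ι] {f f' : ι → ℝ → ℂ} {a b C : ℝ}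
    (hab : a ≤ b)
    (hf : ∀ i, ∀ t ∈ Icc a b, HasDerivWithinAt (f i) (f' i t) (Icc a b) t)
    (hc : ∀ i, ContinuousOn (f' i) (Icc a b))
    (hb : ∀ t ∈ Icc a b, BddSum (fun i => ‖f' i t‖) C)
    (hsa : Summable fun i => f i a) (hsb : Summable fun i => f i b) :
    IntervalIntegrable (fun t => ∑' i, f' i t) volume a b ∧
      ∑' i, f i b - ∑' i, f i a = ∫ t in a..b, ∑' i, f' i t := by
  have hinteg : ∀ i, IntegrableOn (f' i) (Ioc a b) := fun i =>
    ((hc i).integrableOn_compact isCompact_Icc).mono_set Ioc_subset_Icc_self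
  have hftc : ∀ i, ∫ t in Ioc a b, f' i t = f i b - f i a := fun i => by
    rw [← intervalIntegral.integral_of_le hab]
    refine intervalIntegral.integral_eq_sub_of_hasDeriv_right_of_le hab
      (fun t ht => (hf i t ht).continuousWithinAt) (fun t ht => ?_)
      ((intervalIntegrable_iff_integrableOn_Ioc_of_le hab).2 (hinteg i))
    exact ((hf i t (Ioo_subset_Icc_self ht)).hasDerivAt (Icc_mem_nhds ht.1 ht.2)).hasDerivWithinAt
  have hsum : Summable fun i => ∫ t in Ioc a b, ‖f' i t‖ := by
    refine summable_of_sum_le (c := ∫ _ in Ioc a b, C) (fun i => integral_nonneg fun t => norm_nonneg _)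
      fun s => ?_
    rw [← integral_finsetSum s fun i _ => (hinteg i).norm]
    refine setIntegral_mono_on (integrable_finsetSum s fun i _ => (hinteg i).norm)
      (integrableOn_const (by simp)) measurableSet_Ioc fun t ht => ?_
    exact (hb t (Ioc_subset_Icc_self ht)).2 s
  refine ⟨?_, ?_⟩
  · rw [intervalIntegrable_iff_integrableOn_Ioc_of_le hab]
    refine Integrable.of_bound (C := C) ?_ ?_
    · refine aestronglyMeasurable_of_tendsto_ae (Filter.atTop : Filter (Finset ι))
        (f := fun s t => ∑ i ∈ s, f' i t)
        (fun s => (integrable_finsetSum s fun i _ => hinteg i).aestronglyMeasurable) ?_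
      filter_upwards [ae_restrict_mem measurableSet_Ioc] with t ht
      exact (hb t (Ioc_subset_Icc_self ht)).summable_norm.hasSum
    · filter_upwards [ae_restrict_mem measurableSet_Ioc] with t ht
      exact (hb t (Ioc_subset_Icc_self ht)).norm_tsum_le
  · rw [← hsb.tsum_sub hsa, intervalIntegral.integral_of_le hab,
      ← integral_tsum_of_summable_integral_norm hinteg hsum]
    exact tsum_congr fun i => (hftc i).symm

/-- Integral form of the Gronwall inequality. -/
lemma le_exp_of_le_integral {y : ℝ → ℝ} {L A c : ℝ} (hc : 0 ≤ c)
    (hy : ContinuousOn y (Icc 0 L)) (hy0 : ∀ t ∈ Icc 0 L, 0 ≤ y t) 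
    (h : ∀ t ∈ Icc 0 L, y t ≤ A + c * ∫ τ in (0 : ℝ)..t, y τ) :
    ∀ t ∈ Icc 0 L, y t ≤ A * Real.exp (c * t) := by
  intro t ht
  have hL : 0 ≤ L := ht.1.trans ht.2
  have hyi : ∀ s ∈ Icc 0 L, IntervalIntegrable y volume 0 s := fun s hs =>
    (hy.mono (by rw [uIcc_of_le hs.1]; exact Icc_subset_Icc_right hs.2)).intervalIntegrable
  set Y : ℝ → ℝ := fun t => ∫ τ in (0 : ℝ)..t, y τ with hY
  have hYc : ContinuousOn Y (Icc 0 L) := by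
    have := intervalIntegral.continuousOn_primitive_interval'
      (hyi L (right_mem_Icc.2 hL)) (left_mem_uIcc)
    rwa [uIcc_of_le hL] at this
  have hd : ∀ s ∈ Ico 0 L, HasDerivWithinAt Y (y s) (Ici s) s := fun s hs => by
    have hs' : s ∈ Icc 0 L := Ico_subset_Icc_self hs
    have hcs : ContinuousWithinAt y (Ioi s) s :=
      (hy s hs').mono_of_mem_nhdsWithin (Filter.mem_of_superset (Ioo_mem_nhdsGT hs.2)
        fun x hx => ⟨hs.1.trans hx.1.le, hx.2.le⟩)
    refine intervalIntegral.integral_hasDerivWithinAt_right (hyi s hs') (t := Ioi s) ?_ hcs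
    refine ⟨Ioo s L, Ioo_mem_nhdsGT hs.2, ?_⟩
    exact (hy.mono fun x hx => ⟨hs.1.trans hx.1.le, hx.2.le⟩).aestronglyMeasurable
      measurableSet_Ioo
  have hY0 : ∀ s ∈ Icc 0 L, 0 ≤ Y s := fun s hs =>
    intervalIntegral.integral_nonneg hs.1 fun τ hτ => hy0 τ ⟨hτ.1, hτ.2.trans hs.2⟩
  have hg := le_gronwallBound_of_liminf_deriv_right_le (f := Y) (f' := y) (δ := 0) (K := c)
    (ε := A) (a := 0) (b := L) hYc (fun s hs r hr =>
      (hd s hs).liminf_right_slope_le hr) (by simp [hY])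
    (fun s hs => by rw [add_comm]; exact h s (Ico_subset_Icc_self hs)) t ht
  have h1 := h t ht
  rw [sub_zero] at hg
  rcases eq_or_ne c 0 with rfl | hc0
  · simpa using h1
  · rw [gronwallBound_of_K_ne_0 hc0] at hg
    have h2 : c * Y t ≤ c * (0 * Real.exp (c * t) + A / c * (Real.exp (c * t) - 1)) :=
      mul_le_mul_of_nonneg_left hg hc
    have h3 : c * (0 * Real.exp (c * t) + A / c * (Real.exp (c * t) - 1)) =
      A * Real.exp (c * t) - A := by field_simp; ring
    linarith

/-- Two-sided Gronwall inequality. -/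
lemma le_exp_of_le_abs_integral {y : ℝ → ℝ} {a b s A c : ℝ} (hc : 0 ≤ c)
    (hy : ContinuousOn y (Icc a b)) (hy0 : ∀ t ∈ Icc a b, 0 ≤ y t) (hs : s ∈ Icc a b)
    (h : ∀ t ∈ Icc a b, y t ≤ A + c * |∫ τ in s..t, y τ|) :
    ∀ t ∈ Icc a b, y t ≤ A * Real.exp (c * |t - s|) := by
  intro t ht
  rcases le_total s t with hst | hst
  · have hm : ∀ τ ∈ Icc 0 (b - s), s + τ ∈ Icc a b := fun τ hτ =>
      ⟨by linarith [hs.1, hτ.1], by linarith [hτ.2]⟩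
    have := le_exp_of_le_integral (y := fun τ => y (s + τ)) (L := b - s) (A := A) hc
      (hy.comp (by fun_prop) hm) (fun τ hτ => hy0 _ (hm τ hτ)) (fun τ hτ => ?_) (t - s)
      ⟨by linarith, by linarith [ht.2]⟩
    · rw [abs_of_nonneg (by linarith)]
      simpa using this
    · rw [intervalIntegral.integral_comp_add_left (fun x => y x), add_zero]
      refine (h _ (hm τ hτ)).trans (le_of_eq ?_)
      rw [abs_of_nonneg]
      exact intervalIntegral.integral_nonneg (by linarith [hτ.1])
        fun x hx => hy0 x ⟨hs.1.trans hx.1, hx.2.trans (hm τ hτ).2⟩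
  · have hm : ∀ τ ∈ Icc 0 (s - a), s - τ ∈ Icc a b := fun τ hτ =>
      ⟨by linarith [hτ.2], by linarith [hs.2, hτ.1]⟩
    have := le_exp_of_le_integral (y := fun τ => y (s - τ)) (L := s - a) (A := A) hc
      (hy.comp (by fun_prop) hm) (fun τ hτ => hy0 _ (hm τ hτ)) (fun τ hτ => ?_) (s - t)
      ⟨by linarith, by linarith [ht.1]⟩
    · rw [abs_of_nonpos (by linarith), neg_sub]
      simpa using this
    · rw [intervalIntegral.integral_comp_sub_left (fun x => y x), sub_zero]
      refine (h _ (hm τ hτ)).trans (le_of_eq ?_)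
      rw [intervalIntegral.integral_symm, abs_neg, abs_of_nonneg]
      exact intervalIntegral.integral_nonneg (by linarith [hτ.1])
        fun x hx => hy0 x ⟨(hm τ hτ).1.trans hx.1, hx.2.trans hs.2⟩

/-! ### Convolution powers and continuity of the nonlinear terms on balls of `H²`. -/

/-- The convolution power `u ∗ ⋯ ∗ u` with `k + 1` factors. -/
def cpow {𝕜 : Type*} [NormedRing 𝕜] (u : ℤ → 𝕜) : ℕ → ℤ → 𝕜
  | 0 => u
  | k + 1 => conv u (cpow u k)

/-- The coefficients of `-∂ₓ²u`. -/
def sqMul (u : ℤ → ℂ) (n : ℤ) : ℂ := (n : ℂ) ^ 2 * u n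

lemma W1.cpow {u : ℤ → ℂ} {A : ℝ} (h : W1 u A) : ∀ k, W1 (cpow u k) (A ^ (k + 1))
  | 0 => by simpa [MKdV5.cpow] using h
  | k + 1 => by rw [pow_succ']; exact h.conv (h.cpow k)

lemma Q5_eq_cpow {u : ℤ → ℂ} {A : ℝ} (h : W1 u A) : Q5 u = cpow u 4 := by
  have h2 := h.conv h
  have h3 := h.conv h2
  rw [Q5, conv_assoc h2 h2 h, conv_comm (conv u u) u, conv_assoc h h h3]
  simp only [cpow]

lemma tsum_mul_conv {f g k : ℤ → ℂ} {n : ℤ}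
    (h : Summable fun p : ℤ × ℤ => f p.1 * g p.2 * k (n - p.1 - p.2)) :
    ∑' p : ℤ × ℤ, f p.1 * g p.2 * k (n - p.1 - p.2) = conv f (conv g k) n := by
  rw [h.tsum_prod]
  refine tsum_congr fun m => ?_
  rw [conv, ← tsum_mul_left]
  exact tsum_congr fun j => by ring

/-- The cubic form as a combination of convolutions. -/
lemma Maj.T3_eq {α : ℤ → ℝ} {K : ℝ} (h : Maj α K) {u : ℤ → ℂ} (hu : ∀ n, ‖u n‖ ≤ α n) (n : ℤ) :
    T3 (fun a b => u a * u b) u n = (n : ℂ) ^ 2 * cpow u 2 n + 3 * conv (sqMul u) (cpow u 1) n := by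
  have hα := h.nonneg
  have hs := (T3maj_bdd h).1 n
  have hle : ∀ p : ℤ × ℤ, ‖u p.1 * u p.2 * u (n - p.1 - p.2)‖ ≤ α p.1 * α p.2 * α (n - p.1 - p.2) :=
    fun p => by
      rw [norm_mul, norm_mul]
      exact mul_le_mul (mul_le_mul (hu _) (hu _) (norm_nonneg _) (hα _)) (hu _) (norm_nonneg _)
        (mul_nonneg (hα _) (hα _))
  have key : ∀ c : ℤ × ℤ → ℤ, (∀ p : ℤ × ℤ, ((c p : ℤ) : ℝ) ^ 2 ≤ sym3 n p.1 p.2) →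
      Summable fun p : ℤ × ℤ => (c p : ℂ) ^ 2 * (u p.1 * u p.2 * u (n - p.1 - p.2)) := fun c hc =>
    (hs.of_norm_le fun p => by
      rw [norm_mul, norm_pow, norm_intCast_eq, sq_abs]
      exact mul_le_mul (hc p) (hle p) (norm_nonneg _) (sym3_nonneg _ _ _)).summable_norm
  have s0 := key (fun _ => n) fun p => by
    unfold sym3
    nlinarith [sq_nonneg (p.1 : ℝ), sq_nonneg (p.2 : ℝ), sq_nonneg ((n - p.1 - p.2 : ℤ) : ℝ)]
  have s1 := key (fun p => p.1) fun p => by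
    unfold sym3
    nlinarith [sq_nonneg (n : ℝ), sq_nonneg (p.2 : ℝ), sq_nonneg ((n - p.1 - p.2 : ℤ) : ℝ)]
  have s2 := key (fun p => p.2) fun p => by
    unfold sym3
    nlinarith [sq_nonneg (n : ℝ), sq_nonneg (p.1 : ℝ), sq_nonneg ((n - p.1 - p.2 : ℤ) : ℝ)]
  have s3 := key (fun p => n - p.1 - p.2) fun p => by
    unfold sym3
    nlinarith [sq_nonneg (n : ℝ), sq_nonneg (p.1 : ℝ), sq_nonneg (p.2 : ℝ)]
  have e0 : ∑' p : ℤ × ℤ, (n : ℂ) ^ 2 * (u p.1 * u p.2 * u (n - p.1 - p.2)) =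
      (n : ℂ) ^ 2 * cpow u 2 n := by
    rw [tsum_mul_left]
    rcases eq_or_ne n 0 with rfl | hn
    · simp
    · rw [tsum_mul_conv]
      · rfl
      · have hn' : ((n : ℂ) ^ 2) ≠ 0 := by simpa using hn
        exact (summable_mul_left_iff hn').1 s0
  have e1 : ∑' p : ℤ × ℤ, (p.1 : ℂ) ^ 2 * (u p.1 * u p.2 * u (n - p.1 - p.2)) =
      conv (sqMul u) (cpow u 1) n := by
    have : (fun p : ℤ × ℤ => (p.1 : ℂ) ^ 2 * (u p.1 * u p.2 * u (n - p.1 - p.2))) =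
        fun p => sqMul u p.1 * u p.2 * u (n - p.1 - p.2) := by
      funext p; simp only [sqMul]; ring
    rw [this] at s1 ⊢
    rw [tsum_mul_conv s1]
    rfl
  have e2 : ∑' p : ℤ × ℤ, (p.2 : ℂ) ^ 2 * (u p.1 * u p.2 * u (n - p.1 - p.2)) =
      ∑' p : ℤ × ℤ, (p.1 : ℂ) ^ 2 * (u p.1 * u p.2 * u (n - p.1 - p.2)) := by
    rw [← (Equiv.prodComm ℤ ℤ).tsum_eq]
    refine tsum_congr fun p => ?_
    simp only [Equiv.prodComm_apply, Prod.fst_swap, Prod.snd_swap]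
    rw [show n - p.2 - p.1 = n - p.1 - p.2 by ring]
    ring
  have e3 : ∑' p : ℤ × ℤ, ((n - p.1 - p.2 : ℤ) : ℂ) ^ 2 * (u p.1 * u p.2 * u (n - p.1 - p.2)) =
      ∑' p : ℤ × ℤ, (p.1 : ℂ) ^ 2 * (u p.1 * u p.2 * u (n - p.1 - p.2)) := by
    rw [← (swapFst n).tsum_eq]
    refine tsum_congr fun p => ?_
    simp only [swapFst, Equiv.coe_fn_mk]
    rw [show n - (n - p.1 - p.2) - p.2 = p.1 by ring]
    ring
  have e : T3 (fun a b => u a * u b) u n =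
      ∑' p : ℤ × ℤ, (n : ℂ) ^ 2 * (u p.1 * u p.2 * u (n - p.1 - p.2)) +
      ∑' p : ℤ × ℤ, (p.1 : ℂ) ^ 2 * (u p.1 * u p.2 * u (n - p.1 - p.2)) +
      ∑' p : ℤ × ℤ, (p.2 : ℂ) ^ 2 * (u p.1 * u p.2 * u (n - p.1 - p.2)) +
      ∑' p : ℤ × ℤ, ((n - p.1 - p.2 : ℤ) : ℂ) ^ 2 * (u p.1 * u p.2 * u (n - p.1 - p.2)) := by
    rw [← s0.tsum_add s1, ← (s0.add s1).tsum_add s2, ← ((s0.add s1).add s2).tsum_add s3]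
    refine tsum_congr fun p => ?_
    simp only [sym3]
    push_cast
    ring
  rw [e, e3, e2, e1, e0]
  ring

/-- The potential part of the Hamiltonian. -/
def potential (κ l : ℝ) (u : ℤ → ℂ) : ℂ :=
  κ * conv (sqMul u) (cpow u 2) 0 - l / 6 * cpow u 5 0

/-- The majorant `2√R ⟨n⟩⁻²` of the ball. -/
def ballMaj (R : ℝ) (n : ℤ) : ℝ := 2 * Real.sqrt R * (jp n ^ 2)⁻¹

lemma ballMaj_bdd (R : ℝ) : BddSum (ballMaj R) (2 * Real.sqrt R * Jsum) :=
  bddSum_jp.const_mul (by positivity)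

lemma cpow_ballMaj_bdd (R : ℝ) : ∀ k, BddSum (cpow (ballMaj R) k) ((2 * Real.sqrt R * Jsum) ^ (k + 1))
  | 0 => by simpa [cpow] using ballMaj_bdd R
  | k + 1 => by rw [pow_succ']; exact conv_bdd (ballMaj_bdd R) (cpow_ballMaj_bdd R k)

lemma norm_sqMul_le {R : ℝ} {a : ℤ → ℂ} (h : HBall R a) (n : ℤ) : ‖sqMul a n‖ ≤ 2 * Real.sqrt R := by
  have h1 := h.apply_le n
  have h2 := sq_le_jp_sq n
  have h3 : 0 < jp n ^ 2 := pow_pos (jp_pos n) 2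
  rw [sqMul, norm_mul, norm_pow, norm_intCast_eq, sq_abs]
  calc (n : ℝ) ^ 2 * ‖a n‖ ≤ jp n ^ 2 * (2 * Real.sqrt R * (jp n ^ 2)⁻¹) :=
        mul_le_mul h2 h1 (norm_nonneg _) h3.le
    _ = 2 * Real.sqrt R := by rw [mul_comm, mul_assoc, inv_mul_cancel₀ h3.ne', mul_one]

section
open Filter Topology
variable {ι : Type*} {𝓕 : Filter ι}

lemma tendsto_conv {f g : ι → ℤ → ℂ} {f' g' : ℤ → ℂ} {α β : ℤ → ℝ} {n : ℤ}
    (hs : Summable fun m => α m * β (n - m))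
    (hf : ∀ᶠ k in 𝓕, ∀ m, ‖f k m‖ ≤ α m) (hg : ∀ᶠ k in 𝓕, ∀ m, ‖g k m‖ ≤ β m)
    (hf' : ∀ m, Tendsto (fun k => f k m) 𝓕 (𝓝 (f' m)))
    (hg' : ∀ m, Tendsto (fun k => g k m) 𝓕 (𝓝 (g' m))) :
    Tendsto (fun k => conv (f k) (g k) n) 𝓕 (𝓝 (conv f' g' n)) := by
  refine tendsto_tsum_of_dominated_convergence hs (fun m => (hf' m).mul (hg' (n - m))) ?_
  filter_upwards [hf, hg] with k h1 h2 m
  rw [norm_mul]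
  exact mul_le_mul (h1 m) (h2 _) (norm_nonneg _) ((norm_nonneg _).trans (h1 m))

variable {a : ι → ℤ → ℂ} {b : ℤ → ℂ} {R : ℝ}

lemma norm_cpow_le {R : ℝ} {a : ℤ → ℂ} (h : HBall R a) : ∀ k n, ‖cpow a k n‖ ≤ cpow (ballMaj R) k n
  | 0, n => h.apply_le n
  | k + 1, n => norm_conv_le ((conv_fiber_bdd (ballMaj_bdd R) (cpow_ballMaj_bdd R k) n).mono
      (fun m => by positivity) fun m => mul_le_mul (h.apply_le m) (norm_cpow_le h k (n - m))
        (norm_nonneg _) ((ballMaj_bdd R).1 m))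

lemma HBall.of_tendsto [𝓕.NeBot] (hR : ∀ᶠ k in 𝓕, HBall R (a k))
    (ht : ∀ n, Tendsto (fun k => a k n) 𝓕 (𝓝 (b n))) : HBall R b := by
  refine ⟨fun n => by positivity, fun s => ?_⟩
  refine le_of_tendsto (tendsto_finsetSum s fun n _ => ((ht n).norm.pow 2).const_mul _) ?_
  filter_upwards [hR] with k hk
  exact hk.2 s

lemma tendsto_cpow (hR : ∀ᶠ k in 𝓕, HBall R (a k))
    (ht : ∀ n, Tendsto (fun k => a k n) 𝓕 (𝓝 (b n))) :
    ∀ j n, Tendsto (fun k => cpow (a k) j n) 𝓕 (𝓝 (cpow b j n))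
  | 0, n => ht n
  | j + 1, n => tendsto_conv (conv_fiber_bdd (ballMaj_bdd R) (cpow_ballMaj_bdd R j) n).summable
      (hR.mono fun _ h => h.apply_le) (hR.mono fun _ h => norm_cpow_le h j) ht
      (tendsto_cpow hR ht j)

lemma tendsto_conv_sqMul (hR : ∀ᶠ k in 𝓕, HBall R (a k))
    (ht : ∀ n, Tendsto (fun k => a k n) 𝓕 (𝓝 (b n))) (j : ℕ) (n : ℤ) :
    Tendsto (fun k => conv (sqMul (a k)) (cpow (a k) j) n) 𝓕 (𝓝 (conv (sqMul b) (cpow b j) n)) := by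
  refine tendsto_conv (α := fun _ => 2 * Real.sqrt R) (β := cpow (ballMaj R) j) ?_
    (hR.mono fun _ h => norm_sqMul_le h) (hR.mono fun _ h => norm_cpow_le h j)
    (fun m => (ht m).const_mul _) (tendsto_cpow hR ht j)
  exact ((cpow_ballMaj_bdd R j).comp_injective (e := fun m => n - m)
    sub_right_injective).summable.mul_left _

lemma tendsto_G [𝓕.NeBot] (κ l : ℝ) (hR : ∀ᶠ k in 𝓕, HBall R (a k))
    (ht : ∀ n, Tendsto (fun k => a k n) 𝓕 (𝓝 (b n))) (n : ℤ) :
    Tendsto (fun k => G κ l (a k) n) 𝓕 (𝓝 (G κ l b n)) := by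
  have hG : ∀ {c : ℤ → ℂ}, HBall R c → G κ l c n =
      κ * ((n : ℂ) ^ 2 * cpow c 2 n + 3 * conv (sqMul c) (cpow c 1) n) - l * cpow c 4 n := by
    intro c hc
    rw [G, hc.maj.T3_eq fun _ => le_rfl, Q5_eq_cpow (hc.maj.W1 fun _ => le_rfl)]
  rw [hG (HBall.of_tendsto hR ht)]
  refine Tendsto.congr' (hR.mono fun k hk => (hG hk).symm) ?_
  exact ((((tendsto_cpow hR ht 2 n).const_mul _).add
    ((tendsto_conv_sqMul hR ht 1 n).const_mul _)).const_mul _).sub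
    ((tendsto_cpow hR ht 4 n).const_mul _)

lemma tendsto_potential (κ l : ℝ) (hR : ∀ᶠ k in 𝓕, HBall R (a k))
    (ht : ∀ n, Tendsto (fun k => a k n) 𝓕 (𝓝 (b n))) :
    Tendsto (fun k => potential κ l (a k)) 𝓕 (𝓝 (potential κ l b)) :=
  ((tendsto_conv_sqMul hR ht 2 0).const_mul _).sub ((tendsto_cpow hR ht 5 0).const_mul _)

lemma ballMaj_sq_summable (R : ℝ) : Summable fun n => ballMaj R n ^ 2 := by
  have h := ballMaj_bdd R
  refine Summable.of_nonneg_of_le (fun n => sq_nonneg _) (fun n => ?_)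
    (h.summable.mul_left (2 * Real.sqrt R * Jsum))
  rw [sq]
  exact mul_le_mul_of_nonneg_right (h.apply_le n) (h.1 n)

lemma tendsto_tsum_sq (hR : ∀ᶠ k in 𝓕, HBall R (a k))
    (ht : ∀ n, Tendsto (fun k => a k n) 𝓕 (𝓝 (b n))) :
    Tendsto (fun k => ∑' n, ‖a k n‖ ^ 2) 𝓕 (𝓝 (∑' n, ‖b n‖ ^ 2)) := by
  refine tendsto_tsum_of_dominated_convergence (ballMaj_sq_summable R)
    (fun n => (ht n).norm.pow 2) ?_
  filter_upwards [hR] with k hk n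
  rw [norm_pow, norm_norm]
  exact pow_le_pow_left₀ (norm_nonneg _) (hk.apply_le n) 2
end

/-! ### Vanishing of the mass flux. -/

/-- The coefficients of `-i ∂ₓ f`. -/
def numMul (f : ℤ → ℂ) (n : ℤ) : ℂ := (n : ℂ) * f n

lemma W1.numMul {f : ℤ → ℂ} {A : ℝ} (h : W1 f A) : BddSum (fun n => ‖numMul f n‖) A :=
  BddSum.mono h (fun n => norm_nonneg _) fun n => by
    rw [MKdV5.numMul, norm_mul, norm_intCast_eq]
    exact mul_le_mul_of_nonneg_right (abs_le_jp n) (norm_nonneg _)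

lemma numMul_conv {f g : ℤ → ℂ} {A B : ℝ} (hf : W1 f A) (hg : W1 g B) :
    numMul (conv f g) = fun n => conv (numMul f) g n + conv f (numMul g) n := by
  funext n
  change (n : ℂ) * (∑' m, f m * g (n - m)) = _
  rw [← tsum_mul_left]
  refine Eq.trans ?_ ((conv_fiber_summable_of_bddSum hf.numMul hg.l1 n).tsum_add
    (conv_fiber_summable_of_bddSum hf.l1 hg.numMul n))
  refine tsum_congr fun m => ?_
  simp only [numMul]
  push_cast
  ring

lemma conv_numMul_conv {f g h : ℤ → ℂ} {A B C : ℝ} (hf : W1 f A) (hg : W1 g B) (hh : W1 h C) :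
    conv (numMul (conv f g)) h 0 = conv (numMul f) (conv g h) 0 + conv (numMul g) (conv f h) 0 := by
  have h1 := norm_conv_bdd hf.numMul hg.l1
  have h2 := norm_conv_bdd hf.l1 hg.numMul
  rw [← conv_assoc_of_bddSum hf.numMul hg.l1 hh.l1, ← conv_assoc_of_bddSum hg.numMul hf.l1 hh.l1,
    conv_comm (numMul g) f, numMul_conv hf hg]
  refine Eq.trans ?_ ((conv_fiber_summable_of_bddSum h1 hh.l1 0).tsum_add
    (conv_fiber_summable_of_bddSum h2 hh.l1 0))
  exact tsum_congr fun m => add_mul _ _ _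

lemma conv_numMul_antisymm (f g : ℤ → ℂ) : conv (numMul f) g 0 = -conv (numMul g) f 0 := by
  unfold conv
  rw [← tsum_neg, ← (Equiv.neg ℤ).tsum_eq]
  refine tsum_congr fun m => ?_
  simp only [Equiv.neg_apply, numMul, zero_sub, neg_neg]
  push_cast
  ring

lemma conv_cpow {u : ℤ → ℂ} {A : ℝ} (h : W1 u A) (j : ℕ) :
    ∀ k, conv (cpow u k) (cpow u j) = cpow u (k + j + 1)
  | 0 => by rw [Nat.zero_add]; rfl
  | k + 1 => by
    rw [show k + 1 + j + 1 = (k + j + 1) + 1 by ring]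
    simp only [cpow]
    rw [conv_assoc h (h.cpow k) (h.cpow j), conv_cpow h j k]
    rfl

lemma conv_numMul_cpow {u : ℤ → ℂ} {A : ℝ} (h : W1 u A) : ∀ k j : ℕ,
    conv (numMul (cpow u k)) (cpow u j) 0 = (k + 1) * conv (numMul u) (cpow u (k + j)) 0
  | 0, j => by simp [cpow]
  | k + 1, j => by
    have := conv_numMul_conv h (h.cpow k) (h.cpow j)
    have h2 := conv_numMul_cpow h k (j + 1)
    change conv (numMul (cpow u k)) (conv u (cpow u j)) 0 = _ at h2
    change conv (numMul (conv u (cpow u k))) (cpow u j) 0 = _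
    rw [this, h2, conv_cpow h j k, show k + 1 + j = k + j + 1 by ring, ← add_assoc]
    push_cast
    ring

lemma conv_numMul_cpow_self {u : ℤ → ℂ} {A : ℝ} (h : W1 u A) (k : ℕ) :
    conv (numMul (cpow u k)) u 0 = 0 := by
  have h1 := conv_numMul_cpow h k 0
  have h2 := conv_numMul_antisymm (cpow u k) u
  simp only [cpow, Nat.add_zero] at h1
  have h3 : ((k : ℂ) + 2) * conv (numMul (cpow u k)) u 0 = 0 := by linear_combination h1 + (k+1) * h2
  have h4 : (k : ℂ) + 2 ≠ 0 := by exact_mod_cast (by positivity : (k : ℝ) + 2 ≠ 0)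
  exact (mul_eq_zero.1 h3).resolve_left h4

/-- Exchange of the two pairs of frequencies. -/
def swapPairs : ℤ × ℤ × ℤ ≃ ℤ × ℤ × ℤ where
  toFun q := (q.2.2, fourth q, q.1)
  invFun q := (q.2.2, fourth q, q.1)
  left_inv q := by ext <;> simp [fourth]; ring
  right_inv q := by ext <;> simp [fourth]; ring

lemma hBall_zero : HBall 0 fun _ => 0 := ⟨fun n => by simp, fun s => by simp⟩

lemma conv_zero_right (f : ℤ → ℂ) : conv f (fun _ => 0) = fun _ => 0 := by
  funext n; simp [conv]

lemma G_zero (κ l : ℝ) (n : ℤ) : G κ l (fun _ => 0) n = 0 := by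
  simp [G, T3, Q5, conv_zero_right]

lemma stabData_self {κ l R : ℝ} {u : ℤ → ℂ} (hu : HBall R u) :
    StabData (fun n => ‖u n‖) (fun n => ‖G κ l u n‖) u (G κ l u) (fun a b => u a * u b)
      (tensFlux κ l u fun _ => 0) (conv (conv u u) (conv u u)) κ l (stabConst κ l R)
      (∑' n, ‖u n‖ ^ 2) := by
  have h := stabData_sub (κ := κ) (l := l) hu (hBall_zero.le hu.radius_nonneg)
  have e1 : tens u (fun _ => 0) = fun a b => u a * u b := by funext a b; simp [tens]
  have e2 : D5 u (fun _ => 0) = conv (conv u u) (conv u u) := by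
    funext n; simp [D5, conv_zero_right]
  simpa only [G_zero, sub_zero, norm_zero, add_zero, e1, e2] using h

/-- The mass flux of the equation vanishes. -/
lemma tsum_dMass_self {κ l R : ℝ} {u : ℤ → ℂ} (hu : HBall R u) :
    ∑' n, StabData.dMass (G κ l u) u n = 0 := by
  have h := stabData_self (κ := κ) (l := l) hu
  rw [h.tsum_dMass, h.tsum_flux]
  have e1 : ∑' n : ℤ, (n : ℂ) * T3 (fun a b => u a * u b) u n * u (-n) = 0 := by
    have e := h.tsum_cubic.2
    set F : ℤ × ℤ × ℤ → ℂ := fun q =>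
      ((q.1 + q.2.1 : ℤ) : ℂ) * ((sumSq q : ℝ) : ℂ) * quad (fun a b => u a * u b) u q
    have h2 : ∑' q, F q = -∑' q, F q := by
      conv_lhs => rw [← swapPairs.tsum_eq]
      rw [← tsum_neg]
      refine tsum_congr fun q => ?_
      have e4 : fourth (swapPairs q) = q.2.1 := by simp [fourth, swapPairs]; ring
      have e5 : sumSq (swapPairs q) = sumSq q := by
        rw [sumSq, e4]; simp only [swapPairs, Equiv.coe_fn_mk, sumSq]; ring
      simp only [F, e5, quad, e4]
      simp only [swapPairs, Equiv.coe_fn_mk]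
      rw [show q.2.2 + fourth q = -(q.1 + q.2.1) by unfold fourth; ring]
      push_cast
      ring
    have h3 : ∑' q, F q = 0 := by linear_combination h2 / 2
    rw [h3] at e
    simpa using e
  have hW := hu.maj.W1 fun n => le_rfl
  have e2 : ∑' n : ℤ, (n : ℂ) * conv (conv (conv u u) (conv u u)) u n * u (-n) = 0 := by
    have := conv_numMul_cpow_self hW 4
    rw [← Q5_eq_cpow hW] at this
    simpa only [conv, numMul, zero_sub, Q5] using this
  rw [e1, e2]
  ring

/-! ### Weak solutions. -/

/-- A family of coefficients in a ball of `H²` solving the equation coefficient by coefficient. -/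
structure WeakSol (κ l R : ℝ) (S : Set ℝ) (u : ℝ → ℤ → ℂ) : Prop where
  ball : ∀ t ∈ S, HBall R (u t)
  real : ∀ t ∈ S, IsRealCoeff (u t)
  deriv : ∀ t ∈ S, ∀ n : ℤ, HasDerivWithinAt (fun t => u t n)
    (I * (n : ℂ) ^ 5 * u t n + I * n * G κ l (u t) n) S t

namespace WeakSol
variable {κ l R : ℝ} {S : Set ℝ} {u v : ℝ → ℤ → ℂ}

lemma mono (h : WeakSol κ l R S u) {S' : Set ℝ} (hS : S' ⊆ S) : WeakSol κ l R S' u :=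
  ⟨fun t ht => h.ball t (hS ht), fun t ht => h.real t (hS ht),
    fun t ht n => (h.deriv t (hS ht) n).mono hS⟩

lemma le (h : WeakSol κ l R S u) {R' : ℝ} (hR : R ≤ R') : WeakSol κ l R' S u :=
  ⟨fun t ht => (h.ball t ht).le hR, h.real, h.deriv⟩

lemma continuousOn (h : WeakSol κ l R S u) (n : ℤ) : ContinuousOn (fun t => u t n) S :=
  fun t ht => (h.deriv t ht n).continuousWithinAt

lemma continuousOn_G (h : WeakSol κ l R S u) (n : ℤ) :
    ContinuousOn (fun t => G κ l (u t) n) S := fun t ht => by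
  have : (nhdsWithin t S).NeBot := nhdsWithin_neBot_of_mem ht
  exact tendsto_G (R := R) κ l (Filter.eventually_of_mem self_mem_nhdsWithin h.ball)
    (fun m => h.continuousOn m t ht) n

lemma continuousOn_l2 (hu : WeakSol κ l R S u) (hv : WeakSol κ l R S v) :
    ContinuousOn (fun t => ∑' n, ‖u t n - v t n‖ ^ 2) S := fun t ht =>
  tendsto_tsum_sq (R := 4 * R) (Filter.eventually_of_mem self_mem_nhdsWithin
    fun t ht => (hu.ball t ht).sub (hv.ball t ht))
    (fun m => (hu.continuousOn m t ht).sub (hv.continuousOn m t ht))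

lemma mass_eq_of_le {a b : ℝ} (h : WeakSol κ l R (Icc a b) u) (hab : a ≤ b) :
    mass (u b) = mass (u a) := by
  have hd : ∀ t ∈ Icc a b, StabData (fun n => ‖u t n‖) (fun n => ‖G κ l (u t) n‖) (u t)
      (G κ l (u t)) (fun a b => u t a * u t b) (tensFlux κ l (u t) fun _ => 0)
      (conv (conv (u t) (u t)) (conv (u t) (u t))) κ l (stabConst κ l R) (∑' n, ‖u t n‖ ^ 2) :=
    fun t ht => stabData_self (h.ball t ht)
  have hm : ∀ t ∈ Icc a b, (fun n => u t n * u t (-n)) = fun n => ((‖u t n‖ ^ 2 : ℝ) : ℂ) :=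
    fun t ht => funext fun n => StabData.mul_neg_eq (h.real t ht) n
  have hs : ∀ t ∈ Icc a b, Summable fun n => u t n * u t (-n) := fun t ht => by
    rw [hm t ht]
    exact_mod_cast (h.ball t ht).summable_sq
  have key := (tsum_sub_tsum_eq_integral (f := fun n t => u t n * u t (-n))
    (f' := fun n t => StabData.dMass (G κ l (u t)) (u t) n) (C := 4 * stabConst κ l R) hab
    (fun n t ht => ?_) (fun n => ?_) (fun t ht => (hd t ht).dMass_bdd)
    (hs a (left_mem_Icc.2 hab)) (hs b (right_mem_Icc.2 hab))).2
  · have h0 : ∫ t in a..b, ∑' n, StabData.dMass (G κ l (u t)) (u t) n = 0 := by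
      rw [intervalIntegral.integral_congr (g := fun _ => (0 : ℂ))]
      · simp
      · intro t ht
        rw [uIcc_of_le hab] at ht
        exact tsum_dMass_self (h.ball t ht)
    rw [h0, sub_eq_zero, hm a (left_mem_Icc.2 hab), hm b (right_mem_Icc.2 hab),
      ← Complex.ofReal_tsum, ← Complex.ofReal_tsum] at key
    exact Complex.ofReal_injective key
  · refine ((h.deriv t ht n).mul (h.deriv t ht (-n))).congr_deriv ?_
    simp only [StabData.dMass]
    push_cast
    ring
  · have h1 := h.continuousOn n
    have h2 := h.continuousOn (-n)
    have h3 := h.continuousOn_G n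
    have h4 := h.continuousOn_G (-n)
    unfold StabData.dMass
    fun_prop

/-- Conservation of mass. -/
lemma mass_eq {a b : ℝ} (h : WeakSol κ l R (Icc a b) u) {s t : ℝ} (hs : s ∈ Icc a b)
    (ht : t ∈ Icc a b) : mass (u t) = mass (u s) := by
  rcases le_total s t with hst | hst
  · exact (h.mono (Icc_subset_Icc hs.1 ht.2)).mass_eq_of_le hst
  · exact ((h.mono (Icc_subset_Icc ht.1 hs.2)).mass_eq_of_le hst).symm
end WeakSol

/-! ### Stability of weak solutions in `L²`. -/

namespace WeakSol
variable {κ l R : ℝ} {S : Set ℝ} {u v : ℝ → ℤ → ℂ}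

lemma hasDerivWithinAt_sub (hu : WeakSol κ l R S u) (hv : WeakSol κ l R S v) {t : ℝ} (ht : t ∈ S)
    (n : ℤ) : HasDerivWithinAt (fun t => u t n - v t n) (I * (n : ℂ) ^ 5 * (u t n - v t n) +
      I * n * (G κ l (u t) n - G κ l (v t) n)) S t :=
  ((hu.deriv t ht n).sub (hv.deriv t ht n)).congr_deriv (by ring)

lemma hasDerivWithinAt_dMass (hu : WeakSol κ l R S u) (hv : WeakSol κ l R S v) {t : ℝ}
    (ht : t ∈ S) (n : ℤ) :
    HasDerivWithinAt (fun t => (u t n - v t n) * (u t (-n) - v t (-n)))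
      (StabData.dMass (fun n => G κ l (u t) n - G κ l (v t) n) (fun n => u t n - v t n) n) S t := by
  refine ((hu.hasDerivWithinAt_sub hv ht n).mul
    (hu.hasDerivWithinAt_sub hv ht (-n))).congr_deriv ?_
  simp only [StabData.dMass]
  push_cast
  ring

lemma hasDerivWithinAt_tens (hu : WeakSol κ l R S u) (hv : WeakSol κ l R S v) {t : ℝ}
    (ht : t ∈ S) (a b : ℤ) :
    HasDerivWithinAt (fun t => tens (u t) (v t) a b)
      (I * ((a : ℂ) ^ 5 + (b : ℂ) ^ 5) * tens (u t) (v t) a b + tensFlux κ l (u t) (v t) a b)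
      S t := by
  refine ((((hu.deriv t ht a).mul (hu.deriv t ht b)).add
    ((hu.deriv t ht a).mul (hv.deriv t ht b))).add
    ((hv.deriv t ht a).mul (hv.deriv t ht b))).congr_deriv ?_
  simp only [tens, tensFlux]
  ring

lemma hasDerivWithinAt_nfTerm (hu : WeakSol κ l R S u) (hv : WeakSol κ l R S v) {t : ℝ}
    (ht : t ∈ S) (q : ℤ × ℤ × ℤ) :
    HasDerivWithinAt (fun t => nfTerm (tens (u t) (v t)) (fun n => u t n - v t n) q)
      (nfLin (tens (u t) (v t)) (fun n => u t n - v t n) q +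
        nfCoeff (tensFlux κ l (u t) (v t)) (fun n => u t n - v t n) q +
        nfDiff (tens (u t) (v t)) (fun n => G κ l (u t) n - G κ l (v t) n)
          (fun n => u t n - v t n) q) S t := by
  refine (((hu.hasDerivWithinAt_tens hv ht q.1 q.2.1).mul
    ((hu.hasDerivWithinAt_sub hv ht q.2.2).mul
      (hu.hasDerivWithinAt_sub hv ht (fourth q)))).const_mul (nfSym q : ℂ)).congr_deriv ?_
  simp only [nfLin, nfCoeff, nfDiff, quad, omega5, Pi.mul_apply]
  push_cast
  ring

lemma stabData (hu : WeakSol κ l R S u) (hv : WeakSol κ l R S v) {t : ℝ} (ht : t ∈ S) :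
    StabData (fun n => ‖u t n‖ + ‖v t n‖) (fun n => ‖G κ l (u t) n‖ + ‖G κ l (v t) n‖)
      (fun n => u t n - v t n) (fun n => G κ l (u t) n - G κ l (v t) n) (tens (u t) (v t))
      (tensFlux κ l (u t) (v t)) (D5 (u t) (v t)) κ l (stabConst κ l R)
      (∑' n, ‖u t n - v t n‖ ^ 2) := stabData_sub (hu.ball t ht) (hv.ball t ht)

lemma l2_le (hu : WeakSol κ l R S u) (hv : WeakSol κ l R S v) {t : ℝ} (ht : t ∈ S) :
    ∑' n, ‖u t n - v t n‖ ^ 2 ≤ stabConst κ l R :=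
  ((hu.stabData hv ht).maj.l2z.mono (fun _ => sq_nonneg _)
    fun _ => pow_le_pow_left₀ (norm_nonneg _) ((hu.stabData hv ht).w_le _) 2).tsum_le

lemma continuousOn_dMass (hu : WeakSol κ l R S u) (hv : WeakSol κ l R S v) (n : ℤ) :
    ContinuousOn (fun t => StabData.dMass
      (fun n => G κ l (u t) n - G κ l (v t) n) (fun n => u t n - v t n) n) S := by
  unfold StabData.dMass
  have := hu.continuousOn n; have := hu.continuousOn (-n)
  have := hv.continuousOn n; have := hv.continuousOn (-n)
  have := hu.continuousOn_G n; have := hu.continuousOn_G (-n)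
  have := hv.continuousOn_G n; have := hv.continuousOn_G (-n)
  fun_prop

/-- The time derivative of a term of the normal form correction. -/
def nfDeriv (κ l : ℝ) (u v : ℤ → ℂ) (q : ℤ × ℤ × ℤ) : ℂ :=
  nfLin (tens u v) (fun n => u n - v n) q +
    nfCoeff (tensFlux κ l u v) (fun n => u n - v n) q +
    nfDiff (tens u v) (fun n => G κ l u n - G κ l v n) (fun n => u n - v n) q

lemma continuousOn_tensFlux (hu : WeakSol κ l R S u) (hv : WeakSol κ l R S v) (a b : ℤ) :
    ContinuousOn (fun t => tensFlux κ l (u t) (v t) a b) S := by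
  have := hu.continuousOn a; have := hu.continuousOn b
  have := hv.continuousOn a; have := hv.continuousOn b
  have := hu.continuousOn_G a; have := hu.continuousOn_G b
  have := hv.continuousOn_G a; have := hv.continuousOn_G b
  unfold tensFlux
  fun_prop

lemma continuousOn_nfDeriv (hu : WeakSol κ l R S u) (hv : WeakSol κ l R S v) (q : ℤ × ℤ × ℤ) :
    ContinuousOn (fun t => nfDeriv κ l (u t) (v t) q) S := by
  have ct : ContinuousOn (fun t => tens (u t) (v t) q.1 q.2.1) S := fun t ht =>
    (hu.hasDerivWithinAt_tens hv ht q.1 q.2.1).continuousWithinAt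
  have cf := hu.continuousOn_tensFlux hv q.1 q.2.1
  have cw := fun n => (hu.continuousOn n).sub (hv.continuousOn n)
  have cg := fun n => (hu.continuousOn_G n).sub (hv.continuousOn_G n)
  have cww := (cw q.2.2).mul (cw (fourth q))
  exact ((continuousOn_const.mul (ct.mul cww)).add (continuousOn_const.mul (cf.mul cww))).add
    (continuousOn_const.mul (ct.mul (((continuousOn_const.mul (cg q.2.2)).mul (cw (fourth q))).add
      ((cw q.2.2).mul (continuousOn_const.mul (cg (fourth q)))))))

lemma nfDeriv_bdd (hu : WeakSol κ l R S u) (hv : WeakSol κ l R S v) {t : ℝ} (ht : t ∈ S) :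
    BddSum (fun q => ‖nfDeriv κ l (u t) (v t) q‖) (5 / 2 * (8 * stabConst κ l R ^ 4) +
      4 * (stabConst κ l R * (4 * Jsum * stabConst κ l R) +
        stabConst κ l R * (stabConst κ l R * stabConst κ l R)) +
      2 * (stabConst κ l R * (stabConst κ l R * stabConst κ l R) +
        stabConst κ l R * (stabConst κ l R * stabConst κ l R))) := by
  have h := hu.stabData hv ht
  have hy := hu.l2_le hv ht
  have hK := h.maj.pos.le
  have hJ : 0 ≤ Jsum := bddSum_jp.bound_nonneg
  exact (((h.nfLin_bdd.add h.nfCoeff_bdd).add h.nfDiff_bdd).of_norm_le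
    fun q => norm_add₃_le).le (by gcongr)

lemma tsum_nfDeriv (hu : WeakSol κ l R S u) (hv : WeakSol κ l R S v) {t : ℝ} (ht : t ∈ S) :
    ∑' q, nfDeriv κ l (u t) (v t) q =
      ∑' q, nfLin (tens (u t) (v t)) (fun n => u t n - v t n) q +
      ∑' q, nfCoeff (tensFlux κ l (u t) (v t)) (fun n => u t n - v t n) q +
      ∑' q, nfDiff (tens (u t) (v t)) (fun n => G κ l (u t) n - G κ l (v t) n)
        (fun n => u t n - v t n) q := by
  have h := hu.stabData hv ht
  have s1 := h.nfLin_bdd.summable_norm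
  have s2 := h.nfCoeff_bdd.summable_norm
  have s3 := h.nfDiff_bdd.summable_norm
  rw [← s1.tsum_add s2, ← (s1.add s2).tsum_add s3]
  rfl

lemma nfTerm_integral (hu : WeakSol κ l R S u) (hv : WeakSol κ l R S v) {a b : ℝ} (hab : a ≤ b)
    (hS : Icc a b ⊆ S) :
    IntervalIntegrable (fun t => ∑' q, nfDeriv κ l (u t) (v t) q) volume a b ∧
      ∑' q, nfTerm (tens (u b) (v b)) (fun n => u b n - v b n) q -
        ∑' q, nfTerm (tens (u a) (v a)) (fun n => u a n - v a n) q =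
      ∫ t in a..b, ∑' q, nfDeriv κ l (u t) (v t) q := by
  replace hu := hu.mono hS
  replace hv := hv.mono hS
  have hsn : ∀ t ∈ Icc a b, Summable fun q =>
      nfTerm (tens (u t) (v t)) (fun n => u t n - v t n) q := fun t ht =>
    ((hu.stabData hv ht).nfTerm_bdd (ε := 1) one_pos (M := 1) (by norm_num)).summable_norm
  exact tsum_sub_tsum_eq_integral hab (fun q t ht => hu.hasDerivWithinAt_nfTerm hv ht q)
    (fun q => hu.continuousOn_nfDeriv hv q) (fun t ht => hu.nfDeriv_bdd hv ht)
    (hsn a (left_mem_Icc.2 hab)) (hsn b (right_mem_Icc.2 hab))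

lemma sum_integral (hu : WeakSol κ l R S u) (hv : WeakSol κ l R S v) {a b : ℝ} (hab : a ≤ b)
    (hS : Icc a b ⊆ S) (F : Finset ℤ) :
    IntervalIntegrable (fun t => ∑ n ∈ F, StabData.dMass
      (fun n => G κ l (u t) n - G κ l (v t) n) (fun n => u t n - v t n) n) volume a b ∧
      ∑ n ∈ F, (u b n - v b n) * (u b (-n) - v b (-n)) -
        ∑ n ∈ F, (u a n - v a n) * (u a (-n) - v a (-n)) =
      ∫ t in a..b, ∑ n ∈ F, StabData.dMass
        (fun n => G κ l (u t) n - G κ l (v t) n) (fun n => u t n - v t n) n := by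
  replace hu := hu.mono hS
  replace hv := hv.mono hS
  have := tsum_sub_tsum_eq_integral (ι := F) hab
    (fun n t ht => hu.hasDerivWithinAt_dMass hv ht (n : ℤ)) (fun n => hu.continuousOn_dMass hv n)
    (fun t ht => (hu.stabData hv ht).dMass_bdd.comp_injective Subtype.val_injective)
    (hasSum_fintype _).summable (hasSum_fintype _).summable
  simp only [tsum_fintype] at this
  have h (f : ℤ → ℂ) : ∑ n : F, f n = ∑ n ∈ F, f n := Finset.sum_coe_sort F f
  simpa only [h (fun n => (u b n - v b n) * (u b (-n) - v b (-n))),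
    h (fun n => (u a n - v a n) * (u a (-n) - v a (-n))),
    fun t => h (fun n => StabData.dMass (fun n => G κ l (u t) n - G κ l (v t) n)
      (fun n => u t n - v t n) n)] using this

lemma mass_integral (hu : WeakSol κ l R S u) (hv : WeakSol κ l R S v) {a b : ℝ} (hab : a ≤ b)
    (hS : Icc a b ⊆ S) :
    IntervalIntegrable (fun t => ∑' n, StabData.dMass
      (fun n => G κ l (u t) n - G κ l (v t) n) (fun n => u t n - v t n) n) volume a b ∧
      ∑' n, (u b n - v b n) * (u b (-n) - v b (-n)) -
        ∑' n, (u a n - v a n) * (u a (-n) - v a (-n)) =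
      ∫ t in a..b, ∑' n, StabData.dMass
        (fun n => G κ l (u t) n - G κ l (v t) n) (fun n => u t n - v t n) n := by
  replace hu := hu.mono hS
  replace hv := hv.mono hS
  have hsw : ∀ t ∈ Icc a b, Summable fun n => (u t n - v t n) * (u t (-n) - v t (-n)) :=
    fun t ht => by
      have hr : IsRealCoeff fun n => u t n - v t n := fun n => by
        simp only [map_sub, hu.real t ht n, hv.real t ht n]
      have : (fun n => (u t n - v t n) * (u t (-n) - v t (-n))) =
          fun n => ((‖u t n - v t n‖ ^ 2 : ℝ) : ℂ) := funext fun n => StabData.mul_neg_eq hr n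
      rw [this]
      exact_mod_cast (hu.stabData hv ht).w_bdd.summable
  exact tsum_sub_tsum_eq_integral hab (fun n t ht => hu.hasDerivWithinAt_dMass hv ht n)
    (fun n => hu.continuousOn_dMass hv n) (fun t ht => (hu.stabData hv ht).dMass_bdd)
    (hsw a (left_mem_Icc.2 hab)) (hsw b (right_mem_Icc.2 hab))

lemma modEnergy_sub (hu : WeakSol κ l R S u) (hv : WeakSol κ l R S v) {a b : ℝ} (hab : a ≤ b)
    (hS : Icc a b ⊆ S) (Λ : ℝ) (M : ℕ) :
    modEnergy κ Λ M (tens (u b) (v b)) (fun n => u b n - v b n) -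
      modEnergy κ Λ M (tens (u a) (v a)) (fun n => u a n - v a n) =
    ∫ t in a..b, modFlux κ Λ M (tens (u t) (v t)) (tensFlux κ l (u t) (v t))
      (fun n => G κ l (u t) n - G κ l (v t) n) (fun n => u t n - v t n) := by
  obtain ⟨i1, e1⟩ := hu.mass_integral hv hab hS
  obtain ⟨i2, e2⟩ := hu.nfTerm_integral hv hab hS
  obtain ⟨i3, e3⟩ := hu.sum_integral hv hab hS (lowSet M)
  have e5 : ∫ t in a..b, modFlux κ Λ M (tens (u t) (v t)) (tensFlux κ l (u t) (v t))
      (fun n => G κ l (u t) n - G κ l (v t) n) (fun n => u t n - v t n) =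
      ∫ t in a..b, ((∑' n, StabData.dMass
        (fun n => G κ l (u t) n - G κ l (v t) n) (fun n => u t n - v t n) n +
        2 * κ / 5 * ∑' q, nfDeriv κ l (u t) (v t) q) + Λ * ∑ n ∈ lowSet M, StabData.dMass
        (fun n => G κ l (u t) n - G κ l (v t) n) (fun n => u t n - v t n) n) := by
    refine intervalIntegral.integral_congr fun t ht => ?_
    rw [uIcc_of_le hab] at ht
    simp only [modFlux, hu.tsum_nfDeriv hv (hS ht)]
  rw [e5, intervalIntegral.integral_add (i1.add (i2.const_mul _)) (i3.const_mul _),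
    intervalIntegral.integral_add i1 (i2.const_mul _), intervalIntegral.integral_const_mul,
    intervalIntegral.integral_const_mul, ← e1, ← e2, ← e3, modEnergy, modEnergy]
  ring

end WeakSol

/-- Weak solutions with the same mass depend continuously on one another in `L²`. -/
theorem exists_weakSol_stability (κ l R L : ℝ) : ∃ A : ℝ, 0 ≤ A ∧
    ∀ (a b : ℝ) (u v : ℝ → ℤ → ℂ), b - a ≤ L → WeakSol κ l R (Icc a b) u →
      WeakSol κ l R (Icc a b) v → ∀ s ∈ Icc a b, mass (u s) = mass (v s) → ∀ t ∈ Icc a b,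
      ∑' n, ‖u t n - v t n‖ ^ 2 ≤ A * ∑' n, ‖u s n - v s n‖ ^ 2 := by
  obtain ⟨M, Λ, A, hA, key⟩ := exists_modEnergy_sub_bounds κ l R
  refine ⟨2 * A * Real.exp (2 * A * L), by positivity, fun a b u v hL hu hv s hs hm t ht => ?_⟩
  set y : ℝ → ℝ := fun t => ∑' n, ‖u t n - v t n‖ ^ 2 with hydef
  have hy0 : ∀ t, 0 ≤ y t := fun t => tsum_nonneg fun n => sq_nonneg _
  have hyc : ContinuousOn y (Icc a b) := hu.continuousOn_l2 hv
  set E : ℝ → ℂ := fun t => modEnergy κ Λ M (tens (u t) (v t)) (fun n => u t n - v t n) with hE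
  have hk := fun t (ht : t ∈ Icc a b) => key (u t) (v t) (hu.ball t ht) (hv.ball t ht)
    (hu.real t ht) (hv.real t ht)
    (by rw [hu.mass_eq hs ht, hv.mass_eq hs ht, hm])
  have hdiff : ∀ p q : ℝ, p ∈ Icc a b → q ∈ Icc a b → p ≤ q →
      ‖E q - E p‖ ≤ A * ∫ τ in p..q, y τ := fun p q hp hq hpq => by
    have hS : Icc p q ⊆ Icc a b := Icc_subset_Icc hp.1 hq.2
    rw [hE]
    dsimp only
    rw [hu.modEnergy_sub hv hpq hS, ← intervalIntegral.integral_const_mul]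
    refine intervalIntegral.norm_integral_le_of_norm_le hpq
      (Filter.Eventually.of_forall fun τ hτ => (hk τ (hS ⟨hτ.1.le, hτ.2⟩)).2.2) ?_
    exact ((hyc.mono hS).const_mul A).intervalIntegrable_of_Icc hpq
  have hG : ∀ t ∈ Icc a b, y t ≤ 2 * A * y s + 2 * A * |∫ τ in s..t, y τ| := fun t ht => by
    have h1 := (hk t ht).1
    have h2 := (hk s hs).2.1
    have h3 : ‖E t - E s‖ ≤ A * |∫ τ in s..t, y τ| := by
      rcases le_total s t with hst | hst
      · exact (hdiff s t hs ht hst).trans (mul_le_mul_of_nonneg_left (le_abs_self _) hA)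
      · rw [norm_sub_rev, intervalIntegral.integral_symm, abs_neg]
        exact (hdiff t s ht hs hst).trans (mul_le_mul_of_nonneg_left (le_abs_self _) hA)
    have h4 := norm_sub_norm_le (E t) (E s)
    simp only [hydef] at *
    linarith
  have := le_exp_of_le_abs_integral (by positivity) hyc (fun t _ => hy0 t) hs hG t ht
  refine this.trans ?_
  have hts : |t - s| ≤ L := by
    rw [abs_le]; constructor <;> linarith [ht.1, ht.2, hs.1, hs.2]
  calc _ ≤ 2 * A * y s * Real.exp (2 * A * L) := by
        have := hy0 s
        gcongr
    _ = _ := by ring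

/-- Weak solutions are determined by their value at one time. -/
lemma WeakSol.unique {κ l R a b : ℝ} {u v : ℝ → ℤ → ℂ} (hu : WeakSol κ l R (Icc a b) u)
    (hv : WeakSol κ l R (Icc a b) v) {s : ℝ} (hs : s ∈ Icc a b) (h : u s = v s) {t : ℝ}
    (ht : t ∈ Icc a b) : u t = v t := by
  obtain ⟨A, -, hA⟩ := exists_weakSol_stability κ l R (b - a)
  have h1 := hA a b u v le_rfl hu hv s hs (by rw [h]) t ht
  simp only [h, sub_self, norm_zero, ne_eq, OfNat.ofNat_ne_zero, not_false_eq_true, zero_pow,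
    tsum_zero, mul_zero] at h1
  funext n
  have h2 := (hu.stabData hv ht).w_bdd.apply_le n
  have h3 : ‖u t n - v t n‖ ^ 2 ≤ 0 := h2.trans h1
  have h4 : ‖u t n - v t n‖ = 0 := pow_eq_zero_iff two_ne_zero |>.1 (le_antisymm h3 (sq_nonneg _))
  exact sub_eq_zero.1 (norm_eq_zero.1 h4)

/-! ### Coercivity of the Hamiltonian. -/

/-- The Hamiltonian of the equation. -/
def ham (κ l : ℝ) (a : ℤ → ℂ) : ℝ := (∑' n : ℤ, (n : ℝ) ^ 4 * ‖a n‖ ^ 2) / 2 + (potential κ l a).re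

lemma HBall.mass_bdd {R : ℝ} {a : ℤ → ℂ} (h : HBall R a) : BddSum (fun n => ‖a n‖ ^ 2) R :=
  BddSum.mono h (fun _ => sq_nonneg _) fun n =>
    le_mul_of_one_le_left (sq_nonneg _) (one_le_pow₀ (by linarith [sq_nonneg (n : ℝ)]))

lemma HBall.four_bdd {R : ℝ} {a : ℤ → ℂ} (h : HBall R a) :
    BddSum (fun n : ℤ => (n : ℝ) ^ 4 * ‖a n‖ ^ 2) R :=
  BddSum.mono h (fun _ => by positivity) fun n => by
    refine mul_le_mul_of_nonneg_right ?_ (sq_nonneg _)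
    nlinarith [sq_nonneg (n : ℝ)]

lemma hBall_of_bdd {a : ℤ → ℂ} {m X : ℝ} (hm : BddSum (fun n => ‖a n‖ ^ 2) m)
    (hX : BddSum (fun n : ℤ => (n : ℝ) ^ 4 * ‖a n‖ ^ 2) X) : HBall (2 * m + 2 * X) a :=
  ((hm.const_mul zero_le_two).add (hX.const_mul zero_le_two)).mono (fun _ => by positivity)
    fun n => by nlinarith [mul_nonneg (sq_nonneg ((n : ℝ) ^ 2 - 1)) (sq_nonneg ‖a n‖)]

lemma cpow_sq_bdd {a : ℤ → ℂ} {S m : ℝ} (h1 : BddSum (fun n => ‖a n‖) S)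
    (h2 : BddSum (fun n => ‖a n‖ ^ 2) m) :
    ∀ k, BddSum (fun n => ‖cpow a k n‖ ^ 2) ((S ^ 2) ^ k * m)
  | 0 => by simpa [cpow] using h2
  | k + 1 => by
    obtain ⟨hf, hs⟩ := conv_sq_bdd h1 (fun n => norm_nonneg _) (cpow_sq_bdd h1 h2 k)
    refine (hs.mono (fun n => sq_nonneg _) fun n => ?_).le (le_of_eq (by ring))
    exact pow_le_pow_left₀ (norm_nonneg _) (norm_conv_le (hf n)) 2

lemma norm_conv_zero_le {f g : ℤ → ℂ} {C D : ℝ} (hf : BddSum (fun n => ‖f n‖ ^ 2) C)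
    (hg : BddSum (fun n => ‖g n‖ ^ 2) D) : ‖conv f g 0‖ ≤ Real.sqrt C * Real.sqrt D :=
  norm_conv_le (BddSum.cauchy_schwarz (fun n => norm_nonneg _) (fun n => norm_nonneg _) hf
    (hg.comp_injective (e := fun m : ℤ => 0 - m) fun a b h => by simpa using h))

lemma norm_potential_le (κ l : ℝ) {a : ℤ → ℂ} {S m X : ℝ} (h1 : BddSum (fun n => ‖a n‖) S)
    (h2 : BddSum (fun n => ‖a n‖ ^ 2) m)
    (hX : BddSum (fun n : ℤ => (n : ℝ) ^ 4 * ‖a n‖ ^ 2) X) :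
    ‖potential κ l a‖ ≤ |κ| * (Real.sqrt X * (S ^ 2 * Real.sqrt m)) + |l| * ((S ^ 2) ^ 2 * m) := by
  have hm := h2.bound_nonneg
  have e1 : ‖conv (sqMul a) (cpow a 2) 0‖ ≤ Real.sqrt X * (S ^ 2 * Real.sqrt m) := by
    have hs : BddSum (fun n => ‖sqMul a n‖ ^ 2) X := hX.mono (fun n => sq_nonneg _) fun n => by
      rw [sqMul, norm_mul, norm_pow, norm_intCast_eq, sq_abs, mul_pow]
      exact le_of_eq (by ring)
    refine (norm_conv_zero_le hs (cpow_sq_bdd h1 h2 2)).trans (le_of_eq ?_)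
    rw [Real.sqrt_mul (by positivity), Real.sqrt_sq (by positivity)]
  have e2 : ‖cpow a 5 0‖ ≤ (S ^ 2) ^ 2 * m := by
    refine (norm_conv_zero_le h2 (cpow_sq_bdd h1 h2 4)).trans (le_of_eq ?_)
    rw [show ((S ^ 2) ^ 4 : ℝ) = ((S ^ 2) ^ 2) ^ 2 by ring, Real.sqrt_mul (by positivity),
      Real.sqrt_sq (by positivity)]
    linear_combination (S ^ 2) ^ 2 * Real.mul_self_sqrt hm
  rw [potential]
  refine (norm_sub_le _ _).trans (add_le_add ?_ ?_)
  · rw [norm_mul, Complex.norm_real, Real.norm_eq_abs]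
    exact mul_le_mul_of_nonneg_left e1 (abs_nonneg _)
  · rw [norm_mul, norm_div, Complex.norm_real, Real.norm_eq_abs]
    refine mul_le_mul ?_ e2 (norm_nonneg _) (abs_nonneg _)
    rw [show ‖(6 : ℂ)‖ = 6 by norm_num]
    exact div_le_self (abs_nonneg _) (by norm_num)

lemma exists_tsum_inv_le {θ : ℝ} (hθ : 0 < θ) :
    ∃ k : ℕ, 1 ≤ k ∧ BddSum (fun n : ℤ => ((k : ℝ) ^ 2 + (n : ℝ) ^ 2)⁻¹) θ := by
  have hle : ∀ k : ℕ, 1 ≤ k → ∀ n : ℤ, ((k : ℝ) ^ 2 + (n : ℝ) ^ 2)⁻¹ ≤ 2 * (jp n ^ 2)⁻¹ :=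
    fun k hk n => by
      have h1 : (1 : ℝ) ≤ (k : ℝ) ^ 2 := one_le_pow₀ (by exact_mod_cast hk)
      have h2 := jp_sq_le n
      have h3 : 0 < jp n ^ 2 := pow_pos (jp_pos n) 2
      rw [show 2 * (jp n ^ 2)⁻¹ = (jp n ^ 2 / 2)⁻¹ by rw [inv_div, div_eq_mul_inv]]
      exact inv_anti₀ (by positivity) (by linarith)
  have ht : Filter.Tendsto (fun k : ℕ => ∑' n : ℤ, ((k : ℝ) ^ 2 + (n : ℝ) ^ 2)⁻¹) Filter.atTop
      (nhds (∑' _ : ℤ, (0 : ℝ))) := by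
    refine tendsto_tsum_of_dominated_convergence (summable_jp.mul_left 2) (fun n => ?_)
      ((Filter.eventually_ge_atTop 1).mono fun k hk n => ?_)
    · refine Filter.Tendsto.inv_tendsto_atTop (Filter.tendsto_atTop_add_const_right _ _ ?_)
      exact (Filter.tendsto_pow_atTop two_ne_zero).comp tendsto_natCast_atTop_atTop
    · rw [Real.norm_of_nonneg (by positivity)]
      exact hle k hk n
  rw [tsum_zero] at ht
  obtain ⟨k, hk1, hk⟩ := ((Filter.eventually_ge_atTop 1).and (ht.eventually_le_const hθ)).exists
  exact ⟨k, hk1, BddSum.of_summable (fun n => by positivity)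
    (Summable.of_nonneg_of_le (fun n => by positivity) (hle k hk1) (summable_jp.mul_left 2)) hk⟩

lemma l1_bdd {a : ℤ → ℂ} {m X θ : ℝ} {k : ℕ} (hk1 : 1 ≤ k)
    (hk : BddSum (fun n : ℤ => ((k : ℝ) ^ 2 + (n : ℝ) ^ 2)⁻¹) θ)
    (h2 : BddSum (fun n => ‖a n‖ ^ 2) m)
    (hX : BddSum (fun n : ℤ => (n : ℝ) ^ 4 * ‖a n‖ ^ 2) X) :
    BddSum (fun n => ‖a n‖)
      (Real.sqrt (θ * ((k : ℝ) ^ 2 * m + Real.sqrt m * Real.sqrt X))) := by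
  have hk0 : (0 : ℝ) < k := by exact_mod_cast hk1
  have h3 : BddSum (fun n : ℤ => (n : ℝ) ^ 2 * ‖a n‖ ^ 2) (Real.sqrt m * Real.sqrt X) := by
    refine (BddSum.cauchy_schwarz (x := fun n => ‖a n‖) (z := fun n : ℤ => (n : ℝ) ^ 2 * ‖a n‖)
      (fun n => norm_nonneg _) (fun n => by positivity) h2
      (hX.mono (fun n => sq_nonneg _) fun n => le_of_eq (by ring))).mono
      (fun n => by positivity) fun n => le_of_eq (by ring)
  have h4 : BddSum (fun n : ℤ => (Real.sqrt ((k : ℝ) ^ 2 + (n : ℝ) ^ 2) * ‖a n‖) ^ 2)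
      ((k : ℝ) ^ 2 * m + Real.sqrt m * Real.sqrt X) := by
    refine ((h2.const_mul (sq_nonneg (k : ℝ))).add h3).mono (fun n => sq_nonneg _) fun n => ?_
    rw [mul_pow, Real.sq_sqrt (by positivity)]
    exact le_of_eq (by ring)
  have h5 : BddSum (fun n : ℤ => (Real.sqrt ((k : ℝ) ^ 2 + (n : ℝ) ^ 2))⁻¹ ^ 2) θ :=
    hk.mono (fun n => sq_nonneg _) fun n => by
      rw [inv_pow, Real.sq_sqrt (by positivity)]
  rw [Real.sqrt_mul hk.bound_nonneg]
  refine (BddSum.cauchy_schwarz (fun n => by positivity) (fun n => by positivity) h5 h4).mono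
    (fun n => norm_nonneg _) fun n => le_of_eq ?_
  have : Real.sqrt ((k : ℝ) ^ 2 + (n : ℝ) ^ 2) ≠ 0 := (Real.sqrt_pos.2 (by positivity)).ne'
  rw [inv_mul_cancel_left₀ this]

/-- The `H²` norm is controlled by the mass and the Hamiltonian. -/
theorem exists_hBall_of_ham_le (κ l m₀ h₀ : ℝ) : ∃ R : ℝ, ∀ (R' : ℝ) (a : ℤ → ℂ), HBall R' a →
    mass a ≤ m₀ → ham κ l a ≤ h₀ → HBall R a := by
  set P := Real.sqrt m₀ with hP
  have hP0 : 0 ≤ P := Real.sqrt_nonneg _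
  set θ : ℝ := (16 * (1 + |κ| + |l|) * (1 + P ^ 2) ^ 2)⁻¹ with hθ
  have hθ0 : 0 < θ := by positivity
  obtain ⟨k, hk1, hk⟩ := exists_tsum_inv_le hθ0
  refine ⟨2 * m₀ + 2 * (4 * |h₀| + 4 * (k : ℝ) ^ 4 * P ^ 2), fun R' a ha hm hh => ?_⟩
  have hm' : BddSum (fun n => ‖a n‖ ^ 2) m₀ :=
    BddSum.of_summable (fun n => sq_nonneg _) ha.summable_sq hm
  set X : ℝ := ∑' n : ℤ, (n : ℝ) ^ 4 * ‖a n‖ ^ 2 with hX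
  have hX' : BddSum (fun n : ℤ => (n : ℝ) ^ 4 * ‖a n‖ ^ 2) X :=
    BddSum.of_summable ha.four_bdd.1 ha.four_bdd.summable le_rfl
  have hm0 : 0 ≤ m₀ := hm'.bound_nonneg
  refine (hBall_of_bdd hm' hX').le ?_
  have h1 := l1_bdd hk1 hk hm' hX'
  have hpot := norm_potential_le κ l h1 hm' hX'
  have hX0 : 0 ≤ X := hX'.bound_nonneg
  rw [Real.sq_sqrt (by positivity), ← hP] at hpot
  set x := Real.sqrt X with hx
  have hx0 : 0 ≤ x := Real.sqrt_nonneg _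
  have hxX : x ^ 2 = X := Real.sq_sqrt hX0
  have hPm : P ^ 2 = m₀ := Real.sq_sqrt hm0
  have hre := (Complex.abs_re_le_norm (potential κ l a))
  have hre' := neg_abs_le (potential κ l a).re
  rw [ham, ← hX] at hh
  have hham : x ^ 2 / 2 + (potential κ l a).re ≤ h₀ := by rw [hxX]; exact hh
  have hpot' := hpot
  rw [← hPm] at hpot'
  suffices hs : x ^ 2 ≤ 4 * |h₀| + 4 * (k : ℝ) ^ 4 * P ^ 2 by
    rw [hxX] at hs
    linarith
  have hθe : θ * (16 * (1 + |κ| + |l|) * (1 + P ^ 2) ^ 2) = 1 := inv_mul_cancel₀ (by positivity)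
  have hP2 : P ^ 2 ≤ (1 + P ^ 2) ^ 2 := by nlinarith [sq_nonneg P]
  have hP4 : P ^ 4 ≤ (1 + P ^ 2) ^ 2 := by nlinarith [sq_nonneg P]
  have b1 : |κ| * θ * P ^ 2 ≤ 1 / 16 := by
    have : |κ| * θ * P ^ 2 ≤ (1 + |κ| + |l|) * θ * (1 + P ^ 2) ^ 2 := by
      have := abs_nonneg l
      gcongr
      linarith
    linarith
  have b2 : |l| * θ ^ 2 * P ^ 4 ≤ 1 / 16 := by
    have h3 : |l| * θ * P ^ 4 ≤ (1 + |κ| + |l|) * θ * (1 + P ^ 2) ^ 2 := by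
      have := abs_nonneg κ
      gcongr
      linarith
    have h4 : θ ≤ 1 := by
      rw [hθ]
      refine inv_le_one_of_one_le₀ ?_
      have h5 : 1 ≤ 1 + |κ| + |l| := by linarith [abs_nonneg κ, abs_nonneg l]
      have h6 : 1 ≤ (1 + P ^ 2) ^ 2 := one_le_pow₀ (by linarith [sq_nonneg P])
      nlinarith
    have h5 : 0 ≤ |l| * θ * P ^ 4 := by positivity
    calc |l| * θ ^ 2 * P ^ 4 = (|l| * θ * P ^ 4) * θ := by ring
      _ ≤ (|l| * θ * P ^ 4) * 1 := mul_le_mul_of_nonneg_left h4 h5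
      _ ≤ 1 / 16 := by linarith
  have c1 : |κ| * (x * (θ * ((k : ℝ) ^ 2 * P ^ 2 + P * x) * P)) ≤
      1 / 16 * ((k : ℝ) ^ 2 * P * x + x ^ 2) := by
    calc _ = |κ| * θ * P ^ 2 * ((k : ℝ) ^ 2 * P * x + x ^ 2) := by ring
      _ ≤ _ := by gcongr
  have c2 : |l| * ((θ * ((k : ℝ) ^ 2 * P ^ 2 + P * x)) ^ 2 * P ^ 2) ≤
      1 / 16 * ((k : ℝ) ^ 2 * P + x) ^ 2 := by
    calc _ = |l| * θ ^ 2 * P ^ 4 * ((k : ℝ) ^ 2 * P + x) ^ 2 := by ring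
      _ ≤ _ := by gcongr
  have c3 := sq_nonneg ((k : ℝ) ^ 2 * P - x)
  have c4 := le_abs_self h₀
  have c5 := hpot'.trans (add_le_add c1 c2)
  have e1 : (k : ℝ) ^ 4 * P ^ 2 = ((k : ℝ) ^ 2 * P) ^ 2 := by ring
  rw [mul_assoc 4, e1]
  generalize (k : ℝ) ^ 2 * P = z at *
  nlinarith

/-! ### Frequency-truncated flows. -/

lemma W1.of_support {F : Finset ℤ} {a : ℤ → ℂ} (h : ∀ n ∉ F, a n = 0) :
    W1 a (∑ n ∈ F, jp n * ‖a n‖) :=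
  BddSum.of_summable (fun n => mul_nonneg (jp_pos n).le (norm_nonneg _))
    (summable_of_ne_finset_zero fun n hn => by rw [h n hn, norm_zero, mul_zero])
    (tsum_eq_sum fun n hn => by rw [h n hn, norm_zero, mul_zero]).le

lemma HBall.of_support {F : Finset ℤ} {a : ℤ → ℂ} (h : ∀ n ∉ F, a n = 0) :
    HBall (∑ n ∈ F, (1 + (n : ℝ) ^ 2) ^ 2 * ‖a n‖ ^ 2) a :=
  BddSum.of_summable (fun n => by positivity)
    (summable_of_ne_finset_zero (s := F) fun n hn => by simp [h n hn])
    (tsum_eq_sum fun n hn => by simp [h n hn]).le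

lemma conv_eq_sum {F : Finset ℤ} {a : ℤ → ℂ} (h : ∀ n ∉ F, a n = 0) (g : ℤ → ℂ) (n : ℤ) :
    conv a g n = ∑ m ∈ F, a m * g (n - m) :=
  tsum_eq_sum fun m hm => by rw [h m hm, zero_mul]

lemma HBall.G_eq {R : ℝ} {a : ℤ → ℂ} (h : HBall R a) (κ l : ℝ) (n : ℤ) : G κ l a n =
    κ * ((n : ℂ) ^ 2 * cpow a 2 n + 3 * conv (sqMul a) (cpow a 1) n) - l * cpow a 4 n := by
  rw [G, h.maj.T3_eq fun _ => le_rfl, Q5_eq_cpow (h.maj.W1 fun _ => le_rfl)]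

lemma sqMul_support {F : Finset ℤ} {a : ℤ → ℂ} (h : ∀ n ∉ F, a n = 0) : ∀ n ∉ F, sqMul a n = 0 :=
  fun n hn => by rw [sqMul, h n hn, mul_zero]

lemma conv_const_mul_right (f g : ℤ → ℂ) (c : ℂ) :
    conv f (fun n => c * g n) = fun n => c * conv f g n := by
  funext n
  unfold conv
  rw [← tsum_mul_left]
  exact tsum_congr fun m => by ring

section Deriv

variable {F : Finset ℤ} {S : Set ℝ} {t : ℝ} {u : ℝ → ℤ → ℂ} {u' : ℤ → ℂ}

lemma hasDerivWithinAt_conv {f g : ℝ → ℤ → ℂ} {f' g' : ℤ → ℂ} (hf0 : ∀ s, ∀ n ∉ F, f s n = 0)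
    (hf0' : ∀ n ∉ F, f' n = 0)
    (hf : ∀ n, HasDerivWithinAt (fun s => f s n) (f' n) S t)
    (hg : ∀ n, HasDerivWithinAt (fun s => g s n) (g' n) S t) (n : ℤ) :
    HasDerivWithinAt (fun s => conv (f s) (g s) n) (conv f' (g t) n + conv (f t) g' n) S t := by
  simp only [conv_eq_sum (hf0 _), conv_eq_sum hf0']
  rw [← Finset.sum_add_distrib]
  exact HasDerivWithinAt.fun_sum fun m _ => (hf m).mul (hg (n - m))

lemma hasDerivWithinAt_cpow (h0 : ∀ s, ∀ n ∉ F, u s n = 0) (h0' : ∀ n ∉ F, u' n = 0)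
    (hu : ∀ n, HasDerivWithinAt (fun s => u s n) (u' n) S t) : ∀ (k : ℕ) (n : ℤ),
    HasDerivWithinAt (fun s => cpow (u s) (k + 1) n) ((k + 2) * conv u' (cpow (u t) k) n) S t
  | 0, n => by
    refine (hasDerivWithinAt_conv h0 h0' hu hu n).congr_deriv ?_
    rw [conv_comm (u t) u']
    simp only [cpow]
    push_cast
    ring
  | k + 1, n => by
    refine (hasDerivWithinAt_conv h0 h0' hu (hasDerivWithinAt_cpow h0 h0' hu k) n).congr_deriv ?_
    have hA := W1.of_support (h0 t)
    have hA' := W1.of_support h0'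
    rw [conv_const_mul_right, ← conv_assoc hA hA' (hA.cpow k), conv_comm (u t) u',
      conv_assoc hA' hA (hA.cpow k)]
    simp only [cpow]
    push_cast
    ring

lemma hasDerivWithinAt_potential (κ l : ℝ) (h0 : ∀ s, ∀ n ∉ F, u s n = 0)
    (h0' : ∀ n ∉ F, u' n = 0) (hu : ∀ n, HasDerivWithinAt (fun s => u s n) (u' n) S t) :
    HasDerivWithinAt (fun s => potential κ l (u s)) (∑ n ∈ F, u' n * G κ l (u t) (-n)) S t := by
  have h1 := hasDerivWithinAt_conv (fun s => sqMul_support (h0 s)) (sqMul_support h0')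
    (fun n => (hu n).const_mul ((n : ℂ) ^ 2)) (hasDerivWithinAt_cpow h0 h0' hu 1) 0
  have h2 := hasDerivWithinAt_cpow h0 h0' hu 4 0
  refine ((h1.const_mul (κ : ℂ)).sub (h2.const_mul ((l : ℂ) / 6))).congr_deriv ?_
  have hA := W1.of_support (h0 t)
  have hA' := W1.of_support h0'
  have hs := W1.of_support (sqMul_support (h0 t))
  rw [conv_const_mul_right, ← conv_assoc hs hA' (hA.cpow 1), conv_comm (sqMul (u t)) u',
    conv_assoc hA' hs (hA.cpow 1)]
  beta_reduce
  rw [conv_eq_sum h0', conv_eq_sum h0',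
    conv_eq_sum (sqMul_support h0')]
  simp only [(HBall.of_support (h0 t)).G_eq, Finset.mul_sum, ← Finset.sum_add_distrib,
    ← Finset.sum_sub_distrib]
  refine Finset.sum_congr rfl fun m _ => ?_
  rw [zero_sub, sqMul]
  push_cast
  ring

end Deriv

lemma cpow_conj {a : ℤ → ℂ} (h : IsRealCoeff a) : ∀ k, IsRealCoeff (cpow a k)
  | 0 => h
  | k + 1 => fun n => by
    simp only [cpow, conv]
    rw [Complex.conj_tsum, ← (Equiv.neg ℤ).tsum_eq]
    refine tsum_congr fun m => ?_
    rw [map_mul, h, cpow_conj h k, Equiv.neg_apply, neg_neg]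
    congr 2
    ring

lemma G_conj {R : ℝ} {a : ℤ → ℂ} (hR : HBall R a) (h : IsRealCoeff a) (κ l : ℝ) :
    IsRealCoeff (G κ l a) := fun n => by
  have h1 : conj (conv (sqMul a) (cpow a 1) n) = conv (sqMul a) (cpow a 1) (-n) := by
    simp only [conv]
    rw [Complex.conj_tsum, ← (Equiv.neg ℤ).tsum_eq]
    refine tsum_congr fun m => ?_
    simp only [sqMul, map_mul, map_pow, map_intCast, h _, cpow_conj h 1 _,
      Equiv.neg_apply, neg_neg]
    push_cast
    rw [neg_sq]
    congr 2
    ring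
  rw [hR.G_eq, hR.G_eq]
  simp only [map_sub, map_mul, map_add, map_pow, map_intCast, Complex.conj_ofReal, h1,
    cpow_conj h _ _, map_ofNat]
  push_cast
  ring

/-- A real solution of the frequency-truncated equation, with the time-dependent speed `φ`. -/
structure TruncSol (κ l : ℝ) (N : ℕ) (φ : ℝ → ℝ) (S : Set ℝ) (u : ℝ → ℤ → ℂ) : Prop where
  supp : ∀ t, ∀ n ∉ lowSet N, u t n = 0
  real : ∀ t, IsRealCoeff (u t)
  deriv : ∀ t ∈ S, ∀ n ∈ lowSet N, HasDerivWithinAt (fun t => u t n)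
    (φ t * (I * n * ((n : ℂ) ^ 4 * u t n + G κ l (u t) n))) S t

lemma neg_mem_lowSet {N : ℕ} {n : ℤ} : -n ∈ lowSet N ↔ n ∈ lowSet N := by
  simp only [lowSet, Finset.mem_Icc]
  omega

lemma sum_lowSet_neg (N : ℕ) (f : ℤ → ℂ) : ∑ n ∈ lowSet N, f (-n) = ∑ n ∈ lowSet N, f n :=
  Finset.sum_equiv (Equiv.neg ℤ) (fun _ => neg_mem_lowSet.symm) fun _ _ => rfl

lemma eq_of_hasDerivWithinAt_zero {a b : ℝ} {f : ℝ → ℂ}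
    (h : ∀ t ∈ Icc a b, HasDerivWithinAt f 0 (Icc a b) t) {s t : ℝ} (hs : s ∈ Icc a b)
    (ht : t ∈ Icc a b) : f t = f s := by
  have h1 := constant_of_derivWithin_zero (fun x hx => (h x hx).differentiableWithinAt)
    fun x hx => (h x ⟨hx.1, hx.2.le⟩).derivWithin
      (uniqueDiffOn_Icc (hx.1.trans_lt hx.2) x ⟨hx.1, hx.2.le⟩)
  rw [h1 t ht, h1 s hs]

namespace TruncSol

variable {κ l : ℝ} {N : ℕ} {φ : ℝ → ℝ} {S : Set ℝ} {u : ℝ → ℤ → ℂ}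

/-- The right-hand side of the truncated equation. -/
def rhs (κ l : ℝ) (N : ℕ) (c : ℝ) (a : ℤ → ℂ) (n : ℤ) : ℂ :=
  if n ∈ lowSet N then c * (I * n * ((n : ℂ) ^ 4 * a n + G κ l a n)) else 0

lemma rhs_support (κ l : ℝ) (N : ℕ) (c : ℝ) (a : ℤ → ℂ) : ∀ n ∉ lowSet N, rhs κ l N c a n = 0 :=
  fun _ hn => if_neg hn

lemma deriv_rhs (h : TruncSol κ l N φ S u) {t : ℝ} (ht : t ∈ S) (n : ℤ) :
    HasDerivWithinAt (fun t => u t n) (rhs κ l N (φ t) (u t) n) S t := by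
  by_cases hn : n ∈ lowSet N
  · rw [rhs, if_pos hn]
    exact h.deriv t ht n hn
  · rw [rhs, if_neg hn]
    simp only [h.supp _ n hn]
    exact hasDerivWithinAt_const _ _ _

lemma mul_neg (h : TruncSol κ l N φ S u) (t : ℝ) (n : ℤ) :
    u t n * u t (-n) = ((‖u t n‖ ^ 2 : ℝ) : ℂ) := StabData.mul_neg_eq (h.real t) n

lemma hasDeriv_mul_neg (h : TruncSol κ l N φ S u) {t : ℝ} (ht : t ∈ S) {n : ℤ}
    (hn : n ∈ lowSet N) : HasDerivWithinAt (fun t => u t n * u t (-n))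
      (φ t * StabData.dMass (G κ l (u t)) (u t) n) S t := by
  refine ((h.deriv t ht n hn).mul (h.deriv t ht (-n) (neg_mem_lowSet.2 hn))).congr_deriv ?_
  rw [StabData.dMass]
  push_cast
  ring

lemma mass_eq {a b : ℝ} (h : TruncSol κ l N φ (Icc a b) u) {s t : ℝ} (hs : s ∈ Icc a b)
    (ht : t ∈ Icc a b) : mass (u t) = mass (u s) := by
  have h1 : ∀ t, ((mass (u t) : ℝ) : ℂ) = ∑ n ∈ lowSet N, u t n * u t (-n) := fun t => by
    simp only [h.mul_neg]
    rw [← Complex.ofReal_sum, mass, tsum_eq_sum fun n hn => by simp [h.supp t n hn]]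
  have h2 : ∀ t ∈ Icc a b, HasDerivWithinAt (fun t => ∑ n ∈ lowSet N, u t n * u t (-n)) 0
      (Icc a b) t := fun t ht => by
    refine (HasDerivWithinAt.fun_sum fun n hn => h.hasDeriv_mul_neg ht hn).congr_deriv ?_
    have h3 := tsum_dMass_self (κ := κ) (l := l) (HBall.of_support (h.supp t))
    rw [tsum_eq_sum (s := lowSet N) fun n hn => by
      simp [StabData.dMass, h.supp t n hn, h.supp t (-n) (mt neg_mem_lowSet.1 hn)]] at h3
    rw [← Finset.mul_sum, h3, mul_zero]
  have h4 := eq_of_hasDerivWithinAt_zero h2 hs ht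
  rw [← h1, ← h1] at h4
  exact_mod_cast h4

lemma ham_eq {a b : ℝ} (h : TruncSol κ l N φ (Icc a b) u) {s t : ℝ} (hs : s ∈ Icc a b)
    (ht : t ∈ Icc a b) : ham κ l (u t) = ham κ l (u s) := by
  have h1 : ∀ t, ham κ l (u t) = ((∑ n ∈ lowSet N, (n : ℂ) ^ 4 * (u t n * u t (-n))) / 2 +
      potential κ l (u t)).re := fun t => by
    simp only [h.mul_neg]
    rw [ham, tsum_eq_sum (s := lowSet N) fun n hn => by simp [h.supp t n hn], Complex.add_re]
    congr 1
    have : (∑ n ∈ lowSet N, (n : ℂ) ^ 4 * ((‖u t n‖ ^ 2 : ℝ) : ℂ)) / 2 =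
        (((∑ n ∈ lowSet N, (n : ℝ) ^ 4 * ‖u t n‖ ^ 2) / 2 : ℝ) : ℂ) := by push_cast; rfl
    rw [this, Complex.ofReal_re]
  have h2 : ∀ t ∈ Icc a b, HasDerivWithinAt (fun t => (∑ n ∈ lowSet N, (n : ℂ) ^ 4 *
      (u t n * u t (-n))) / 2 + potential κ l (u t)) 0 (Icc a b) t := fun t ht => by
    refine (((HasDerivWithinAt.fun_sum fun n hn =>
      (h.hasDeriv_mul_neg ht hn).const_mul ((n : ℂ) ^ 4)).div_const 2).add
      (hasDerivWithinAt_potential κ l h.supp (rhs_support κ l N (φ t) (u t))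
        fun n => h.deriv_rhs ht n)).congr_deriv ?_
    have e1 := sum_lowSet_neg N fun n => (n : ℂ) ^ 5 * (u t n * G κ l (u t) (-n))
    have e2 := sum_lowSet_neg N fun n => (n : ℂ) * (G κ l (u t) n * G κ l (u t) (-n))
    simp only [Int.cast_neg, neg_neg] at e1 e2
    have e4 : ∀ n ∈ lowSet N, rhs κ l N (φ t) (u t) n * G κ l (u t) (-n) =
        φ t * I * ((n : ℂ) ^ 5 * (u t n * G κ l (u t) (-n)) +
          (n : ℂ) * (G κ l (u t) n * G κ l (u t) (-n))) := fun n hn => by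
      rw [rhs, if_pos hn]
      ring
    have e5 : ∑ n ∈ lowSet N, (n : ℂ) * (G κ l (u t) n * G κ l (u t) (-n)) = 0 := by
      have : ∑ n ∈ lowSet N, -(n : ℂ) * (G κ l (u t) (-n) * G κ l (u t) n) =
          -∑ n ∈ lowSet N, (n : ℂ) * (G κ l (u t) n * G κ l (u t) (-n)) := by
        rw [← Finset.sum_neg_distrib]
        exact Finset.sum_congr rfl fun n _ => by ring
      rw [this] at e2
      linear_combination -(1 / 2 : ℂ) * e2
    rw [Finset.sum_congr rfl e4, ← Finset.mul_sum, Finset.sum_add_distrib, e5, add_zero]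
    have e6 : ∑ n ∈ lowSet N, (n : ℂ) ^ 4 * (φ t * StabData.dMass (G κ l (u t)) (u t) n) =
        φ t * I * (∑ n ∈ lowSet N, (-(n : ℂ)) ^ 5 * (u t (-n) * G κ l (u t) n)) * (-1) -
        φ t * I * ∑ n ∈ lowSet N, (n : ℂ) ^ 5 * (u t n * G κ l (u t) (-n)) := by
      rw [Finset.mul_sum, Finset.mul_sum, Finset.sum_mul, ← Finset.sum_sub_distrib]
      refine Finset.sum_congr rfl fun n _ => ?_
      rw [StabData.dMass]
      push_cast
      ring
    rw [e6, e1]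
    ring
  rw [h1, h1, eq_of_hasDerivWithinAt_zero h2 hs ht]

end TruncSol

namespace TruncSol

variable {N : ℕ}

/-- Extension by zero of a vector of low-frequency coefficients. -/
def ext (a : lowSet N → ℂ) (n : ℤ) : ℂ := if h : n ∈ lowSet N then a ⟨n, h⟩ else 0

/-- The real part of the extension. -/
def symExt (a : lowSet N → ℂ) (n : ℤ) : ℂ := (ext a n + conj (ext a (-n))) / 2

lemma symExt_support (a : lowSet N → ℂ) : ∀ n ∉ lowSet N, symExt a n = 0 := fun n hn => by
  simp [symExt, ext, hn, neg_mem_lowSet]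

lemma symExt_real (a : lowSet N → ℂ) : IsRealCoeff (symExt a) := fun n => by
  simp only [symExt, map_div₀, map_add, map_ofNat, Complex.conj_conj, neg_neg]
  ring

lemma contDiff_symExt (n : ℤ) : ContDiff ℝ 1 fun a : lowSet N → ℂ => symExt a n := by
  have h : ∀ n, ContDiff ℝ 1 fun a : lowSet N → ℂ => ext a n := fun n => by
    by_cases hn : n ∈ lowSet N
    · simp only [ext, hn, dif_pos]
      exact contDiff_apply ℝ ℂ _
    · simp only [ext, hn, dif_neg, not_false_eq_true]
      exact contDiff_const
  exact ((h n).add (Complex.conjCLE.contDiff.comp (h (-n)))).div_const 2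

lemma contDiff_conv {f g : (lowSet N → ℂ) → ℤ → ℂ} (h0 : ∀ a, ∀ n ∉ lowSet N, f a n = 0)
    (hf : ∀ n, ContDiff ℝ 1 fun a => f a n) (hg : ∀ n, ContDiff ℝ 1 fun a => g a n) (n : ℤ) :
    ContDiff ℝ 1 fun a => conv (f a) (g a) n := by
  simp only [conv_eq_sum (h0 _)]
  exact ContDiff.sum fun m _ => (hf m).mul (hg (n - m))

lemma contDiff_cpow : ∀ (k : ℕ) (n : ℤ),
    ContDiff ℝ 1 fun a : lowSet N → ℂ => cpow (symExt a) k n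
  | 0, n => contDiff_symExt n
  | k + 1, n => contDiff_conv symExt_support contDiff_symExt (contDiff_cpow k) n

lemma contDiff_G (κ l : ℝ) (n : ℤ) : ContDiff ℝ 1 fun a : lowSet N → ℂ => G κ l (symExt a) n := by
  simp only [(HBall.of_support (symExt_support _)).G_eq]
  refine (contDiff_const.mul ((contDiff_const.mul (contDiff_cpow 2 n)).add
    (contDiff_const.mul (contDiff_conv (fun a => sqMul_support (symExt_support a)) (fun m => ?_)
      (contDiff_cpow 1) n)))).sub (contDiff_const.mul (contDiff_cpow 4 n))
  exact contDiff_const.mul (contDiff_symExt m)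

/-- The truncated vector field, cut off outside a ball. -/
def field (κ l : ℝ) (φ : ContDiffBump (0 : lowSet N → ℂ)) (a : lowSet N → ℂ) : lowSet N → ℂ :=
  fun n => rhs κ l N (φ a) (symExt a) n

lemma contDiff_field (κ l : ℝ) (φ : ContDiffBump (0 : lowSet N → ℂ)) :
    ContDiff ℝ 1 (field κ l φ) := by
  rw [contDiff_pi]
  intro n
  simp only [field, rhs, n.2, if_pos]
  exact (Complex.ofRealCLM.contDiff.comp φ.contDiff).mul (contDiff_const.mul
    ((contDiff_const.mul (contDiff_symExt _)).add (contDiff_G κ l _)))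

lemma hasCompactSupport_field (κ l : ℝ) (φ : ContDiffBump (0 : lowSet N → ℂ)) :
    HasCompactSupport (field κ l φ) :=
  φ.hasCompactSupport.mono fun a ha => by
    contrapose! ha
    simp only [Function.mem_support, not_not] at ha ⊢
    funext n
    simp [field, rhs, ha]

lemma exists_integral_curve {E : Type*} [NormedAddCommGroup E] [NormedSpace ℝ E] [CompleteSpace E]
    {f : E → E} (hf : ContDiff ℝ 1 f) (hc : HasCompactSupport f) (x₀ : E) {T : ℝ} (hT : 0 ≤ T) :
    ∃ x : ℝ → E, x 0 = x₀ ∧ ∀ t ∈ Icc (-T) T, HasDerivWithinAt x (f (x t)) (Icc (-T) T) t := by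
  obtain ⟨K, hK⟩ := ContDiff.lipschitzWith_of_hasCompactSupport hc hf one_ne_zero
  obtain ⟨C, hC⟩ := hc.exists_bound_of_continuous hf.continuous
  have h0 : (0 : ℝ) ∈ Icc (-T) T := ⟨by linarith, hT⟩
  have hpl : IsPicardLindelof (fun _ => f) (⟨0, h0⟩ : Icc (-T) T) x₀
      (C.toNNReal * T.toNNReal) 0 C.toNNReal K :=
    { lipschitzOnWith := fun _ _ => hK.lipschitzOnWith
      continuousOn := fun _ _ => continuousOn_const
      norm_le := fun _ _ x _ => (hC x).trans (Real.le_coe_toNNReal C)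
      mul_max_le := by simp [hT] }
  obtain ⟨x, hx0, hx⟩ := hpl.exists_eq_forall_mem_Icc_hasDerivWithinAt₀
  exact ⟨x, hx0, hx⟩

/-- Global existence for the truncated equation. -/
theorem exists_truncSol (κ l : ℝ) (N : ℕ) {T : ℝ} (hT : 0 ≤ T) {u₀ : ℤ → ℂ}
    (h0 : ∀ n ∉ lowSet N, u₀ n = 0) (hr : IsRealCoeff u₀) :
    ∃ u : ℝ → ℤ → ℂ, u 0 = u₀ ∧ TruncSol κ l N (fun _ => 1) (Icc (-T) T) u := by
  obtain ⟨φ, hφ⟩ : ∃ φ : ContDiffBump (0 : lowSet N → ℂ), φ.rIn = Real.sqrt (mass u₀) + 1 :=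
    ⟨⟨Real.sqrt (mass u₀) + 1, Real.sqrt (mass u₀) + 2, by positivity, by linarith⟩, rfl⟩
  obtain ⟨x, hx0, hx⟩ := exists_integral_curve (contDiff_field κ l φ)
    (hasCompactSupport_field κ l φ) (fun n => u₀ n) hT
  have hI : (0 : ℝ) ∈ Icc (-T) T := ⟨by linarith, hT⟩
  have hs0 : symExt (x 0) = u₀ := by
    have he : ext (x 0) = u₀ := by
      funext n
      by_cases hn : n ∈ lowSet N <;> simp [ext, hx0, hn, h0]
    funext n
    rw [symExt, he, hr, neg_neg]
    ring
  have hd : ∀ t ∈ Icc (-T) T, ∀ n, HasDerivWithinAt (fun t => ext (x t) n)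
      (rhs κ l N (φ (x t)) (symExt (x t)) n) (Icc (-T) T) t := fun t ht n => by
    by_cases hn : n ∈ lowSet N
    · simp only [ext, hn, dif_pos]
      exact hasDerivWithinAt_pi.1 (hx t ht) ⟨n, hn⟩
    · simp only [ext, rhs, hn, dif_neg, if_neg, not_false_eq_true]
      exact hasDerivWithinAt_const _ _ _
  have hrc : ∀ (c : ℝ) (a : lowSet N → ℂ), IsRealCoeff (rhs κ l N c (symExt a)) := fun c a n => by
    by_cases hn : n ∈ lowSet N
    · simp only [rhs, hn, neg_mem_lowSet.2 hn, if_pos, map_mul, map_add, map_pow, map_intCast,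
        Complex.conj_ofReal, Complex.conj_I, symExt_real a n,
        G_conj (HBall.of_support (symExt_support a)) (symExt_real a) κ l n]
      push_cast
      ring
    · simp [rhs, hn, neg_mem_lowSet]
  have hds : ∀ t ∈ Icc (-T) T, ∀ n, HasDerivWithinAt (fun t => symExt (x t) n)
      (rhs κ l N (φ (x t)) (symExt (x t)) n) (Icc (-T) T) t := fun t ht n => by
    refine (((hd t ht n).add (Complex.conjCLE.toContinuousLinearMap.hasFDerivAt.comp_hasDerivWithinAt t
      (hd t ht (-n)))).div_const 2).congr_deriv ?_
    have := hrc (φ (x t)) (x t) (-n)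
    rw [neg_neg] at this
    change (_ + conj _) / 2 = _
    rw [this]
    ring
  have hsol : TruncSol κ l N (fun t => φ (x t)) (Icc (-T) T) fun t => symExt (x t) :=
    ⟨fun t => symExt_support _, fun t => symExt_real _, fun t ht n hn => by
      have := hds t ht n
      rwa [rhs, if_pos hn] at this⟩
  have heq : ∀ t ∈ Icc (-T) T, ∀ n, ext (x t) n = symExt (x t) n := fun t ht n => by
    have h1 := eq_of_hasDerivWithinAt_zero
      (fun t ht => ((hd t ht n).sub (hds t ht n)).congr_deriv (sub_self _)) hI ht
    have h2 : ext (x 0) n = symExt (x 0) n := by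
      rw [hs0]
      by_cases hn : n ∈ lowSet N <;> simp [ext, hx0, hn, h0]
    simp only [Pi.sub_apply, h2, sub_self] at h1
    exact sub_eq_zero.1 h1
  have hone : ∀ t ∈ Icc (-T) T, φ (x t) = 1 := fun t ht => by
    refine φ.one_of_mem_closedBall ?_
    rw [mem_closedBall_zero_iff, hφ, pi_norm_le_iff_of_nonneg (by positivity)]
    intro n
    have h1 : x t n = symExt (x t) n := by
      rw [← heq t ht, ext, dif_pos n.2]
    have h2 : ‖symExt (x t) n‖ ^ 2 ≤ mass u₀ := by
      rw [← hs0, ← hsol.mass_eq hI ht]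
      exact (HBall.of_support (symExt_support (x t))).summable_sq.le_tsum _
        fun _ _ => sq_nonneg _
    rw [h1]
    exact (Real.le_sqrt (norm_nonneg _) (h2.trans' (sq_nonneg _)) |>.2 h2).trans (by linarith)
  exact ⟨fun t => symExt (x t), hs0, hsol.supp, hsol.real, fun t ht n hn => by
    have := hsol.deriv t ht n hn
    rwa [hone t ht] at this⟩

end TruncSol

/-! ### Compactness and existence. -/

lemma integral_eq_sub_of_hasDerivWithinAt_Icc {f g : ℝ → ℂ} {a b : ℝ}
    (hf : ∀ t ∈ Icc a b, HasDerivWithinAt f (g t) (Icc a b) t) (hg : ContinuousOn g (Icc a b))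
    {s t : ℝ} (hs : s ∈ Icc a b) (ht : t ∈ Icc a b) : ∫ τ in s..t, g τ = f t - f s := by
  have key : ∀ s t, s ∈ Icc a b → t ∈ Icc a b → s ≤ t → ∫ τ in s..t, g τ = f t - f s :=
    fun s t hs ht hst => by
      have hsub : Icc s t ⊆ Icc a b := Icc_subset_Icc hs.1 ht.2
      refine intervalIntegral.integral_eq_sub_of_hasDeriv_right_of_le hst
        (fun x hx => ((hf x (hsub hx)).mono hsub).continuousWithinAt) (fun x hx => ?_)
        ((hg.mono hsub).intervalIntegrable_of_Icc hst)
      exact ((hf x (hsub (Ioo_subset_Icc_self hx))).hasDerivAt (Icc_mem_nhds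
        (hs.1.trans_lt hx.1) (hx.2.trans_le ht.2))).hasDerivWithinAt
  rcases le_total s t with h | h
  · exact key s t hs ht h
  · rw [intervalIntegral.integral_symm, key t s ht hs h, neg_sub]

lemma hasDerivWithinAt_of_integral_eq {f g : ℝ → ℂ} {a b s : ℝ} (hs : s ∈ Icc a b)
    (hg : ContinuousOn g (Icc a b)) (h : ∀ t ∈ Icc a b, f t = f s + ∫ τ in s..t, g τ) :
    ∀ t ∈ Icc a b, HasDerivWithinAt f (g t) (Icc a b) t := fun t ht => by
  have hab : a ≤ b := hs.1.trans hs.2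
  set e : ℝ → ℂ := IccExtend hab (domRestrict (Icc a b) g) with he
  have hec : Continuous e := (continuousOn_iff_continuous_domRestrict.1 hg).Icc_extend'
  have heq : ∀ τ ∈ Icc a b, e τ = g τ := fun τ hτ => by
    rw [he, IccExtend_of_mem hab _ hτ, domRestrict_apply]
  have h1 := (intervalIntegral.integral_hasDerivAt_right (hec.intervalIntegrable s t)
    (hec.stronglyMeasurableAtFilter _ _) hec.continuousAt).const_add (f s)
  rw [heq t ht] at h1
  have h2 : ∀ x ∈ Icc a b, f x = f s + ∫ τ in s..x, e τ := fun x hx => by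
    rw [h x hx]
    congr 1
    refine intervalIntegral.integral_congr fun τ hτ => (heq τ ?_).symm
    exact (uIcc_subset_Icc hs hx) hτ
  exact h1.hasDerivWithinAt.congr h2 (h2 t ht)

lemma exists_subseq_tendsto {T : ℝ} (hT : 0 ≤ T) {u : ℕ → ℝ → ℤ → ℂ} {B L : ℤ → ℝ}
    (hB : ∀ k, ∀ t ∈ Icc (-T) T, ∀ n, ‖u k t n‖ ≤ B n)
    (hL : ∀ k, ∀ s ∈ Icc (-T) T, ∀ t ∈ Icc (-T) T, ∀ n, ‖u k t n - u k s n‖ ≤ L n * |t - s|) :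
    ∃ (φ : ℕ → ℕ) (v : ℝ → ℤ → ℂ), StrictMono φ ∧ ∀ t ∈ Icc (-T) T, ∀ n,
      Filter.Tendsto (fun k => u (φ k) t n) Filter.atTop (nhds (v t n)) := by
  have hab : -T ≤ T := by linarith
  set w : ℕ → ℝ → ℤ → ℂ := fun k t => u k (projIcc (-T) T hab t) with hw
  have hwL : ∀ k s t n, ‖w k t n - w k s n‖ ≤ |L n| * |t - s| := fun k s t n =>
    (hL k _ (projIcc (-T) T hab s).2 _ (projIcc (-T) T hab t).2 n).trans
      (mul_le_mul (le_abs_self _) (abs_projIcc_sub_projIcc hab) (abs_nonneg _) (abs_nonneg _))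
  obtain ⟨x, -, φ, hφ, hx⟩ := (isCompact_univ_pi fun i : ℚ × ℤ =>
    isCompact_closedBall (0 : ℂ) (B i.2)).tendsto_subseq (x := fun k i => w k i.1 i.2)
    fun k i _ => by
      rw [mem_closedBall_zero_iff]
      exact hB k _ (projIcc (-T) T hab i.1).2 i.2
  rw [tendsto_pi_nhds] at hx
  have hc : ∀ t n, CauchySeq fun k => w (φ k) t n := fun t n => by
    rw [Metric.cauchySeq_iff']
    intro ε hε
    have hp : 0 < ε / (4 * (|L n| + 1)) := by positivity
    obtain ⟨q, hq1, hq2⟩ := exists_rat_btwn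
      (show t < t + ε / (4 * (|L n| + 1)) by linarith)
    obtain ⟨N, hN⟩ := Metric.cauchySeq_iff'.1 (hx (q, n)).cauchySeq (ε / 2) (by positivity)
    refine ⟨N, fun k hk => ?_⟩
    have h1 := hN k hk
    have h0 : |L n| * |(q : ℝ) - t| ≤ ε / 4 := by
      rw [abs_of_pos (by linarith : (0 : ℝ) < q - t)]
      calc |L n| * ((q : ℝ) - t) ≤ (|L n| + 1) * (ε / (4 * (|L n| + 1))) := by
            have := abs_nonneg (L n)
            refine mul_le_mul (by linarith) (by linarith) (by linarith) (by linarith)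
        _ = ε / 4 := by
            have : |L n| + 1 ≠ 0 := by positivity
            field_simp
    have h2 := (hwL (φ k) t q n).trans h0
    have h3 := (hwL (φ N) t q n).trans h0
    simp only [Function.comp_apply, dist_eq_norm] at h1 ⊢
    have h4 : w (φ k) t n - w (φ N) t n = (w (φ k) q n - w (φ N) q n) -
        (w (φ k) q n - w (φ k) t n) + (w (φ N) q n - w (φ N) t n) := by ring
    rw [h4]
    refine (norm_add_le _ _).trans_lt ?_
    linarith [norm_sub_le (w (φ k) q n - w (φ N) q n) (w (φ k) q n - w (φ k) t n)]
  choose v hv using fun t n => cauchySeq_tendsto_of_complete (hc t n)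
  refine ⟨φ, v, hφ, fun t ht n => ?_⟩
  have := hv t n
  simpa only [hw, projIcc_of_mem hab ht] using this

lemma continuousOn_G_of {κ l R : ℝ} {S : Set ℝ} {u : ℝ → ℤ → ℂ} (hR : ∀ t ∈ S, HBall R (u t))
    (hu : ∀ n, ContinuousOn (fun t => u t n) S) (n : ℤ) :
    ContinuousOn (fun t => G κ l (u t) n) S := fun t ht => by
  have : (nhdsWithin t S).NeBot := nhdsWithin_neBot_of_mem ht
  exact tendsto_G κ l (Filter.eventually_of_mem self_mem_nhdsWithin hR) (fun m => hu m t ht) n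

lemma norm_G_le (κ l : ℝ) {R : ℝ} {a : ℤ → ℂ} (h : HBall R a) (n : ℤ) :
    ‖G κ l a n‖ ≤ 1 + stabConst κ l R := by
  have h1 := (stabData_self (κ := κ) (l := l) h).γ_bdd.apply_le n
  nlinarith [sq_nonneg (‖G κ l a n‖ - 1), norm_nonneg (G κ l a n)]

lemma exists_norm_potential_le (κ l R : ℝ) : ∃ P, ∀ a, HBall R a → ‖potential κ l a‖ ≤ P :=
  ⟨_, fun _ h => norm_potential_le κ l (h.maj.W1 fun _ => le_rfl).l1 h.mass_bdd h.four_bdd⟩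

/-- The truncation of a sequence to `lowSet N`. -/
def trunc (N : ℕ) (a : ℤ → ℂ) (n : ℤ) : ℂ := if n ∈ lowSet N then a n else 0

lemma norm_trunc_le (N : ℕ) (a : ℤ → ℂ) (n : ℤ) : ‖trunc N a n‖ ≤ ‖a n‖ := by
  by_cases hn : n ∈ lowSet N <;> simp [trunc, hn]

lemma trunc_real (N : ℕ) {a : ℤ → ℂ} (h : IsRealCoeff a) : IsRealCoeff (trunc N a) := fun n => by
  by_cases hn : n ∈ lowSet N
  · simp only [trunc, hn, neg_mem_lowSet.2 hn, if_pos, h n]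
  · simp [trunc, hn, neg_mem_lowSet]

lemma eventually_mem_lowSet (n : ℤ) : ∀ᶠ N in Filter.atTop, n ∈ lowSet N :=
  (Filter.eventually_ge_atTop n.natAbs).mono fun N hN => by
    simp only [lowSet, Finset.mem_Icc]
    omega

lemma tendsto_trunc (a : ℤ → ℂ) (n : ℤ) :
    Filter.Tendsto (fun N => trunc N a n) Filter.atTop (nhds (a n)) :=
  tendsto_const_nhds.congr' ((eventually_mem_lowSet n).mono fun N hN => by simp [trunc, hN])

lemma HBall.trunc {R : ℝ} {a : ℤ → ℂ} (h : HBall R a) (N : ℕ) : HBall R (trunc N a) :=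
  BddSum.mono h (fun _ => by positivity) fun n => by
    have := norm_trunc_le N a n
    gcongr

lemma ham_trunc_le (κ l : ℝ) {R : ℝ} {a : ℤ → ℂ} (h : HBall R a) (N : ℕ) :
    ham κ l (trunc N a) ≤ (∑' n : ℤ, (n : ℝ) ^ 4 * ‖a n‖ ^ 2) / 2 +
      (potential κ l (trunc N a)).re := by
  have := (h.trunc N).four_bdd.summable.tsum_le_tsum (fun n => by
    have := norm_trunc_le N a n
    gcongr) h.four_bdd.summable
  rw [ham]
  linarith

lemma ham_le_of_norm_potential_le {κ l R P : ℝ} {a : ℤ → ℂ} (h : HBall R a)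
    (hP : ‖potential κ l a‖ ≤ P) : ham κ l a ≤ R / 2 + P := by
  have h1 := h.four_bdd.tsum_le
  have h2 := (Complex.re_le_norm (potential κ l a)).trans hP
  rw [ham]
  linarith

lemma TruncSol.exists_hBall (κ l R₀ : ℝ) : ∃ R, ∀ (N : ℕ) (T : ℝ) (u : ℝ → ℤ → ℂ), 0 ≤ T →
    HBall R₀ (u 0) → TruncSol κ l N (fun _ => 1) (Icc (-T) T) u →
    ∀ t ∈ Icc (-T) T, HBall R (u t) := by
  obtain ⟨P, hP⟩ := exists_norm_potential_le κ l R₀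
  obtain ⟨R, hR⟩ := exists_hBall_of_ham_le κ l R₀ (R₀ / 2 + P)
  refine ⟨R, fun N T u hT hB h t ht => hR _ _ (HBall.of_support (h.supp t)) ?_ ?_⟩
  · rw [h.mass_eq (s := 0) ⟨by linarith, hT⟩ ht]
    exact hB.mass_bdd.tsum_le
  · rw [h.ham_eq (s := 0) ⟨by linarith, hT⟩ ht]
    exact ham_le_of_norm_potential_le hB (hP _ hB)

lemma norm_flux_le {κ l R : ℝ} {a : ℤ → ℂ} (h : HBall R a) (n : ℤ) :
    ‖I * (n : ℂ) * ((n : ℂ) ^ 4 * a n + G κ l a n)‖ ≤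
      |(n : ℝ)| * (|(n : ℝ)| ^ 4 * ballMaj R n + (1 + stabConst κ l R)) := by
  rw [norm_mul, norm_mul, norm_I, one_mul, norm_intCast_eq]
  refine mul_le_mul_of_nonneg_left ((norm_add_le _ _).trans (add_le_add ?_ (norm_G_le κ l h n)))
    (abs_nonneg _)
  rw [norm_mul, norm_pow, norm_intCast_eq]
  exact mul_le_mul_of_nonneg_left (h.apply_le n) (by positivity)

lemma TruncSol.lipschitz {κ l R T : ℝ} {N : ℕ} {u : ℝ → ℤ → ℂ}
    (h : TruncSol κ l N (fun _ => 1) (Icc (-T) T) u) (hR : ∀ t ∈ Icc (-T) T, HBall R (u t))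
    {s t : ℝ} (hs : s ∈ Icc (-T) T) (ht : t ∈ Icc (-T) T) (n : ℤ) :
    ‖u t n - u s n‖ ≤
      |(n : ℝ)| * (|(n : ℝ)| ^ 4 * ballMaj R n + (1 + stabConst κ l R)) * |t - s| := by
  have h0 : 0 ≤ |(n : ℝ)| * (|(n : ℝ)| ^ 4 * ballMaj R n + (1 + stabConst κ l R)) :=
    (norm_nonneg _).trans (norm_flux_le (κ := κ) (l := l) (hR t ht) n)
  by_cases hn : n ∈ lowSet N
  · exact (convex_Icc (-T) T).norm_image_sub_le_of_norm_hasDerivWithin_le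
      (fun τ hτ => h.deriv τ hτ n hn) (fun τ hτ => by
        simpa only [ofReal_one, one_mul] using norm_flux_le (hR τ hτ) n) hs ht
  · rw [h.supp t n hn, h.supp s n hn, sub_zero, norm_zero]
    positivity

lemma ham_le_of_tendsto_trunc {κ l R R₀ : ℝ} {a : ℕ → ℤ → ℂ} {u₀ b : ℤ → ℂ} {φ : ℕ → ℕ}
    (hφ : Filter.Tendsto φ Filter.atTop Filter.atTop) (h₀ : HBall R₀ u₀)
    (hR : ∀ k, HBall R (a k)) (ha : ∀ n, Filter.Tendsto (fun k => a k n) Filter.atTop (nhds (b n)))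
    (hh : ∀ k, ham κ l (a k) = ham κ l (trunc (φ k) u₀)) : ham κ l b ≤ ham κ l u₀ := by
  have hb : HBall R b := HBall.of_tendsto (.of_forall hR) ha
  have p1 : Filter.Tendsto (fun k => (potential κ l (a k)).re) Filter.atTop
      (nhds (potential κ l b).re) :=
    (Complex.continuous_re.tendsto _).comp (tendsto_potential κ l (.of_forall hR) ha)
  have p2 : Filter.Tendsto (fun k => (potential κ l (trunc (φ k) u₀)).re) Filter.atTop
      (nhds (potential κ l u₀).re) :=
    (Complex.continuous_re.tendsto _).comp (tendsto_potential κ l (.of_forall fun k => h₀.trunc _)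
      fun n => (tendsto_trunc u₀ n).comp hφ)
  have key : BddSum (fun n : ℤ => (n : ℝ) ^ 4 * ‖b n‖ ^ 2)
      (2 * (ham κ l u₀ - (potential κ l b).re)) := by
    refine ⟨fun n => by positivity, fun s => ?_⟩
    have e : ham κ l u₀ - (potential κ l b).re = (∑' n : ℤ, (n : ℝ) ^ 4 * ‖u₀ n‖ ^ 2) / 2 +
        (potential κ l u₀).re - (potential κ l b).re := rfl
    rw [e]
    refine le_of_tendsto_of_tendsto' (tendsto_finsetSum s fun n _ => ((ha n).norm.pow 2).const_mul _)
      (((p2.const_add _).sub p1).const_mul 2) fun k => ?_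
    have h1 := ham_trunc_le κ l h₀ (φ k)
    have h2 := (hR k).four_bdd.summable.sum_le_tsum s fun n _ => by positivity
    have h3 := hh k
    rw [ham] at h3
    linarith
  have := key.tsum_le
  rw [ham]
  linarith

lemma TruncSol.continuousOn_flux {κ l R T : ℝ} {N : ℕ} {u : ℝ → ℤ → ℂ}
    (h : TruncSol κ l N (fun _ => 1) (Icc (-T) T) u) (hR : ∀ t ∈ Icc (-T) T, HBall R (u t))
    (n : ℤ) : ContinuousOn (fun t => I * (n : ℂ) * ((n : ℂ) ^ 4 * u t n + G κ l (u t) n))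
      (Icc (-T) T) := by
  have hc : ∀ n, ContinuousOn (fun t => u t n) (Icc (-T) T) := fun n => by
    by_cases hn : n ∈ lowSet N
    · exact fun t ht => (h.deriv t ht n hn).continuousWithinAt
    · simp only [h.supp _ n hn]
      exact continuousOn_const
  exact continuousOn_const.mul ((continuousOn_const.mul (hc n)).add (continuousOn_G_of hR hc n))

/-- Existence of a solution whose Hamiltonian does not exceed its initial value. -/
theorem exists_weakSol (κ l : ℝ) {T R₀ : ℝ} (hT : 0 ≤ T) {u₀ : ℤ → ℂ} (h₀ : HBall R₀ u₀)
    (hr : IsRealCoeff u₀) : ∃ (R : ℝ) (u : ℝ → ℤ → ℂ), u 0 = u₀ ∧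
      WeakSol κ l R (Icc (-T) T) u ∧ ∀ t ∈ Icc (-T) T, ham κ l (u t) ≤ ham κ l u₀ := by
  have h0 : (0 : ℝ) ∈ Icc (-T) T := ⟨by linarith, hT⟩
  obtain ⟨R, hR⟩ := TruncSol.exists_hBall κ l R₀
  choose u hu0 hu using fun N : ℕ => TruncSol.exists_truncSol κ l N hT (u₀ := trunc N u₀)
    (fun n hn => by simp [trunc, hn]) (trunc_real N hr)
  have hB : ∀ N, ∀ t ∈ Icc (-T) T, HBall R (u N t) := fun N =>
    hR N T (u N) hT (by rw [hu0]; exact h₀.trunc N) (hu N)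
  obtain ⟨φ, v, hφ, hv⟩ := exists_subseq_tendsto hT (fun k t ht n => (hB k t ht).apply_le n)
    (fun k s hs t ht n => (hu k).lipschitz (hB k) hs ht n)
  have hφ' := hφ.tendsto_atTop
  have hvB : ∀ t ∈ Icc (-T) T, HBall R (v t) := fun t ht =>
    HBall.of_tendsto (.of_forall fun k => hB (φ k) t ht) (hv t ht)
  have hv0 : v 0 = u₀ := funext fun n => tendsto_nhds_unique (hv 0 h0 n) <| by
    simp only [hu0]
    exact (tendsto_trunc u₀ n).comp hφ'
  have hvc : ∀ n, ContinuousOn (fun t => v t n) (Icc (-T) T) := fun n => by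
    refine LipschitzOnWith.continuousOn (K := Real.toNNReal
      (|(n : ℝ)| * (|(n : ℝ)| ^ 4 * ballMaj R n + (1 + stabConst κ l R)))) ?_
    refine LipschitzOnWith.of_dist_le_mul fun t ht s hs => ?_
    rw [dist_eq_norm, Real.dist_eq, Real.coe_toNNReal _ ((norm_nonneg _).trans
      (norm_flux_le (κ := κ) (l := l) (hvB t ht) n))]
    exact le_of_tendsto' ((hv t ht n).sub (hv s hs n)).norm fun k =>
      (hu (φ k)).lipschitz (hB (φ k)) hs ht n
  have hfc : ∀ n : ℤ, ContinuousOn (fun t => I * (n : ℂ) * ((n : ℂ) ^ 4 * v t n + G κ l (v t) n))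
      (Icc (-T) T) := fun n => continuousOn_const.mul ((continuousOn_const.mul (hvc n)).add
        (continuousOn_G_of hvB hvc n))
  refine ⟨R, v, hv0, ⟨hvB, fun t ht n => ?_, fun t ht n => ?_⟩, fun t ht => ?_⟩
  · refine tendsto_nhds_unique (f := fun k => conj (u (φ k) t n)) (l := Filter.atTop) ?_ ?_
    · exact (Complex.continuous_conj.tendsto _).comp (hv t ht n)
    · simp only [(hu _).real t n]
      exact hv t ht (-n)
  · have hd : ∀ t ∈ Icc (-T) T, v t n = v 0 n +
        ∫ τ in (0 : ℝ)..t, I * (n : ℂ) * ((n : ℂ) ^ 4 * v τ n + G κ l (v τ) n) := fun t ht => by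
      have hsub : Set.uIoc 0 t ⊆ Icc (-T) T := uIoc_subset_uIcc.trans (uIcc_subset_Icc h0 ht)
      have hl := intervalIntegral.tendsto_integral_filter_of_dominated_convergence (μ := volume)
        (a := 0) (b := t) (l := Filter.atTop)
        (F := fun k τ => I * (n : ℂ) * ((n : ℂ) ^ 4 * u (φ k) τ n + G κ l (u (φ k) τ) n))
        (f := fun τ => I * (n : ℂ) * ((n : ℂ) ^ 4 * v τ n + G κ l (v τ) n))
        (fun _ => |(n : ℝ)| * (|(n : ℝ)| ^ 4 * ballMaj R n + (1 + stabConst κ l R)))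
        ?_ ?_ ?_ ?_
      · have hl2 := ((hv t ht n).sub (hv 0 h0 n)).congr' (f₂ := fun k => ∫ τ in (0 : ℝ)..t,
          I * (n : ℂ) * ((n : ℂ) ^ 4 * u (φ k) τ n + G κ l (u (φ k) τ) n)) ?_
        · rw [← tendsto_nhds_unique hl2 hl]
          ring
        · filter_upwards [hφ'.eventually (eventually_mem_lowSet n)] with k hk
          refine (integral_eq_sub_of_hasDerivWithinAt_Icc (f := fun τ => u (φ k) τ n) (fun τ hτ => ?_) ?_ h0 ht).symm
          · simpa only [ofReal_one, one_mul] using (hu (φ k)).deriv τ hτ n hk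
          · exact (hu (φ k)).continuousOn_flux (hB (φ k)) n
      · refine .of_forall fun k => ?_
        exact (((hu (φ k)).continuousOn_flux (hB (φ k)) n).mono hsub).aestronglyMeasurable
          measurableSet_uIoc
      · exact .of_forall fun k => .of_forall fun τ hτ => norm_flux_le (hB _ τ (hsub hτ)) n
      · exact intervalIntegrable_const
      · refine .of_forall fun τ hτ => ?_
        exact (((hv τ (hsub hτ) n).const_mul _).add (tendsto_G κ l
          (.of_forall fun k => hB (φ k) τ (hsub hτ)) (hv τ (hsub hτ)) n)).const_mul _
    have := hasDerivWithinAt_of_integral_eq h0 (hfc n) hd t ht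
    convert this using 1
    ring
  · refine ham_le_of_tendsto_trunc hφ' h₀ (fun k => hB (φ k) t ht) (hv t ht) fun k => ?_
    rw [(hu (φ k)).ham_eq h0 ht, hu0]

/-! ### Conservation of the Hamiltonian and strong continuity. -/

lemma WeakSol.comp_add_const {κ l R a b : ℝ} {u : ℝ → ℤ → ℂ} (h : WeakSol κ l R (Icc a b) u)
    (r : ℝ) : WeakSol κ l R (Icc (a - r) (b - r)) (fun t => u (t + r)) := by
  have hm : MapsTo (fun t => t + r) (Icc (a - r) (b - r)) (Icc a b) := fun t ht =>
    ⟨by linarith [ht.1], by linarith [ht.2]⟩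
  refine ⟨fun t ht => h.ball _ (hm ht), fun t ht => h.real _ (hm ht), fun t ht n => ?_⟩
  have h1 := (h.deriv _ (hm ht) n).scomp t ((hasDerivWithinAt_id t _).add_const r) hm
  rw [one_smul] at h1
  exact h1

lemma WeakSol.ham_le {κ l R a b : ℝ} {u : ℝ → ℤ → ℂ} (h : WeakSol κ l R (Icc a b) u) {s t : ℝ}
    (hs : s ∈ Icc a b) (ht : t ∈ Icc a b) : ham κ l (u t) ≤ ham κ l (u s) := by
  have hab := hs.1.trans hs.2
  obtain ⟨R', w, hw0, hw, hwh⟩ := exists_weakSol κ l (sub_nonneg.2 hab) (h.ball s hs) (h.real s hs)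
  have h1 : WeakSol κ l R' (Icc a b) (fun t => w (t + -s)) :=
    (hw.comp_add_const (-s)).mono fun t ht => ⟨by linarith [ht.1, hs.2], by linarith [ht.2, hs.1]⟩
  have h2 := (h.le (le_max_left R R')).unique (h1.le (le_max_right R R')) hs
    (by simp [hw0]) ht
  rw [h2]
  exact hwh _ ⟨by linarith [ht.1, hs.2], by linarith [ht.2, hs.1]⟩

lemma WeakSol.ham_eq {κ l R a b : ℝ} {u : ℝ → ℤ → ℂ} (h : WeakSol κ l R (Icc a b) u) {s t : ℝ}
    (hs : s ∈ Icc a b) (ht : t ∈ Icc a b) : ham κ l (u t) = ham κ l (u s) :=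
  (h.ham_le hs ht).antisymm (h.ham_le ht hs)

open Filter Topology in
lemma tendsto_tsum_sub_sq {ι : Type*} {𝓕 : Filter ι} {w : ℤ → ℝ} (hw : ∀ n, 0 ≤ w n)
    {a : ι → ℤ → ℂ} {b : ℤ → ℂ} (ha : ∀ᶠ k in 𝓕, Summable fun n => w n * ‖a k n‖ ^ 2)
    (hb : Summable fun n => w n * ‖b n‖ ^ 2) (ht : ∀ n, Tendsto (fun k => a k n) 𝓕 (𝓝 (b n)))
    (hn : Tendsto (fun k => ∑' n, w n * ‖a k n‖ ^ 2) 𝓕 (𝓝 (∑' n, w n * ‖b n‖ ^ 2))) :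
    Tendsto (fun k => ∑' n, w n * ‖a k n - b n‖ ^ 2) 𝓕 (𝓝 0) := by
  rw [Metric.tendsto_nhds]
  intro ε hε
  have hδ : 0 < ε / 10 := by positivity
  obtain ⟨s, hs⟩ := ((hb.hasSum.eventually_const_lt (show
    (∑' n, w n * ‖b n‖ ^ 2) - ε / 10 < ∑' n, w n * ‖b n‖ ^ 2 by linarith))).exists
  have t1 : Tendsto (fun k => ∑ n ∈ s, w n * ‖a k n - b n‖ ^ 2) 𝓕 (𝓝 0) := by
    have := tendsto_finsetSum s fun n _ => (((ht n).sub_const (b n)).norm.pow 2).const_mul (w n)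
    simpa using this
  have t2 := tendsto_finsetSum s fun n _ => ((ht n).norm.pow 2).const_mul (w n)
  filter_upwards [ha, t1.eventually_lt_const hδ, hn.eventually_lt_const (lt_add_of_pos_right _ hδ),
    t2.eventually_const_lt (sub_lt_self _ hδ)] with k hk k1 k2 k3
  have hle : ∀ n, w n * ‖a k n - b n‖ ^ 2 ≤ 2 * (w n * ‖a k n‖ ^ 2) + 2 * (w n * ‖b n‖ ^ 2) :=
    fun n => by
      have h1 := norm_sub_le (a k n) (b n)
      have h2 : ‖a k n - b n‖ ^ 2 ≤ 2 * ‖a k n‖ ^ 2 + 2 * ‖b n‖ ^ 2 := by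
        nlinarith [norm_nonneg (a k n - b n), sq_nonneg (‖a k n‖ - ‖b n‖)]
      nlinarith [mul_le_mul_of_nonneg_left h2 (hw n)]
  have h0 : ∀ n, 0 ≤ w n * ‖a k n - b n‖ ^ 2 := fun n => mul_nonneg (hw n) (sq_nonneg _)
  have hsum := (hk.mul_left 2).add (hb.mul_left 2)
  have hd : Summable fun n => w n * ‖a k n - b n‖ ^ 2 := .of_nonneg_of_le h0 hle hsum
  rw [Real.dist_0_eq_abs, abs_of_nonneg (tsum_nonneg h0)]
  have e1 := (hsum.sub hd).sum_le_tsum s fun n _ => sub_nonneg.2 (hle n)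
  rw [hsum.tsum_sub hd, (hk.mul_left 2).tsum_add (hb.mul_left 2), tsum_mul_left, tsum_mul_left,
    Finset.sum_sub_distrib, Finset.sum_add_distrib, ← Finset.mul_sum, ← Finset.mul_sum] at e1
  linarith

lemma hsWeight_two (n : ℤ) : hsWeight 2 n = (1 + (n : ℝ) ^ 2) ^ 2 := by
  rw [hsWeight]
  norm_cast

lemma HBall.inHs {R : ℝ} {a : ℤ → ℂ} (h : HBall R a) : InHs 2 a := by
  simp only [InHs, hsWeight_two]
  exact h.summable

lemma InHs.hBall {a : ℤ → ℂ} (h : InHs 2 a) : HBall (hsNormSq 2 a) a := by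
  simp only [InHs, hsNormSq, hsWeight_two] at h ⊢
  exact BddSum.of_summable (fun n => by positivity) h le_rfl

lemma HBall.hsNormSq_le {R : ℝ} {a : ℤ → ℂ} (h : HBall R a) : hsNormSq 2 a ≤ R := by
  simp only [hsNormSq, hsWeight_two]
  exact h.tsum_le

open Filter Topology in
/-- Coefficientwise convergence and convergence of the Hamiltonian imply strong convergence. -/
lemma tendsto_hsNorm_sub {ι : Type*} {𝓕 : Filter ι} {κ l R : ℝ} {a : ι → ℤ → ℂ} {b : ℤ → ℂ}
    (hR : ∀ᶠ k in 𝓕, HBall R (a k)) (hb : HBall R b)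
    (ht : ∀ n, Tendsto (fun k => a k n) 𝓕 (𝓝 (b n)))
    (hh : Tendsto (fun k => ham κ l (a k)) 𝓕 (𝓝 (ham κ l b))) :
    Tendsto (fun k => hsNorm 2 (fun n => a k n - b n)) 𝓕 (𝓝 0) := by
  rcases 𝓕.eq_or_neBot with rfl | _
  · exact tendsto_bot
  have h1 := tendsto_tsum_sub_sq (w := fun _ => 1) (fun _ => zero_le_one)
    (hR.mono fun k hk => by simpa using hk.mass_bdd.summable) (by simpa using hb.mass_bdd.summable)
    ht (by simpa using tendsto_tsum_sq hR ht)
  have h2 : Tendsto (fun k => ∑' n : ℤ, (n : ℝ) ^ 4 * ‖a k n‖ ^ 2) 𝓕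
      (𝓝 (∑' n : ℤ, (n : ℝ) ^ 4 * ‖b n‖ ^ 2)) := by
    have h3 := (hh.sub ((Complex.continuous_re.tendsto _).comp
      (tendsto_potential κ l hR ht))).const_mul 2
    refine (h3.congr fun k => ?_).trans (le_of_eq ?_)
    · simp only [ham, Function.comp_apply]
      ring
    · congr 1
      rw [ham]
      ring
  have h4 := tendsto_tsum_sub_sq (w := fun n : ℤ => (n : ℝ) ^ 4) (fun _ => by positivity)
    (hR.mono fun k hk => hk.four_bdd.summable) hb.four_bdd.summable ht h2
  have h5 := ((h1.const_mul 2).add (h4.const_mul 2)).sqrt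
  simp only [mul_zero, add_zero, Real.sqrt_zero, one_mul] at h5
  refine squeeze_zero' (.of_forall fun k => Real.sqrt_nonneg _) ?_ h5
  filter_upwards [hR] with k hk
  have hd := hk.sub hb
  exact Real.sqrt_le_sqrt (hBall_of_bdd
    (BddSum.of_summable (fun _ => sq_nonneg _) hd.mass_bdd.summable le_rfl)
    (BddSum.of_summable (fun _ => by positivity) hd.four_bdd.summable le_rfl)).hsNormSq_le

lemma WeakSol.contHs {κ l R T : ℝ} {u : ℝ → ℤ → ℂ} (h : WeakSol κ l R (Icc (-T) T) u) :
    ContHs 2 T u := by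
  refine ⟨fun t ht => (h.ball t ht).inHs, fun t ht ε hε => ?_⟩
  have h1 := tendsto_hsNorm_sub (κ := κ) (l := l) (𝓕 := nhdsWithin t (Icc (-T) T)) (a := u)
    (Filter.eventually_of_mem self_mem_nhdsWithin h.ball) (h.ball t ht)
    (fun n => h.continuousOn n t ht) (tendsto_const_nhds.congr' (Filter.eventually_of_mem
      self_mem_nhdsWithin fun s hs => (h.ham_eq ht hs).symm))
  obtain ⟨δ, hδ, h2⟩ := Metric.mem_nhdsWithin_iff.1 (h1.eventually_lt_const hε)
  exact ⟨δ, hδ, fun t' ht' hd => h2 ⟨by rwa [Metric.mem_ball, Real.dist_eq], ht'⟩⟩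

/-! ### The nonlinearity in symmetrized form. -/

/-- The reflection `(p₁, p₂) ↦ (p₁, n - p₁ - p₂)`. -/
def reflEquiv (n : ℤ) : Equiv.Perm (ℤ × ℤ) :=
  Function.Involutive.toPerm (fun p => (p.1, n - p.1 - p.2)) fun p => by ext <;> simp

lemma six_mul_tsum {n : ℤ} {f : ℤ × ℤ → ℂ} (hf : Summable f) :
    6 * ∑' p, f p = ∑' p : ℤ × ℤ, (f (p.1, p.2) + f (p.2, p.1) + f (p.1, n - p.1 - p.2) +
      f (n - p.1 - p.2, p.1) + f (p.2, n - p.1 - p.2) + f (n - p.1 - p.2, p.2)) := by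
  have key : ∀ e : Equiv.Perm (ℤ × ℤ), HasSum (fun p => f (e p)) (∑' p, f p) := fun e =>
    (Equiv.hasSum_iff e).2 hf.hasSum
  set s := Equiv.prodComm ℤ ℤ
  set r := reflEquiv n
  have h := (((((key (Equiv.refl _)).add (key s)).add (key r)).add (key (r.trans s))).add
    (key (s.trans r))).add (key ((s.trans r).trans s))
  rw [show 6 * ∑' p, f p = ∑' p, f p + ∑' p, f p + ∑' p, f p + ∑' p, f p + ∑' p, f p + ∑' p, f p
    by ring, ← h.tsum_eq]
  refine tsum_congr fun ⟨p, q⟩ => ?_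
  simp only [Equiv.trans_apply, s, r, reflEquiv, Function.Involutive.toPerm, Equiv.coe_fn_mk,
    Equiv.prodComm_apply, Prod.swap, Equiv.refl_apply, sub_right_comm n q p]

lemma norm_mkdvCubicKer_le (c : ℝ) (p q r n : ℤ) (h : p + q + r = n) :
    ‖mkdvCubicKer (4 * c) c c p q r‖ ≤ |c| * (7 + |(n : ℝ)|) * (jp p * jp q * (r : ℝ) ^ 2) := by
  have e : mkdvCubicKer (4 * c) c c p q r = -I * ((c * (4 * q * r ^ 2 + r ^ 3 + p * q * r) : ℝ) : ℂ) := by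
    rw [mkdvCubicKer]
    push_cast
    linear_combination ((4 * c : ℂ) * q * r ^ 2 * I + c * r ^ 3 * I + c * p * q * r * I) * I_sq
  rw [e, norm_mul, norm_neg, norm_I, one_mul, norm_real, Real.norm_eq_abs, abs_mul,
    mul_assoc |c|]
  refine mul_le_mul_of_nonneg_left ?_ (abs_nonneg c)
  have hr : |(r : ℝ)| ≤ (r : ℝ) ^ 2 := by
    rcases eq_or_ne r 0 with rfl | h0
    · simp
    · have : (1 : ℝ) ≤ |(r : ℝ)| := by exact_mod_cast Int.one_le_abs h0
      nlinarith [sq_abs (r : ℝ)]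
  have hr' : |(r : ℝ)| ≤ |(n : ℝ)| + jp p + jp q := by
    have : (r : ℝ) = n - p - q := by
      have : (n : ℝ) = p + q + r := by exact_mod_cast h.symm
      linarith
    rw [this]
    have h1 := norm_sub_le (n - p : ℝ) q
    have h2 := norm_sub_le (n : ℝ) p
    simp only [Real.norm_eq_abs] at h1 h2
    linarith [abs_le_jp p, abs_le_jp q]
  have h1 := one_le_jp p
  have h2 := one_le_jp q
  have h3 : jp p ≤ jp p * jp q := by nlinarith
  have h4 : jp q ≤ jp p * jp q := by nlinarith
  have h5 : 1 ≤ jp p * jp q := by linarith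
  have h6 : |(p : ℝ)| * |(q : ℝ)| ≤ jp p * jp q :=
    mul_le_mul (abs_le_jp p) (abs_le_jp q) (abs_nonneg _) (by linarith)
  have h7 := abs_nonneg (n : ℝ)
  have k1 : |(4 : ℝ) * q * r ^ 2| ≤ 4 * (jp p * jp q) * (r : ℝ) ^ 2 := by
    rw [abs_mul, abs_mul, abs_pow, sq_abs, abs_of_pos (by norm_num : (0 : ℝ) < 4)]
    exact mul_le_mul_of_nonneg_right (by linarith [abs_le_jp q]) (sq_nonneg _)
  have k2 : |(r : ℝ) ^ 3| ≤ (|(n : ℝ)| + 2) * (jp p * jp q) * (r : ℝ) ^ 2 := by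
    rw [pow_succ, abs_mul, abs_pow, sq_abs, mul_comm]
    refine mul_le_mul_of_nonneg_right (hr'.trans ?_) (sq_nonneg _)
    nlinarith
  have k3 : |(p : ℝ) * q * r| ≤ jp p * jp q * (r : ℝ) ^ 2 := by
    rw [abs_mul, abs_mul]
    exact mul_le_mul h6 hr (abs_nonneg _) (by linarith)
  have k4 := abs_add_le ((4 : ℝ) * q * r ^ 2 + r ^ 3) (p * q * r)
  have k5 := abs_add_le ((4 : ℝ) * q * r ^ 2) (r ^ 3 : ℝ)
  linarith

lemma HBall.summable_cubic {R : ℝ} {a : ℤ → ℂ} (h : HBall R a) (c : ℝ) (n : ℤ) :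
    Summable fun p : ℤ × ℤ => mkdvCubicKer (4 * c) c c p.1 p.2 (n - p.1 - p.2) * a p.1 * a p.2 *
      a (n - p.1 - p.2) := by
  have h1 : W1 a (HBall.const R) := h.maj.W1 fun _ => le_rfl
  have h2 := (BddSum.mul_prod h1 h1).summable.mul_left (|c| * (7 + |(n : ℝ)|) * (2 * Real.sqrt R))
  refine Summable.of_norm_bounded h2 fun p => ?_
  have k1 := norm_mkdvCubicKer_le c p.1 p.2 (n - p.1 - p.2) n (by ring)
  have k2 := norm_sqMul_le h (n - p.1 - p.2)
  rw [sqMul, norm_mul, norm_pow, norm_intCast_eq, sq_abs] at k2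
  have j1 := jp_pos p.1
  have j2 := jp_pos p.2
  rw [norm_mul, norm_mul, norm_mul]
  set X := ‖a (n - p.1 - p.2)‖
  set r : ℝ := ((n - p.1 - p.2 : ℤ) : ℝ)
  calc _ ≤ |c| * (7 + |(n : ℝ)|) * (jp p.1 * jp p.2 * r ^ 2) * ‖a p.1‖ * ‖a p.2‖ * X := by gcongr
    _ = |c| * (7 + |(n : ℝ)|) * (r ^ 2 * X) * ((jp p.1 * ‖a p.1‖) * (jp p.2 * ‖a p.2‖)) := by ring
    _ ≤ _ := by gcongr

lemma HBall.tsum_cubic {R : ℝ} {a : ℤ → ℂ} (h : HBall R a) (c : ℝ) (n : ℤ) :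
    ∑' p : ℤ × ℤ, mkdvCubicKer (4 * c) c c p.1 p.2 (n - p.1 - p.2) * a p.1 * a p.2 *
      a (n - p.1 - p.2) = -I * n * (c / 6) * T3 (fun a' b' => a a' * a b') a n := by
  have h6 := six_mul_tsum (n := n) (h.summable_cubic c n)
  have h7 : ∑' p : ℤ × ℤ, (-I * n * c) * (((sym3 n p.1 p.2 : ℝ) : ℂ) *
      (a p.1 * a p.2 * a (n - p.1 - p.2))) = (-I * n * c) * T3 (fun a' b' => a a' * a b') a n :=
    tsum_mul_left
  rw [show -I * n * (c / 6) * T3 (fun a' b' => a a' * a b') a n =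
    (-I * n * c) * T3 (fun a' b' => a a' * a b') a n / 6 by ring, ← h7,
    eq_div_iff (by norm_num), mul_comm, h6]
  refine tsum_congr fun p => ?_
  obtain ⟨p, q⟩ := p
  have e1 : n - p - (n - p - q) = q := by ring
  have e2 : n - q - p = n - p - q := by ring
  have e3 : n - (n - p - q) - p = q := by ring
  have e4 : n - q - (n - p - q) = p := by ring
  have e5 : n - (n - p - q) - q = p := by ring
  simp only [e1, e2, e3, e4, e5, mkdvCubicKer, sym3]
  push_cast
  have hI : I ^ 3 = -I := by rw [pow_succ, I_sq]; ring
  ring_nf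
  simp only [hI]
  ring

lemma tsum_prod_conv {α : Type*} {f K : ℤ → ℂ} {H : α → ℤ → ℂ} {h : α → ℝ}
    (hf : Summable fun n => ‖f n‖) (hh : Summable h) (hH : ∀ r N, ‖H r N‖ ≤ h r)
    (hK : ∀ N, ∑' r, H r N = K N) (n : ℤ) :
    ∑' p : ℤ × α, f p.1 * H p.2 (n - p.1) = conv f K n := by
  have hs : Summable fun p : ℤ × α => f p.1 * H p.2 (n - p.1) := by
    refine Summable.of_norm_bounded (hf.mul_of_nonneg hh (fun _ => norm_nonneg _)
      fun r => (norm_nonneg _).trans (hH r 0)) fun p => ?_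
    rw [norm_mul]
    exact mul_le_mul_of_nonneg_left (hH _ _) (norm_nonneg _)
  rw [hs.tsum_prod, conv]
  exact tsum_congr fun m => (tsum_mul_left (a := f m)).trans (congrArg _ (hK (n - m)))

/-- The coefficients of `-i u^k ∂ₓu`. -/
def cpowD (a : ℤ → ℂ) : ℕ → ℤ → ℂ
  | 0 => fun n => n * a n
  | k + 1 => conv a (cpowD a k)

lemma W1.mul_l1 {a : ℤ → ℂ} {A : ℝ} (h : W1 a A) : BddSum (fun n : ℤ => ‖(n : ℂ) * a n‖) A :=
  BddSum.mono h (fun _ => norm_nonneg _) fun n => by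
    rw [norm_mul, norm_intCast_eq]
    exact mul_le_mul_of_nonneg_right (abs_le_jp n) (norm_nonneg _)

lemma W1.conv_mul_cpow {a : ℤ → ℂ} {A : ℝ} (h : W1 a A) :
    ∀ k, MKdV5.conv (fun n => (n : ℂ) * a n) (MKdV5.cpow a k) = cpowD a (k + 1)
  | 0 => conv_comm _ _
  | k + 1 => by
    rw [MKdV5.cpow, ← conv_assoc_of_bddSum h.mul_l1 h.l1 (h.cpow k).l1, conv_comm _ a,
      conv_assoc_of_bddSum h.l1 h.mul_l1 (h.cpow k).l1, h.conv_mul_cpow k]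
    rfl

lemma W1.mul_cpow {a : ℤ → ℂ} {A : ℝ} (h : W1 a A) :
    ∀ k (n : ℤ), (n : ℂ) * MKdV5.cpow a k n = (k + 1) * cpowD a k n
  | 0, n => by simp [MKdV5.cpow, cpowD]
  | k + 1, n => by
    have h1 := (conv_fiber_summable_of_bddSum h.mul_l1 (h.cpow k).l1 n).tsum_add
      (conv_fiber_summable_of_bddSum h.l1 (h.cpow k).mul_l1 n)
    have h2 : MKdV5.conv (fun n => (n : ℂ) * a n) (MKdV5.cpow a k) n +
        MKdV5.conv a (fun n => (n : ℂ) * MKdV5.cpow a k n) n = n * MKdV5.cpow a (k + 1) n := by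
      rw [MKdV5.conv, MKdV5.conv, ← h1, MKdV5.cpow, MKdV5.conv, ← tsum_mul_left]
      refine tsum_congr fun m => ?_
      push_cast
      ring
    rw [← h2, h.conv_mul_cpow, show (fun n : ℤ => (n : ℂ) * MKdV5.cpow a k n) =
      fun n => ((k : ℂ) + 1) * cpowD a k n from funext (h.mul_cpow k), conv_const_mul_right, cpowD]
    push_cast
    ring

lemma HBall.tsum_quintic {R : ℝ} {a : ℤ → ℂ} (h : HBall R a) (n : ℤ) :
    ∑' q : ℤ × ℤ × ℤ × ℤ, (I * ((n - q.1 - q.2.1 - q.2.2.1 - q.2.2.2 : ℤ) : ℂ)) * a q.1 *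
      a q.2.1 * a q.2.2.1 * a q.2.2.2 * a (n - q.1 - q.2.1 - q.2.2.1 - q.2.2.2) =
      I * (n / 5) * Q5 a n := by
  have hW : W1 a (HBall.const R) := h.maj.W1 fun _ => le_rfl
  have ha := hW.l1.summable
  have hD := hW.mul_l1
  set D : ℤ → ℂ := fun n => (n : ℂ) * a n with hDdef
  have b1 : ∀ (r N : ℤ), ‖a r * D (N - r)‖ ≤ HBall.const R * ‖a r‖ := fun r N => by
    rw [norm_mul, mul_comm]
    exact mul_le_mul_of_nonneg_right (hD.apply_le _) (norm_nonneg _)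
  have s1 := ha.mul_left (HBall.const R)
  have b2 : ∀ (r : ℤ × ℤ) (N : ℤ), ‖a r.1 * (a r.2 * D (N - r.1 - r.2))‖ ≤
      ‖a r.1‖ * (HBall.const R * ‖a r.2‖) := fun r N => by
    rw [norm_mul]
    exact mul_le_mul_of_nonneg_left (b1 _ _) (norm_nonneg _)
  have hc := hW.bound_nonneg
  have s2 := ha.mul_of_nonneg s1 (fun _ => norm_nonneg _) fun _ => by positivity
  have b3 : ∀ (r : ℤ × ℤ × ℤ) (N : ℤ), ‖a r.1 * (a r.2.1 * (a r.2.2 * D (N - r.1 - r.2.1 - r.2.2)))‖ ≤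
      ‖a r.1‖ * (‖a r.2.1‖ * (HBall.const R * ‖a r.2.2‖)) := fun r N => by
    rw [norm_mul]
    exact mul_le_mul_of_nonneg_left (b2 r.2 _) (norm_nonneg _)
  have s3 := ha.mul_of_nonneg s2 (fun _ => norm_nonneg _) fun _ => by positivity
  have t2 := tsum_prod_conv (K := conv a D) ha s1 b1 fun N => rfl
  have t3 := tsum_prod_conv (H := fun (r : ℤ × ℤ) N => a r.1 * (a r.2 * D (N - r.1 - r.2)))
    ha s2 b2 t2
  have t4 := tsum_prod_conv (H := fun (r : ℤ × ℤ × ℤ) N =>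
    a r.1 * (a r.2.1 * (a r.2.2 * D (N - r.1 - r.2.1 - r.2.2)))) ha s3 b3 t3 n
  have e := hW.mul_cpow 4 n
  rw [Q5_eq_cpow hW, show I * ((n : ℂ) / 5) * cpow a 4 n = I * (n * cpow a 4 n) / 5 by ring, e]
  have t5 : conv a (conv a (conv a (conv a D))) n = cpowD a 4 n := rfl
  rw [← t5, ← t4]
  push_cast
  rw [show ∀ x : ℂ, I * ((4 + 1) * x) / 5 = I * x by intro x; ring, ← tsum_mul_left]
  refine tsum_congr fun q => ?_
  simp only [hDdef]
  push_cast
  ring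

lemma HBall.mkdvNonlin_eq {R : ℝ} {a : ℤ → ℂ} (h : HBall R a) {c₁ c₂ c₃ c₄ : ℝ}
    (hc : CoeffConstraint c₁ c₂ c₃ c₄) (n : ℤ) : mkdvNonlin c₁ c₂ c₃ c₄ a n =
      -(I * n * G (c₂ / (6 * (2 * Real.pi))) (c₄ / (5 * (2 * Real.pi) ^ 2)) a n) := by
  obtain ⟨h1, h2, -⟩ := hc
  obtain rfl : c₁ = 4 * c₂ := by linarith
  subst h2
  rw [mkdvNonlin, h.tsum_cubic, h.tsum_quintic, G]
  push_cast
  have hpi : (Real.pi : ℂ) ≠ 0 := by exact_mod_cast Real.pi_ne_zero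
  field_simp
  ring

/-! ### The Duhamel formula. -/

lemma hasDerivAt_exp_mul (μ : ℂ) (t : ℝ) :
    HasDerivAt (fun t : ℝ => Complex.exp (μ * t)) (Complex.exp (μ * t) * μ) t := by
  simpa using (((hasDerivAt_id t).ofReal_comp).const_mul μ).cexp

lemma exp_mul_integral (μ : ℂ) (h : ℝ → ℂ) (t : ℝ) :
    Complex.exp (μ * t) * ∫ τ in (0 : ℝ)..t, Complex.exp (-μ * τ) * h τ =
      ∫ τ in (0 : ℝ)..t, Complex.exp (μ * ((t - τ : ℝ) : ℂ)) * h τ := by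
  rw [← intervalIntegral.integral_const_mul]
  congr 1
  funext τ
  rw [← mul_assoc, ← Complex.exp_add]
  congr 2
  push_cast
  ring

lemma duhamel_iff {a b : ℝ} (h0 : (0 : ℝ) ∈ Icc a b) {f h : ℝ → ℂ} (hh : ContinuousOn h (Icc a b))
    (μ : ℂ) : (∀ t ∈ Icc a b, HasDerivWithinAt f (μ * f t + h t) (Icc a b) t) ↔
      ∀ t ∈ Icc a b, f t = Complex.exp (μ * t) * f 0 +
        ∫ τ in (0 : ℝ)..t, Complex.exp (μ * ((t - τ : ℝ) : ℂ)) * h τ := by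
  have hg : ContinuousOn (fun τ : ℝ => Complex.exp (-μ * τ) * h τ) (Icc a b) :=
    ContinuousOn.mul (Continuous.continuousOn (by fun_prop)) hh
  have hinv : ∀ t : ℝ, Complex.exp (μ * t) * Complex.exp (-μ * t) = 1 := fun t => by
    rw [← Complex.exp_add, neg_mul, add_neg_cancel, Complex.exp_zero]
  constructor
  · intro H t ht
    have h1 := integral_eq_sub_of_hasDerivWithinAt_Icc
      (f := fun t : ℝ => Complex.exp (-μ * t) * f t) (fun t ht => by
        refine ((hasDerivAt_exp_mul (-μ) t).hasDerivWithinAt.mul (H t ht)).congr_deriv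
          (g' := Complex.exp (-μ * t) * h t) ?_
        ring) hg h0 ht
    rw [← exp_mul_integral, h1]
    simp only [ofReal_zero, mul_zero, Complex.exp_zero, one_mul]
    linear_combination (-f t) * hinv t
  · intro H
    have h1 := hasDerivWithinAt_of_integral_eq (f := fun t : ℝ => Complex.exp (-μ * t) * f t) h0 hg
      fun t ht => by
        have h2 := H t ht
        rw [← exp_mul_integral] at h2
        simp only [ofReal_zero, mul_zero, Complex.exp_zero, one_mul]
        rw [h2, mul_add, ← mul_assoc, ← mul_assoc, mul_comm (Complex.exp (-μ * t)), hinv]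
        ring
    intro t ht
    have h3 := (hasDerivAt_exp_mul μ t).hasDerivWithinAt.mul (h1 t ht)
    have h4 : ∀ s : ℝ, f s = Complex.exp (μ * s) * (Complex.exp (-μ * s) * f s) := fun s => by
      rw [← mul_assoc, hinv, one_mul]
    refine (h3.congr (fun s _ => h4 s) (h4 t)).congr_deriv ?_
    linear_combination (μ * f t + h t) * hinv t

lemma norm_le_hsNorm {a : ℤ → ℂ} (h : InHs 2 a) (n : ℤ) : ‖a n‖ ≤ hsNorm 2 a := by
  refine Real.le_sqrt_of_sq_le ?_
  have h1 := h.hBall.apply_le n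
  refine (le_mul_of_one_le_left (sq_nonneg _) ?_).trans (BddSum.apply_le h.hBall n)
  exact one_le_pow₀ (by linarith [sq_nonneg (n : ℝ)])

lemma HBall.neg {R : ℝ} {a : ℤ → ℂ} (h : HBall R a) : HBall R (fun n => -a n) := by
  simpa only [HBall, norm_neg] using h

lemma InHs.sub {a b : ℤ → ℂ} (ha : InHs 2 a) (hb : InHs 2 b) : InHs 2 (fun n => a n - b n) :=
  ((ha.hBall.le (le_max_left _ (hsNormSq 2 b))).sub (hb.hBall.le (le_max_right _ _))).inHs

lemma hBall_of_hsNorm_sub_le {a b : ℤ → ℂ} (ha : InHs 2 a) (hb : InHs 2 b) {r : ℝ}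
    (h : hsNorm 2 (fun n => a n - b n) ≤ r) : HBall (4 * max (r ^ 2) (hsNormSq 2 b)) a := by
  have hd := (ha.sub hb).hBall
  have h1 : hsNormSq 2 (fun n => a n - b n) ≤ r ^ 2 := Real.sqrt_le_left (Real.sqrt_nonneg _ |>.trans h) |>.1 h
  have h2 := (hd.le (h1.trans (le_max_left _ (hsNormSq 2 b)))).sub (hb.hBall.neg.le (le_max_right _ _))
  simpa using h2

lemma ContHs.exists_hBall {T : ℝ} {u : ℝ → ℤ → ℂ} (h : ContHs 2 T u) :
    ∃ R, ∀ t ∈ Icc (-T) T, HBall R (u t) := by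
  refine isCompact_Icc.induction_on (p := fun s => ∃ R, ∀ t ∈ s, t ∈ Icc (-T) T → HBall R (u t))
    ⟨0, fun t ht => ht.elim⟩ (fun s t hst ⟨R, hR⟩ => ⟨R, fun x hx => hR x (hst hx)⟩)
    (fun s t ⟨R, hR⟩ ⟨R', hR'⟩ => ⟨max R R', ?_⟩) (fun t ht => ?_) |>.imp
    fun R hR t ht => hR t ht ht
  · rintro x (hx | hx) hxT
    · exact (hR x hx hxT).le (le_max_left _ _)
    · exact (hR' x hx hxT).le (le_max_right _ _)
  · obtain ⟨δ, hδ, h1⟩ := h.2 t ht 1 one_pos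
    refine ⟨Metric.ball t δ, mem_nhdsWithin_of_mem_nhds (Metric.ball_mem_nhds t hδ), _,
      fun s hs hsT => hBall_of_hsNorm_sub_le (h.1 s hsT) (h.1 t ht) (h1 s hsT ?_).le⟩
    rwa [Metric.mem_ball, Real.dist_eq] at hs

lemma ContHs.continuousOn {T : ℝ} {u : ℝ → ℤ → ℂ} (h : ContHs 2 T u) (n : ℤ) :
    ContinuousOn (fun t => u t n) (Icc (-T) T) := by
  rw [Metric.continuousOn_iff]
  intro t ht ε hε
  obtain ⟨δ, hδ, h1⟩ := h.2 t ht ε hε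
  refine ⟨δ, hδ, fun s hs hd => ?_⟩
  rw [dist_eq_norm]
  exact (norm_le_hsNorm ((h.1 s hs).sub (h.1 t ht)) n).trans_lt (h1 s hs hd)

lemma duhamel_mkdv_iff {c₁ c₂ c₃ c₄ R T : ℝ} (hc : CoeffConstraint c₁ c₂ c₃ c₄) (hT : 0 ≤ T)
    {u : ℝ → ℤ → ℂ} (hR : ∀ t ∈ Icc (-T) T, HBall R (u t))
    (hu : ∀ n, ContinuousOn (fun t => u t n) (Icc (-T) T)) (n : ℤ) :
    (∀ t ∈ Icc (-T) T, HasDerivWithinAt (fun t => u t n) (I * (n : ℂ) ^ 5 * u t n +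
      I * n * G (c₂ / (6 * (2 * Real.pi))) (c₄ / (5 * (2 * Real.pi) ^ 2)) (u t) n)
      (Icc (-T) T) t) ↔
    ∀ t ∈ Icc (-T) T, u t n = Complex.exp (I * (t : ℂ) * (n : ℂ) ^ 5) * u 0 n -
      ∫ τ in (0 : ℝ)..t, Complex.exp (I * ((t - τ : ℝ) : ℂ) * (n : ℂ) ^ 5) *
        mkdvNonlin c₁ c₂ c₃ c₄ (u τ) n := by
  have h0 : (0 : ℝ) ∈ Icc (-T) T := ⟨by linarith, hT⟩
  have hh : ContinuousOn (fun t => I * n * G (c₂ / (6 * (2 * Real.pi)))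
      (c₄ / (5 * (2 * Real.pi) ^ 2)) (u t) n) (Icc (-T) T) :=
    continuousOn_const.mul (continuousOn_G_of hR hu n)
  refine (duhamel_iff h0 (f := fun t => u t n) hh (I * (n : ℂ) ^ 5)).trans ?_
  refine forall₂_congr fun t ht => ?_
  rw [sub_eq_add_neg, ← intervalIntegral.integral_neg, mul_right_comm I]
  have : ∫ τ in (0 : ℝ)..t, -(Complex.exp (I * ((t - τ : ℝ) : ℂ) * (n : ℂ) ^ 5) *
      mkdvNonlin c₁ c₂ c₃ c₄ (u τ) n) = ∫ τ in (0 : ℝ)..t, Complex.exp (I * (n : ℂ) ^ 5 *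
      ((t - τ : ℝ) : ℂ)) * (I * n * G (c₂ / (6 * (2 * Real.pi)))
        (c₄ / (5 * (2 * Real.pi) ^ 2)) (u τ) n) := by
    refine intervalIntegral.integral_congr fun τ hτ => ?_
    rw [(hR τ (uIcc_subset_Icc h0 ht hτ)).mkdvNonlin_eq hc, mul_neg, neg_neg, mul_right_comm I]
  rw [this]

lemma WeakSol.isSolution {c₁ c₂ c₃ c₄ R T : ℝ} (hc : CoeffConstraint c₁ c₂ c₃ c₄) (hT : 0 ≤ T)
    {u : ℝ → ℤ → ℂ} {u₀ : ℤ → ℂ} (h : WeakSol (c₂ / (6 * (2 * Real.pi)))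
      (c₄ / (5 * (2 * Real.pi) ^ 2)) R (Icc (-T) T) u) (h0 : u 0 = u₀) :
    IsSolution c₁ c₂ c₃ c₄ 2 T u₀ u := by
  subst h0
  exact ⟨h.contHs, h.real, fun n => rfl, fun t ht n =>
    (duhamel_mkdv_iff hc hT h.ball h.continuousOn n).1 (fun t ht => h.deriv t ht n) t ht⟩

lemma IsSolution.exists_weakSol {c₁ c₂ c₃ c₄ T : ℝ} (hc : CoeffConstraint c₁ c₂ c₃ c₄) (hT : 0 ≤ T)
    {u : ℝ → ℤ → ℂ} {u₀ : ℤ → ℂ} (h : IsSolution c₁ c₂ c₃ c₄ 2 T u₀ u) :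
    ∃ R, WeakSol (c₂ / (6 * (2 * Real.pi))) (c₄ / (5 * (2 * Real.pi) ^ 2)) R (Icc (-T) T) u := by
  obtain ⟨hcont, hreal, h0, hd⟩ := h
  obtain ⟨R, hR⟩ := hcont.exists_hBall
  obtain rfl : u 0 = u₀ := funext h0
  exact ⟨R, hR, hreal, fun t ht n => (duhamel_mkdv_iff hc hT hR hcont.continuousOn n).2
    (fun t ht => hd t ht n) t ht⟩

/-! ### Continuity of the flow at fixed mass. -/

lemma abs_four_sub_le {a b : ℤ → ℂ} (ha : InHs 2 a) (hb : InHs 2 b) :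
    |(∑' n : ℤ, (n : ℝ) ^ 4 * ‖a n‖ ^ 2) - ∑' n : ℤ, (n : ℝ) ^ 4 * ‖b n‖ ^ 2| ≤
      hsNorm 2 (fun n => a n - b n) ^ 2 + hsNorm 2 (fun n => a n - b n) +
        hsNorm 2 (fun n => a n - b n) * hsNormSq 2 b := by
  set δ := hsNorm 2 (fun n => a n - b n) with hδ
  have hab := ha.sub hb
  have hδsq : δ ^ 2 = hsNormSq 2 (fun n => a n - b n) :=
    Real.sq_sqrt (hab.hBall.four_bdd.bound_nonneg)
  have hδ0 : 0 ≤ δ := Real.sqrt_nonneg _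
  rcases hδ0.eq_or_lt with h0 | hpos
  · have : a = b := funext fun n => by
      have := norm_le_hsNorm hab n
      rw [← hδ, ← h0] at this
      exact sub_eq_zero.1 (norm_le_zero_iff.1 this)
    subst this
    rw [← h0]
    simp
  · have sa := ha.hBall.four_bdd.summable
    have sb := hb.hBall.four_bdd
    have sd := hab.hBall.four_bdd
    rw [← sa.tsum_sub sb.summable]
    have hpt : ∀ n : ℤ, ‖(n : ℝ) ^ 4 * ‖a n‖ ^ 2 - (n : ℝ) ^ 4 * ‖b n‖ ^ 2‖ ≤
        (1 + δ⁻¹) * ((n : ℝ) ^ 4 * ‖a n - b n‖ ^ 2) + δ * ((n : ℝ) ^ 4 * ‖b n‖ ^ 2) := fun n => by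
      have h4 : (0 : ℝ) ≤ (n : ℝ) ^ 4 := by positivity
      rw [← mul_sub, norm_mul, Real.norm_eq_abs, Real.norm_eq_abs, abs_of_nonneg h4]
      have h1 := abs_norm_sub_norm_le (a n) (b n)
      have h2 : |‖a n‖ ^ 2 - ‖b n‖ ^ 2| ≤ ‖a n - b n‖ * (‖a n - b n‖ + 2 * ‖b n‖) := by
        rw [sq_sub_sq, abs_mul, mul_comm]
        refine mul_le_mul h1 ?_ (abs_nonneg _) (norm_nonneg _)
        rw [abs_of_nonneg (by positivity)]
        linarith [(abs_le.1 h1).2]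
      have h3 : 2 * (‖a n - b n‖ * ‖b n‖) ≤ δ⁻¹ * ‖a n - b n‖ ^ 2 + δ * ‖b n‖ ^ 2 := by
        have h5 : 0 ≤ δ⁻¹ * (‖a n - b n‖ - δ * ‖b n‖) ^ 2 := by positivity
        have h6 : δ⁻¹ * (‖a n - b n‖ - δ * ‖b n‖) ^ 2 = δ⁻¹ * ‖a n - b n‖ ^ 2 -
            2 * (‖a n - b n‖ * ‖b n‖) + δ * ‖b n‖ ^ 2 := by
          field_simp
          ring
        linarith
      calc _ ≤ (n : ℝ) ^ 4 * ((1 + δ⁻¹) * ‖a n - b n‖ ^ 2 + δ * ‖b n‖ ^ 2) :=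
            mul_le_mul_of_nonneg_left (by nlinarith) h4
        _ = _ := by ring
    have hs := (sd.summable.mul_left (1 + δ⁻¹)).add (sb.summable.mul_left δ)
    have h7 := tsum_of_norm_bounded hs.hasSum hpt
    rw [Real.norm_eq_abs, (sd.summable.mul_left (1 + δ⁻¹)).tsum_add (sb.summable.mul_left δ),
      tsum_mul_left, tsum_mul_left] at h7
    refine h7.trans ?_
    have h8 : (1 + δ⁻¹) * ∑' n : ℤ, (n : ℝ) ^ 4 * ‖a n - b n‖ ^ 2 ≤ δ ^ 2 + δ :=
      calc _ ≤ (1 + δ⁻¹) * δ ^ 2 :=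
            mul_le_mul_of_nonneg_left (by rw [hδsq]; exact sd.tsum_le) (by positivity)
        _ = _ := by field_simp
    exact add_le_add h8 (mul_le_mul_of_nonneg_left sb.tsum_le hpos.le)

open Filter Topology in
lemma tendsto_ham {ι : Type*} {𝓕 : Filter ι} (κ l : ℝ) {a : ι → ℤ → ℂ} {b : ℤ → ℂ}
    (ha : ∀ k, InHs 2 (a k)) (hb : InHs 2 b)
    (h : Tendsto (fun k => hsNorm 2 (fun n => a k n - b n)) 𝓕 (𝓝 0)) :
    Tendsto (fun k => ham κ l (a k)) 𝓕 (𝓝 (ham κ l b)) := by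
  have hR : ∀ᶠ k in 𝓕, HBall (4 * max (1 ^ 2) (hsNormSq 2 b)) (a k) :=
    (h.eventually_le_const one_pos).mono fun k hk => hBall_of_hsNorm_sub_le (ha k) hb hk
  have ht : ∀ n, Tendsto (fun k => a k n) 𝓕 (𝓝 (b n)) := fun n => by
    rw [tendsto_iff_norm_sub_tendsto_zero]
    exact squeeze_zero (fun k => norm_nonneg _) (fun k => norm_le_hsNorm ((ha k).sub hb) n) h
  refine Tendsto.add (Tendsto.div_const ?_ 2)
    ((continuous_re.tendsto _).comp (tendsto_potential κ l hR ht))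
  rw [tendsto_iff_norm_sub_tendsto_zero]
  refine squeeze_zero (fun k => norm_nonneg _) (fun k => abs_four_sub_le (ha k) hb) ?_
  simpa using ((h.pow 2).add h).add (h.mul_const (hsNormSq 2 b))

lemma hsNorm_sub_le {a b c : ℤ → ℂ} (ha : InHs 2 a) (hb : InHs 2 b) (hc : InHs 2 c) {r : ℝ}
    (h1 : hsNorm 2 (fun n => a n - c n) ≤ r) (h2 : hsNorm 2 (fun n => b n - c n) ≤ r) :
    hsNorm 2 (fun n => a n - b n) ≤ 2 * r := by
  have hr : 0 ≤ r := (Real.sqrt_nonneg _).trans h1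
  have h3 := (ha.sub hc).hBall.le (Real.sqrt_le_left hr |>.1 h1)
  have h4 := (hb.sub hc).hBall.le (Real.sqrt_le_left hr |>.1 h2)
  have h5 := (h3.sub h4).hsNormSq_le
  simp only [sub_sub_sub_cancel_right] at h5
  exact Real.sqrt_le_left (by positivity) |>.2 (h5.trans_eq (by ring))

/-- Solutions with data in a fixed `H²` ball stay in a fixed ball. -/
lemma exists_uniform_weakSol (κ l R : ℝ) : ∃ R', ∀ (T S : ℝ) (u : ℝ → ℤ → ℂ), 0 ≤ T →
    WeakSol κ l S (Icc (-T) T) u → HBall R (u 0) → WeakSol κ l R' (Icc (-T) T) u := by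
  obtain ⟨P, hP⟩ := exists_norm_potential_le κ l R
  obtain ⟨R', hR'⟩ := exists_hBall_of_ham_le κ l R (R / 2 + P)
  refine ⟨R', fun T S u hT hu h0 => ⟨fun t ht => ?_, hu.real, hu.deriv⟩⟩
  have hI : (0 : ℝ) ∈ Icc (-T) T := ⟨by linarith, hT⟩
  refine hR' S (u t) (hu.ball t ht) ?_ ?_
  · rw [hu.mass_eq hI ht]
    exact h0.mass_bdd.tsum_le
  · rw [hu.ham_eq hI ht]
    exact ham_le_of_norm_potential_le h0 (hP _ h0)

open Filter Topology in
theorem WeakSol.exists_hsNorm_sub_lt {κ l R T : ℝ} (hT : 0 ≤ T) {u : ℝ → ℤ → ℂ}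
    (hu : WeakSol κ l R (Icc (-T) T) u) {ε : ℝ} (hε : 0 < ε) : ∃ δ > 0, ∀ (S : ℝ) (v : ℝ → ℤ → ℂ),
    WeakSol κ l S (Icc (-T) T) v → mass (v 0) = mass (u 0) →
    hsNorm 2 (fun n => v 0 n - u 0 n) < δ → ∀ t ∈ Icc (-T) T,
    hsNorm 2 (fun n => v t n - u t n) < ε := by
  have hI : (0 : ℝ) ∈ Icc (-T) T := ⟨by linarith, hT⟩
  by_contra! H
  have hpos : ∀ k : ℕ, (0 : ℝ) < 1 / ((k : ℝ) + 1) := fun k => by positivity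
  choose S v hv hm hd t ht he using fun k : ℕ => H _ (hpos k)
  have hi : ∀ {S : ℝ} {v : ℝ → ℤ → ℂ}, WeakSol κ l S (Icc (-T) T) v → ∀ t ∈ Icc (-T) T,
    InHs 2 (v t) := fun h t ht => (h.ball t ht).inHs
  obtain ⟨R', hR'⟩ := exists_uniform_weakSol κ l (4 * max (1 ^ 2) (hsNormSq 2 (u 0)))
  have hv' : ∀ k, WeakSol κ l R' (Icc (-T) T) (v k) := fun k =>
    hR' T (S k) (v k) hT (hv k) (hBall_of_hsNorm_sub_le (hi (hv k) 0 hI) (hi hu 0 hI)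
      ((hd k).le.trans (div_le_self zero_le_one (by linarith [k.cast_nonneg (α := ℝ)]))))
  have hd0 : Tendsto (fun k => hsNorm 2 (fun n => v k 0 n - u 0 n)) atTop (𝓝 0) :=
    squeeze_zero (fun k => Real.sqrt_nonneg _) (fun k => (hd k).le)
      tendsto_one_div_add_atTop_nhds_zero_nat
  have hham := tendsto_ham κ l (fun k => hi (hv k) 0 hI) (hi hu 0 hI) hd0
  obtain ⟨A, hA0, hA⟩ := exists_weakSol_stability κ l (max R R') (T - -T)
  have hL2 : ∀ k, ∑' n, ‖v k (t k) n - u (t k) n‖ ^ 2 ≤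
      A * hsNorm 2 (fun n => v k 0 n - u 0 n) ^ 2 := fun k => by
    have hsub := ((hi (hv k) 0 hI).sub (hi hu 0 hI)).hBall
    refine (hA (-T) T (v k) u le_rfl ((hv' k).le (le_max_right _ _)) (hu.le (le_max_left _ _))
      0 hI (hm k) (t k) (ht k)).trans (mul_le_mul_of_nonneg_left ?_ hA0)
    rw [hsNorm, Real.sq_sqrt (hsub.mass_bdd.bound_nonneg)]
    exact hsub.mass_bdd.tsum_le
  obtain ⟨s, hs, φ, hφ, hts⟩ := isCompact_Icc.tendsto_subseq ht
  have htw : Tendsto (t ∘ φ) atTop (𝓝[Icc (-T) T] s) :=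
    tendsto_nhdsWithin_iff.2 ⟨hts, Eventually.of_forall fun k => ht _⟩
  have hcoef : ∀ n, Tendsto (fun k => v (φ k) (t (φ k)) n) atTop (𝓝 (u s n)) := fun n => by
    have h1 : Tendsto (fun k => u (t (φ k)) n) atTop (𝓝 (u s n)) :=
      ((hu.continuousOn n) s hs).tendsto.comp htw
    have h2 : Tendsto (fun k => v (φ k) (t (φ k)) n - u (t (φ k)) n) atTop (𝓝 0) := by
      have h3 := (hd0.comp hφ.tendsto_atTop).const_mul (Real.sqrt A)
      rw [mul_zero] at h3
      refine squeeze_zero_norm (fun k => ?_) h3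
      have h4 := ((hi (hv (φ k)) _ (ht (φ k))).sub (hi hu _ (ht (φ k)))).hBall.mass_bdd
      refine (pow_le_pow_iff_left₀ (norm_nonneg _)
        (mul_nonneg (Real.sqrt_nonneg _) (Real.sqrt_nonneg _)) two_ne_zero).1 ?_
      rw [mul_pow, Real.sq_sqrt hA0]
      exact (h4.summable.le_tsum n fun _ _ => sq_nonneg _).trans (hL2 (φ k))
    simpa using h2.add h1
  have hham' : Tendsto (fun k => ham κ l (v (φ k) (t (φ k)))) atTop (𝓝 (ham κ l (u s))) := by
    rw [hu.ham_eq hI hs]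
    simp only [(hv _).ham_eq hI (ht _)]
    exact hham.comp hφ.tendsto_atTop
  have h1 := tendsto_hsNorm_sub (R := max R R') (Eventually.of_forall fun k =>
    ((hv' (φ k)).ball _ (ht (φ k))).le (le_max_right _ _)) ((hu.ball s hs).le (le_max_left _ _))
    hcoef hham'
  obtain ⟨δ, hδ, h2⟩ := hu.contHs.2 s hs (ε / 4) (by positivity)
  obtain ⟨k, hk1, hk2⟩ := ((h1.eventually_lt_const (show 0 < ε / 4 by positivity)).and
    (Metric.tendsto_nhds.1 hts δ hδ)).exists
  have h3 := hsNorm_sub_le (hi (hv (φ k)) _ (ht _)) (hi hu _ (ht (φ k))) (hi hu s hs) hk1.le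
    (h2 _ (ht (φ k)) (by rwa [Real.dist_eq] at hk2)).le
  linarith [he (φ k)]

/-! ### The restriction norm `FkTNorm`, defined through a real-valued supremum. -/

lemma BumpFun.abs_chi_le {η₀ : ℝ → ℝ} (hη : BumpFun η₀) (j : ℕ) (x : ℝ) : |chi η₀ j x| ≤ 1 := by
  cases j with
  | zero => exact abs_le.2 ⟨(by norm_num : (-1 : ℝ) ≤ 0).trans (hη.mem x).1, (hη.mem x).2⟩
  | succ i =>
    have h1 := hη.mem (x / 2 ^ (i + 1))
    have h2 := hη.mem (x / 2 ^ i)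
    simp only [chi]
    exact abs_le.2 ⟨by linarith [h1.1, h2.2], by linarith [h1.2, h2.1]⟩

lemma BumpFun.chi_eq_zero {η₀ : ℝ → ℝ} (hη : BumpFun η₀) {i : ℕ} {x : ℝ}
    (hx : |x| ≤ 2 ^ i ∨ 4 * 2 ^ i < |x|) : chi η₀ (i + 1) x = 0 := by
  have hp : (0 : ℝ) < 2 ^ i := by positivity
  have habs : ∀ m : ℕ, |x / 2 ^ m| = |x| / 2 ^ m := fun m => by
    rw [abs_div, abs_of_pos (by positivity : (0 : ℝ) < 2 ^ m)]
  simp only [chi]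
  rcases hx with hx | hx
  · rw [hη.eq_one _ (abs_le.1 ?_), hη.eq_one _ (abs_le.1 ?_), sub_self]
    · rwa [habs, div_le_one hp]
    · rw [habs, div_le_one (by positivity), pow_succ]
      linarith
  · rw [hη.supp _ ?_, hη.supp _ ?_, sub_self]
    · rw [habs, lt_div_iff₀ hp]
      linarith
    · rw [habs, lt_div_iff₀ (by positivity), pow_succ]
      linarith

lemma two_rpow_mul_betaWt_le (j k : ℕ) : (2 : ℝ) ^ ((j : ℝ) / 2) * betaWt j k ≤ 2 * 2 ^ j := by
  have hj : (0 : ℝ) ≤ j := j.cast_nonneg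
  have hk : (0 : ℝ) ≤ k := k.cast_nonneg
  have h1 : betaWt j k ≤ 2 * (2 : ℝ) ^ ((j : ℝ) / 2) := by
    have h2 : (1 : ℝ) ≤ (2 : ℝ) ^ ((j : ℝ) / 2) := Real.one_le_rpow one_le_two (by positivity)
    have h3 : (2 : ℝ) ^ (((j : ℝ) - 5 * (k : ℝ)) / 4) ≤ (2 : ℝ) ^ ((j : ℝ) / 2) :=
      Real.rpow_le_rpow_of_exponent_le one_le_two (by linarith)
    unfold betaWt
    split_ifs <;> linarith
  calc _ ≤ (2 : ℝ) ^ ((j : ℝ) / 2) * (2 * (2 : ℝ) ^ ((j : ℝ) / 2)) := by gcongr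
    _ = 2 * ((2 : ℝ) ^ ((j : ℝ) / 2) * (2 : ℝ) ^ ((j : ℝ) / 2)) := by ring
    _ = 2 * 2 ^ j := by
      rw [← Real.rpow_add two_pos, add_halves, Real.rpow_natCast]

lemma betaWt_nonneg (j k : ℕ) : 0 ≤ betaWt j k := by
  unfold betaWt
  split_ifs <;> positivity

lemma BumpFun.integral_chi_mul_sq_le {η₀ : ℝ → ℝ} (hη : BumpFun η₀) {f : ℝ → ℂ} {C : ℝ}
    (hf : ∀ τ, |τ| ^ 3 * ‖f τ‖ ≤ C) (i : ℕ) :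
    ∫ τ, ‖((chi η₀ (i + 1) τ : ℝ) : ℂ) * f τ‖ ^ 2 ≤ (3 * C * (2⁻¹ ^ i) ^ 2) ^ 2 := by
  have hp : (1 : ℝ) ≤ 2 ^ i := one_le_pow₀ one_le_two
  have hC : 0 ≤ C := (by positivity : (0 : ℝ) ≤ |0| ^ 3 * ‖f 0‖).trans (hf 0)
  set S : Set ℝ := Icc (-(4 * 2 ^ i)) (4 * 2 ^ i) with hS
  have hb : ∀ τ, ‖((chi η₀ (i + 1) τ : ℝ) : ℂ) * f τ‖ ^ 2 ≤
      S.indicator (fun _ => (C / (2 ^ i) ^ 3) ^ 2) τ := fun τ => by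
    by_cases h1 : |τ| ≤ 2 ^ i ∨ 4 * 2 ^ i < |τ|
    · rw [hη.chi_eq_zero h1]
      simpa using indicator_nonneg (fun _ _ => by positivity) τ
    · push Not at h1
      rw [indicator_of_mem (show τ ∈ S from abs_le.1 h1.2)]
      have h2 : ‖f τ‖ ≤ C / (2 ^ i) ^ 3 := by
        rw [le_div_iff₀ (by positivity), mul_comm]
        exact (mul_le_mul_of_nonneg_right (pow_le_pow_left₀ (by positivity) h1.1.le 3)
          (norm_nonneg _)).trans (hf τ)
      refine pow_le_pow_left₀ (norm_nonneg _) ?_ 2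
      rw [norm_mul, norm_real, Real.norm_eq_abs]
      exact (mul_le_of_le_one_left (norm_nonneg _) (hη.abs_chi_le _ _)).trans h2
  have hinteg : Integrable (S.indicator fun _ => (C / (2 ^ i) ^ 3) ^ 2) :=
    (integrable_indicator_iff measurableSet_Icc).2 (by simp)
  refine (integral_mono_of_nonneg (Filter.Eventually.of_forall fun τ => sq_nonneg _) hinteg
    (Filter.Eventually.of_forall hb)).trans ?_
  rw [integral_indicator measurableSet_Icc, setIntegral_const, Real.volume_real_Icc,
    smul_eq_mul, max_eq_left (by linarith)]
  have h3 : (2⁻¹ : ℝ) ^ i = (2 ^ i)⁻¹ := inv_pow _ _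
  rw [h3]
  have h4 : (4 * 2 ^ i - -(4 * 2 ^ i)) * (C / (2 ^ i) ^ 3) ^ 2 =
      8 * C ^ 2 * ((2 ^ i : ℝ)⁻¹) ^ 4 * (2 ^ i)⁻¹ := by
    field_simp
    ring
  rw [h4]
  calc _ ≤ 8 * C ^ 2 * ((2 ^ i : ℝ)⁻¹) ^ 4 * 1 := by
        gcongr
        exact inv_le_one_of_one_le₀ hp
    _ ≤ _ := by
        have : 0 ≤ C ^ 2 * ((2 ^ i : ℝ)⁻¹) ^ 4 := by positivity
        nlinarith

lemma BumpFun.summable_chi {η₀ : ℝ → ℝ} (hη : BumpFun η₀) {f : ℝ → ℂ} {C : ℝ}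
    (hf : ∀ τ, |τ| ^ 3 * ‖f τ‖ ≤ C) (k : ℕ) :
    Summable fun j : ℕ => (2 : ℝ) ^ ((j : ℝ) / 2) * betaWt j k *
      Real.sqrt (∫ τ, ‖((chi η₀ j τ : ℝ) : ℂ) * f τ‖ ^ 2) := by
  have hC : 0 ≤ C := (by positivity : (0 : ℝ) ≤ |0| ^ 3 * ‖f 0‖).trans (hf 0)
  rw [← summable_nat_add_iff 1]
  refine Summable.of_nonneg_of_le (fun i => mul_nonneg (mul_nonneg (by positivity)
    (betaWt_nonneg _ _)) (Real.sqrt_nonneg _)) (fun i => ?_)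
    ((summable_geometric_of_lt_one (r := (2⁻¹ : ℝ)) (by norm_num) (by norm_num)).mul_left (12 * C))
  have h1 := Real.sqrt_le_sqrt (hη.integral_chi_mul_sq_le hf i)
  rw [Real.sqrt_sq (by positivity)] at h1
  refine (mul_le_mul (two_rpow_mul_betaWt_le (i + 1) k) h1 (Real.sqrt_nonneg _)
    (by positivity)).trans_eq ?_
  rw [inv_pow, pow_succ]
  field_simp
  ring

lemma BumpFun.hasCompactSupport_comp_mul {η₀ : ℝ → ℝ} (hη : BumpFun η₀) {c : ℝ} (hc : 1 ≤ c) :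
    HasCompactSupport fun t => η₀ (c * t) := by
  refine HasCompactSupport.intro (isCompact_Icc (a := -2) (b := 2)) fun t ht => hη.supp _ ?_
  have h1 : 2 < |t| := by
    by_contra! h
    exact ht (abs_le.1 h)
  rw [abs_mul, abs_of_nonneg (by linarith)]
  nlinarith

open FourierTransform in
/-- The Fourier transform of the rescaled bump function. -/
lemma BumpFun.exists_fourier {η₀ : ℝ → ℝ} (hη : BumpFun η₀) {c : ℝ} (hc : 1 ≤ c) :
    ∃ f : ℝ → ℂ, Continuous f ∧ f 0 ≠ 0 ∧ (∃ C, ∀ τ, |τ| ^ 3 * ‖f τ‖ ≤ C) ∧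
      ∀ τ : ℝ, f τ = ∫ t : ℝ, Complex.exp (-(I * (τ : ℂ) * (t : ℂ))) * ((η₀ (c * t) : ℝ) : ℂ) := by
  have hcs := hη.hasCompactSupport_comp_mul hc
  have hsm : ContDiff ℝ (⊤ : ℕ∞) fun t : ℝ => ((η₀ (c * t) : ℝ) : ℂ) :=
    Complex.ofRealCLM.contDiff.comp (hη.smooth.comp (contDiff_const.mul contDiff_id))
  have hcs' : HasCompactSupport fun t : ℝ => ((η₀ (c * t) : ℝ) : ℂ) :=
    hcs.comp_left (g := fun x : ℝ => (x : ℂ)) ofReal_zero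
  set φ : SchwartzMap ℝ ℂ := hcs'.toSchwartzMap hsm with hφ
  have hφt : ∀ t, φ t = ((η₀ (c * t) : ℝ) : ℂ) := fun t => rfl
  have hf : ∀ τ : ℝ, (𝓕 φ) (τ / (2 * Real.pi)) =
      ∫ t : ℝ, Complex.exp (-(I * (τ : ℂ) * (t : ℂ))) * ((η₀ (c * t) : ℝ) : ℂ) := fun τ => by
    rw [SchwartzMap.fourier_coe, Real.fourier_eq']
    refine integral_congr_ae (Filter.Eventually.of_forall fun t => ?_)
    simp only [smul_eq_mul, hφt]
    congr 2
    have hpi : (Real.pi : ℂ) ≠ 0 := ofReal_ne_zero.2 Real.pi_ne_zero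
    simp
    field_simp
  refine ⟨fun τ => (𝓕 φ) (τ / (2 * Real.pi)), (SchwartzMap.continuous _).comp
    (continuous_id.div_const _), ?_, ?_, hf⟩
  · simp only
    rw [hf 0]
    simp only [ofReal_zero, mul_zero, zero_mul, neg_zero, Complex.exp_zero, one_mul]
    rw [show ∫ t : ℝ, ((η₀ (c * t) : ℝ) : ℂ) = ((∫ t : ℝ, η₀ (c * t) : ℝ) : ℂ) from integral_ofReal,
      ofReal_ne_zero]
    refine (Continuous.integral_pos_of_hasCompactSupport_nonneg_nonzero
      (hη.smooth.continuous.comp (continuous_const.mul continuous_id)) hcs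
      (fun t => (hη.mem _).1) (x := 0) ?_).ne'
    change η₀ (c * 0) ≠ 0
    rw [mul_zero, hη.eq_one 0 (by simp)]
    exact one_ne_zero
  · refine ⟨(2 * Real.pi) ^ 3 * SchwartzMap.seminorm ℝ 3 0 (𝓕 φ), fun τ => ?_⟩
    have h1 := SchwartzMap.norm_pow_mul_le_seminorm ℝ (𝓕 φ) 3 (τ / (2 * Real.pi))
    rw [Real.norm_eq_abs, abs_div, abs_of_pos Real.two_pi_pos, div_pow, div_mul_eq_mul_div,
      div_le_iff₀ (by have := Real.two_pi_pos; positivity)] at h1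
    linarith

lemma Xnorm_nonneg (η₀ : ℝ → ℝ) (d₁ d₂ : ℝ) (k : ℕ) (f : ℝ → ℤ → ℂ) : 0 ≤ Xnorm η₀ d₁ d₂ k f :=
  tsum_nonneg fun j => mul_nonneg (mul_nonneg (by positivity) (betaWt_nonneg j k))
    (Real.sqrt_nonneg _)

lemma FkNorm_nonneg (η₀ : ℝ → ℝ) (d₁ d₂ : ℝ) (k : ℕ) (u : ℝ → ℤ → ℂ) : 0 ≤ FkNorm η₀ d₁ d₂ k u :=
  Real.iSup_nonneg fun _ => Xnorm_nonneg _ _ _ _ _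

lemma muPhase_zero (d₁ d₂ : ℝ) : muPhase d₁ d₂ 0 = 0 := by simp [muPhase]

/-- The extension from `[-T,T]` whose zero mode is an unbounded staircase. -/
def stairExt (T : ℝ) (u : ℝ → ℤ → ℂ) : ℝ → ℤ → ℂ :=
  open Classical in fun t n =>
    if t ∈ Icc (-T) T then u t n else if n = 0 then ((⌊(t - T) / 10⌋ : ℤ) : ℂ) else 0

lemma BumpFun.timeLoc_stairExt {η₀ : ℝ → ℝ} (hη : BumpFun η₀) (T : ℝ) (u : ℝ → ℤ → ℂ) (k m : ℕ)
    (t : ℝ) (n : ℤ) : timeLoc η₀ k (T + 3 + 10 * m) (stairExt T u) t n =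
      ((η₀ ((2 : ℝ) ^ (2 * k) * (t - (T + 3 + 10 * m))) : ℝ) : ℂ) * if n = 0 then (m : ℂ) else 0 := by
  have hm : (0 : ℝ) ≤ m := m.cast_nonneg
  have hp : (1 : ℝ) ≤ 2 ^ (2 * k) := one_le_pow₀ one_le_two
  unfold timeLoc
  by_cases h : 2 < |t - (T + 3 + 10 * m)|
  · have : η₀ ((2 : ℝ) ^ (2 * k) * (t - (T + 3 + 10 * m))) = 0 := hη.supp _ (by
      rw [abs_mul, abs_of_nonneg (by positivity)]
      nlinarith)
    rw [this, ofReal_zero, zero_mul, zero_mul]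
  · rw [not_lt, abs_le] at h
    have h1 : t ∉ Icc (-T) T := fun h2 => by linarith [h2.2, h.1]
    have h2 : ⌊(t - T) / 10⌋ = (m : ℤ) := by
      rw [Int.floor_eq_iff]
      push_cast
      exact ⟨by linarith [h.1], by linarith [h.2]⟩
    rw [stairExt, if_neg h1, h2, Int.cast_natCast]

lemma integral_exp_mul_shift (g : ℝ → ℂ) (τ s : ℝ) :
    ∫ t : ℝ, Complex.exp (-(I * (τ : ℂ) * (t : ℂ))) * g (t - s) =
      Complex.exp (-(I * (τ : ℂ) * (s : ℂ))) *
        ∫ t : ℝ, Complex.exp (-(I * (τ : ℂ) * (t : ℂ))) * g t := by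
  rw [← integral_sub_right_eq_self (fun t : ℝ => Complex.exp (-(I * (τ : ℂ) * (t : ℂ))) * g t) s,
    ← integral_const_mul]
  congr 1
  funext t
  rw [← mul_assoc, ← Complex.exp_add]
  congr 2
  push_cast
  ring

/-- The real supremum defining `FkNorm` of the staircase extension is over an unbounded set. -/
lemma BumpFun.FkNorm_stairExt {η₀ : ℝ → ℝ} (hη : BumpFun η₀) (d₁ d₂ T : ℝ) (k : ℕ)
    (u : ℝ → ℤ → ℂ) : FkNorm η₀ d₁ d₂ k (stairExt T u) = 0 := by
  obtain ⟨f, hfc, hf0, ⟨C, hC⟩, hf⟩ := hη.exists_fourier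
    (one_le_pow₀ one_le_two : (1 : ℝ) ≤ 2 ^ (2 * k))
  set q : ℝ := (Real.sqrt (2 * Real.pi))⁻¹ with hq
  have hq0 : 0 < q := by
    have := Real.two_pi_pos
    positivity
  set X : ℝ := ∑' j : ℕ, (2 : ℝ) ^ ((j : ℝ) / 2) * betaWt j k *
    Real.sqrt (∫ τ, ‖((chi η₀ j τ : ℝ) : ℂ) * f τ‖ ^ 2) with hX
  have hnorm : ∀ (m : ℕ) (τ : ℝ) (n : ℤ), ‖timeFT (timeLoc η₀ k (T + 3 + 10 * m)
      (stairExt T u)) τ n‖ = if n = 0 then q * m * ‖f τ‖ else 0 := fun m τ n => by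
    unfold timeFT
    simp only [hη.timeLoc_stairExt]
    split_ifs with hn
    · have h1 := integral_exp_mul_shift (fun t => ((η₀ ((2 : ℝ) ^ (2 * k) * t) : ℝ) : ℂ)) τ
        (T + 3 + 10 * m)
      simp only [← mul_assoc]
      rw [integral_mul_const, h1, ← hf, norm_mul, norm_mul, norm_mul, norm_inv, norm_real,
        Real.norm_eq_abs, abs_of_nonneg (Real.sqrt_nonneg _), Complex.norm_natCast,
        show -(I * (τ : ℂ) * ((T + 3 + 10 * m : ℝ) : ℂ)) = ((-(τ * (T + 3 + 10 * m)) : ℝ) : ℂ) * I by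
          push_cast
          ring, Complex.norm_exp_ofReal_mul_I]
      ring
    · simp
  have hl2 : ∀ m j : ℕ, l2l2 (fun τ n => ((chi η₀ j (τ - muPhase d₁ d₂ n) : ℝ) : ℂ) *
      timeFT (timeLoc η₀ k (T + 3 + 10 * m) (stairExt T u)) τ n) =
      q * m * Real.sqrt (∫ τ, ‖((chi η₀ j τ : ℝ) : ℂ) * f τ‖ ^ 2) := fun m j => by
    have h1 : ∀ τ : ℝ, ∑' n : ℤ, ‖((chi η₀ j (τ - muPhase d₁ d₂ n) : ℝ) : ℂ) *
        timeFT (timeLoc η₀ k (T + 3 + 10 * m) (stairExt T u)) τ n‖ ^ 2 =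
        (q * m) ^ 2 * ‖((chi η₀ j τ : ℝ) : ℂ) * f τ‖ ^ 2 := fun τ => by
      rw [tsum_eq_single 0 fun n hn => by rw [norm_mul, hnorm, if_neg hn]; simp, norm_mul, hnorm,
        if_pos rfl, muPhase_zero, sub_zero, norm_mul]
      ring
    simp only [l2l2, h1]
    rw [integral_const_mul, Real.sqrt_mul (sq_nonneg _), Real.sqrt_sq (by positivity)]
  have hXm : ∀ m : ℕ, Xnorm η₀ d₁ d₂ k (timeFT (timeLoc η₀ k (T + 3 + 10 * m) (stairExt T u))) =
      q * m * X := fun m => by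
    simp only [Xnorm, hl2]
    rw [hX, ← tsum_mul_left]
    congr 1
    funext j
    ring
  have hXpos : 0 < X := by
    refine (hη.summable_chi hC k).tsum_pos (fun j => mul_nonneg (mul_nonneg (by positivity)
      (betaWt_nonneg j k)) (Real.sqrt_nonneg _)) 0 (mul_pos (mul_pos (by positivity) ?_)
      (Real.sqrt_pos.2 ?_))
    · unfold betaWt
      split_ifs <;> positivity
    · have hcs : HasCompactSupport η₀ := by simpa using hη.hasCompactSupport_comp_mul le_rfl
      refine Continuous.integral_pos_of_hasCompactSupport_nonneg_nonzero
        (f := fun τ => ‖((η₀ τ : ℝ) : ℂ) * f τ‖ ^ 2)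
        (((continuous_ofReal.comp hη.smooth.continuous).mul hfc).norm.pow 2) ?_
        (fun τ => sq_nonneg _) (x := 0) ?_
      · refine HasCompactSupport.intro hcs fun τ hτ => ?_
        rw [image_eq_zero_of_notMem_tsupport hτ]
        simp
      · simp [hη.eq_one 0 (by simp), hf0]
  refine Real.iSup_of_not_bddAbove fun ⟨B, hB⟩ => ?_
  obtain ⟨m, hm⟩ := exists_nat_gt (B / (q * X))
  have h1 := hB ⟨T + 3 + 10 * m, hXm m⟩
  rw [div_lt_iff₀ (by positivity)] at hm
  linarith

lemma BumpFun.FkTNorm_eq_zero {η₀ : ℝ → ℝ} (hη : BumpFun η₀) (d₁ d₂ T : ℝ) (k : ℕ)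
    (u : ℝ → ℤ → ℂ) : FkTNorm η₀ d₁ d₂ k T u = 0 := by
  have hmem : (0 : ℝ) ∈ FkNorm η₀ d₁ d₂ k '' {w | ∀ t ∈ Icc (-T) T, w t = u t} :=
    ⟨stairExt T u, fun t ht => funext fun n => if_pos ht, hη.FkNorm_stairExt d₁ d₂ T k u⟩
  have h0 : ∀ x ∈ FkNorm η₀ d₁ d₂ k '' {w | ∀ t ∈ Icc (-T) T, w t = u t}, (0 : ℝ) ≤ x := by
    rintro _ ⟨w, -, rfl⟩
    exact FkNorm_nonneg _ _ _ _ _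
  exact le_antisymm (csInf_le ⟨0, h0⟩ hmem) (Real.sInf_nonneg h0)

lemma BumpFun.inGaugeClass {η₀ : ℝ → ℝ} (hη : BumpFun η₀) (d₁ d₂ s T : ℝ) (u : ℝ → ℤ → ℂ) :
    InGaugeClass η₀ d₁ d₂ s T u := fun η _ => by
  simp only [MemFsT, hη.FkTNorm_eq_zero, ne_eq, OfNat.ofNat_ne_zero, not_false_eq_true, zero_pow,
    mul_zero]
  exact summable_zero

/-- **Global well-posedness of the fifth-order mKdV in the energy space `H²(𝕋)`**
(Corollary 1.2): for every real-valued `u₀ ∈ H²(𝕋)` and every `T > 0` there is a solution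
`u ∈ C([-T,T];H²)` with datum `u₀`, unique in the class of solutions whose gauged version
`η(t)·NT(u)` lies in `F²(T)` (with `d₁ = 10∫u₀²`, `d₂ = 10∫((∂ₓu₀)² + u₀⁴)`), and the
solution map is continuous on each level set. -/
theorem fifth_mkdv_global_wellposedness_energy (η₀ : ℝ → ℝ) (hη : BumpFun η₀)
    (c₁ c₂ c₃ c₄ : ℝ) (hc : CoeffConstraint c₁ c₂ c₃ c₄) :
    (∀ u₀ : ℤ → ℂ, InHs 2 u₀ → IsRealCoeff u₀ → ∀ T > (0:ℝ),
      ∃ u : ℝ → ℤ → ℂ,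
        IsSolution c₁ c₂ c₃ c₄ 2 T u₀ u ∧
        InGaugeClass η₀ (10 * mass u₀) (10 * energy1 u₀) 2 T u ∧
        (∀ u' : ℝ → ℤ → ℂ,
          IsSolution c₁ c₂ c₃ c₄ 2 T u₀ u' →
          InGaugeClass η₀ (10 * mass u₀) (10 * energy1 u₀) 2 T u' →
          ∀ t ∈ Icc (-T) T, ∀ n : ℤ, u' t n = u t n)) ∧
    (∀ γ₁ γ₂ : ℝ, ∀ T > (0:ℝ),
      ∀ u₀ : ℤ → ℂ, InLevelSet 2 γ₁ γ₂ u₀ → ∀ ε > (0:ℝ), ∃ δ > (0:ℝ),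
        ∀ u₀' : ℤ → ℂ, InLevelSet 2 γ₁ γ₂ u₀' →
          hsNorm 2 (fun n => u₀' n - u₀ n) < δ →
          ∀ u u' : ℝ → ℤ → ℂ,
            IsSolution c₁ c₂ c₃ c₄ 2 T u₀ u →
            InGaugeClass η₀ (10 * γ₁) (10 * γ₂) 2 T u →
            IsSolution c₁ c₂ c₃ c₄ 2 T u₀' u' →
            InGaugeClass η₀ (10 * γ₁) (10 * γ₂) 2 T u' →
            ∀ t ∈ Icc (-T) T, hsNorm 2 (fun n => u' t n - u t n) < ε) := by
  constructor
  · intro u₀ h₀ hr T hT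
    obtain ⟨R, u, hu0, hu, -⟩ := exists_weakSol (c₂ / (6 * (2 * Real.pi)))
      (c₄ / (5 * (2 * Real.pi) ^ 2)) hT.le h₀.hBall hr
    refine ⟨u, hu.isSolution hc hT.le hu0, hη.inGaugeClass _ _ _ _ _, fun u' hu' _ t ht n => ?_⟩
    obtain ⟨R', hw⟩ := hu'.exists_weakSol hc hT.le
    have hI : (0 : ℝ) ∈ Icc (-T) T := ⟨by linarith, hT.le⟩
    have h0 : u' 0 = u 0 := by
      rw [hu0]
      exact funext hu'.2.2.1
    exact congrFun ((hw.le (le_max_left R' R)).unique (hu.le (le_max_right R' R)) hI h0 ht) n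
  · rintro γ₁ γ₂ T hT u₀ ⟨h₀, hr, hm, -⟩ ε hε
    obtain ⟨R, v, hv0, hv, -⟩ := exists_weakSol (c₂ / (6 * (2 * Real.pi)))
      (c₄ / (5 * (2 * Real.pi) ^ 2)) hT.le h₀.hBall hr
    have hI : (0 : ℝ) ∈ Icc (-T) T := ⟨by linarith, hT.le⟩
    obtain ⟨δ, hδ, H⟩ := hv.exists_hsNorm_sub_lt hT.le hε
    refine ⟨δ, hδ, fun u₀' ⟨_, _, hm', _⟩ hd u u' hu _ hu' _ t ht => ?_⟩
    obtain ⟨S, hw⟩ := hu.exists_weakSol hc hT.le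
    obtain ⟨S', hw'⟩ := hu'.exists_weakSol hc hT.le
    obtain rfl : u 0 = u₀ := funext hu.2.2.1
    obtain rfl : u' 0 = u₀' := funext hu'.2.2.1
    have huv : u t = v t :=
      (hw.le (le_max_left S R)).unique (hv.le (le_max_right S R)) hI hv0.symm ht
    rw [huv]
    exact H S' u' hw' (by rw [hm', hv0, hm]) (by rwa [hv0]) t ht

end MKdV5
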